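/- Let u : A → A' be a regular morphism of Noetherian rings and let B be an A-algebra of finite type. Then every A-algebra homomorphism v : B → A' factors through a smooth A-algebra C, i.e. there exist a smooth A-algebra C, an A-algebra homomorphism B → C and an A-algebra homomorphism C → A' whose composite is v. -/

import Mathlib

universe u

def IsRegularLocalRingP (R : Type u) [CommRing R] : Prop :=
  IsNoetherianRing R ∧ ∃ _h : IsLocalRing R, ∃ s : Finset R,
    Ideal.span (s : Set R) = IsLocalRing.maximalIdeal R ∧
      (s.card : WithBot (WithTop ℕ)) = ringKrullDim R

open TensorProduct in
def HasGeometricallyRegularFibers (A A' : Type u) [CommRing A] [CommRing A']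
    [Algebra A A'] : Prop :=
  ∀ (P : Ideal A), P.IsPrime →
    ∀ (K : Type u) [Field K] [Algebra (A ⧸ P) K]
      [Algebra (FractionRing (A ⧸ P)) K]
      [IsScalarTower (A ⧸ P) (FractionRing (A ⧸ P)) K]
      [Module.Finite (FractionRing (A ⧸ P)) K],
      ∀ (Q : Ideal (K ⊗[A ⧸ P] (A' ⧸ (P.map (algebraMap A A'))))) [Q.IsPrime],
        IsRegularLocalRingP (Localization.AtPrime Q)

universe v

open MvPolynomial
open Ideal (span subset_span span_le mul_mem_left mul_mem_right mem_span_singleton_self map_span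
  mem_span_range_iff_exists_fun mem_map_of_mem mk_ker mem_comap)
open Ideal.Quotient (mk mk_surjective eq_zero_iff_mem)
open Sum (inl inr)
open IntermediateField (adjoin)
open RingHom (ker mem_ker)
open Set (range)
open Finset (sum_congr mul_sum sum_comm sum_add_distrib mem_univ)
open Localization (AtPrime)
open Function (Surjective Injective)
open IsScalarTower (of_algebraMap_eq toAlgHom)
open KaehlerDifferential (D)
open Algebra (FinitePresentation FormallySmooth Smooth EssFiniteType FiniteType)

set_option linter.unusedSectionVars false

section Infinitesimal

/-- First order Taylor expansion modulo the square of an ideal. -/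
theorem taylor_mem_sq {P B : Type*} [CommRing P] [CommRing B] [Algebra P B] {ι : Type*} [Fintype ι]
    (N : Ideal B) (x v : ι → B) (hv : ∀ j, v j ∈ N) (f : MvPolynomial ι P) :
    aeval (x + v) f - aeval x f - ∑ j, aeval x (pderiv j f) * v j ∈ N ^ 2 := by
  classical
  induction f using MvPolynomial.induction_on with
  | C a => simp
  | add p q hp hq =>
    have := add_mem hp hq
    convert this using 1
    simp only [map_add, add_mul, sum_add_distrib]
    ring
  | mul_X p i hp =>
    have h1 : ∑ j, aeval x (pderiv j p) * v j ∈ N :=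
      Ideal.sum_mem _ fun j _ => mul_mem_left _ _ (hv j)
    have h2 : ∑ j, aeval x (pderiv j (p * X i)) * v j =
        (∑ j, aeval x (pderiv j p) * v j) * x i + aeval x p * v i := by
      simp only [Derivation.leibniz, pderiv_X, smul_eq_mul, map_add, map_mul, aeval_X, add_mul,
        sum_add_distrib]
      rw [add_comm]
      congr 1
      · rw [Finset.sum_mul]; exact sum_congr rfl fun j _ => by ring
      · rw [Finset.sum_eq_single i]
        · simp
        · intro j _ hj; simp [Ne.symm hj]
        · simp
    rw [h2]
    have h3 := mul_mem_right (x i + v i) _ hp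
    have h4 : (∑ j, aeval x (pderiv j p) * v j) * v i ∈ N ^ 2 := by
      rw [sq]; exact Ideal.mul_mem_mul h1 (hv i)
    convert add_mem h3 h4 using 1
    simp only [map_mul, aeval_X, Pi.add_apply]
    ring

theorem aeval_add_eq_of_sq_eq_bot {P B : Type*} [CommRing P] [CommRing B] [Algebra P B]
    {ι : Type*} [Fintype ι] {N : Ideal B} (hN : N ^ 2 = ⊥) (x v : ι → B) (hv : ∀ j, v j ∈ N)
    (f : MvPolynomial ι P) :
    aeval (x + v) f = aeval x f + ∑ j, aeval x (pderiv j f) * v j := by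
  have := taylor_mem_sq N x v hv f
  rw [hN, Ideal.mem_bot] at this
  linear_combination this

theorem aeval_sub_mem {P B : Type*} [CommRing P] [CommRing B] [Algebra P B]
    {ι : Type*} {N : Ideal B} {x y : ι → B} (h : ∀ j, x j - y j ∈ N)
    (f : MvPolynomial ι P) : aeval x f - aeval y f ∈ N := by
  rw [← Ideal.Quotient.eq]
  have h1 : ∀ z : ι → B, mk N (aeval z f) = aeval (fun i => mk N (z i)) f := fun z => by
    have := MvPolynomial.map_aeval (R := P) z (mk N) f
    rw [this]; rfl
  rw [h1, h1]
  congr 2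
  funext i
  exact Ideal.Quotient.eq.2 (h i)

theorem taylor_mul {P B : Type*} [CommRing P] [CommRing B] [Algebra P B] {ι : Type*} [Fintype ι]
    (c : B) (x v : ι → B) (f : MvPolynomial ι P) :
    ∃ q, aeval (fun j => x j + c * v j) f =
      aeval x f + c * ∑ j, aeval x (pderiv j f) * v j + c ^ 2 * q := by
  have := taylor_mem_sq (span {c}) x (fun j => c * v j)
    (fun j => mul_mem_right _ _ (mem_span_singleton_self c)) f
  rw [Ideal.span_singleton_pow, Ideal.mem_span_singleton] at this
  obtain ⟨q, hq⟩ := this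
  refine ⟨q, ?_⟩
  have h2 : ∑ j, aeval x (pderiv j f) * (c * v j) = c * ∑ j, aeval x (pderiv j f) * v j := by
    rw [mul_sum]; exact sum_congr rfl fun j _ => by ring
  rw [h2] at hq
  change aeval (x + fun j => c * v j) f = _
  linear_combination hq

/-- Infinitesimal lifting for the solutions of the polynomial system `h`
on the locus where `δ` is invertible. -/
def LiftsAt {P : Type u} [CommRing P] {ι κ : Type*} (h : κ → MvPolynomial ι P)
    (δ : MvPolynomial ι P) : Prop :=
  ∀ (B : Type u) [CommRing B] [Algebra P B] (N : Ideal B), N ^ 2 = ⊥ → ∀ x : ι → B,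
    (∀ i, aeval x (h i) ∈ N) → IsUnit (aeval x δ) →
      ∃ x' : ι → B, (∀ j, x' j - x j ∈ N) ∧ ∀ i, aeval x' (h i) = 0

theorem isUnit_of_sub_mem {B : Type*} [CommRing B] {N : Ideal B} (hN : N ^ 2 = ⊥) {a b : B}
    (ha : IsUnit a) (h : b - a ∈ N) : IsUnit b := by
  have h1 : (b - a) ^ 2 = 0 := by
    have := Ideal.pow_mem_pow h 2
    rwa [hN, Ideal.mem_bot] at this
  have h2 : IsNilpotent (b - a) := ⟨2, h1⟩
  have := h2.isUnit_add_left_of_commute ha (Commute.all _ _)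
  simpa using this

variable {P : Type u} [CommRing P]

theorem LiftsAt.of_dvd {ι κ : Type*} {h : κ → MvPolynomial ι P} {δ δ' : MvPolynomial ι P}
    (H : LiftsAt h δ) (hd : δ ∣ δ') : LiftsAt h δ' := fun B _ _ N hN x hx hu =>
  H B N hN x hx (isUnit_of_dvd_unit (map_dvd (aeval x) hd) hu)

/-- The ideal generated by a system of polynomials. -/
noncomputable abbrev sysIdeal {R : Type*} [CommRing R] {ι κ : Type*} (h : κ → MvPolynomial ι R) :
    Ideal (MvPolynomial ι R) := span (range h)

theorem mem_sysIdeal {R : Type*} [CommRing R] {ι κ : Type*} (h : κ → MvPolynomial ι R) (i : κ) :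
    h i ∈ sysIdeal h := subset_span ⟨i, rfl⟩

theorem aeval_mem_of_mem_sysIdeal {B : Type*} [CommRing B] [Algebra P B] {ι κ : Type*}
    {h : κ → MvPolynomial ι P} {N : Ideal B} {x : ι → B} (hx : ∀ i, aeval x (h i) ∈ N)
    {f : MvPolynomial ι P} (hf : f ∈ sysIdeal h) : aeval x f ∈ N := by
  have : sysIdeal h ≤ N.comap (aeval x).toRingHom := by
    rw [sysIdeal, span_le]; rintro _ ⟨i, rfl⟩; exact hx i
  exact this hf

theorem aeval_eq_zero_of_mem_sysIdeal {B : Type*} [CommRing B] [Algebra P B] {ι κ : Type*}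
    {h : κ → MvPolynomial ι P} {x : ι → B} (hx : ∀ i, aeval x (h i) = 0)
    {f : MvPolynomial ι P} (hf : f ∈ sysIdeal h) : aeval x f = 0 := by
  have := aeval_mem_of_mem_sysIdeal (N := ⊥) (x := x) (h := h) (by simpa using hx) hf
  simpa using this

/-- Infinitesimal lifting for algebra maps out of `C`, on the locus where `c` is invertible. -/
def SmoothOn (P : Type u) {C : Type u} [CommRing P] [CommRing C] [Algebra P C] (c : C) : Prop :=
  ∀ (B : Type u) [CommRing B] [Algebra P B] (N : Ideal B), N ^ 2 = ⊥ →
    ∀ f : C →ₐ[P] B ⧸ N, IsUnit (f c) → ∃ f' : C →ₐ[P] B, (Ideal.Quotient.mkₐ P N).comp f' = f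

theorem isUnit_of_isUnit_mk {B : Type*} [CommRing B] {N : Ideal B} (hN : N ^ 2 = ⊥) {b : B}
    (h : IsUnit (mk N b)) : IsUnit b := by
  obtain ⟨a, ha⟩ := h.exists_right_inv
  obtain ⟨a, rfl⟩ := mk_surjective a
  rw [← map_mul, ← map_one (mk N), Ideal.Quotient.eq] at ha
  exact isUnit_of_mul_isUnit_left (isUnit_of_sub_mem hN isUnit_one ha)

theorem SmoothOn.of_dvd {C : Type u} [CommRing C] [Algebra P C] {c c' : C}
    (H : SmoothOn P c) (hd : c ∣ c') : SmoothOn P c' := fun B _ _ N hN f hu =>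
  H B N hN f (isUnit_of_dvd_unit (map_dvd f hd) hu)

theorem SmoothOn.smooth {C : Type u} [CommRing C] [Algebra P C] [FinitePresentation P C]
    {c : C} (H : SmoothOn P c) (D : Type u) [CommRing D] [Algebra C D] [Algebra P D]
    [IsScalarTower P C D] [IsLocalization.Away c D] : Smooth P D := by
  have : FinitePresentation C D := IsLocalization.Away.finitePresentation c
  have : FinitePresentation P D := FinitePresentation.trans P C _
  refine ⟨FormallySmooth.of_comp_surjective ?_, this⟩
  intro B _ _ N hN f
  obtain ⟨l, hl⟩ := H B N hN (f.comp (toAlgHom P C D))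
    ((IsLocalization.Away.algebraMap_isUnit (S := D) c).map f)
  have hu : IsUnit (l c) := by
    apply isUnit_of_isUnit_mk hN
    have := DFunLike.congr_fun hl c
    simp only [AlgHom.comp_apply, Ideal.Quotient.mkₐ_eq_mk] at this
    rw [this]
    exact (IsLocalization.Away.algebraMap_isUnit (S := D) c).map f
  refine ⟨IsLocalization.liftAlgHom (M := Submonoid.powers c) (f := l) ?_, ?_⟩
  · rintro ⟨_, n, rfl⟩
    simpa using hu.pow n
  · apply IsLocalization.algHom_ext (Submonoid.powers c)
    ext a
    refine Eq.trans ?_ (DFunLike.congr_fun hl a)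
    exact congrArg (mk N) (IsLocalization.lift_eq _ _)

theorem SmoothOn.of_smooth {C : Type u} [CommRing C] [Algebra P C]
    {c : C} (D : Type u) [CommRing D] [Algebra C D] [Algebra P D]
    [IsScalarTower P C D] [IsLocalization.Away c D] [FormallySmooth P D] :
    SmoothOn P c := by
  intro B _ _ N hN f hu
  let f' : D →ₐ[P] B ⧸ N := IsLocalization.liftAlgHom (M := Submonoid.powers c) (f := f) (by
    rintro ⟨_, n, rfl⟩
    simpa using hu.pow n)
  obtain ⟨l, hl⟩ := FormallySmooth.exists_lift N ⟨2, hN⟩ f'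
  refine ⟨l.comp (toAlgHom P C D), ?_⟩
  rw [← AlgHom.comp_assoc, hl]
  refine AlgHom.ext fun a => ?_
  simp only [AlgHom.comp_apply, IsScalarTower.coe_toAlgHom', f', IsLocalization.liftAlgHom_apply,
    IsLocalization.lift_eq]
  rfl

theorem SmoothOn.trans {C E : Type u} [CommRing C] [Algebra P C] [CommRing E] [Algebra C E]
    [Algebra P E] [IsScalarTower P C E] {c : C} {e : E} (H : SmoothOn P c) (H' : SmoothOn C e)
    (hd : algebraMap C E c ∣ e) : SmoothOn P e := by
  intro B _ _ N hN f hu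
  obtain ⟨l, hl⟩ := H B N hN (f.comp (toAlgHom P C E)) (isUnit_of_dvd_unit (map_dvd f hd) hu)
  let : Algebra C B := l.toRingHom.toAlgebra
  have : IsScalarTower P C B := of_algebraMap_eq fun x => (l.commutes x).symm
  let f' : E →ₐ[C] B ⧸ N := { f with commutes' := fun r => (DFunLike.congr_fun hl r).symm }
  obtain ⟨k, hk⟩ := H' B N hN f' hu
  exact ⟨k.restrictScalars P, AlgHom.ext fun x => DFunLike.congr_fun hk x⟩

theorem smoothOn_iff_liftsAt {ι κ : Type} {h : κ → MvPolynomial ι P} {C : Type u}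
    [CommRing C] [Algebra P C] (φ : MvPolynomial ι P →ₐ[P] C) (hφ : Surjective φ)
    (hker : ker φ = sysIdeal h) (δ : MvPolynomial ι P) :
    SmoothOn P (φ δ) ↔ LiftsAt h δ := by
  constructor
  · intro H B _ _ N hN x hx hu
    let f₀ : MvPolynomial ι P →ₐ[P] B ⧸ N := (Ideal.Quotient.mkₐ P N).comp (aeval x)
    have hf₀ : ∀ a, φ a = 0 → f₀ a = 0 := fun a ha => by
      have : a ∈ sysIdeal h := by rw [← hker]; exact ha
      exact eq_zero_iff_mem.2 (aeval_mem_of_mem_sysIdeal hx this)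
    let f := Ideal.Quotient.liftₐ (ker φ) f₀ fun a ha => hf₀ a ha
    let e := Ideal.quotientKerAlgEquivOfSurjective hφ
    have he : ∀ a, e.symm (φ a) = mk _ a := fun a => by
      rw [AlgEquiv.symm_apply_eq]; rfl
    have hfe : ∀ a, (f.comp e.symm.toAlgHom) (φ a) = f₀ a := fun a => by
      change f (e.symm (φ a)) = _
      rw [he]; rfl
    obtain ⟨l, hl⟩ := H B N hN (f.comp e.symm.toAlgHom) (by
      rw [hfe]; exact hu.map (mk N))
    have hlφ : ∀ a, aeval (fun j => l (φ (X j))) a = l (φ a) := fun a =>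
      DFunLike.congr_fun (MvPolynomial.aeval_unique (l.comp φ)).symm a
    refine ⟨fun j => l (φ (X j)), fun j => ?_, fun i => ?_⟩
    · rw [← Ideal.Quotient.eq]
      refine (DFunLike.congr_fun hl (φ (X j))).trans ((hfe _).trans ?_)
      exact congrArg (mk N) (aeval_X _ _)
    · rw [hlφ]
      have : h i ∈ ker φ := by rw [hker]; exact mem_sysIdeal h i
      rw [(mem_ker).1 this, map_zero]
  · intro H B _ _ N hN f hu
    choose x hx using fun i => mk_surjective (I := N) (f (φ (X i)))
    have hf : ∀ g, mk N (aeval x g) = f (φ g) := fun g => by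
      have : (Ideal.Quotient.mkₐ P N).comp (aeval x) = f.comp φ := by
        apply MvPolynomial.algHom_ext
        intro i
        simp only [AlgHom.comp_apply, aeval_X]
        exact hx i
      exact DFunLike.congr_fun this g
    have hmem : ∀ i, aeval x (h i) ∈ N := fun i => by
      have : h i ∈ ker φ := by rw [hker]; exact mem_sysIdeal h i
      rw [← eq_zero_iff_mem, hf, (mem_ker).1 this, map_zero]
    obtain ⟨x', hx', h0⟩ := H B N hN x hmem (isUnit_of_isUnit_mk hN (by rwa [hf]))
    let e := Ideal.quotientKerAlgEquivOfSurjective hφ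
    have he : ∀ a, e.symm (φ a) = mk _ a := fun a => by
      rw [AlgEquiv.symm_apply_eq]; rfl
    let l := Ideal.Quotient.liftₐ (ker φ) (aeval x') fun a ha =>
      aeval_eq_zero_of_mem_sysIdeal h0 (hker ▸ ha)
    refine ⟨l.comp e.symm.toAlgHom, ?_⟩
    rw [← AlgHom.cancel_right hφ]
    apply MvPolynomial.algHom_ext
    intro i
    change mk N (l (e.symm (φ (X i)))) = f (φ (X i))
    rw [he, ← hf (X i)]
    refine Ideal.Quotient.eq.2 ?_
    have : l (mk _ (X i)) = x' i := aeval_X x' i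
    rw [this, aeval_X]
    exact hx' i

/-- The elements `π` for which multiplication by `π` on the conormal module of the system `h`
factors through its Jacobian matrix. -/
def IsStd {R : Type*} [CommRing R] {ι κ : Type*} [Fintype ι] [Fintype κ]
    (h : κ → MvPolynomial ι R) (π : MvPolynomial ι R) (S : ι → κ → MvPolynomial ι R) : Prop :=
  ∀ i, π * h i - ∑ j, ∑ l, pderiv j (h i) * S j l * h l ∈ sysIdeal h ^ 2

noncomputable def stdIdeal {R : Type*} [CommRing R] {ι κ : Type*} [Fintype ι] [Fintype κ]
    (h : κ → MvPolynomial ι R) : Ideal (MvPolynomial ι R) where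
  carrier := {π | ∃ S, IsStd h π S}
  zero_mem' := ⟨0, fun i => by simp⟩
  add_mem' := by
    rintro a b ⟨S, hS⟩ ⟨S', hS'⟩
    refine ⟨S + S', fun i => ?_⟩
    have h1 : (a + b) * h i - ∑ j, ∑ l, pderiv j (h i) * (S + S') j l * h l =
        (a * h i - ∑ j, ∑ l, pderiv j (h i) * S j l * h l) +
          (b * h i - ∑ j, ∑ l, pderiv j (h i) * S' j l * h l) := by
      simp only [Pi.add_apply, mul_add, add_mul, sum_add_distrib]
      ring
    rw [h1]
    exact add_mem (hS i) (hS' i)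
  smul_mem' := by
    rintro c a ⟨S, hS⟩
    refine ⟨fun j l => c * S j l, fun i => ?_⟩
    have h1 : ∑ j, ∑ l, pderiv j (h i) * (c * S j l) * h l =
        c * ∑ j, ∑ l, pderiv j (h i) * S j l * h l := by
      simp only [mul_sum]
      exact sum_congr rfl fun j _ => sum_congr rfl fun l _ => by ring
    rw [h1, smul_eq_mul, mul_assoc, ← mul_sub]
    exact mul_mem_left _ c (hS i)

end Infinitesimal

section Standard

variable {P : Type u} [CommRing P] {ι κ : Type} [Fintype ι] [Fintype κ]

/-- If `π` is standard for `h`, approximate solutions at which `π` is invertible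
can be corrected by an explicit vector. -/
theorem aeval_correct {B : Type*} [CommRing B] [Algebra P B] {h : κ → MvPolynomial ι P}
    {π : MvPolynomial ι P} (hπ : π ∈ stdIdeal h) {N : Ideal B} (hN : N ^ 2 = ⊥) {x : ι → B}
    (hx : ∀ i, aeval x (h i) ∈ N) (hu : IsUnit (aeval x π)) :
    ∃ x' : ι → B, (∀ j, x' j - x j ∈ N) ∧ ∀ i, aeval x' (h i) = 0 := by
  obtain ⟨S, hS⟩ := hπ
  obtain ⟨p, hp⟩ := hu.exists_right_inv
  let v : ι → B := fun j => - (p * ∑ l, aeval x (S j l) * aeval x (h l))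
  have hv : ∀ j, v j ∈ N := fun j => neg_mem (mul_mem_left _ _
    (Ideal.sum_mem _ fun l _ => mul_mem_left _ _ (hx l)))
  refine ⟨x + v, fun j => by simpa using hv j, fun i => ?_⟩
  rw [aeval_add_eq_of_sq_eq_bot hN x v hv]
  have h1 : aeval x (π * h i - ∑ j, ∑ l, pderiv j (h i) * S j l * h l) = 0 := by
    have h2 : sysIdeal h ^ 2 ≤ (⊥ : Ideal B).comap (aeval x).toRingHom := by
      rw [← hN]
      refine le_trans (Ideal.pow_right_mono (?_ : sysIdeal h ≤ N.comap (aeval x).toRingHom) 2)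
        (Ideal.le_comap_pow _ _)
      exact fun a ha => aeval_mem_of_mem_sysIdeal hx ha
    simpa using h2 (hS i)
  simp only [map_sub, map_mul, map_sum] at h1
  have h3 : ∑ j, aeval x (pderiv j (h i)) * v j = - p * ∑ j, ∑ l,
      aeval x (pderiv j (h i)) * aeval x (S j l) * aeval x (h l) := by
    simp only [v, mul_sum, mul_neg, ← Finset.sum_neg_distrib]
    exact sum_congr rfl fun j _ => sum_congr rfl fun l _ => by ring
  rw [h3]
  linear_combination p * h1 - aeval x (h i) * hp

theorem liftsAt_of_mem_stdIdeal {h : κ → MvPolynomial ι P} {π : MvPolynomial ι P}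
    (hπ : π ∈ stdIdeal h) : LiftsAt h π := fun _ _ _ _ hN _ hx hu => aeval_correct hπ hN hx hu

theorem LiftsAt.pow_mem_stdIdeal {h : κ → MvPolynomial ι P} {π : MvPolynomial ι P}
    (H : LiftsAt h π) : ∃ e, π ^ e ∈ stdIdeal h := by
  let I := sysIdeal h
  let Q := MvPolynomial ι P ⧸ I ^ 2
  let q : Q := mk _ π
  let B := Localization.Away q
  let φ : MvPolynomial ι P →ₐ[P] B :=
    (toAlgHom P Q B).comp (Ideal.Quotient.mkₐ P (I ^ 2))
  let x : ι → B := fun j => φ (X j)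
  have hφ : ∀ f, aeval x f = φ f := fun f =>
    DFunLike.congr_fun (MvPolynomial.aeval_unique φ).symm f
  have hφ0 : ∀ f, φ f = 0 → ∃ n, π ^ n * f ∈ I ^ 2 := fun f hf => by
    have : algebraMap Q B (mk _ f) = algebraMap Q B 0 := by
      rw [map_zero]; exact hf
    obtain ⟨n, hn⟩ := IsLocalization.Away.exists_of_eq q this
    refine ⟨n, ?_⟩
    rw [← eq_zero_iff_mem, map_mul, map_pow]
    simpa using hn
  have hφI : ∀ f ∈ I ^ 2, φ f = 0 := fun f hf => by
    change algebraMap Q B (mk _ f) = 0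
    rw [eq_zero_iff_mem.2 hf, map_zero]
  let N : Ideal B := I.map φ
  have hN : N ^ 2 = ⊥ := by
    rw [← Ideal.map_pow, eq_bot_iff, Ideal.map_le_iff_le_comap]
    intro f hf
    exact hφI f hf
  have hunit : IsUnit (φ π) := IsLocalization.Away.algebraMap_isUnit (S := B) q
  obtain ⟨x', hx', h0⟩ := H B N hN x
    (fun i => by rw [hφ]; exact mem_map_of_mem _ (mem_sysIdeal h i)) (by rwa [hφ])
  -- denominators
  have hsurj : ∀ b : B, ∃ n f, b * φ π ^ n = φ f := fun b => by
    obtain ⟨n, a, ha⟩ := IsLocalization.Away.surj q b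
    obtain ⟨f, rfl⟩ := mk_surjective a
    exact ⟨n, f, ha⟩
  have hv : ∀ j, ∃ n : ℕ, ∃ s : κ → MvPolynomial ι P,
      (x' j - x j) * φ π ^ n = φ (∑ l, s l * h l) := fun j => by
    have h1 : N = span (range fun l => φ (h l)) := by
      simp only [N, I, map_span, ← Set.range_comp]; rfl
    have h2 := hx' j
    rw [h1, mem_span_range_iff_exists_fun] at h2
    obtain ⟨c, hc⟩ := h2
    choose n f hf using fun l => hsurj (c l)
    refine ⟨∑ l, n l, fun l => π ^ (∑ l, n l - n l) * f l, ?_⟩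
    rw [← hc, map_sum, Finset.sum_mul]
    refine sum_congr rfl fun l _ => ?_
    have h3 : n l ≤ ∑ l, n l := Finset.single_le_sum (fun _ _ => Nat.zero_le _) (mem_univ l)
    rw [map_mul, map_mul, map_pow, ← hf]
    have h4 : φ π ^ (∑ l, n l) = φ π ^ (∑ l, n l - n l) * φ π ^ n l := by
      rw [← pow_add, Nat.sub_add_cancel h3]
    rw [h4]; ring
  choose n s hs using hv
  let m := ∑ j, n j
  have hs' : ∀ j, ∃ s : κ → MvPolynomial ι P, (x' j - x j) * φ π ^ m = φ (∑ l, s l * h l) :=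
    fun j => ⟨fun l => π ^ (m - n j) * s j l, by
      have h3 : n j ≤ m := Finset.single_le_sum (fun _ _ => Nat.zero_le _) (mem_univ j)
      have h4 : φ π ^ m = φ π ^ (m - n j) * φ π ^ n j := by
        rw [← pow_add, Nat.sub_add_cancel h3]
      rw [h4]
      simp only [mul_assoc, ← mul_sum]
      rw [map_mul, map_pow, ← hs]; ring⟩
  choose s hs using hs'
  have key : ∀ i, φ (π ^ m * h i + ∑ j, ∑ l, pderiv j (h i) * s j l * h l) = 0 := fun i => by
    have h1 := aeval_add_eq_of_sq_eq_bot hN x (fun j => x' j - x j) hx' (h i)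
    have h2 : x + (fun j => x' j - x j) = x' := by funext j; simp
    rw [h2, h0, hφ] at h1
    have h3 : ∑ j, ∑ l, pderiv j (h i) * s j l * h l = ∑ j, pderiv j (h i) * ∑ l, s j l * h l := by
      simp only [mul_sum, mul_assoc]
    rw [h3, map_add, map_sum, map_mul, map_pow]
    have h4 : ∀ j, φ (pderiv j (h i) * ∑ l, s j l * h l) =
        φ π ^ m * (aeval x (pderiv j (h i)) * (x' j - x j)) := fun j => by
      rw [map_mul, ← hs, hφ]; ring
    simp only [h4, ← mul_sum]
    linear_combination - φ π ^ m * h1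
  choose t ht using fun i => hφ0 _ (key i)
  refine ⟨∑ i, t i + m, fun j l => - (π ^ (∑ i, t i) * s j l), fun i => ?_⟩
  have h3 : t i ≤ ∑ i, t i := Finset.single_le_sum (fun _ _ => Nat.zero_le _) (mem_univ i)
  have h4 : π ^ (∑ i, t i) = π ^ (∑ i, t i - t i) * π ^ t i := by
    rw [← pow_add, Nat.sub_add_cancel h3]
  have h5 := mul_mem_left _ (π ^ (∑ i, t i - t i)) (ht i)
  rw [← mul_assoc, ← h4] at h5
  have h6 : ∑ j, ∑ l, pderiv j (h i) * -(π ^ (∑ i, t i) * s j l) * h l =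
      - (π ^ (∑ i, t i) * ∑ j, ∑ l, pderiv j (h i) * s j l * h l) := by
    simp only [mul_sum, ← Finset.sum_neg_distrib]
    exact sum_congr rfl fun j _ => sum_congr rfl fun l _ => by ring
  rw [h6]
  convert h5 using 1
  ring

/-- The matrix `π - H S` annihilates the conormal module, hence `(π - H S) H` vanishes
modulo the system. -/
theorem IsStd.mul_jacobian_mem {h : κ → MvPolynomial ι P} {π : MvPolynomial ι P}
    {S : ι → κ → MvPolynomial ι P} (hS : IsStd h π S) (i : κ) (j : ι) :
    π * pderiv j (h i) - ∑ k, ∑ l, pderiv k (h i) * S k l * pderiv j (h l) ∈ sysIdeal h := by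
  have h1 : ∀ a ∈ sysIdeal h ^ 2, pderiv j a ∈ sysIdeal h := by
    intro a ha
    rw [sq] at ha
    refine Submodule.mul_induction_on ha (fun b hb c hc => ?_) fun b c hb hc => ?_
    · rw [Derivation.leibniz]
      exact add_mem (mul_mem_right _ _ hb) (mul_mem_right _ _ hc)
    · rw [map_add]; exact add_mem hb hc
  have h2 := h1 _ (hS i)
  simp only [map_sub, map_sum, Derivation.leibniz, smul_eq_mul] at h2
  have h3 : h i * pderiv j π - ∑ k, ∑ l, h l * pderiv j (pderiv k (h i) * S k l) ∈ sysIdeal h :=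
    sub_mem (mul_mem_right _ _ (mem_sysIdeal h i)) (Ideal.sum_mem _ fun k _ =>
      Ideal.sum_mem _ fun l _ => mul_mem_right _ _ (mem_sysIdeal h l))
  convert sub_mem h2 h3 using 1
  simp only [sum_add_distrib, Derivation.leibniz, smul_eq_mul]
  ring

end Standard

section Jacobian

variable {P : Type u} [CommRing P]

/-- A system can be solved infinitesimally where a maximal minor of its Jacobian matrix is
invertible. -/
theorem liftsAt_det {τ ω : Type*} [Fintype τ] [DecidableEq τ] [Fintype ω]
    (F : τ → MvPolynomial (τ ⊕ ω) P) :
    LiftsAt F (Matrix.of fun i j => pderiv (inl j) (F i)).det := by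
  intro B _ _ N hN x hx hu
  let J : Matrix τ τ B := Matrix.of fun i j => aeval x (pderiv (inl j) (F i))
  have hJ : IsUnit J.det := by
    have : J = (aeval x).toRingHom.mapMatrix (Matrix.of fun i j => pderiv (inl j) (F i)) := by
      ext i j; rfl
    rw [this, ← RingHom.map_det]; exact hu
  let v : τ → B := - (J⁻¹.mulVec fun i => aeval x (F i))
  have hv : ∀ j, v j ∈ N := fun j => N.neg_mem (Ideal.sum_mem _ fun i _ =>
    mul_mem_left _ _ (hx i))
  have hv' : ∀ j, Sum.elim v (0 : ω → B) j ∈ N := by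
    rintro (j | j)
    · exact hv j
    · exact N.zero_mem
  refine ⟨x + Sum.elim v 0, fun j => by simpa using hv' j, fun i => ?_⟩
  rw [aeval_add_eq_of_sq_eq_bot hN x _ hv']
  have h1 : J.mulVec v = - fun i => aeval x (F i) := by
    rw [Matrix.mulVec_neg, Matrix.mulVec_mulVec, Matrix.mul_nonsing_inv _ hJ, Matrix.one_mulVec]
  have h2 := congrFun h1 i
  simp only [Matrix.mulVec, dotProduct, J, Matrix.of_apply, Pi.neg_apply] at h2
  rw [Fintype.sum_sum_type]
  simp [h2]

theorem det_jacobian_eq {τ ω : Type*} [Fintype τ] [DecidableEq τ]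
    (F : τ → MvPolynomial (τ ⊕ ω) P) (π : MvPolynomial (τ ⊕ ω) P)
    (hF : ∀ i, ∃ (c : P) (s : MvPolynomial (τ ⊕ ω) P), F i = X (inl i) - C c + π ^ 2 * s) :
    ∃ r, (Matrix.of fun i j => pderiv (inl j) (F i)).det = 1 + π * r := by
  have h1 : (mk (span {π})).mapMatrix (Matrix.of fun i j => pderiv (inl j) (F i)) = 1 := by
    ext i j
    obtain ⟨c, s, h⟩ := hF i
    have h3 : mk (span {π}) π = 0 := by
      rw [eq_zero_iff_mem]; exact mem_span_singleton_self π
    classical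
    simp only [RingHom.mapMatrix_apply, Matrix.map_apply, Matrix.of_apply, h, map_add, map_sub,
      pderiv_C, pderiv_X, Derivation.leibniz, smul_eq_mul, map_mul, map_pow, h3,
      Derivation.leibniz_pow, Matrix.one_apply, Pi.single_apply, inl.injEq]
    by_cases hij : i = j <;> simp [hij, h3, eq_comm]
  have h2 := congrArg Matrix.det h1
  rw [← RingHom.map_det, Matrix.det_one, ← map_one (mk (span {π})),
    Ideal.Quotient.eq, Ideal.mem_span_singleton] at h2
  obtain ⟨r, hr⟩ := h2
  exact ⟨r, by linear_combination hr⟩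

end Jacobian

namespace Desing

variable {P : Type u} [CommRing P] {ι κ : Type} [Fintype ι] [Fintype κ]
  (h : κ → MvPolynomial ι P) (π : MvPolynomial ι P) (S : ι → κ → MvPolynomial ι P)
  {B : Type*} [CommRing B] [Algebra P B]

/-- The Jacobian matrix of `h` at `x`. -/
noncomputable def jac (x : ι → B) : Matrix κ ι B := Matrix.of fun i j => aeval x (pderiv j (h i))

noncomputable def sec (x : ι → B) : Matrix ι κ B := Matrix.of fun j l => aeval x (S j l)

noncomputable def val (x : ι → B) : κ → B := fun i => aeval x (h i)

/-- The displacement attached to the variables `w, t, ν`. -/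
noncomputable def disp (w : ι → B) (t : κ → B) (ν : ι → B) : ι → B :=
  (sec S w).mulVec t + aeval w π • ν - (sec S w).mulVec ((jac h w).mulVec ν)

variable {h π S}

theorem defect_mul_jac_mem (hS : IsStd h π S) (x : ι → B) (i : κ) (j : ι) :
    (aeval x π • jac h x - jac h x * sec S x * jac h x) i j ∈ span (range (val h x)) := by
  have := aeval_mem_of_mem_sysIdeal (N := span (range (val h x))) (x := x) (h := h)
    (fun i => subset_span ⟨i, rfl⟩) (hS.mul_jacobian_mem i j)
  convert this using 1
  simp only [jac, sec, Matrix.sub_apply, Matrix.smul_apply, Matrix.of_apply, smul_eq_mul,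
    Matrix.mul_apply, map_sub, map_mul, map_sum, Finset.sum_mul]
  rw [sum_comm]

theorem defect_val_mem (hS : IsStd h π S) (x : ι → B) (i : κ) :
    (aeval x π • val h x - (jac h x).mulVec ((sec S x).mulVec (val h x))) i ∈
      span (range (val h x)) ^ 2 := by
  have h1 : (sysIdeal h ^ 2) ≤ (span (range (val h x)) ^ 2).comap
      (aeval x : MvPolynomial ι P →ₐ[P] B).toRingHom := by
    refine le_trans (Ideal.pow_right_mono ?_ 2) (Ideal.le_comap_pow _ 2)
    rw [sysIdeal, span_le]; rintro _ ⟨i, rfl⟩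
    exact subset_span ⟨i, rfl⟩
  have := h1 (hS i)
  rw [mem_comap] at this
  convert this using 1
  simp only [jac, sec, val, Matrix.mulVec, dotProduct, mul_sum, mul_assoc, Pi.sub_apply,
    Pi.smul_apply, smul_eq_mul, Matrix.of_apply, AlgHom.toRingHom_eq_coe, map_sub, map_mul, map_sum,
    RingHom.coe_coe]

theorem jac_mulVec_disp (w : ι → B) (t : κ → B) (ν : ι → B) :
    (jac h w).mulVec (disp h π S w t ν) = (jac h w).mulVec ((sec S w).mulVec t) +
      (aeval w π • jac h w - jac h w * sec S w * jac h w).mulVec ν := by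
  simp only [disp, Matrix.mulVec_add, Matrix.mulVec_sub, Matrix.mulVec_smul, Matrix.sub_mulVec,
    Matrix.smul_mulVec, Matrix.mulVec_mulVec, Matrix.mul_assoc]
  abel

/-- The image of `t` under the defect of the section `S`. -/
noncomputable def defVec (h : κ → MvPolynomial ι P) (π : MvPolynomial ι P)
    (S : ι → κ → MvPolynomial ι P) (w : ι → B) (t : κ → B) : κ → B :=
  aeval w π • t - (jac h w).mulVec ((sec S w).mulVec t)

theorem mulVec_mem {α β : Type*} [Fintype β] {I : Ideal B} {G : Matrix α β B}
    (hG : ∀ i j, G i j ∈ I) (v : β → B) (i : α) : (G.mulVec v) i ∈ I :=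
  Ideal.sum_mem _ fun j _ => mul_mem_right _ _ (hG i j)

theorem mulVec_mem' {α β : Type*} [Fintype β] {I : Ideal B} (G : Matrix α β B)
    {v : β → B} (hv : ∀ j, v j ∈ I) (i : α) : (G.mulVec v) i ∈ I :=
  Ideal.sum_mem _ fun j _ => mul_mem_left _ _ (hv j)

theorem val_eq {w : ι → B} {t : κ → B} {ν : ι → B} {Q γ v : κ → B} {η : B}
    (hT : ∀ i, v i = val h w i - aeval w π ^ 3 * ((jac h w).mulVec (disp h π S w t ν)) i +
      aeval w π ^ 6 * Q i)
    (hv : ∀ i, v i = (aeval w π * η) ^ 6 * γ i)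
    (hE : ∀ i, t i + aeval w π ^ 2 * (η ^ 6 * γ i - Q i) = 0) :
    val h w = aeval w π ^ 3 • ((aeval w π • jac h w - jac h w * sec S w * jac h w).mulVec ν -
      defVec h π S w t) := by
  funext i
  have h1 := hT i
  rw [jac_mulVec_disp] at h1
  simp only [Pi.add_apply, Pi.smul_apply, Pi.sub_apply, smul_eq_mul, defVec] at h1 ⊢
  linear_combination hv i - h1 + (aeval w π) ^ 4 * hE i

theorem mul_val_mem (hS : IsStd h π S) {w : ι → B} {t : κ → B} {ν : ι → B}
    (hval : val h w = aeval w π ^ 3 •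
      ((aeval w π • jac h w - jac h w * sec S w * jac h w).mulVec ν - defVec h π S w t)) (i : κ) :
    aeval w π * val h w i ∈ span {aeval w π ^ 3} * span (range (val h w)) := by
  set p : B := aeval w π
  set V := span (range (val h w)) with hV
  set G := p • jac h w - jac h w * sec S w * jac h w with hGdef
  have hG : ∀ i j, G i j ∈ V := defect_mul_jac_mem hS w
  have hV1 : V ≤ span {p ^ 3} := by
    rw [hV, span_le]
    rintro _ ⟨i, rfl⟩
    rw [hval]
    exact mul_mem_right _ _ (mem_span_singleton_self _)
  have hV2 : V ^ 2 ≤ span {p ^ 3} * V := by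
    rw [sq]; exact Ideal.mul_mono_left hV1
  have key : p • val h w = p ^ 3 • (p • G.mulVec ν - (p • G.mulVec ν -
      (jac h w).mulVec ((sec S w).mulVec (G.mulVec ν))) - G.mulVec ((sec S w).mulVec t)) +
      (p • val h w - (jac h w).mulVec ((sec S w).mulVec (val h w))) := by
    have h1 : (jac h w).mulVec ((sec S w).mulVec (val h w)) = p ^ 3 •
        ((jac h w).mulVec ((sec S w).mulVec (G.mulVec ν)) -
          (jac h w).mulVec ((sec S w).mulVec (defVec h π S w t))) := by
      conv_lhs => rw [hval]
      simp only [Matrix.mulVec_smul, Matrix.mulVec_sub]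
    have h2 : (jac h w).mulVec ((sec S w).mulVec (defVec h π S w t)) =
        G.mulVec ((sec S w).mulVec t) := by
      simp only [defVec, hGdef, Matrix.mulVec_smul, Matrix.mulVec_sub, Matrix.sub_mulVec,
        Matrix.mulVec_mulVec, Matrix.mul_assoc, Matrix.sub_mul, Matrix.smul_mul,
        Matrix.smul_mulVec, p]
    rw [h1, h2]
    funext i
    simp only [Pi.add_apply, Pi.smul_apply, Pi.sub_apply, smul_eq_mul]
    ring
  have h3 := congrFun key i
  rw [Pi.smul_apply, smul_eq_mul] at h3
  rw [h3, Pi.add_apply]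
  refine add_mem ?_ (hV2 (defect_val_mem hS w i))
  refine Ideal.mul_mem_mul (mem_span_singleton_self _) ?_
  have hGν : ∀ j, (G.mulVec ν) j ∈ V := mulVec_mem hG ν
  refine sub_mem (sub_mem (V.mul_mem_left _ (hGν i)) (sub_mem (V.mul_mem_left _ (hGν i)) ?_))
    (mulVec_mem hG _ i)
  exact mulVec_mem' _ (mulVec_mem' _ hGν) i

/-- In a ring where the annihilators of `π` and of its square agree, the solutions of the square
system lie on the zero locus of `h`. -/
theorem val_eq_zero (hS : IsStd h π S) {w : ι → B} {t t' : κ → B} {ν : ι → B}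
    (hval : val h w = aeval w π ^ 3 •
      ((aeval w π • jac h w - jac h w * sec S w * jac h w).mulVec ν - defVec h π S w t))
    (ht : t = aeval w π • t') (hann : ∀ b : B, aeval w π ^ 2 * b = 0 → aeval w π * b = 0)
    {δ : B} (hδ : IsUnit δ) (hz : ∀ i, δ * (aeval w π * val h w i) = 0) :
    val h w = 0 ∧ defVec h π S w t = 0 := by
  have hann' : ∀ (n : ℕ) (b : B), aeval w π ^ (n + 1) * b = 0 → aeval w π * b = 0 := by
    intro n
    induction n with
    | zero => intro b hb; simpa using hb
    | succ n ih =>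
      intro b hb
      refine hann _ ?_
      have := ih (aeval w π * b) (by rw [← hb]; ring)
      rw [← this]; ring
  have hv : val h w = 0 := by
    funext i
    have h1 : aeval w π * val h w i = 0 := (hδ.mul_right_eq_zero).1 (hz i)
    have h2 := congrFun hval i
    rw [Pi.smul_apply, smul_eq_mul] at h2
    rw [h2] at h1
    rw [← mul_assoc, ← pow_succ'] at h1
    have := hann' 3 _ h1
    rw [h2, Pi.zero_apply, pow_succ, mul_assoc, this, mul_zero]
  refine ⟨hv, ?_⟩
  have hG : aeval w π • jac h w - jac h w * sec S w * jac h w = 0 := by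
    ext i j
    have := defect_mul_jac_mem hS w i j
    rw [hv] at this
    have h0 : span (range (0 : κ → B)) = ⊥ := by
      rw [Ideal.span_eq_bot]; rintro _ ⟨i, rfl⟩; rfl
    rwa [h0, Ideal.mem_bot] at this
  rw [hv, hG] at hval
  have hd : defVec h π S w t = aeval w π • defVec h π S w t' := by
    simp only [defVec, ht, Matrix.mulVec_smul, smul_sub]
  funext i
  have h3 := congrFun hval i
  rw [hd] at h3 ⊢
  simp only [Matrix.zero_mulVec, Pi.zero_apply, Pi.smul_apply, Pi.neg_apply, zero_sub,
    smul_eq_mul] at h3 ⊢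
  exact hann' 3 _ (by linear_combination h3)

end Desing

namespace Desing

variable {P : Type u} [CommRing P] {ι κ : Type} [Fintype ι] [Fintype κ]
  {h : κ → MvPolynomial ι P} {π : MvPolynomial ι P} {S : ι → κ → MvPolynomial ι P}
  {B B' : Type*} [CommRing B] [Algebra P B] [CommRing B'] [Algebra P B']

theorem map_aeval (f : B →ₐ[P] B') (x : ι → B) (p : MvPolynomial ι P) :
    f (aeval x p) = aeval (fun j => f (x j)) p := by
  rw [← AlgHom.comp_apply, comp_aeval]

theorem map_jac_apply (f : B →ₐ[P] B') (w : ι → B) (i : κ) (j : ι) :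
    f (jac h w i j) = jac h (fun j => f (w j)) i j := map_aeval f w _

theorem map_sec_apply (f : B →ₐ[P] B') (w : ι → B) (j : ι) (i : κ) :
    f (sec S w j i) = sec S (fun j => f (w j)) j i := map_aeval f w _

theorem map_jac (f : B →ₐ[P] B') (w : ι → B) : (jac h w).map f = jac h fun j => f (w j) := by
  ext i j; simp [jac, map_aeval]

theorem map_sec (f : B →ₐ[P] B') (w : ι → B) : (sec S w).map f = sec S fun j => f (w j) := by
  ext i j; simp [sec, map_aeval]

theorem map_val (f : B →ₐ[P] B') (w : ι → B) (i : κ) :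
    f (val h w i) = val h (fun j => f (w j)) i := map_aeval f w (h i)

theorem map_mulVec {α β : Type*} [Fintype β] (f : B →ₐ[P] B') (G : Matrix α β B) (v : β → B)
    (i : α) : f ((G.mulVec v) i) = ((G.map f).mulVec fun j => f (v j)) i := by
  simp [Matrix.mulVec, dotProduct]

theorem map_disp (f : B →ₐ[P] B') (w : ι → B) (t : κ → B) (ν : ι → B) (j : ι) :
    f (disp h π S w t ν j) =
      disp h π S (fun j => f (w j)) (fun i => f (t i)) (fun j => f (ν j)) j := by
  simp only [disp, Pi.add_apply, Pi.sub_apply, Pi.smul_apply, smul_eq_mul, map_add, map_sub,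
    map_mul, map_mulVec, map_jac, map_sec, map_aeval]

theorem map_defVec (f : B →ₐ[P] B') (w : ι → B) (t : κ → B) (i : κ) :
    f (defVec h π S w t i) = defVec h π S (fun j => f (w j)) (fun i => f (t i)) i := by
  simp only [defVec, Pi.sub_apply, Pi.smul_apply, smul_eq_mul, map_sub, map_mul, map_mulVec,
    map_jac, map_sec, map_aeval]

/-- Universal second order expansions of `h` and `π` along the displacement. -/
structure Expansion (h : κ → MvPolynomial ι P) (π : MvPolynomial ι P)
    (S : ι → κ → MvPolynomial ι P) where
  Q : κ → MvPolynomial ((ι ⊕ κ) ⊕ ι) P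
  r : MvPolynomial ((ι ⊕ κ) ⊕ ι) P
  hQ : ∀ i, aeval (fun j => X (inl (inl j)) - aeval (fun j => X (inl (inl j))) π ^ 3
      * disp h π S (fun j => X (inl (inl j))) (fun i => X (inl (inr i)))
        (fun j => X (inr j)) j) (h i) =
    val h (fun j => X (inl (inl j))) i - aeval (fun j => X (inl (inl j))) π ^ 3 *
      ((jac h (fun j => X (inl (inl j)))).mulVec
        (disp h π S (fun j => X (inl (inl j))) (fun i => X (inl (inr i)))
          (fun j => (X (inr j) : MvPolynomial ((ι ⊕ κ) ⊕ ι) P)))) i +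
      aeval (fun j => X (inl (inl j))) π ^ 6 * Q i
  hr : aeval (fun j => X (inl (inl j)) - aeval (fun j => X (inl (inl j))) π ^ 3
      * disp h π S (fun j => X (inl (inl j))) (fun i => X (inl (inr i)))
        (fun j => X (inr j)) j) π = aeval (fun j => X (inl (inl j))) π *
      (1 + aeval (fun j => X (inl (inl j))) π * r)

theorem nonempty_expansion (h : κ → MvPolynomial ι P) (π : MvPolynomial ι P)
    (S : ι → κ → MvPolynomial ι P) : Nonempty (Expansion h π S) := by
  let W : ι → MvPolynomial ((ι ⊕ κ) ⊕ ι) P := fun j => X (inl (inl j))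
  let U := disp h π S W (fun i => X (inl (inr i))) (fun j => X (inr j))
  have key : ∀ f : MvPolynomial ι P, ∃ q, aeval (fun j => W j - aeval W π ^ 3 * U j) f =
      aeval W f - aeval W π ^ 3 * ∑ j, aeval W (pderiv j f) * U j + aeval W π ^ 6 * q := by
    intro f
    obtain ⟨q, hq⟩ := taylor_mul (- aeval W π ^ 3) W U f
    refine ⟨q, ?_⟩
    have : (fun j => W j - aeval W π ^ 3 * U j) = fun j => W j + -aeval W π ^ 3 * U j := by
      funext j; ring
    rw [this, hq]; ring
  choose Q hQ using key
  refine ⟨⟨fun i => Q (h i), aeval W π * (- ∑ j, aeval W (pderiv j π) * U j) +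
    aeval W π ^ 4 * Q π, fun i => hQ (h i), ?_⟩⟩
  rw [hQ π]; ring

namespace Expansion

variable (E : Expansion h π S)

theorem expand_val {y : (ι ⊕ κ) ⊕ ι → B} (w : ι → B) (t : κ → B) (ν : ι → B)
    (hy : y = Sum.elim (Sum.elim w t) ν) (i : κ) :
    aeval (fun j => w j - aeval w π ^ 3 * disp h π S w t ν j) (h i) = val h w i -
      aeval w π ^ 3 * ((jac h w).mulVec (disp h π S w t ν)) i + aeval w π ^ 6 * aeval y (E.Q i) := by
  subst hy
  have := congrArg (aeval (Sum.elim (Sum.elim w t) ν)) (E.hQ i)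
  simpa only [map_add, map_sub, map_mul, map_pow, map_mulVec, map_jac, map_disp, map_val,
    map_aeval, aeval_X, Sum.elim_inl, Sum.elim_inr] using this

theorem expand_pi {y : (ι ⊕ κ) ⊕ ι → B} (w : ι → B) (t : κ → B) (ν : ι → B)
    (hy : y = Sum.elim (Sum.elim w t) ν) :
    aeval (fun j => w j - aeval w π ^ 3 * disp h π S w t ν j) π =
      aeval w π * (1 + aeval w π * aeval y E.r) := by
  subst hy
  have := congrArg (aeval (Sum.elim (Sum.elim w t) ν)) E.hr
  simpa only [map_add, map_sub, map_mul, map_pow, map_one, map_disp,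
    map_aeval, aeval_X, Sum.elim_inl, Sum.elim_inr] using this

/-- The square system. -/
noncomputable def sys (ρ : ι → P) (γ : κ → P) : ι ⊕ κ → MvPolynomial ((ι ⊕ κ) ⊕ ι) P :=
  Sum.elim (fun j => X (inl (inl j)) - C (ρ j) - aeval (fun j => X (inl (inl j))) π ^ 3 *
      disp h π S (fun j => X (inl (inl j))) (fun i => X (inl (inr i))) (fun j => X (inr j)) j)
    (fun i => X (inl (inr i)) + aeval (fun j => X (inl (inl j))) π ^ 2 *
      ((1 + aeval (fun j => X (inl (inl j))) π * E.r) ^ 6 * C (γ i) - E.Q i))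

/-- The square system together with the equations of `h`. -/
noncomputable def fullSys (ρ : ι → P) (γ : κ → P) :
    (ι ⊕ κ) ⊕ (κ ⊕ κ) → MvPolynomial ((ι ⊕ κ) ⊕ ι) P :=
  Sum.elim (E.sys ρ γ) (Sum.elim (val h fun j => X (inl (inl j)))
    (defVec h π S (fun j => X (inl (inl j))) (fun i => X (inl (inr i)))))

theorem aeval_sys_inl (ρ : ι → P) (γ : κ → P) (w : ι → B) (t : κ → B) (ν : ι → B) (j : ι) :
    aeval (Sum.elim (Sum.elim w t) ν) (E.sys ρ γ (inl j)) =
      w j - algebraMap P B (ρ j) - aeval w π ^ 3 * disp h π S w t ν j := by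
  simp only [sys, Sum.elim_inl, map_sub, map_mul, map_pow, map_disp, map_aeval, aeval_X,
    Sum.elim_inr, aeval_C]

theorem aeval_sys_inr (ρ : ι → P) (γ : κ → P) (w : ι → B) (t : κ → B) (ν : ι → B) (i : κ) :
    aeval (Sum.elim (Sum.elim w t) ν) (E.sys ρ γ (inr i)) =
      t i + aeval w π ^ 2 * ((1 + aeval w π * aeval (Sum.elim (Sum.elim w t) ν) E.r) ^ 6 *
        algebraMap P B (γ i) - aeval (Sum.elim (Sum.elim w t) ν) (E.Q i)) := by
  simp only [sys, Sum.elim_inl, map_sub, map_add, map_mul, map_pow, map_one, map_aeval, aeval_X,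
    Sum.elim_inr, aeval_C]

theorem aeval_fullSys_val (ρ : ι → P) (γ : κ → P) (w : ι → B) (t : κ → B) (ν : ι → B) (i : κ) :
    aeval (Sum.elim (Sum.elim w t) ν) (E.fullSys ρ γ (inr (inl i))) = val h w i := by
  simp only [fullSys, Sum.elim_inl, Sum.elim_inr, map_val, aeval_X]

theorem aeval_fullSys_defVec (ρ : ι → P) (γ : κ → P) (w : ι → B) (t : κ → B) (ν : ι → B) (i : κ) :
    aeval (Sum.elim (Sum.elim w t) ν) (E.fullSys ρ γ (inr (inr i))) = defVec h π S w t i := by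
  simp only [fullSys, Sum.elim_inl, Sum.elim_inr, map_defVec, aeval_X]

theorem smul_jac_eq (hS : IsStd h π S) {w : ι → B} (hw : val h w = 0) :
    aeval w π • jac h w = jac h w * sec S w * jac h w := by
  ext i j
  have := defect_mul_jac_mem hS w i j
  rw [hw] at this
  have h0 : span (range (0 : κ → B)) = ⊥ := by
    rw [Ideal.span_eq_bot]; rintro _ ⟨i, rfl⟩; rfl
  rw [h0, Ideal.mem_bot, Matrix.sub_apply, sub_eq_zero] at this
  exact this

theorem jac_mulVec_disp_of_val (hS : IsStd h π S) {w : ι → B} (hw : val h w = 0) (t : κ → B)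
    (ν : ι → B) : (jac h w).mulVec (disp h π S w t ν) = aeval w π • t - defVec h π S w t := by
  rw [jac_mulVec_disp, smul_jac_eq hS hw, sub_self, Matrix.zero_mulVec, add_zero, defVec]
  abel

theorem jac_sec_jac (hS : IsStd h π S) {w : ι → B} (hw : val h w = 0) (v : ι → B) :
    (jac h w).mulVec ((sec S w).mulVec ((jac h w).mulVec v)) = aeval w π • (jac h w).mulVec v := by
  rw [Matrix.mulVec_mulVec, Matrix.mulVec_mulVec, ← smul_jac_eq hS hw, Matrix.smul_mulVec]

theorem disp_section (hS : IsStd h π S) {w : ι → B} (hw : val h w = 0) {p : B}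
    (hp : aeval w π * p = 1) (u z : ι → B) :
    disp h π S w (p • (jac h w).mulVec u)
      (p • u + p • (sec S w).mulVec ((jac h w).mulVec z)) = u := by
  rw [disp]
  simp only [Matrix.mulVec_smul, Matrix.mulVec_add, jac_sec_jac hS hw]
  funext j
  simp only [Pi.add_apply, Pi.sub_apply, Pi.smul_apply, smul_eq_mul]
  linear_combination u j * hp

theorem solution_unique (hS : IsStd h π S) {w ν : ι → B} {t : κ → B} (hw : val h w = 0)
    (ht : defVec h π S w t = 0) {p : B} (hp : aeval w π * p = 1) {c : ι → B}
    (hc : ∀ j, w j - c j - aeval w π ^ 3 * disp h π S w t ν j = 0) :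
    (∀ j, disp h π S w t ν j = p ^ 3 * (w j - c j)) ∧
    t = p • (jac h w).mulVec (disp h π S w t ν) ∧
    ν = p • disp h π S w t ν + p • (sec S w).mulVec ((jac h w).mulVec
      (ν - p • disp h π S w t ν)) := by
  have h1 : t = p • (jac h w).mulVec (disp h π S w t ν) := by
    rw [jac_mulVec_disp_of_val hS hw, ht, sub_zero, smul_smul, mul_comm, hp, one_smul]
  refine ⟨fun j => ?_, h1, ?_⟩
  · have h2 : aeval w π ^ 3 * p ^ 3 = 1 := by rw [← mul_pow, hp, one_pow]
    linear_combination (-disp h π S w t ν j) * h2 - p ^ 3 * hc j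
  · have h2 : disp h π S w t ν = p • (sec S w).mulVec ((jac h w).mulVec (disp h π S w t ν)) +
        aeval w π • ν - (sec S w).mulVec ((jac h w).mulVec ν) := by
      conv_lhs => rw [disp, h1]
      rw [Matrix.mulVec_smul]
    simp only [Matrix.mulVec_sub, Matrix.mulVec_smul]
    funext j
    have h3 := congrFun h2 j
    simp only [Pi.add_apply, Pi.sub_apply, Pi.smul_apply, smul_eq_mul] at h3 ⊢
    linear_combination (-ν j) * hp - p * h3

/-- The full system has infinitesimal lifting where `π` is invertible. -/
theorem liftsAt_fullSys (hS : IsStd h π S) {ρ : ι → P} {γ : κ → P}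
    (hρ : ∀ i, aeval ρ (h i) = aeval ρ π ^ 6 * γ i) :
    LiftsAt (E.fullSys ρ γ) (aeval (fun j => X (inl (inl j))) π) := by
  intro B _ _ N hN y hy hu
  obtain ⟨w, t, ν, rfl⟩ : ∃ (w : ι → B) (t : κ → B) (ν : ι → B), y = Sum.elim (Sum.elim w t) ν :=
    ⟨fun j => y (inl (inl j)), fun i => y (inl (inr i)), fun j => y (inr j), by
      funext x; rcases x with (x | x) | x <;> rfl⟩
  simp only [map_aeval, aeval_X, Sum.elim_inl] at hu
  have hval : ∀ i, aeval w (h i) ∈ N := fun i => by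
    have := hy (inr (inl i)); rwa [aeval_fullSys_val] at this
  have hdef : ∀ i, defVec h π S w t i ∈ N := fun i => by
    have := hy (inr (inr i)); rwa [aeval_fullSys_defVec] at this
  have hFw : ∀ j, w j - algebraMap P B (ρ j) - aeval w π ^ 3 * disp h π S w t ν j ∈ N := fun j => by
    have := hy (inl (inl j)); rwa [fullSys, Sum.elim_inl, aeval_sys_inl] at this
  obtain ⟨w', hw', hw0⟩ := aeval_correct (π := π) (h := h) ⟨S, hS⟩ hN hval hu
  have hw0' : val h w' = 0 := funext hw0
  have hu' : IsUnit (aeval w' π) := isUnit_of_sub_mem hN hu (aeval_sub_mem hw' π)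
  obtain ⟨p, hp⟩ := hu'.exists_right_inv
  let u' : ι → B := fun j => p ^ 3 * (w' j - algebraMap P B (ρ j))
  let t' : κ → B := p • (jac h w').mulVec u'
  let ν' : ι → B := p • u' + p • (sec S w').mulVec ((jac h w').mulVec (ν - p • u'))
  have hdisp : disp h π S w' t' ν' = u' := disp_section hS hw0' hp u' (ν - p • u')
  refine ⟨Sum.elim (Sum.elim w' t') ν', ?_, ?_⟩
  · let f := Ideal.Quotient.mkₐ P N
    have hf : ∀ {a b : B}, f a = f b ↔ a - b ∈ N := Ideal.Quotient.eq
    have hf0 : ∀ {a : B}, f a = 0 ↔ a ∈ N := eq_zero_iff_mem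
    have hww : (fun j => f (w' j)) = fun j => f (w j) := funext fun j => hf.2 (hw' j)
    have hp' : aeval (fun j => f (w j)) π * f p = 1 := by
      rw [← hww, ← map_aeval, ← map_mul, hp, map_one]
    obtain ⟨e1, e2, e3⟩ := solution_unique hS (w := fun j => f (w j)) (ν := fun j => f (ν j))
      (t := fun i => f (t i)) (p := f p) (c := fun j => f (algebraMap P B (ρ j)))
      (by funext i; rw [← map_val]; exact hf0.2 (hval i))
      (by funext i; rw [← map_defVec]; exact hf0.2 (hdef i)) hp'
      (by
        intro j
        rw [← map_disp, ← map_aeval, ← map_pow, ← map_mul, ← map_sub, ← map_sub]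
        exact hf0.2 (hFw j))
    have hu : (fun j => f (u' j)) = disp h π S (fun j => f (w j)) (fun i => f (t i))
        (fun j => f (ν j)) := by
      funext j
      rw [e1 j]
      simp only [u', map_mul, map_pow, map_sub]
      rw [congrFun hww j]
    have ht : ∀ i, f (t' i) = f (t i) := by
      intro i
      rw [congrFun e2 i, ← hu, ← hww]
      simp only [t', Pi.smul_apply, smul_eq_mul, map_mul, map_mulVec, map_jac]
    have hν : ∀ j, f (ν' j) = f (ν j) := by
      intro j
      rw [congrFun e3 j, ← hu, ← hww]
      simp only [ν', Pi.add_apply, smul_eq_mul, map_mul, map_add, map_mulVec,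
        map_jac, map_sec, map_sub, Pi.sub_def, Pi.smul_def]
    rintro ((j | i) | j)
    · exact hw' j
    · exact hf.1 (ht i)
    · exact hf.1 (hν j)
  · have hmul : ∀ j, aeval w' π ^ 3 * u' j = w' j - algebraMap P B (ρ j) := fun j => by
      rw [← mul_assoc, ← mul_pow, hp, one_pow, one_mul]
    have hρ' : (fun j => w' j - aeval w' π ^ 3 * disp h π S w' t' ν' j) =
        fun j => Algebra.ofId P B (ρ j) := by
      funext j; rw [hdisp, hmul]; simp [Algebra.ofId_apply]
    have hd : defVec h π S w' t' = 0 := by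
      rw [defVec]
      simp only [t', Matrix.mulVec_smul, jac_sec_jac hS hw0']
      rw [smul_comm, sub_self]
    rintro ((j | i) | (i | i))
    · rw [fullSys, Sum.elim_inl, aeval_sys_inl, hdisp, hmul, sub_self]
    · rw [fullSys, Sum.elim_inl, aeval_sys_inr]
      have h1 := E.expand_val w' t' ν' rfl i
      have h2 := E.expand_pi w' t' ν' rfl
      rw [hρ', ← map_aeval] at h1 h2
      rw [hρ i, map_mul, map_pow, h2, hw0', jac_mulVec_disp_of_val hS hw0', hd] at h1
      simp only [Pi.zero_apply, sub_zero, Pi.smul_apply, smul_eq_mul, Algebra.ofId_apply] at h1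
      have hu4 : IsUnit (aeval w' π ^ 4) := hu'.pow 4
      refine (hu4.mul_right_eq_zero).1 ?_
      linear_combination h1
    · rw [aeval_fullSys_val]; exact hw0 i
    · rw [aeval_fullSys_defVec, hd]; rfl

/-- A solution of `h` close to `ρ` gives a solution of the full system. -/
theorem aeval_fullSys_eq_zero (hS : IsStd h π S) {ρ : ι → P} {γ : κ → P}
    (hρ : ∀ i, aeval ρ (h i) = aeval ρ π ^ 6 * γ i) {w μ : ι → B} (hw : val h w = 0)
    (hμ : ∀ j, w j - algebraMap P B (ρ j) = aeval w π ^ 5 * μ j)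
    (hann : ∀ b : B, aeval w π ^ 2 * b = 0 → aeval w π * b = 0) (x : (ι ⊕ κ) ⊕ (κ ⊕ κ)) :
    aeval (Sum.elim (Sum.elim w ((jac h w).mulVec (aeval w π • μ))) (aeval w π • μ))
      (E.fullSys ρ γ x) = 0 := by
  set t := (jac h w).mulVec (aeval w π • μ) with ht
  set ν := aeval w π • μ with hν
  have hd : defVec h π S w t = 0 := by
    rw [defVec, ht, jac_sec_jac hS hw, sub_self]
  have hdisp : disp h π S w t ν = aeval w π • ν := by
    rw [disp, ht]; abel
  have hFw : ∀ j, w j - algebraMap P B (ρ j) = aeval w π ^ 3 * disp h π S w t ν j := fun j => by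
    rw [hμ, hdisp, hν]; simp only [Pi.smul_apply, smul_eq_mul]; ring
  have hρ' : (fun j => w j - aeval w π ^ 3 * disp h π S w t ν j) =
      fun j => Algebra.ofId P B (ρ j) := by
    funext j; rw [← hFw]; simp [Algebra.ofId_apply]
  have hann' : ∀ (n : ℕ) (b : B), aeval w π ^ (n + 1) * b = 0 → aeval w π * b = 0 := by
    intro n
    induction n with
    | zero => intro b hb; simpa using hb
    | succ n ih =>
      intro b hb
      refine hann _ ?_
      have := ih (aeval w π * b) (by rw [← hb]; ring)
      rw [← this]; ring
  rcases x with (j | i) | (i | i)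
  · rw [fullSys, Sum.elim_inl, aeval_sys_inl, hFw, sub_self]
  · rw [fullSys, Sum.elim_inl, aeval_sys_inr]
    have h1 := E.expand_val w t ν rfl i
    have h2 := E.expand_pi w t ν rfl
    rw [hρ', ← map_aeval] at h1 h2
    rw [hρ i, map_mul, map_pow, h2, hw, jac_mulVec_disp_of_val hS hw, hd] at h1
    simp only [Pi.zero_apply, sub_zero, Pi.smul_apply, smul_eq_mul, Algebra.ofId_apply] at h1
    have h3 : t i = aeval w π * (jac h w).mulVec μ i := by
      rw [ht, hν, Matrix.mulVec_smul]; rfl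
    rw [h3] at h1 ⊢
    have h4 := hann' 4 ((jac h w).mulVec μ i + aeval w π *
      ((1 + aeval w π * aeval (Sum.elim (Sum.elim w t) ν) E.r) ^ 6 *
        algebraMap P B (γ i) - aeval (Sum.elim (Sum.elim w t) ν) (E.Q i)))
      (by linear_combination h1)
    linear_combination h4
  · rw [aeval_fullSys_val, hw]; rfl
  · rw [aeval_fullSys_defVec, hd]; rfl

end Expansion

end Desing

open Desing Expansion in
/-- The desingularization lemma. -/
theorem exists_desing {P : Type u} [CommRing P] {ι κ : Type} [Fintype ι] [Fintype κ]
    {h : κ → MvPolynomial ι P} {π : MvPolynomial ι P} {S : ι → κ → MvPolynomial ι P}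
    (hS : IsStd h π S) {ρ : ι → P} {γ : κ → P}
    (hρ : ∀ i, aeval ρ (h i) = aeval ρ π ^ 6 * γ i)
    {Λ : Type u} [CommRing Λ] [Algebra P Λ] {w μ : ι → Λ} (hw : ∀ i, aeval w (h i) = 0)
    (hμ : ∀ j, w j - algebraMap P Λ (ρ j) = aeval w π ^ 5 * μ j)
    (hann : ∀ b : Λ, aeval w π ^ 2 * b = 0 → aeval w π * b = 0) :
    ∃ (B : Type u) (_ : CommRing B) (_ : Algebra P B) (_ : FinitePresentation P B)
      (ζ : ι → B) (φ : B →ₐ[P] Λ), (∀ i, aeval ζ (h i) = 0) ∧ (∀ j, φ (ζ j) = w j) ∧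
      SmoothOn P (aeval ζ π) ∧
      ∀ g : P, (∀ (E : Type u) [CommRing E] [Algebra P E] [Smooth P E],
          IsUnit (algebraMap P E g) → ∀ x : E, algebraMap P E (aeval ρ π) ^ 2 * x = 0 →
            algebraMap P E (aeval ρ π) * x = 0) →
        ∃ c : B, SmoothOn P c ∧ ∃ r, φ c = algebraMap P Λ g + aeval w π * r := by
  classical
  obtain ⟨E⟩ := nonempty_expansion h π S
  let PX := MvPolynomial ((ι ⊕ κ) ⊕ ι) P
  let W : ι → PX := fun j => X (inl (inl j))
  let B0 := PX ⧸ sysIdeal (E.sys ρ γ)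
  let B1 := PX ⧸ sysIdeal (E.fullSys ρ γ)
  have : FinitePresentation P B0 := FinitePresentation.quotient
    ((Submodule.fg_span (Set.finite_range _)))
  have : FinitePresentation P B1 := FinitePresentation.quotient
    ((Submodule.fg_span (Set.finite_range _)))
  let m0 : PX →ₐ[P] B0 := Ideal.Quotient.mkₐ P _
  let m1 : PX →ₐ[P] B1 := Ideal.Quotient.mkₐ P _
  have hsys : ∀ x, E.sys ρ γ x ∈ sysIdeal (E.fullSys ρ γ) := fun x =>
    mem_sysIdeal (E.fullSys ρ γ) (inl x)
  let q : B0 →ₐ[P] B1 := Ideal.Quotient.liftₐ _ m1 fun a ha => by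
    have : sysIdeal (E.sys ρ γ) ≤ sysIdeal (E.fullSys ρ γ) := by
      rw [sysIdeal, span_le]; rintro _ ⟨i, rfl⟩; exact hsys i
    exact eq_zero_iff_mem.2 (this ha)
  have hval : val h w = 0 := funext hw
  let φ : B1 →ₐ[P] Λ := Ideal.Quotient.liftₐ _
    (aeval (Sum.elim (Sum.elim w ((jac h w).mulVec (aeval w π • μ))) (aeval w π • μ)))
    fun a ha => aeval_eq_zero_of_mem_sysIdeal (E.aeval_fullSys_eq_zero hS hρ hval hμ hann) ha
  have hφW : ∀ j, φ (m1 (W j)) = w j := fun j => by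
    change aeval (Sum.elim (Sum.elim w _) _) (X (inl (inl j))) = _
    rw [aeval_X]; rfl
  have hm0 : ∀ f : PX, aeval (Sum.elim (Sum.elim (fun j => m0 (W j))
      (fun i => m0 (X (inl (inr i))))) (fun j => m0 (X (inr j)))) f = m0 f := by
    intro f
    conv_rhs => rw [aeval_unique m0]
    congr 2
    funext x
    rcases x with (x | x) | x <;> rfl
  refine ⟨B1, inferInstance, inferInstance, inferInstance, fun j => m1 (W j), φ, ?_, hφW, ?_, ?_⟩
  · intro i
    rw [← Desing.map_aeval]
    exact eq_zero_iff_mem.2 (mem_sysIdeal (E.fullSys ρ γ) (inr (inl i)))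
  · rw [← Desing.map_aeval]
    exact (smoothOn_iff_liftsAt m1 mk_surjective mk_ker _).2 (E.liftsAt_fullSys hS hρ)
  intro g hg
  let δ : PX := (Matrix.of fun i j => pderiv (inl j) (E.sys ρ γ i)).det
  have hδ : SmoothOn P (m0 δ) :=
    (smoothOn_iff_liftsAt m0 mk_surjective mk_ker _).2 (liftsAt_det _)
  obtain ⟨r1, hr1⟩ : ∃ r, δ = 1 + aeval W π * r := by
    refine det_jacobian_eq _ _ ?_
    rintro (j | i)
    · exact ⟨ρ j, _, show _ = _ - C (ρ j) + aeval W π ^ 2 * (- aeval W π *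
        disp h π S W (fun i => X (inl (inr i))) (fun j => X (inr j)) j) from by
        simp only [sys, Sum.elim_inl, W]; ring⟩
    · exact ⟨0, _, show _ = _ - C 0 + aeval W π ^ 2 *
        ((1 + aeval W π * E.r) ^ 6 * C (γ i) - E.Q i) from by
        simp only [sys, Sum.elim_inr, W, map_zero, sub_zero]⟩
  let w0 : ι → B0 := fun j => m0 (W j)
  let t0 : κ → B0 := fun i => m0 (X (inl (inr i)))
  let ν0 : ι → B0 := fun j => m0 (X (inr j))
  have hsys0 : ∀ x, m0 (E.sys ρ γ x) = 0 := fun x =>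
    eq_zero_iff_mem.2 (mem_sysIdeal (E.sys ρ γ) x)
  have hE1 : ∀ j, w0 j - algebraMap P B0 (ρ j) = aeval w0 π ^ 3 * disp h π S w0 t0 ν0 j := by
    intro j
    have := hsys0 (inl j)
    rw [← hm0, aeval_sys_inl] at this
    linear_combination this
  have hE2 : ∀ i, t0 i + aeval w0 π ^ 2 * ((1 + aeval w0 π * m0 E.r) ^ 6 *
      algebraMap P B0 (γ i) - m0 (E.Q i)) = 0 := by
    intro i
    have := hsys0 (inr i)
    rwa [← hm0, aeval_sys_inr, hm0, hm0] at this
  have hρ' : (fun j => w0 j - aeval w0 π ^ 3 * disp h π S w0 t0 ν0 j) =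
      fun j => Algebra.ofId P B0 (ρ j) := by
    funext j; rw [← hE1]; simp [Algebra.ofId_apply]
  have h2 := E.expand_pi w0 t0 ν0 rfl
  rw [hρ', ← Desing.map_aeval, hm0] at h2
  have hval0 := Desing.val_eq (h := h) (π := π) (S := S) (w := w0) (t := t0) (ν := ν0)
    (Q := fun i => m0 (E.Q i)) (γ := fun i => algebraMap P B0 (γ i))
    (η := 1 + aeval w0 π * m0 E.r) (v := fun i => Algebra.ofId P B0 (aeval ρ (h i)))
    (fun i => by
      rw [Desing.map_aeval, ← hρ']
      exact (E.expand_val w0 t0 ν0 rfl i).trans (by rw [hm0]))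
    (fun i => by rw [hρ i, map_mul, map_pow, h2]; rfl) hE2
  let V := span (range (val h w0))
  let 𝔞 : Ideal B0 := span {aeval w0 π} * V
  obtain ⟨δ2, hδ2, hδ2'⟩ := Submodule.exists_sub_one_mem_and_smul_eq_zero_of_fg_of_le_smul
    (span {aeval w0 π}) 𝔞
    (Submodule.FG.mul (Submodule.fg_span_singleton _) (Submodule.fg_span (Set.finite_range _)))
    (by
      have h3 : 𝔞 ≤ span {aeval w0 π ^ 3} * V := by
        rw [Ideal.span_singleton_mul_le_iff]
        intro v hv
        induction hv using Submodule.span_induction with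
        | mem x hx => obtain ⟨i, rfl⟩ := hx; exact mul_val_mem hS hval0 i
        | zero => simp
        | add x y _ _ hx hy => rw [mul_add]; exact add_mem hx hy
        | smul a x _ hx => rw [smul_eq_mul, mul_left_comm]; exact mul_mem_left _ _ hx
      refine h3.trans ?_
      rw [smul_eq_mul, ← mul_assoc, Ideal.span_singleton_mul_span_singleton]
      refine Ideal.mul_mono_left ?_
      rw [Ideal.span_singleton_le_span_singleton]
      exact ⟨aeval w0 π, by ring⟩)
  rw [Ideal.mem_span_singleton] at hδ2
  obtain ⟨r2, hr2⟩ := hδ2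
  have hr2' : δ2 = 1 + aeval w0 π * r2 := by linear_combination hr2
  let c0 : B0 := algebraMap P B0 g * (m0 δ * (δ2 * (1 + aeval w0 π * m0 E.r)))
  have hd1 : m0 δ ∣ c0 := ⟨algebraMap P B0 g * (δ2 * (1 + aeval w0 π * m0 E.r)), by
    simp only [c0]; ring⟩
  refine ⟨q c0, ?_, ?_⟩
  · have : Smooth P (Localization.Away c0) := (hδ.of_dvd hd1).smooth _
    have hc0 : IsUnit (algebraMap B0 (Localization.Away c0) c0) :=
      IsLocalization.Away.algebraMap_isUnit c0
    let l : B0 →ₐ[P] Localization.Away c0 := toAlgHom P B0 _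
    have hlg : IsUnit (algebraMap P (Localization.Away c0) g) := by
      rw [IsScalarTower.algebraMap_apply P B0]
      exact isUnit_of_dvd_unit (map_dvd (algebraMap B0 (Localization.Away c0))
        (show algebraMap P B0 g ∣ c0 from Dvd.intro _ rfl)) hc0
    have hlδ2 : IsUnit (l δ2) := isUnit_of_dvd_unit (map_dvd l
      (show δ2 ∣ c0 from ⟨algebraMap P B0 g * m0 δ * (1 + aeval w0 π * m0 E.r), by
        simp only [c0]; ring⟩)) hc0
    have hlη : IsUnit (l (1 + aeval w0 π * m0 E.r)) := isUnit_of_dvd_unit (map_dvd l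
      (show (1 + aeval w0 π * m0 E.r) ∣ c0 from ⟨algebraMap P B0 g * m0 δ * δ2, by
        simp only [c0]; ring⟩)) hc0
    have hρl : algebraMap P (Localization.Away c0) (aeval ρ π) =
        aeval (fun j => l (w0 j)) π * l (1 + aeval w0 π * m0 E.r) := by
      rw [← Desing.map_aeval, ← map_mul, ← h2]
      exact (l.commutes _).symm
    have key := Desing.val_eq_zero hS (w := fun j => l (w0 j)) (t := fun i => l (t0 i))
      (ν := fun j => l (ν0 j)) (t' := fun i => l (- (aeval w0 π * ((1 + aeval w0 π * m0 E.r) ^ 6 *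
        algebraMap P B0 (γ i) - m0 (E.Q i)))))
      (by
        funext i
        have := congrArg l (congrFun hval0 i)
        rw [Desing.map_val] at this
        rw [this, Pi.smul_apply, Pi.smul_apply, smul_eq_mul,
          smul_eq_mul, map_mul, map_pow, Desing.map_aeval, Pi.sub_apply, Pi.sub_apply, map_sub,
          Desing.map_defVec, Desing.map_mulVec]
        congr 4
        ext i j
        simp only [Matrix.map_apply, Matrix.sub_apply, Matrix.smul_apply, Matrix.mul_apply,
          smul_eq_mul, map_sub, map_mul, map_sum, Desing.map_jac_apply, Desing.map_sec_apply,
          Desing.map_aeval])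
      (by
        funext i
        rw [Pi.smul_apply, smul_eq_mul, ← Desing.map_aeval, ← map_mul]
        congr 1
        linear_combination hE2 i)
      (by
        intro b hb
        have h5 := hg (Localization.Away c0) hlg b (by
          rw [hρl, mul_pow, mul_right_comm, hb, zero_mul])
        rw [hρl, mul_right_comm] at h5
        exact hlη.mul_left_eq_zero.1 h5) hlδ2
      (by
        intro i
        rw [← Desing.map_val, ← Desing.map_aeval, ← map_mul, ← map_mul]
        have := hδ2' (aeval w0 π * val h w0 i) (Ideal.mul_mem_mul
          (mem_span_singleton_self _) (subset_span ⟨i, rfl⟩))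
        rw [smul_eq_mul] at this
        rw [this, map_zero])
    intro B _ _ N hN f hf
    obtain ⟨f0, hf0⟩ := hδ.of_dvd hd1 B N hN (f.comp q) hf
    have hf0u : IsUnit (f0 c0) := isUnit_of_isUnit_mk hN (by
      have := DFunLike.congr_fun hf0 c0
      change mk N (f0 c0) = f (q c0) at this
      rw [this]; exact hf)
    have hzero : ∀ b : B0, l b = 0 → f0 b = 0 := by
      intro b hb
      have h6 := IsLocalization.Away.lift_eq (S := Localization.Away c0) c0
        (g := (f0 : B0 →+* B)) hf0u b
      rw [show algebraMap B0 (Localization.Away c0) b = 0 from hb, map_zero] at h6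
      exact h6.symm
    let f' : B1 →ₐ[P] B := Ideal.Quotient.liftₐ _ (f0.comp m0) fun a ha => by
      have hx : ∀ x, (f0.comp m0) (E.fullSys ρ γ x) = 0 := by
        rintro (x | (i | i))
        · exact (congrArg f0 (hsys0 x)).trans (map_zero f0)
        · refine hzero _ ?_
          change l (m0 (val h W i)) = 0
          rw [Desing.map_val, Desing.map_val]
          exact congrFun key.1 i
        · refine hzero _ ?_
          change l (m0 (defVec h π S W (fun i => X (inl (inr i))) i)) = 0
          rw [Desing.map_defVec, Desing.map_defVec]
          exact congrFun key.2 i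
      have : sysIdeal (E.fullSys ρ γ) ≤ ker (f0.comp m0) := by
        rw [sysIdeal, span_le]; rintro _ ⟨x, rfl⟩; exact hx x
      exact this ha
    refine ⟨f', Ideal.Quotient.algHom_ext _ (AlgHom.ext fun p => ?_)⟩
    exact DFunLike.congr_fun hf0 (m0 p)
  · have hψπ : φ (q (aeval w0 π)) = aeval w π := by
      rw [Desing.map_aeval, Desing.map_aeval]
      congr 2
      funext j
      exact hφW j
    have e1 : φ (q (m0 δ)) = 1 + aeval w π * φ (q (m0 r1)) := by
      rw [hr1, map_add, map_mul, Desing.map_aeval, map_add, map_mul, map_add, map_mul, hψπ]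
      simp only [map_one]
    refine ⟨algebraMap P Λ g * (φ (q (m0 r1)) * (1 + aeval w π * φ (q r2)) *
      (1 + aeval w π * φ (q (m0 E.r))) + φ (q r2) * (1 + aeval w π * φ (q (m0 E.r))) +
      φ (q (m0 E.r))), ?_⟩
    simp only [c0, hr2', map_mul, map_add, map_one, hψπ, e1, AlgHom.commutes]
    ring

section SmoothIdeal

variable {R : Type u} [CommRing R]

theorem SmoothOn.of_formallySmooth {C : Type u} [CommRing C] [Algebra R C]
    [FormallySmooth R C] (c : C) : SmoothOn R c := fun _ _ _ N hN f _ =>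
  ⟨FormallySmooth.lift N ⟨2, hN⟩ f, FormallySmooth.comp_lift N ⟨2, hN⟩ f⟩

theorem SmoothOn.of_pow {C : Type u} [CommRing C] [Algebra R C] {c : C} {n : ℕ}
    (H : SmoothOn R (c ^ n)) : SmoothOn R c := fun B _ _ N hN f hu =>
  H B N hN f (by rw [map_pow]; exact hu.pow n)

theorem smoothOn_iff_basicOpen_subset {C : Type u} [CommRing C] [Algebra R C]
    [FinitePresentation R C] {c : C} :
    SmoothOn R c ↔ (PrimeSpectrum.basicOpen c : Set (PrimeSpectrum C)) ⊆
      Algebra.smoothLocus R C := by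
  rw [Algebra.basicOpen_subset_smoothLocus_iff]
  constructor
  · intro H
    have := H.smooth (Localization.Away c)
    infer_instance
  · intro H
    exact SmoothOn.of_smooth (Localization.Away c)

/-- The ideal of elements `c` such that `C` is smooth over `R` away from the zeros of `c`. -/
def smoothIdeal (R C : Type u) [CommRing R] [CommRing C] [Algebra R C]
    [FinitePresentation R C] : Ideal C where
  carrier := {c | SmoothOn R c}
  zero_mem' := smoothOn_iff_basicOpen_subset.2 (by simp)
  add_mem' := by
    intro a b ha hb
    change SmoothOn R _ at ha hb ⊢
    rw [smoothOn_iff_basicOpen_subset] at ha hb ⊢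
    intro p hp
    by_cases h : a ∈ p.asIdeal
    · refine hb ?_
      intro h'
      exact hp (add_mem h h')
    · exact ha h
  smul_mem' := fun a _ hb => SmoothOn.of_dvd hb (Dvd.intro_left a rfl)

theorem mem_smoothIdeal {C : Type u} [CommRing C] [Algebra R C]
    [FinitePresentation R C] {c : C} : c ∈ smoothIdeal R C ↔ SmoothOn R c := Iff.rfl

/-- The algebra map `v` factors through a smooth algebra. -/
def HasSmoothFactor {R B Λ : Type u} [CommRing R] [CommRing B] [CommRing Λ] [Algebra R B]
    [Algebra R Λ] (v : B →ₐ[R] Λ) : Prop :=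
  ∃ (C : Type u) (_ : CommRing C) (_ : Algebra R C), Smooth R C ∧
    ∃ (f : B →ₐ[R] C) (g : C →ₐ[R] Λ), g.comp f = v

variable {B C Λ : Type u} [CommRing B] [CommRing C] [CommRing Λ] [Algebra R B] [Algebra R C]
  [Algebra R Λ]

theorem HasSmoothFactor.comp {g : C →ₐ[R] Λ} (H : HasSmoothFactor g) (f : B →ₐ[R] C) :
    HasSmoothFactor (g.comp f) := by
  obtain ⟨D, _, _, hD, f', g', rfl⟩ := H
  exact ⟨D, _, _, hD, f'.comp f, g', rfl⟩

theorem SmoothOn.hasSmoothFactor [FinitePresentation R C] {c : C} (H : SmoothOn R c)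
    (φ : C →ₐ[R] Λ) (hu : IsUnit (φ c)) : HasSmoothFactor φ := by
  have hs := H.smooth (Localization.Away c)
  let g : Localization.Away c →ₐ[R] Λ :=
    IsLocalization.liftAlgHom (M := Submonoid.powers c) (f := φ) (by
      rintro ⟨_, n, rfl⟩
      simpa using hu.pow n)
  refine ⟨Localization.Away c, _, _, hs, toAlgHom R C _, g, ?_⟩
  refine AlgHom.ext fun a => ?_
  simp [g]

theorem SmoothOn.mvPolynomial {c : C} (H : SmoothOn R c) (σ : Type) [Finite σ] :
    SmoothOn R (MvPolynomial.C (σ := σ) c) :=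
  H.trans (SmoothOn.of_formallySmooth _) dvd_rfl

theorem exists_sum_of_mem_map_smoothIdeal [FinitePresentation R C] {φ : C →ₐ[R] Λ}
    {x : Λ} (hx : x ∈ (smoothIdeal R C).map φ) :
    ∃ (n : ℕ) (c : Fin n → C) (r : Fin n → Λ), (∀ i, SmoothOn R (c i)) ∧
      ∑ i, φ (c i) * r i = x := by
  obtain ⟨n, r, g, hg⟩ := Submodule.mem_span_set'.1 hx
  choose c hc hc' using fun i => (g i).2
  exact ⟨n, c, r, hc, by rw [← hg]; simp [hc', mul_comm]⟩

theorem hasSmoothFactor_of_map_eq_top [FinitePresentation R C] (φ : C →ₐ[R] Λ)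
    (h : (smoothIdeal R C).map φ = ⊤) : HasSmoothFactor φ := by
  obtain ⟨n, c, r, hc, hr⟩ := exists_sum_of_mem_map_smoothIdeal
    (h ▸ Submodule.mem_top : (1 : Λ) ∈ (smoothIdeal R C).map φ)
  let φ' : MvPolynomial (Fin n) C →ₐ[R] Λ := MvPolynomial.aevalTower φ r
  have : FinitePresentation R (MvPolynomial (Fin n) C) :=
    FinitePresentation.trans R C _
  have h1 : (∑ i, MvPolynomial.C (c i) * X i : MvPolynomial (Fin n) C) ∈ smoothIdeal R _ :=
    Ideal.sum_mem _ fun i _ => mul_mem_right _ _ ((hc i).mvPolynomial (Fin n))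
  have h2 := (mem_smoothIdeal.1 h1).hasSmoothFactor φ' (by simp [φ', hr])
  have h3 : φ = φ'.comp (toAlgHom R C (MvPolynomial (Fin n) C)) :=
    AlgHom.ext fun a => by simp [φ']
  rw [h3]
  exact h2.comp _

theorem exists_presentation (R C : Type u) [CommRing R] [CommRing C] [Algebra R C]
    [FinitePresentation R C] :
    ∃ (n m : ℕ) (h : Fin m → MvPolynomial (Fin n) R) (φ : MvPolynomial (Fin n) R →ₐ[R] C),
      Surjective φ ∧ ker φ = sysIdeal h := by
  obtain ⟨n, φ, hφ, hker⟩ := FinitePresentation.out (R := R) (A := C)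
  obtain ⟨m, h, hh⟩ := Submodule.fg_iff_exists_fin_generating_family.1 hker
  exact ⟨n, m, h, φ, hφ, hh.symm⟩

theorem exists_extension_of_sum [FinitePresentation R C] (φ : C →ₐ[R] Λ)
    {J K : Type} [Fintype J] [Fintype K] (c : K → C) (hc : ∀ l, SmoothOn R (c l)) (π : J → C)
    (r : J → K → Λ) (hr : ∀ j, ∑ l, φ (c l) * r j l = φ (π j)) :
    ∃ (D : Type u) (_ : CommRing D) (_ : Algebra R D) (_ : FinitePresentation R D)
      (f : C →ₐ[R] D) (g : D →ₐ[R] Λ), g.comp f = φ ∧ ∀ j, SmoothOn R (f (π j)) ∧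
        ∃ s : K → D, ∑ l, f (c l) * s l = f (π j) := by
  classical
  let h : J → MvPolynomial (J × K) C := fun j =>
    ∑ l, MvPolynomial.C (c l) * X (j, l) - MvPolynomial.C (π j)
  let D := MvPolynomial (J × K) C ⧸ sysIdeal h
  let m : MvPolynomial (J × K) C →ₐ[C] D := Ideal.Quotient.mkₐ C _
  have hD : FinitePresentation C D := FinitePresentation.quotient
    ((Submodule.fg_span (Set.finite_range _)))
  have hD' : FinitePresentation R D := FinitePresentation.trans R C D
  let g0 : MvPolynomial (J × K) C →ₐ[R] Λ := MvPolynomial.aevalTower φ fun p => r p.1 p.2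
  have hg0 : ∀ a ∈ sysIdeal h, g0 a = 0 := fun a ha => by
    have : sysIdeal h ≤ ker g0 := by
      rw [sysIdeal, span_le]
      rintro _ ⟨j, rfl⟩
      simp [h, g0, mem_ker, hr]
    exact this ha
  let g : D →ₐ[R] Λ := Ideal.Quotient.liftₐ (sysIdeal h) g0 hg0
  have hstd : ∀ l, (MvPolynomial.C (c l) : MvPolynomial (J × K) C) ∈ stdIdeal h := fun l => by
    refine ⟨fun p j => if p = (j, l) then 1 else 0, fun i => ?_⟩
    have h1 : ∑ p, ∑ k, pderiv p (h i) * (if p = (k, l) then 1 else 0) * h k =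
        MvPolynomial.C (c l) * h i := by
      rw [sum_comm]
      have h2 : ∀ k, pderiv (k, l) (h i) = if i = k then MvPolynomial.C (c l) else 0 := fun k => by
        simp only [h, map_sub, map_sum, Derivation.leibniz, pderiv_X, pderiv_C, smul_eq_mul,
          mul_zero, add_zero, sub_zero, Pi.single_apply, Prod.mk.injEq]
        by_cases hik : i = k
        · simp [hik]
        · simp [hik]
      simp [h2]
    rw [h1, sub_self]
    exact zero_mem _
  have hsm : ∀ l, SmoothOn R (algebraMap C D (c l)) := fun l => by
    refine (hc l).trans (E := D) ?_ dvd_rfl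
    exact (smoothOn_iff_liftsAt m mk_surjective mk_ker
      (MvPolynomial.C (c l))).2 (liftsAt_of_mem_stdIdeal (hstd l))
  refine ⟨D, inferInstance, inferInstance, hD', toAlgHom R C D, g, ?_, fun j => ?_⟩
  · refine AlgHom.ext fun a => ?_
    change g0 (MvPolynomial.C a) = φ a
    simp [g0]
  · have h1 : m (h j) = 0 := eq_zero_iff_mem.2 (mem_sysIdeal h j)
    have h2 : algebraMap C D (π j) = ∑ l, algebraMap C D (c l) * m (X (j, l)) := by
      simp only [h, map_sub, map_sum, map_mul] at h1
      exact (sub_eq_zero.1 h1).symm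
    refine ⟨?_, fun l => m (X (j, l)), h2.symm⟩
    rw [IsScalarTower.coe_toAlgHom', h2, ← mem_smoothIdeal]
    exact Ideal.sum_mem _ fun l _ => mul_mem_right _ _ (hsm l)

theorem exists_extension [FinitePresentation R C] (φ : C →ₐ[R] Λ) {J : Type} [Fintype J]
    (π : J → C) (hπ : ∀ j, φ (π j) ∈ (smoothIdeal R C).map φ) :
    ∃ (D : Type u) (_ : CommRing D) (_ : Algebra R D) (_ : FinitePresentation R D)
      (f : C →ₐ[R] D) (g : D →ₐ[R] Λ), g.comp f = φ ∧ ∀ j, SmoothOn R (f (π j)) := by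
  classical
  choose n c r hc hr using fun j => exists_sum_of_mem_map_smoothIdeal (hπ j)
  have key : ∀ j, ∑ p : Σ j, Fin (n j), φ (c p.1 p.2) * (if p.1 = j then r p.1 p.2 else 0) =
      φ (π j) := fun j => by
    rw [Fintype.sum_sigma, Finset.sum_eq_single j]
    · simp [hr]
    · intro b _ hb; simp [hb]
    · simp
  obtain ⟨D, i₁, i₂, i₃, f, g, h, h'⟩ := exists_extension_of_sum φ (K := Σ j, Fin (n j))
    (fun p => c p.1 p.2) (fun p => hc _ _) π (fun j p => if p.1 = j then r p.1 p.2 else 0) key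
  exact ⟨D, i₁, i₂, i₃, f, g, h, fun j => (h' j).1⟩

end SmoothIdeal

section Jacobian

variable {P : Type u} [CommRing P]

theorem liftsAt_det_mul {τ ω : Type*} [Fintype τ] [DecidableEq τ] [Fintype ω]
    (F : τ → MvPolynomial ω P) (S : ω → τ → MvPolynomial ω P) :
    LiftsAt F (Matrix.of fun i k => ∑ j, pderiv j (F i) * S j k).det := by
  intro B _ _ N hN x hx hu
  let K : Matrix τ τ B := Matrix.of fun i k => ∑ j, aeval x (pderiv j (F i)) * aeval x (S j k)
  have hK : IsUnit K.det := by
    have : K = (aeval x).toRingHom.mapMatrix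
        (Matrix.of fun i k => ∑ j, pderiv j (F i) * S j k) := by
      ext i j; simp [K]
    rw [this, ← RingHom.map_det]; exact hu
  let y : τ → B := K⁻¹.mulVec fun i => aeval x (F i)
  have hy : ∀ k, y k ∈ N := fun j => Ideal.sum_mem _ fun i _ => mul_mem_left _ _ (hx i)
  let v : ω → B := fun j => - ∑ k, aeval x (S j k) * y k
  have hv : ∀ j, v j ∈ N := fun j => N.neg_mem (Ideal.sum_mem _ fun k _ =>
    mul_mem_left _ _ (hy k))
  refine ⟨x + v, fun j => by simpa using hv j, fun i => ?_⟩
  rw [aeval_add_eq_of_sq_eq_bot hN x v hv]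
  have h1 : K.mulVec y = fun i => aeval x (F i) := by
    simp only [y, Matrix.mulVec_mulVec, Matrix.mul_nonsing_inv _ hK, Matrix.one_mulVec]
  have h2 : aeval x (F i) = ∑ j, aeval x (pderiv j (F i)) * ∑ k, aeval x (S j k) * y k := by
    rw [← congrFun h1 i]
    simp only [Matrix.mulVec, dotProduct, K, Matrix.of_apply, Finset.sum_mul, mul_sum]
    rw [sum_comm]
    exact sum_congr rfl fun j _ => sum_congr rfl fun k _ => by ring
  simp only [v, mul_neg, Finset.sum_neg_distrib, ← h2, add_neg_cancel]

end Jacobian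

section Symmetrization

variable {P : Type u} [CommRing P] {ι κ : Type} [Fintype ι] [Fintype κ] [DecidableEq κ]

/-- The matrix `c - (∂f)S`. -/
noncomputable def stdMat (f : κ → MvPolynomial ι P) (c : MvPolynomial ι P)
    (S : ι → κ → MvPolynomial ι P) (i l : κ) : MvPolynomial ι P :=
  (if i = l then c else 0) - ∑ j, pderiv j (f i) * S j l

/-- The system `f + M Y - p T` in the variables `z`, `Y`, `T`. -/
noncomputable def symSys (f : κ → MvPolynomial ι P) (M : κ → κ → MvPolynomial ι P)
    (p : MvPolynomial ι P) (i : κ) : MvPolynomial (ι ⊕ (κ ⊕ κ)) P :=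
  rename inl (f i) + ∑ l, rename inl (M i l) * X (inr (inl l)) - rename inl p * X (inr (inr i))

/-- A jacobian determinant on whose locus of invertibility `symSys f M p` is smooth. -/
noncomputable def symJac (f : κ → MvPolynomial ι P) (M : κ → κ → MvPolynomial ι P)
    (p : MvPolynomial ι P) (S : ι → κ → MvPolynomial ι P) : MvPolynomial (ι ⊕ (κ ⊕ κ)) P :=
  (Matrix.of fun i k => ∑ j, pderiv j (symSys f M p i) * (Sum.elim (fun j => rename inl (S j k))
      (Sum.elim (fun l => if l = k then 1 else 0) 0) : ι ⊕ (κ ⊕ κ) → _) j).det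

theorem liftsAt_symJac (f : κ → MvPolynomial ι P) (M : κ → κ → MvPolynomial ι P)
    (p : MvPolynomial ι P) (S : ι → κ → MvPolynomial ι P) :
    LiftsAt (symSys f M p) (symJac f M p S) :=
  liftsAt_det_mul (symSys f M p) fun j k => (Sum.elim (fun j => rename inl (S j k))
      (Sum.elim (fun l => if l = k then 1 else 0) 0) : ι ⊕ (κ ⊕ κ) → _) j

theorem aeval_symSys {A : Type*} [CommRing A] [Algebra P A] (f : κ → MvPolynomial ι P)
    (M : κ → κ → MvPolynomial ι P) (p : MvPolynomial ι P) (i : κ) (z : ι → A) (Y T : κ → A) :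
    aeval (Sum.elim z (Sum.elim Y T)) (symSys f M p i) =
      aeval z (f i) + ∑ l, aeval z (M i l) * Y l - aeval z p * T i := by
  simp [symSys, aeval_rename]

theorem pderiv_inl_rename {τ : Type*} (j : ι) (f : MvPolynomial ι P) :
    pderiv (inl j : ι ⊕ τ) (rename inl f) = rename inl (pderiv j f) :=
  (pderiv_rename Sum.inl_injective _ _)

theorem pderiv_inr_rename {τ : Type*} (j : τ) (f : MvPolynomial ι P) :
    pderiv (inr j : ι ⊕ τ) (rename inl f) = 0 := by
  classical
  apply pderiv_eq_zero_of_notMem_vars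
  intro h
  have := vars_rename inl f h
  simp at this

theorem aeval_symJac {A : Type*} [CommRing A] [Algebra P A] (f : κ → MvPolynomial ι P)
    (c : MvPolynomial ι P) (p : MvPolynomial ι P) (S : ι → κ → MvPolynomial ι P)
    (z : ι → A) (T : κ → A) :
    aeval (Sum.elim z (Sum.elim 0 T)) (symJac f (stdMat f c S) p S) =
      (Matrix.of fun i k => (if i = k then aeval z c else 0) -
        T i * ∑ j, aeval z (pderiv j p) * aeval z (S j k)).det := by
  classical
  rw [symJac, AlgHom.map_det]
  congr 1
  ext i k
  simp only [AlgHom.mapMatrix_apply, Matrix.map_apply, Matrix.of_apply, Fintype.sum_sum_type,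
    Sum.elim_inl, Sum.elim_inr, Pi.zero_apply, mul_zero, Finset.sum_const_zero, add_zero, map_add,
    map_sum, map_mul, symSys, map_sub, Derivation.leibniz, smul_eq_mul, pderiv_inl_rename,
    pderiv_inr_rename, aeval_rename, aeval_X, Sum.elim_comp_inl, pderiv_X, Pi.single_apply,
    inr.injEq, inl.injEq, reduceCtorEq, if_false, zero_mul, add_zero, zero_add,
    mul_ite, mul_one, Finset.sum_ite_eq', mem_univ, if_true, sub_zero]
  simp only [stdMat, map_sub, map_sum, map_mul, apply_ite (aeval z), map_zero, sub_mul,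
    Finset.sum_sub_distrib, mul_sum]
  rw [sum_congr rfl fun j _ => mul_assoc (T i) _ _]
  ring

theorem exists_mul_of_mem_sq {f : κ → MvPolynomial ι P} {a : MvPolynomial ι P}
    (ha : a ∈ sysIdeal f ^ 2) : ∃ q : κ → MvPolynomial ι P, (∀ l, q l ∈ sysIdeal f) ∧
      a = ∑ l, q l * f l := by
  rw [sq, ← smul_eq_mul, Submodule.mem_ideal_smul_span_iff_exists_sum] at ha
  obtain ⟨q, hq, rfl⟩ := ha
  exact ⟨q, hq, by rw [Finsupp.sum_fintype _ _ (by simp)]; rfl⟩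

theorem exists_mul_of_mem_sysIdeal {f : κ → MvPolynomial ι P} {a : MvPolynomial ι P}
    (ha : a ∈ sysIdeal f) : ∃ q : κ → MvPolynomial ι P, a = ∑ l, q l * f l := by
  obtain ⟨q, hq⟩ := (mem_span_range_iff_exists_fun).1 ha
  exact ⟨q, hq.symm⟩

theorem IsStd.exists_denominator {f : κ → MvPolynomial ι P} {c : MvPolynomial ι P}
    {S : ι → κ → MvPolynomial ι P} (hS : IsStd f c S) :
    ∃ (Q : κ → κ → MvPolynomial ι P) (d : MvPolynomial (ι ⊕ (κ ⊕ κ)) P)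
      (e : κ → MvPolynomial (ι ⊕ (κ ⊕ κ)) P),
      (∀ i l, Q i l ∈ sysIdeal f) ∧ (∀ i, ∑ l, stdMat f c S i l * f l = ∑ l, Q i l * f l) ∧
      (∀ (A : Type u) [CommRing A] [Algebra P A] (z : ι → A) (Y T : κ → A) (p : A),
        (∀ i, aeval z (f i) + ∑ l, aeval z (stdMat f c S i l) * Y l - p * T i = 0) → ∀ i,
          aeval (Sum.elim z (Sum.elim Y T)) d * aeval z (f i) =
            p * aeval (Sum.elim z (Sum.elim Y T)) (e i)) ∧
      (∀ (A : Type u) [CommRing A] [Algebra P A] (z : ι → A) (T : κ → A),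
        (∀ i, ∑ l, aeval z (Q i l) * T l = ∑ l, aeval z (stdMat f c S i l) * T l) → ∀ i,
          aeval (Sum.elim z (Sum.elim 0 T)) (e i) = aeval (Sum.elim z (Sum.elim 0 T)) d * T i) ∧
      (∀ (A : Type u) [CommRing A] [Algebra P A] (z : ι → A) (T : κ → A),
        aeval (Sum.elim z (Sum.elim 0 T)) d =
          (Matrix.of fun i l => (if i = l then aeval z c else 0) - aeval z (Q i l)).det) := by
  let M := stdMat f c S
  have hM : ∀ i, ∑ l, M i l * f l ∈ sysIdeal f ^ 2 := fun i => by
    have : ∑ l, M i l * f l = c * f i - ∑ j, ∑ l, pderiv j (f i) * S j l * f l := by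
      simp only [M, stdMat, sub_mul, Finset.sum_sub_distrib, ite_mul, zero_mul,
        Finset.sum_ite_eq, mem_univ, if_true, Finset.sum_mul]
      rw [sum_comm]
    rw [this]
    exact hS i
  choose Q hQ hQ' using fun i => exists_mul_of_mem_sq (hM i)
  have hM1 : ∀ i j, ∑ l, M i l * pderiv j (f l) ∈ sysIdeal f := fun i j => by
    have : ∑ l, M i l * pderiv j (f l) =
        c * pderiv j (f i) - ∑ k, ∑ l, pderiv k (f i) * S k l * pderiv j (f l) := by
      simp only [M, stdMat, sub_mul, Finset.sum_sub_distrib, ite_mul, zero_mul,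
        Finset.sum_ite_eq, mem_univ, if_true, Finset.sum_mul]
      rw [sum_comm]
    rw [this]
    exact hS.mul_jacobian_mem i j
  choose q hq using fun i j => exists_mul_of_mem_sysIdeal (hM1 i j)
  let V := ι ⊕ (κ ⊕ κ)
  let r : MvPolynomial ι P →ₐ[P] MvPolynomial V P := rename inl
  let N : Matrix κ κ (MvPolynomial V P) := Matrix.of fun i m =>
    (if i = m then r c else 0) - r (Q i m) + ∑ j, ∑ l, r (q i j m) * r (S j l) * X (inr (inl l))
  let e' : κ → MvPolynomial V P := fun i => r c * X (inr (inr i)) - ∑ l, r (M i l) * X (inr (inr l))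
  refine ⟨Q, N.det, N.adjugate.mulVec e', hQ, hQ', ?_, ?_, ?_⟩
  · intro A _ _ z Y T p hF i
    let a := aeval (R := P) (Sum.elim z (Sum.elim Y T))
    let NA : Matrix κ κ A := a.mapMatrix N
    have hr : ∀ b, a (r b) = aeval z b := fun b => by simp [a, r, aeval_rename]
    have hNA : ∀ i m, NA i m = (if i = m then aeval z c else 0) - aeval z (Q i m) +
        ∑ j, ∑ l, aeval z (q i j m) * aeval z (S j l) * Y l := fun i m => by
      simp only [NA, N, AlgHom.mapMatrix_apply, Matrix.map_apply, Matrix.of_apply, map_add, map_sub,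
        map_sum, map_mul, hr, apply_ite a, map_zero]
      simp [a]
    have he' : ∀ i, a (e' i) = aeval z c * T i - ∑ l, aeval z (M i l) * T l := fun i => by
      simp only [e', map_sub, map_sum, map_mul, hr]
      simp [a]
    have h1 : NA.mulVec (fun i => aeval z (f i)) = fun i => p * a (e' i) := by
      funext i
      have hf : ∀ i, ∑ l, aeval z (M i l) * Y l = p * T i - aeval z (f i) := fun i => by
        linear_combination hF i
      have e1 : ∑ l, aeval z (M i l) * aeval z (f l) = ∑ l, aeval z (Q i l) * aeval z (f l) := by
        simpa using congrArg (aeval z) (hQ' i)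
      have e2 : ∀ j, ∑ l, aeval z (M i l) * aeval z (pderiv j (f l)) =
          ∑ m, aeval z (q i j m) * aeval z (f m) := fun j => by
        simpa using congrArg (aeval z) (hq i j)
      have e3 : ∑ m, (∑ j, ∑ l, aeval z (q i j m) * aeval z (S j l) * Y l) * aeval z (f m) =
          ∑ k, aeval z (M i k) * ∑ l, (∑ j, aeval z (pderiv j (f k)) * aeval z (S j l)) * Y l := by
        calc _ = ∑ j, ∑ l, (∑ m, aeval z (q i j m) * aeval z (f m)) * aeval z (S j l) * Y l := by
              simp only [Finset.sum_mul]
              rw [sum_comm]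
              refine sum_congr rfl fun j _ => ?_
              rw [sum_comm]
              exact sum_congr rfl fun l _ => sum_congr rfl fun m _ => by ring
          _ = ∑ j, ∑ l, (∑ k, aeval z (M i k) * aeval z (pderiv j (f k))) * aeval z (S j l) *
              Y l := by simp only [e2]
          _ = _ := by
              simp only [Finset.sum_mul, mul_sum]
              rw [sum_congr rfl fun j _ => sum_comm, sum_comm]
              refine sum_congr rfl fun k _ => ?_
              rw [sum_comm]
              exact sum_congr rfl fun l _ => sum_congr rfl fun j _ => by ring
      have e4 : ∀ k, ∑ l, (∑ j, aeval z (pderiv j (f k)) * aeval z (S j l)) * Y l =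
          aeval z c * Y k - (p * T k - aeval z (f k)) := fun k => by
        rw [← hf k]
        simp [M, stdMat, sub_mul, apply_ite (aeval z), ite_mul]
      simp only [e4] at e3
      simp only [Matrix.mulVec, dotProduct, hNA, add_mul, sub_mul, sum_add_distrib,
        Finset.sum_sub_distrib, ite_mul, zero_mul, Finset.sum_ite_eq, mem_univ, if_true,
        he', e3, mul_sub]
      have e5 : ∑ k, aeval z (M i k) * (aeval z c * Y k) = aeval z c * (p * T i - aeval z (f i)) := by
        rw [← hf i, mul_sum]
        exact sum_congr rfl fun k _ => by ring
      have e6 : ∑ k, aeval z (M i k) * (p * T k) = p * ∑ k, aeval z (M i k) * T k := by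
        rw [mul_sum]
        exact sum_congr rfl fun k _ => by ring
      rw [e5, e6, e1]
      ring
    have h2 : NA.adjugate.mulVec (NA.mulVec (fun i => aeval z (f i))) =
        NA.det • (fun i => aeval z (f i)) := by
      rw [Matrix.mulVec_mulVec, Matrix.adjugate_mul, Matrix.smul_mulVec, Matrix.one_mulVec]
    rw [h1] at h2
    have h3 : a N.det = NA.det := AlgHom.map_det _ _
    have h4 : NA.adjugate = a.mapMatrix N.adjugate := (AlgHom.map_adjugate _ _).symm
    have h5 := congrFun h2 i
    change a N.det * _ = p * a _
    rw [h3]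
    refine h5.symm.trans ?_
    rw [h4]
    simp only [Matrix.mulVec, dotProduct, map_sum, map_mul, AlgHom.mapMatrix_apply,
      Matrix.map_apply, mul_sum]
    exact sum_congr rfl fun k _ => by ring
  · intro A _ _ z T hT i
    let a := aeval (R := P) (Sum.elim z (Sum.elim (0 : κ → A) T))
    let NA : Matrix κ κ A := a.mapMatrix N
    have hr : ∀ b, a (r b) = aeval z b := fun b => by simp [a, r, aeval_rename]
    have hNA : ∀ i m, NA i m = (if i = m then aeval z c else 0) - aeval z (Q i m) := fun i m => by
      simp only [NA, N, AlgHom.mapMatrix_apply, Matrix.map_apply, Matrix.of_apply, map_add, map_sub,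
        map_sum, map_mul, hr, apply_ite a, map_zero]
      simp [a]
    have h1 : NA.mulVec T = fun i => a (e' i) := by
      funext i
      simp only [e', map_sub, map_sum, map_mul, hr, Matrix.mulVec, dotProduct, hNA, sub_mul,
        Finset.sum_sub_distrib, ite_mul, zero_mul, Finset.sum_ite_eq, mem_univ, if_true, hT]
      simp [a, M]
    have h2 : NA.adjugate.mulVec (NA.mulVec T) = NA.det • T := by
      rw [Matrix.mulVec_mulVec, Matrix.adjugate_mul, Matrix.smul_mulVec, Matrix.one_mulVec]
    rw [h1] at h2
    have h3 : a N.det = NA.det := AlgHom.map_det _ _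
    have h4 : NA.adjugate = a.mapMatrix N.adjugate := (AlgHom.map_adjugate _ _).symm
    have h5 := congrFun h2 i
    change a _ = a N.det * _
    rw [h3]
    refine Eq.trans ?_ h5
    rw [h4]
    simp only [Matrix.mulVec, dotProduct, map_sum, map_mul, AlgHom.mapMatrix_apply,
      Matrix.map_apply]
  · intro A _ _ z T
    rw [AlgHom.map_det]
    congr 1
    ext i m
    simp only [N, AlgHom.mapMatrix_apply, Matrix.map_apply, Matrix.of_apply, map_add, map_sub,
        map_sum, map_mul, apply_ite (aeval (Sum.elim z (Sum.elim (0 : κ → A) T))), map_zero]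
    simp [r, aeval_rename]

end Symmetrization

section Lift

theorem exists_algHom_of_ker_le {R A B C : Type*} [CommRing R] [CommRing A] [CommRing B]
    [CommRing C] [Algebra R A] [Algebra R B] [Algebra R C] (π : A →ₐ[R] B)
    (hπ : Surjective π) (f : A →ₐ[R] C) (h : ker π ≤ ker f) :
    ∃ g : B →ₐ[R] C, ∀ a, g (π a) = f a := by
  refine ⟨(Ideal.Quotient.liftₐ (ker π) f h).comp
    (Ideal.quotientKerAlgEquivOfSurjective hπ).symm.toAlgHom, fun a => ?_⟩
  have : (Ideal.quotientKerAlgEquivOfSurjective hπ).symm (π a) = mk _ a := by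
    rw [AlgEquiv.symm_apply_eq]; rfl
  change Ideal.Quotient.liftₐ (ker π) f h
    ((Ideal.quotientKerAlgEquivOfSurjective hπ).symm (π a)) = f a
  rw [this]
  rfl

theorem exists_ringHom_of_ker_le {A B C : Type*} [CommRing A] [CommRing B]
    [CommRing C] (π : A →+* B) (hπ : Surjective π) (f : A →+* C)
    (h : ker π ≤ ker f) : ∃ g : B →+* C, g.comp π = f :=
  ⟨RingHom.liftOfSurjective π hπ ⟨f, h⟩, RingHom.liftOfRightInverse_comp _ _ _ _⟩

theorem exists_algHom_of_sys {R : Type*} [CommRing R] {ι κ : Type*} {h : κ → MvPolynomial ι R}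
    {C A : Type*} [CommRing C] [Algebra R C] [CommRing A] [Algebra R A]
    (φ : MvPolynomial ι R →ₐ[R] C) (hφ : Surjective φ)
    (hker : ker φ = sysIdeal h) {x : ι → A} (hx : ∀ i, aeval x (h i) = 0) :
    ∃ g : C →ₐ[R] A, ∀ a, g (φ a) = aeval x a :=
  exists_algHom_of_ker_le φ hφ (aeval x) (by
    rw [hker, sysIdeal, span_le]; rintro _ ⟨i, rfl⟩; exact hx i)

theorem SmoothOn.smooth_of_isUnit {P C : Type u} [CommRing P] [CommRing C] [Algebra P C]
    [FinitePresentation P C] {c : C} (H : SmoothOn P c) (hc : IsUnit c) :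
    Smooth P C :=
  have : IsLocalization.Away c C :=
    IsLocalization.away_of_isUnit_of_bijective C hc Function.bijective_id
  H.smooth C

theorem aeval_map_of_tower {R Rb A : Type*} [CommRing R] [CommRing Rb] [CommRing A] [Algebra R Rb]
    [Algebra Rb A] [Algebra R A] [IsScalarTower R Rb A] {ι : Type*} (x : ι → A)
    (f : MvPolynomial ι R) : aeval x (MvPolynomial.map (algebraMap R Rb) f) = aeval x f :=
  aeval_map_algebraMap Rb x f

theorem map_stdMat {R Rb : Type u} [CommRing R] [CommRing Rb] [Algebra R Rb] {ι κ : Type}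
    [Fintype ι] [Fintype κ] [DecidableEq κ] (f : κ → MvPolynomial ι R) (c : MvPolynomial ι R)
    (S : ι → κ → MvPolynomial ι R) (i l : κ) :
    MvPolynomial.map (algebraMap R Rb) (stdMat f c S i l) =
      stdMat (fun i => MvPolynomial.map (algebraMap R Rb) (f i))
        (MvPolynomial.map (algebraMap R Rb) c)
        (fun j k => MvPolynomial.map (algebraMap R Rb) (S j k)) i l := by
  simp [stdMat, pderiv_map, apply_ite (MvPolynomial.map (algebraMap R Rb))]

/-- A smooth algebra over `R / p` with a point in `Λ / p` is dominated by the reduction of a smooth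
algebra over `R` with a point in `Λ`. -/
theorem exists_smooth_lift {R Rb E Λ Λb : Type u} [CommRing R] [CommRing Rb] [CommRing E]
    [CommRing Λ] [CommRing Λb] [Algebra R Rb] [Algebra R E] [Algebra Rb E] [IsScalarTower R Rb E]
    [Algebra R Λ] [Algebra Λ Λb] [Algebra R Λb] [IsScalarTower R Λ Λb] [Algebra Rb Λb]
    [IsScalarTower R Rb Λb] [Smooth Rb E] {p : R}
    (hR : Surjective (algebraMap R Rb))
    (hRk : ker (algebraMap R Rb) = span {p})
    (hΛ : Surjective (algebraMap Λ Λb))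
    (hΛk : ker (algebraMap Λ Λb) = span {algebraMap R Λ p}) (gb : E →ₐ[Rb] Λb) :
    ∃ (P : Type u) (_ : CommRing P) (_ : Algebra R P) (g : P →ₐ[R] Λ)
      (θ : E →ₐ[R] P ⧸ span {algebraMap R P p}), Smooth R P ∧
      ∀ x y, mk _ y = θ x → algebraMap Λ Λb (g y) = gb x := by
  classical
  obtain ⟨n, m, fb, φ, hφ, hker⟩ := exists_presentation Rb E
  obtain ⟨e, he⟩ := ((smoothOn_iff_liftsAt φ hφ hker 1).1
    (SmoothOn.of_formallySmooth _)).pow_mem_stdIdeal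
  rw [one_pow] at he
  obtain ⟨Sb, hSb⟩ := he
  have hs : ∀ {σ : Type}, Surjective
      (MvPolynomial.map (σ := σ) (algebraMap R Rb)) := map_surjective _ hR
  choose f hf using fun i => hs (fb i)
  choose S hS using fun i j => hs (Sb i j)
  obtain ⟨Q, db, eb, hQ, -, hden, -, hdet⟩ := hSb.exists_denominator
  obtain ⟨d, hd⟩ := hs db
  have hM : ∀ i l, MvPolynomial.map (algebraMap R Rb) (stdMat f 1 S i l) =
      stdMat fb 1 Sb i l := fun i l => by
    rw [map_stdMat]; simp [hf, hS]
  choose ξ hξ using fun j => hΛ (gb (φ (X j)))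
  have hgφ : ∀ a, aeval (fun j => algebraMap Λ Λb (ξ j)) a = gb (φ a) := fun a => by
    simp only [hξ]
    exact (comp_aeval_apply (fun j => X j) (gb.comp φ) a).symm.trans (by simp)
  have hξΛ : ∀ a : MvPolynomial (Fin n) R, algebraMap Λ Λb (aeval ξ a) =
      gb (φ (MvPolynomial.map (algebraMap R Rb) a)) := fun a => by
    rw [← hgφ, aeval_map_of_tower]
    exact (aeval_algebraMap_apply Λb ξ a).symm
  have hφf : ∀ i, φ (fb i) = 0 := fun i => by
    have := mem_sysIdeal fb i
    rw [← hker] at this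
    exact this
  have ht : ∀ i, aeval ξ (f i) ∈ span {algebraMap R Λ p} := fun i => by
    rw [← hΛk, mem_ker, hξΛ, hf, hφf, map_zero]
  simp only [Ideal.mem_span_singleton'] at ht
  choose t ht using ht
  let F := symSys f (stdMat f 1 S) (C p)
  let V := Fin n ⊕ (Fin m ⊕ Fin m)
  let W := MvPolynomial V R ⧸ sysIdeal F
  let mW : MvPolynomial V R →ₐ[R] W := Ideal.Quotient.mkₐ R _
  have hFP : FinitePresentation R W := FinitePresentation.quotient
    ((Submodule.fg_span (Set.finite_range _)))
  let pt : V → Λ := Sum.elim ξ (Sum.elim 0 t)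
  obtain ⟨g0, hg0⟩ := exists_algHom_of_sys mW mk_surjective mk_ker (x := pt) (fun i => by
      simp only [pt]
      rw [aeval_symSys, ← ht]
      simp [mul_comm])
  have hsm : SmoothOn R (mW (symJac f (stdMat f 1 S) (C p) S)) :=
    (smoothOn_iff_liftsAt mW mk_surjective mk_ker _).2 (liftsAt_symJac _ _ _ _)
  obtain ⟨W1, _, _, hW1, f1, g1, hg1⟩ := hsm.hasSmoothFactor g0 (by
    rw [hg0]
    simp only [pt]
    rw [aeval_symJac]
    have : (Matrix.of fun i k => (if i = k then aeval ξ (1 : MvPolynomial (Fin n) R) else 0) -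
        t i * ∑ j, aeval ξ (pderiv j (C p)) * aeval ξ (S j k)) = 1 := by
      ext i k
      simp [Matrix.one_apply]
    rw [this, Matrix.det_one]
    exact isUnit_one)
  have hdΛ : g0 (mW d) - 1 ∈ span {algebraMap R Λ p} := by
    rw [← hΛk, mem_ker, hg0, map_sub, map_one, sub_eq_zero, ← aeval_algebraMap_apply,
      ← aeval_map_of_tower (Rb := Rb), hd]
    have : (algebraMap Λ Λb ∘ pt) = Sum.elim (fun i => algebraMap Λ Λb (ξ i))
        (Sum.elim 0 (fun i => algebraMap Λ Λb (t i))) := by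
      funext i
      rcases i with i | i | i <;> simp [pt]
    rw [this, hdet]
    have : (Matrix.of fun i l => (if i = l then
        aeval (fun j => algebraMap Λ Λb (ξ j)) (1 : MvPolynomial (Fin n) Rb) else 0) -
        aeval (fun j => algebraMap Λ Λb (ξ j)) (Q i l)) = 1 := by
      ext i k
      have h0 : φ (Q i k) = 0 := by
        have := hQ i k
        rw [← hker] at this
        exact this
      simp [Matrix.one_apply, hgφ, h0]
    rw [this, Matrix.det_one]
  obtain ⟨v1, hv1⟩ := Ideal.mem_span_singleton'.1 hdΛ
  have : FinitePresentation R W1 := hW1.2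
  have : FormallySmooth R W1 := hW1.1
  obtain ⟨P, _, _, hP, f2, g2, hg2, hP2⟩ := exists_extension_of_sum g1 (J := Unit) (K := Bool)
    (fun b => if b then f1 (mW d) else algebraMap R W1 p)
    (fun b => SmoothOn.of_formallySmooth _) (fun _ => 1) (fun _ b => if b then 1 else - v1)
    (fun _ => by
      have : g1 (f1 (mW d)) = g0 (mW d) := DFunLike.congr_fun hg1 _
      simp only [Fintype.sum_bool, if_true, this, Bool.false_eq_true, if_false, AlgHom.commutes]
      rw [map_one]
      linear_combination - hv1)
  obtain ⟨hP2, s, hs2⟩ := hP2 ()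
  have hsmP : Smooth R P := hP2.smooth_of_isUnit (by simp)
  let Pb := P ⧸ span {algebraMap R P p}
  let q : P →ₐ[R] Pb := Ideal.Quotient.mkₐ R _
  obtain ⟨a, ha⟩ := exists_ringHom_of_ker_le (algebraMap R Rb) hR (algebraMap R Pb) (by
    rw [hRk, span_le, Set.singleton_subset_iff]
    exact eq_zero_iff_mem.2 (mem_span_singleton_self _))
  let : Algebra Rb Pb := a.toAlgebra
  have : IsScalarTower R Rb Pb := IsScalarTower.of_algebraMap_eq' ha.symm
  let w : V → Pb := fun i => q (f2 (f1 (mW (X i))))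
  have hw : ∀ b, aeval w b = q (f2 (f1 (mW b))) := fun b => by
    exact (comp_aeval_apply (fun j => X j) (((q.comp f2).comp f1).comp mW) b).symm.trans (by simp)
  let z : Fin n → Pb := fun i => w (inl i)
  have hwe : w = Sum.elim z (Sum.elim (fun i => w (inr (inl i))) fun i => w (inr (inr i))) := by
    funext i
    rcases i with i | i | i <;> rfl
  have hp0 : algebraMap R Pb p = 0 :=
    eq_zero_iff_mem.2 (mem_span_singleton_self _)
  have hzf : ∀ i, aeval z (fb i) = 0 := fun i => by
    have h1 := hden Pb z (fun i => w (inr (inl i))) (fun i => w (inr (inr i))) 0 (fun i => by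
        have h2 : aeval w (F i) = 0 := by
          rw [hw]
          have : mW (F i) = 0 := eq_zero_iff_mem.2 (mem_sysIdeal F i)
          rw [this]; simp
        rw [hwe, aeval_symSys] at h2
        rw [← hf]
        simp only [← hM, aeval_map_of_tower]
        simpa [hp0] using h2) i
    rw [← hwe, ← hd, aeval_map_of_tower, zero_mul, hw] at h1
    have h3 : IsUnit (q (f2 (f1 (mW d)))) := by
      have h4 := congrArg q hs2
      simp only [Fintype.sum_bool, if_true, Bool.false_eq_true, if_false, AlgHom.commutes, map_add,
        map_mul, map_one, hp0, zero_mul, add_zero] at h4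
      exact IsUnit.of_mul_eq_one _ h4
    exact (h3.mul_right_eq_zero).1 h1
  obtain ⟨θ, hθ⟩ := exists_algHom_of_sys φ hφ hker hzf
  refine ⟨P, inferInstance, inferInstance, g2, θ.restrictScalars R, hsmP, fun x y hxy => ?_⟩
  obtain ⟨b, rfl⟩ := hφ x
  obtain ⟨b, rfl⟩ := hs b
  have h1 : mk _ y = q (f2 (f1 (mW (rename inl b)))) := by
    rw [hxy, ← hw, aeval_rename]
    change θ _ = _
    rw [hθ, aeval_map_of_tower]
    rfl
  have h2 : y - f2 (f1 (mW (rename inl b))) ∈ span {algebraMap R P p} :=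
    Ideal.Quotient.eq.1 h1
  obtain ⟨c, hc⟩ := Ideal.mem_span_singleton'.1 h2
  have h3 : g2 y = aeval ξ b + g2 c * algebraMap R Λ p := by
    have e1 : g2 (f2 (f1 (mW (rename inl b)))) = aeval ξ b := by
      have e2 : ∀ x, g2 (f2 x) = g1 x := DFunLike.congr_fun hg2
      have e3 : ∀ x, g1 (f1 x) = g0 x := DFunLike.congr_fun hg1
      rw [e2, e3, hg0, aeval_rename]
      rfl
    rw [← e1, ← AlgHom.commutes g2 p, ← map_mul, ← map_add, hc]
    simp
  have h4 : algebraMap Λ Λb (algebraMap R Λ p) = 0 := by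
    rw [← mem_ker, hΛk]; exact mem_span_singleton_self _
  rw [h3, map_add, map_mul, h4, mul_zero, add_zero, hξΛ]

end Lift

section Approx

open TensorProduct in
/-- Every `R`-algebra map from a finite type algebra to `Λ` factors through a smooth algebra. -/
def HasDesing (R Λ : Type u) [CommRing R] [CommRing Λ] [Algebra R Λ] : Prop :=
  ∀ (B : Type u) [CommRing B] [Algebra R B] [FiniteType R B] (v : B →ₐ[R] Λ), HasSmoothFactor v

/-- The map `v` factors through the reduction modulo `p` of a smooth algebra over `Λ`. -/
def HasSmoothApprox {R B Λ : Type u} [CommRing R] [CommRing B] [CommRing Λ] [Algebra R B]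
    [Algebra R Λ] (v : B →ₐ[R] Λ) (p : R) : Prop :=
  ∃ (P : Type u) (_ : CommRing P) (_ : Algebra R P) (g : P →ₐ[R] Λ)
    (ρ : B →ₐ[R] P ⧸ span {algebraMap R P p}), Smooth R P ∧
    ∀ x y, mk _ y = ρ x → g y - v x ∈ span {algebraMap R Λ p}

theorem HasSmoothFactor.hasSmoothApprox {R Rb B Bb Λ Λb : Type u} [CommRing R] [CommRing Rb]
    [CommRing B] [CommRing Bb] [CommRing Λ] [CommRing Λb] [Algebra R Rb] [Algebra R B]
    [Algebra R Bb] [Algebra Rb Bb] [IsScalarTower R Rb Bb]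
    [Algebra R Λ] [Algebra Λ Λb] [Algebra R Λb] [IsScalarTower R Λ Λb] [Algebra Rb Λb]
    [IsScalarTower R Rb Λb] {p : R}
    (hR : Surjective (algebraMap R Rb))
    (hRk : ker (algebraMap R Rb) = span {p})
    (hΛ : Surjective (algebraMap Λ Λb))
    (hΛk : ker (algebraMap Λ Λb) = span {algebraMap R Λ p})
    {vb : Bb →ₐ[Rb] Λb} (H : HasSmoothFactor vb) (v : B →ₐ[R] Λ) (β : B →ₐ[R] Bb)
    (hβ : ∀ x, vb (β x) = algebraMap Λ Λb (v x)) : HasSmoothApprox v p := by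
  obtain ⟨E, _, _, hE, f, gb, hgb⟩ := H
  let : Algebra R E := Algebra.compHom E (algebraMap R Rb)
  have : IsScalarTower R Rb E := IsScalarTower.of_algebraMap_eq' rfl
  obtain ⟨P, _, _, g, θ, hP, hθ⟩ := exists_smooth_lift hR hRk hΛ hΛk gb
  refine ⟨P, inferInstance, inferInstance, g, (θ.comp (f.restrictScalars R)).comp β, hP,
    fun x y hxy => ?_⟩
  rw [← hΛk, mem_ker, map_sub, hθ _ _ hxy, sub_eq_zero, ← hβ, ← hgb]
  rfl

open TensorProduct in
theorem HasDesing.hasSmoothApprox {R Rb B Λ Λb : Type u} [CommRing R] [CommRing Rb] [CommRing B]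
    [CommRing Λ] [CommRing Λb] [Algebra R Rb] [Algebra R B] [FiniteType R B]
    [Algebra R Λ] [Algebra Λ Λb] [Algebra R Λb] [IsScalarTower R Λ Λb] [Algebra Rb Λb]
    [IsScalarTower R Rb Λb] (H : HasDesing Rb Λb) {p : R}
    (hR : Surjective (algebraMap R Rb))
    (hRk : ker (algebraMap R Rb) = span {p})
    (hΛ : Surjective (algebraMap Λ Λb))
    (hΛk : ker (algebraMap Λ Λb) = span {algebraMap R Λ p})
    (v : B →ₐ[R] Λ) : HasSmoothApprox v p :=
  (H (Rb ⊗[R] B) (Algebra.TensorProduct.lift (Algebra.ofId Rb Λb)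
    ((toAlgHom R Λ Λb).comp v) fun _ _ => mul_comm _ _)).hasSmoothApprox
      hR hRk hΛ hΛk v Algebra.TensorProduct.includeRight fun x =>
        (Algebra.TensorProduct.lift_tmul _ _ _ _ _).trans (by simp)

theorem IsStd.map {R P : Type u} [CommRing R] [CommRing P] [Algebra R P] {ι κ : Type}
    [Fintype ι] [Fintype κ] {h : κ → MvPolynomial ι R} {c : MvPolynomial ι R}
    {S : ι → κ → MvPolynomial ι R} (hS : IsStd h c S) :
    IsStd (fun i => MvPolynomial.map (algebraMap R P) (h i)) (MvPolynomial.map (algebraMap R P) c)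
      (fun j k => MvPolynomial.map (algebraMap R P) (S j k)) := fun i => by
  have h1 := mem_map_of_mem (MvPolynomial.map (algebraMap R P)) (hS i)
  rw [Ideal.map_pow, sysIdeal, map_span, ← Set.range_comp] at h1
  change _ ∈ (span (range (MvPolynomial.map (algebraMap R P) ∘ h))) ^ 2
  simpa [pderiv_map] using h1

theorem Module.Flat.mul_eq_zero_of_mul_eq_zero {R A : Type*} [CommRing R] [CommRing A]
    [Algebra R A] [Module.Flat R A] {a b : R} (h : ∀ x, a * x = 0 → b * x = 0) {x : A}
    (hx : algebraMap R A a * x = 0) : algebraMap R A b * x = 0 := by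
  obtain ⟨k, c, y, hc, hy⟩ := Module.Flat.isTrivialRelation_of_sum_smul_eq_zero (R := R) (M := A)
    (ι := Unit) (f := fun _ => a) (x := fun _ => x) (by simpa [Algebra.smul_def] using hx)
  rw [show x = _ from hc (), mul_sum]
  refine Finset.sum_eq_zero fun j _ => ?_
  have := h _ (by simpa using hy j)
  rw [Algebra.smul_def, ← mul_assoc, ← map_mul, this, map_zero, zero_mul]

theorem hasSmoothFactor_of_approx {R B Λ : Type u} [CommRing R] [CommRing B] [CommRing Λ]
    [Algebra R B] [Algebra R Λ] (v : B →ₐ[R] Λ) {ι κ : Type} [Fintype ι] [Fintype κ]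
    {h : κ → MvPolynomial ι R} (φ : MvPolynomial ι R →ₐ[R] B) (hφ : Surjective φ)
    (hker : ker φ = sysIdeal h) {r : R} (hr : C r ∈ stdIdeal h)
    (hR : ∀ x : R, r ^ 2 * x = 0 → r * x = 0)
    (hΛ : ∀ x : Λ, algebraMap R Λ r ^ 2 * x = 0 → algebraMap R Λ r * x = 0)
    (happ : HasSmoothApprox v (r ^ 6)) : HasSmoothFactor v := by
  obtain ⟨S, hS⟩ := hr
  obtain ⟨P, _, _, g, θ, hP, hθ⟩ := happ
  have : Smooth R P := hP
  have : FormallySmooth R P := hP.1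
  have : FinitePresentation R P := hP.2
  let : Algebra P Λ := g.toRingHom.toAlgebra
  have hgΛ : ∀ x, algebraMap P Λ x = g x := fun _ => rfl
  have : IsScalarTower R P Λ := of_algebraMap_eq fun x => (g.commutes x).symm
  choose ρ hρ using fun j => mk_surjective (θ (φ (X j)))
  have hπ : ∀ (A : Type u) [CommRing A] [Algebra R A] [Algebra P A] [IsScalarTower R P A]
      (x : ι → A), aeval x (MvPolynomial.map (algebraMap R P) (C r)) = algebraMap R A r :=
    fun A _ _ _ _ x => by rw [aeval_map_of_tower, aeval_C]
  have hφh : ∀ i, φ (h i) = 0 := fun i => by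
    have := mem_sysIdeal h i
    rw [← hker] at this
    exact this
  have hρh : ∀ i, aeval ρ (h i) ∈ span {algebraMap R P (r ^ 6)} := fun i => by
    rw [← eq_zero_iff_mem]
    have h1 : mk (span {algebraMap R P (r ^ 6)}) (aeval ρ (h i)) =
        aeval (fun j => θ (φ (X j))) (h i) := by
      simp only [← hρ]
      exact comp_aeval_apply ρ (Ideal.Quotient.mkₐ R (span {algebraMap R P (r ^ 6)})) (h i)
    rw [h1]
    refine (comp_aeval_apply (fun j => X j) (θ.comp φ) (h i)).symm.trans ?_
    simp [hφh]
  simp only [Ideal.mem_span_singleton'] at hρh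
  choose γ hγ using hρh
  have hμ : ∀ j, g (ρ j) - v (φ (X j)) ∈ span {algebraMap R Λ (r ^ 6)} := fun j =>
    hθ _ _ (hρ j)
  simp only [Ideal.mem_span_singleton'] at hμ
  choose μ hμ using hμ
  have hv : ∀ a, aeval (fun j => v (φ (X j))) a = v (φ a) := fun a =>
    (comp_aeval_apply (fun j => X j) (v.comp φ) a).symm.trans (by simp)
  obtain ⟨B', _, _, hB', ζ, φ', hζ, hφ', hsm, hcomp⟩ := exists_desing (hS.map (P := P)) (ρ := ρ)
    (γ := γ) (fun i => by
      rw [aeval_map_of_tower, ← hγ, hπ, mul_comm, map_pow])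
    (w := fun j => v (φ (X j))) (μ := fun j => - (algebraMap R Λ r * μ j)) (fun i => by
      rw [aeval_map_of_tower, hv, hφh, map_zero]) (fun j => by
      rw [hπ, hgΛ]
      have := hμ j
      rw [map_pow] at this
      linear_combination this) (by simpa only [hπ] using hΛ)
  obtain ⟨c, hc, r', hr'⟩ := hcomp 1 (fun E _ _ _ _ x hx => by
    have hfP : Module.Flat R P := Smooth.flat R P
    have hfE : Module.Flat P E := Smooth.flat P E
    rw [hπ] at hx ⊢
    rw [← map_pow, ← map_pow] at hx
    refine Module.Flat.mul_eq_zero_of_mul_eq_zero (fun y hy => ?_) hx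
    exact Module.Flat.mul_eq_zero_of_mul_eq_zero hR hy)
  let : Algebra R B' := Algebra.compHom B' (algebraMap R P)
  have : IsScalarTower R P B' := IsScalarTower.of_algebraMap_eq' rfl
  have : FinitePresentation R B' := FinitePresentation.trans R P B'
  have htr : ∀ b : B', SmoothOn P b → SmoothOn R b := fun b hb =>
    (SmoothOn.of_formallySmooth (1 : P)).trans hb (by simp)
  have htop := hasSmoothFactor_of_map_eq_top (φ'.restrictScalars R) (by
    rw [Ideal.eq_top_iff_one]
    have h1 : φ' c ∈ (smoothIdeal R B').map (φ'.restrictScalars R) :=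
      mem_map_of_mem (φ'.restrictScalars R) (htr _ hc)
    have h2 : φ' (algebraMap R B' r) ∈ (smoothIdeal R B').map (φ'.restrictScalars R) := by
      rw [hπ] at hsm
      exact mem_map_of_mem (φ'.restrictScalars R) (htr _ hsm)
    have h3 : φ' (algebraMap R B' r) = algebraMap R Λ r := (φ'.restrictScalars R).commutes r
    rw [hπ] at hr'
    rw [h3] at h2
    rw [hr', map_one] at h1
    have := Ideal.sub_mem _ h1 (mul_mem_right r' _ h2)
    simpa using this)
  obtain ⟨f, hf⟩ := exists_algHom_of_sys φ hφ hker (x := ζ) (fun i => by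
    rw [← aeval_map_of_tower (Rb := P)]; exact hζ i)
  have hv' : v = (φ'.restrictScalars R).comp f := by
    refine AlgHom.ext fun b => ?_
    obtain ⟨a, rfl⟩ := hφ b
    rw [AlgHom.comp_apply, hf, ← hv]
    refine Eq.trans ?_ (comp_aeval_apply ζ (φ'.restrictScalars R) a).symm
    congr 2
    funext j
    exact (hφ' j).symm
  rw [hv']
  exact htop.comp f

theorem pow_mul_eq_zero_of_sq {A : Type*} [CommRing A] {r : A}
    (h : ∀ x, r ^ 2 * x = 0 → r * x = 0) (n : ℕ) {x : A} (hx : r ^ (n + 1) * x = 0) :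
    r * x = 0 := by
  induction n with
  | zero => simpa using hx
  | succ n ih =>
    refine ih ?_
    have := h (r ^ n * x) (by linear_combination hx)
    linear_combination this

theorem sq_pow_mul_eq_zero {A : Type*} [CommRing A] {r : A}
    (h : ∀ x, r ^ 2 * x = 0 → r * x = 0) (e : ℕ) {x : A} (hx : (r ^ e) ^ 2 * x = 0) :
    r ^ e * x = 0 := by
  obtain _ | e := e
  · simpa using hx
  · have := pow_mul_eq_zero_of_sq h (2 * e + 1) (x := x) (by rw [← hx]; ring)
    linear_combination r ^ e * this

theorem SmoothOn.hasSmoothFactor_of_approx {R B Λ : Type u} [CommRing R] [CommRing B] [CommRing Λ]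
    [Algebra R B] [Algebra R Λ] [FinitePresentation R B] (v : B →ₐ[R] Λ) {r : R}
    (hr : SmoothOn R (algebraMap R B r)) (hR : ∀ x : R, r ^ 2 * x = 0 → r * x = 0)
    (hΛ : ∀ x : Λ, algebraMap R Λ r ^ 2 * x = 0 → algebraMap R Λ r * x = 0)
    (happ : ∀ n, HasSmoothApprox v (r ^ n)) : HasSmoothFactor v := by
  obtain ⟨n, m, h, φ, hφ, hker⟩ := exists_presentation R B
  have h1 : SmoothOn R (φ (C r)) := by
    rwa [← MvPolynomial.algebraMap_eq, AlgHom.commutes]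
  obtain ⟨e, he⟩ := ((smoothOn_iff_liftsAt φ hφ hker _).1 h1).pow_mem_stdIdeal
  rw [← C_pow] at he
  refine _root_.hasSmoothFactor_of_approx v φ hφ hker he (fun x => sq_pow_mul_eq_zero hR e)
    (fun x hx => ?_) ?_
  · rw [map_pow] at hx ⊢
    exact sq_pow_mul_eq_zero hΛ e hx
  · rw [← pow_mul]; exact happ _

end Approx

section SquareZero

theorem exists_lift_of_sq_eq_zero {R P P₂ Λ : Type u} [CommRing R] [CommRing P] [CommRing P₂]
    [CommRing Λ] [Algebra R P] [Algebra R P₂] [Algebra R Λ] [Smooth R P]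
    {r : R} (hr : r ^ 2 = 0) (g : P →ₐ[R] Λ) (g₂ : P₂ →ₐ[R] Λ)
    (θ : P →ₐ[R] P₂ ⧸ span {algebraMap R P₂ r})
    (hθ : ∀ x y, mk _ y = θ x → g₂ y - g x ∈ span {algebraMap R Λ r}) :
    ∃ (n : ℕ) (ε : Fin n → Λ) (f : P →ₐ[R] MvPolynomial (Fin n) P₂),
      (∀ x, aevalTower g₂ ε (f x) = g x) ∧
      ∀ x y, mk _ y = θ x → f x - C y ∈ span {algebraMap R (MvPolynomial (Fin n) P₂) r} := by
  have hnil : IsNilpotent (span {algebraMap R P₂ r}) := ⟨2, by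
    rw [Ideal.span_singleton_pow, ← map_pow, hr, map_zero]; simp⟩
  let f := FormallySmooth.lift _ hnil θ
  have hf : ∀ x, mk _ (f x) = θ x := fun x =>
    DFunLike.congr_fun (FormallySmooth.comp_lift _ hnil θ) x
  have hfg : ∀ x, ∃ y, g₂ (f x) = g x + algebraMap R Λ r * y := fun x => by
    obtain ⟨y, hy⟩ := Ideal.mem_span_singleton'.1 (hθ _ _ (hf x))
    exact ⟨y, by linear_combination - hy⟩
  have hr' : ∀ (A : Type u) [CommRing A] [Algebra R A], algebraMap R A r ^ 2 = 0 :=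
    fun A _ _ => by rw [← map_pow, hr, map_zero]
  let : Algebra P Λ := g.toRingHom.toAlgebra
  have hg : ∀ x, algebraMap P Λ x = g x := fun _ => rfl
  have : IsScalarTower R P Λ := of_algebraMap_eq fun x => (g.commutes x).symm
  let D : Derivation R P Λ := Derivation.mk' (g₂.toLinearMap ∘ₗ f.toLinearMap - g.toLinearMap) (by
    intro a b
    obtain ⟨y, hy⟩ := hfg a
    obtain ⟨z, hz⟩ := hfg b
    simp only [LinearMap.sub_apply, LinearMap.comp_apply, AlgHom.toLinearMap_apply, map_mul,
      Algebra.smul_def, hg, hy, hz]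
    linear_combination y * z * hr' Λ)
  have hD : ∀ x, D x = g₂ (f x) - g x := fun _ => rfl
  let L := D.liftKaehlerDifferential
  have hL : ∀ ω, L ω ∈ span {algebraMap R Λ r} := fun ω => by
    have : ω ∈ Submodule.span P (range (KaehlerDifferential.D R P)) := by
      rw [KaehlerDifferential.span_range_derivation]; trivial
    induction this using Submodule.span_induction with
    | mem _ h =>
      obtain ⟨x, rfl⟩ := h
      rw [D.liftKaehlerDifferential_comp_D, hD]
      exact hθ _ _ (hf x)
    | zero => simp
    | add _ _ _ _ h h' => rw [map_add]; exact add_mem h h'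
    | smul a _ _ h => rw [map_smul, Algebra.smul_def]; exact mul_mem_left _ _ h
  obtain ⟨n, q, hq⟩ := Module.Finite.exists_fin' P (Ω[P⁄R])
  obtain ⟨s, hs⟩ := Module.projective_lifting_property q LinearMap.id hq
  have hε : ∀ j, ∃ y, y * algebraMap R Λ r = L (q (Pi.single j 1)) := fun j =>
    Ideal.mem_span_singleton'.1 (hL _)
  choose ε hε using hε
  let δ : P → Fin n → P := fun x => s (KaehlerDifferential.D R P x)
  have hδ : ∀ x, D x = ∑ j, g (δ x j) * (ε j * algebraMap R Λ r) := fun x => by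
    have h1 : q (δ x) = KaehlerDifferential.D R P x := LinearMap.congr_fun hs _
    rw [← D.liftKaehlerDifferential_comp_D, ← h1, LinearMap.pi_apply_eq_sum_univ q (δ x), map_sum]
    refine sum_congr rfl fun j _ => ?_
    rw [map_smul, Algebra.smul_def, hg, hε]
    congr 3
    funext i
    simp [Pi.single_apply, eq_comm]
  have hrX := hr' (MvPolynomial (Fin n) P₂)
  let f' : P →ₐ[R] (MvPolynomial (Fin n) P₂) :=
    { toFun := fun x => C (f x) - algebraMap R (MvPolynomial (Fin n) P₂) r * ∑ j, C (f (δ x j)) * X j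
      map_one' := by simp [δ]
      map_mul' := fun x y => by
        have h1 : ∀ j, δ (x * y) j = x * δ y j + y * δ x j := fun j => by simp [δ]
        simp only [h1, map_mul, map_add, add_mul, sum_add_distrib, mul_assoc, ← mul_sum]
        linear_combination - hrX * (∑ j, C (f (δ x j)) * X j) * (∑ j, C (f (δ y j)) * X j)
      map_zero' := by simp [δ]
      map_add' := fun x y => by
        have h1 : ∀ j, δ (x + y) j = δ x j + δ y j := fun j => by simp [δ]
        simp only [h1, map_add, add_mul, sum_add_distrib]
        ring
      commutes' := fun a => by
        simp [δ, IsScalarTower.algebraMap_apply R P₂ (MvPolynomial (Fin n) P₂), MvPolynomial.algebraMap_eq] }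
  have hf' : ∀ x, f' x = C (f x) - algebraMap R (MvPolynomial (Fin n) P₂) r * ∑ j, C (f (δ x j)) * X j := fun _ => rfl
  refine ⟨n, ε, f', fun x => ?_, fun x y hxy => ?_⟩
  · have h1 : algebraMap R Λ r * ∑ j, g₂ (f (δ x j)) * ε j = D x := by
      rw [hδ, mul_sum]
      refine sum_congr rfl fun j _ => ?_
      obtain ⟨y, hy⟩ := hfg (δ x j)
      rw [hy]
      linear_combination y * ε j * hr' Λ
    rw [hf']
    simp only [map_sub, map_mul, map_sum, aevalTower_C, aevalTower_X,
      AlgHom.commutes]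
    rw [h1, hD]
    ring
  · have h1 : f x - y ∈ span {algebraMap R P₂ r} := by
      rw [← Ideal.Quotient.eq, hf, hxy]
    obtain ⟨z, hz⟩ := Ideal.mem_span_singleton'.1 h1
    refine Ideal.mem_span_singleton'.2 ⟨C z - ∑ j, C (f (δ x j)) * X j, ?_⟩
    have h2 : C (f x) - C y = C z * algebraMap R (MvPolynomial (Fin n) P₂) r := by
      rw [← C_sub, ← hz, C_mul, IsScalarTower.algebraMap_apply R P₂ (MvPolynomial (Fin n) P₂), MvPolynomial.algebraMap_eq]
    rw [hf']
    linear_combination - h2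

/-- Desingularization lifts along a square-zero principal ideal. -/
theorem HasDesing.of_sq_eq_zero {R Λ : Type u} [CommRing R] [CommRing Λ] [Algebra R Λ]
    [IsNoetherianRing R] [Module.Flat R Λ] {r : R} (hr : r ^ 2 = 0)
    (H : ∀ (B : Type u) [CommRing B] [Algebra R B] [FiniteType R B] (v : B →ₐ[R] Λ),
      HasSmoothApprox v r) : HasDesing R Λ := by
  intro B _ _ _ v
  have : FinitePresentation R B := FinitePresentation.of_finiteType.1 inferInstance
  obtain ⟨n, m, h, φ, hφ, hker⟩ := exists_presentation R B
  obtain ⟨P, _, _, g, θ, hP, hθ⟩ := H B v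
  have hφh : ∀ i, φ (h i) = 0 := fun i => by
    have := mem_sysIdeal h i
    rw [← hker] at this
    exact this
  have hr' : ∀ (A : Type u) [CommRing A] [Algebra R A], algebraMap R A r ^ 2 = 0 :=
    fun A _ _ => by rw [← map_pow, hr, map_zero]
  choose ρ hρ using fun j => mk_surjective (θ (φ (X j)))
  have hρh : ∀ i, aeval ρ (h i) ∈ span {algebraMap R P r} := fun i => by
    rw [← eq_zero_iff_mem]
    have h1 : mk (span {algebraMap R P r}) (aeval ρ (h i)) =
        aeval (fun j => θ (φ (X j))) (h i) := by
      simp only [← hρ]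
      exact comp_aeval_apply ρ (Ideal.Quotient.mkₐ R (span {algebraMap R P r})) (h i)
    rw [h1]
    refine (comp_aeval_apply (fun j => X j) (θ.comp φ) (h i)).symm.trans ?_
    simp [hφh]
  simp only [Ideal.mem_span_singleton'] at hρh
  choose γ hγ using hρh
  have hμ : ∀ j, g (ρ j) - v (φ (X j)) ∈ span {algebraMap R Λ r} := fun j =>
    hθ _ _ (hρ j)
  simp only [Ideal.mem_span_singleton'] at hμ
  choose μ' hμ' using hμ
  let μ : Fin n → Λ := fun j => - μ' j
  have hμ : ∀ j, v (φ (X j)) = g (ρ j) + algebraMap R Λ r * μ j := fun j => by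
    simp only [μ]
    linear_combination hμ' j
  have hv : ∀ a, aeval (fun j => v (φ (X j))) a = v (φ a) := fun a =>
    (comp_aeval_apply (fun j => X j) (v.comp φ) a).symm.trans (by simp)
  have expand : ∀ (A : Type u) [CommRing A] [Algebra R A] (f : P →ₐ[R] A) (ν : Fin n → A) i,
      aeval (fun j => f (ρ j) + algebraMap R A r * ν j) (h i) =
        algebraMap R A r * (f (γ i) + ∑ j, f (aeval ρ (pderiv j (h i))) * ν j) := by
    intro A _ _ f ν i
    obtain ⟨q, hq⟩ := taylor_mul (P := R) (algebraMap R A r) (fun j => f (ρ j)) ν (h i)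
    have h1 : ∀ a : MvPolynomial (Fin n) R, aeval (fun j => f (ρ j)) a = f (aeval ρ a) := fun a =>
      (comp_aeval_apply ρ f a).symm
    rw [hq, hr', h1, ← hγ, map_mul, AlgHom.commutes]
    simp only [h1]
    ring
  have hzero : ∀ i, ∑ _x : Unit, r • (g (γ i) + ∑ j, g (aeval ρ (pderiv j (h i))) * μ j) = 0 :=
    fun i => by
      have h1 := hv (h i)
      simp only [hμ] at h1
      rw [expand, hφh, map_zero] at h1
      simpa [Algebra.smul_def] using h1
  choose k c χ hc hχ using fun i =>
    Module.Flat.isTrivialRelation_of_sum_smul_eq_zero (R := R) (M := Λ) (hzero i)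
  let F : Fin m → MvPolynomial (Fin n ⊕ (i : Fin m) × Fin (k i)) P := fun i => C (γ i) +
    ∑ j, C (aeval ρ (pderiv j (h i))) * X (inl j) -
    ∑ l, algebraMap R _ (c i () l) * X (inr ⟨i, l⟩)
  let Q := MvPolynomial (Fin n ⊕ (i : Fin m) × Fin (k i)) P ⧸ sysIdeal F
  let m₀ : MvPolynomial (Fin n ⊕ (i : Fin m) × Fin (k i)) P →ₐ[P] Q := Ideal.Quotient.mkₐ P _
  have : FiniteType R (MvPolynomial (Fin n ⊕ (i : Fin m) × Fin (k i)) P) := FiniteType.trans (S := P)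
    inferInstance inferInstance
  have hQ : FiniteType R Q := FiniteType.of_surjective (m₀.restrictScalars R) mk_surjective
  let x₀ : (Fin n ⊕ (i : Fin m) × Fin (k i)) → Λ := Sum.elim μ fun p => χ p.1 p.2
  obtain ⟨v₂, hv₂⟩ := exists_algHom_of_ker_le (m₀.restrictScalars R) mk_surjective
    (aevalTower g x₀) (by
      have : ker (m₀.restrictScalars R) = sysIdeal F := mk_ker
      rw [this, sysIdeal, span_le]
      rintro _ ⟨i, rfl⟩
      have h1 := hc i ()
      simp only [Algebra.smul_def] at h1
      simp only [F, SetLike.mem_coe, mem_ker, map_sub, map_add, map_sum, map_mul, aevalTower_C,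
        aevalTower_X, AlgHom.commutes, x₀, Sum.elim_inl, Sum.elim_inr, h1, sub_self])
  obtain ⟨P₂, _, _, g₂, θ₂, hP₂, hθ₂⟩ := H Q v₂
  let ιP : P →ₐ[R] Q := (m₀.restrictScalars R).comp (toAlgHom R P (MvPolynomial (Fin n ⊕ (i : Fin m) × Fin (k i)) P))
  have hv₂P : ∀ x, v₂ (ιP x) = g x := fun x => (hv₂ _).trans (by
    simp [MvPolynomial.algebraMap_eq])
  obtain ⟨N, ε, f, hf, hfθ⟩ := exists_lift_of_sq_eq_zero hr g g₂ (θ₂.comp ιP) (fun x y hxy => by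
    rw [← hv₂P]
    exact hθ₂ _ _ hxy)
  choose ν₀ hν₀ using fun i => mk_surjective (θ₂ (m₀ (X i)))
  have hν₀Λ : ∀ j, ∃ y, y * algebraMap R Λ r = g₂ (ν₀ (inl j)) - μ j := fun j => by
    have := hθ₂ _ _ (hν₀ (inl j))
    have h2 : v₂ (m₀ (X (inl j))) = μ j := (hv₂ _).trans (by simp [x₀])
    rw [h2] at this
    exact Ideal.mem_span_singleton'.1 this
  let G : (MvPolynomial (Fin N) P₂) →ₐ[R] Λ := aevalTower g₂ ε
  have : Smooth P₂ (MvPolynomial (Fin N) P₂) := ⟨inferInstance, inferInstance⟩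
  have hE : Smooth R (MvPolynomial (Fin N) P₂) := Smooth.comp R P₂ (MvPolynomial (Fin N) P₂)
  let ν : Fin n → (MvPolynomial (Fin N) P₂) := fun j => C (ν₀ (inl j))
  let w : Fin n → (MvPolynomial (Fin N) P₂) := fun j => f (ρ j) + algebraMap R (MvPolynomial (Fin N) P₂) r * ν j
  have hw : ∀ i, aeval w (h i) = 0 := fun i => by
    simp only [w]
    rw [expand]
    choose y hy using fun x => mk_surjective (θ₂ (ιP x))
    have h1 : ∀ x, ∃ z, f x = C (y x) + z * algebraMap R (MvPolynomial (Fin N) P₂) r := fun x => by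
      obtain ⟨z, hz⟩ := Ideal.mem_span_singleton'.1 (hfθ x (y x) (hy x))
      exact ⟨z, by linear_combination - hz⟩
    have h2 : ∀ x, algebraMap R (MvPolynomial (Fin N) P₂) r * f x = algebraMap R (MvPolynomial (Fin N) P₂) r * C (y x) := fun x => by
      obtain ⟨z, hz⟩ := h1 x
      rw [hz]
      linear_combination z * hr' (MvPolynomial (Fin N) P₂)
    let p : Fin m → P₂ := fun i => y (γ i) + ∑ j, y (aeval ρ (pderiv j (h i))) * ν₀ (inl j) -
      ∑ l, algebraMap R _ (c i () l) * ν₀ (inr ⟨i, l⟩)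
    have h3 : mk (span {algebraMap R P₂ r}) (p i) = θ₂ (m₀ (F i)) := by
      have e1 : ∀ x, θ₂ (m₀ (C x)) = θ₂ (ιP x) := fun _ => rfl
      have e2 : ∀ a, θ₂ (m₀ (algebraMap R _ a)) =
          mk (span {algebraMap R P₂ r}) (algebraMap R P₂ a) := fun a =>
        (θ₂.comp (m₀.restrictScalars R)).commutes a
      simp only [p, F, map_add, map_sub, map_sum, map_mul, e1, e2, ← hy, ← hν₀]
    have h4 : m₀ (F i) = 0 := eq_zero_iff_mem.2 (mem_sysIdeal F i)
    rw [h4, map_zero, eq_zero_iff_mem, Ideal.mem_span_singleton'] at h3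
    obtain ⟨z, hz⟩ := h3
    have h5 : C (y (γ i)) + ∑ j, C (y (aeval ρ (pderiv j (h i)))) * ν j =
        ∑ l, algebraMap R (MvPolynomial (Fin N) P₂) (c i () l) * C (ν₀ (inr ⟨i, l⟩)) + C z * algebraMap R (MvPolynomial (Fin N) P₂) r := by
      have hC : ∀ a, (C (algebraMap R P₂ a) : (MvPolynomial (Fin N) P₂)) = algebraMap R (MvPolynomial (Fin N) P₂) a := fun a => by
        rw [IsScalarTower.algebraMap_apply R P₂ (MvPolynomial (Fin N) P₂), MvPolynomial.algebraMap_eq]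
      have := congrArg (C : P₂ →+* (MvPolynomial (Fin N) P₂)) hz
      simp only [p, map_add, map_sub, map_sum, map_mul, hC] at this
      simp only [ν]
      linear_combination - this
    have h6 : algebraMap R (MvPolynomial (Fin N) P₂) r * (f (γ i) + ∑ j, f (aeval ρ (pderiv j (h i))) * ν j) =
        algebraMap R (MvPolynomial (Fin N) P₂) r * (C (y (γ i)) + ∑ j, C (y (aeval ρ (pderiv j (h i)))) * ν j) := by
      rw [mul_add, mul_add, h2, mul_sum, mul_sum]
      congr 1
      exact sum_congr rfl fun j _ => by rw [← mul_assoc, h2, mul_assoc]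
    have h7 : algebraMap R (MvPolynomial (Fin N) P₂) r * ∑ l, algebraMap R (MvPolynomial (Fin N) P₂) (c i () l) * C (ν₀ (inr ⟨i, l⟩)) = 0 := by
      rw [mul_sum]
      refine Finset.sum_eq_zero fun l _ => ?_
      have : r * c i () l = 0 := by simpa using hχ i l
      rw [← mul_assoc, ← map_mul, this, map_zero, zero_mul]
    rw [h6, h5, mul_add, h7]
    linear_combination C z * hr' (MvPolynomial (Fin N) P₂)
  obtain ⟨f₀, hf₀⟩ := exists_algHom_of_sys φ hφ hker hw
  refine ⟨(MvPolynomial (Fin N) P₂), inferInstance, inferInstance, hE, f₀, G, AlgHom.ext fun b => ?_⟩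
  obtain ⟨a, rfl⟩ := hφ b
  rw [AlgHom.comp_apply, hf₀, ← hv]
  refine (comp_aeval_apply w G a).trans ?_
  congr 2
  funext j
  obtain ⟨y, hy⟩ := hν₀Λ j
  simp only [w, map_add, map_mul, AlgHom.commutes]
  have e1 : G (f (ρ j)) = g (ρ j) := hf _
  have e2 : G (ν j) = g₂ (ν₀ (inl j)) := aevalTower_C _ _ _
  rw [e1, e2, hμ]
  linear_combination y * hr' Λ - algebraMap R Λ r * hy

end SquareZero

section Homogenize

theorem exists_homogenization {C : Type u} [CommRing C] {ι : Type*} (F : MvPolynomial ι C) :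
    ∃ n, ∀ m, n ≤ m → ∃ G : MvPolynomial (Option ι) C,
      (∀ (B : Type u) [CommRing B] [Algebra C B] (x : ι → B) (s : B),
        aeval (fun o : Option ι => o.elim s fun j => s * x j) G = s ^ m * aeval x F) ∧
      ∀ (B : Type u) [CommRing B] [Algebra C B] (y : Option ι → B) (t : B),
        aeval (fun o => t * y o) G = t ^ m * aeval y G := by
  induction F using MvPolynomial.induction_on with
  | C c =>
    refine ⟨0, fun m _ => ⟨MvPolynomial.C c * X none ^ m, fun B _ _ x s => ?_, fun B _ _ y t => ?_⟩⟩
    · simp [mul_comm]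
    · simp [mul_pow, mul_left_comm]
  | add F F' h h' =>
    obtain ⟨n, hn⟩ := h
    obtain ⟨n', hn'⟩ := h'
    refine ⟨max n n', fun m hm => ?_⟩
    obtain ⟨G, h1, h2⟩ := hn m (le_of_max_le_left hm)
    obtain ⟨G', h1', h2'⟩ := hn' m (le_of_max_le_right hm)
    refine ⟨G + G', fun B _ _ x s => ?_, fun B _ _ y t => ?_⟩
    · simp only [map_add, h1, h1', mul_add]
    · simp only [map_add, h2, h2', mul_add]
  | mul_X F j h =>
    obtain ⟨n, hn⟩ := h
    refine ⟨n + 1, fun m hm => ?_⟩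
    obtain ⟨m, rfl⟩ : ∃ k, m = k + 1 := ⟨m - 1, by omega⟩
    obtain ⟨G, h1, h2⟩ := hn m (by omega)
    refine ⟨G * X (some j), fun B _ _ x s => ?_, fun B _ _ y t => ?_⟩
    · simp only [map_mul, h1, aeval_X, Option.elim_some]; ring
    · simp only [map_mul, h2, aeval_X]; ring

/-- A factorization of `C → S⁻¹Λ` through a smooth algebra yields an algebra under `C` and over `Λ`
which is smooth after inverting an element mapping into `S`. -/
theorem exists_smoothOn_of_isLocalization {R C E Λ Λ' : Type u} [CommRing R] [CommRing C]
    [CommRing E] [CommRing Λ] [CommRing Λ'] [Algebra R C] [Algebra R E] [Algebra R Λ]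
    [Algebra R Λ'] [Algebra Λ Λ'] [IsScalarTower R Λ Λ'] (S : Submonoid Λ) [IsLocalization S Λ']
    [FinitePresentation R C] [Smooth R E] (φ : C →ₐ[R] Λ) (f : C →ₐ[R] E)
    (g : E →ₐ[R] Λ') (hfg : ∀ c, g (f c) = algebraMap Λ Λ' (φ c)) :
    ∃ (C' : Type u) (_ : CommRing C') (_ : Algebra R C') (_ : FinitePresentation R C')
      (f' : C →ₐ[R] C') (φ' : C' →ₐ[R] Λ) (σ : C'), φ'.comp f' = φ ∧ SmoothOn R σ ∧ φ' σ ∈ S := by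
  let : Algebra C E := f.toRingHom.toAlgebra
  have hCE : ∀ c, algebraMap C E c = f c := fun _ => rfl
  have : IsScalarTower R C E := of_algebraMap_eq fun x => (f.commutes x).symm
  let : Algebra C Λ := φ.toRingHom.toAlgebra
  have : IsScalarTower R C Λ := of_algebraMap_eq fun x => (φ.commutes x).symm
  let : Algebra C Λ' := ((algebraMap Λ Λ').comp φ.toRingHom).toAlgebra
  have : IsScalarTower C Λ Λ' := of_algebraMap_eq fun x => rfl
  let gC : E →ₐ[C] Λ' := { g with commutes' := fun c => by rw [hCE]; exact hfg c }
  have : FinitePresentation C E :=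
    FinitePresentation.of_restrict_scalars_finitePresentation R C E
  obtain ⟨n, m, F, ψ, hψ, hker⟩ := exists_presentation C E
  have hψF : ∀ i, ψ (F i) = 0 := fun i => by
    have := mem_sysIdeal F i
    rw [← hker] at this
    exact this
  choose d hd using fun i => exists_homogenization (F i)
  have hd1 := fun i => hd i (d i + 1) (Nat.le_succ _)
  choose G hG hGh using hd1
  obtain ⟨s, hs⟩ := IsLocalization.exist_integer_multiples_of_finite S fun j => g (ψ (X j))
  choose ξ hξ using hs
  have hx : ∀ i, ∃ t : S, (t : Λ) *
      aeval (fun o : Option (Fin n) => o.elim (s : Λ) ξ) (G i) = 0 := fun i => by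
    rw [← IsLocalization.map_eq_zero_iff S Λ']
    have h1 := hG i Λ' (fun j => g (ψ (X j))) (algebraMap Λ Λ' s)
    have h2 : aeval (fun j => g (ψ (X j))) (F i) = 0 :=
      (comp_aeval_apply (fun j => X j) (gC.comp ψ) (F i)).symm.trans (by simp [hψF])
    rw [h2, mul_zero] at h1
    rw [← h1]
    refine (comp_aeval_apply _ (toAlgHom C Λ Λ') (G i)).trans ?_
    congr 2
    funext o
    cases o with
    | none => rfl
    | some j => exact (hξ j).trans (Algebra.smul_def _ _)
  choose t ht using hx
  let τ : S := ∏ i, t i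
  have hτ : ∀ i, (τ : Λ) * aeval (fun o : Option (Fin n) => o.elim (s : Λ) ξ) (G i) = 0 :=
    fun i => by
      obtain ⟨q, hq⟩ : t i ∣ τ := Finset.dvd_prod_of_mem _ (mem_univ i)
      rw [hq, Submonoid.coe_mul, mul_right_comm, ht, zero_mul]
  let y : Option (Fin n) → Λ := fun o => τ * o.elim (s : Λ) ξ
  have hy : ∀ i, aeval y (G i) = 0 := fun i => by
    simp only [y]
    rw [hGh, pow_succ, mul_assoc, hτ, mul_zero]
  let m₀ : MvPolynomial (Option (Fin n)) C →ₐ[C] MvPolynomial (Option (Fin n)) C ⧸ sysIdeal G :=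
    Ideal.Quotient.mkₐ C _
  have hm₀ : Surjective m₀ := mk_surjective
  have hm₀k : ker m₀ = sysIdeal G := mk_ker
  have hm₀G : ∀ i, m₀ (G i) = 0 := fun i => eq_zero_iff_mem.2 (mem_sysIdeal G i)
  obtain ⟨φ', hφ'⟩ := exists_algHom_of_sys m₀ hm₀ hm₀k hy
  have hfp : FinitePresentation C (MvPolynomial (Option (Fin n)) C ⧸ sysIdeal G) :=
    FinitePresentation.of_surjective hm₀ (by
      change (ker m₀).FG
      rw [hm₀k]
      exact Submodule.fg_span (Set.finite_range _))
  refine ⟨MvPolynomial (Option (Fin n)) C ⧸ sysIdeal G, inferInstance, inferInstance,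
    FinitePresentation.trans R C _, toAlgHom R C _,
    φ'.restrictScalars R, m₀ (X none), AlgHom.ext fun c => φ'.commutes c, ?_, ?_⟩
  · intro B _ _ N hN e hu
    have hE : ∃ eE : E →ₐ[R] B ⧸ N, (∀ c, eE (f c) = e (m₀ (MvPolynomial.C c))) ∧
        ∀ j, e (m₀ (X none)) * eE (ψ (X j)) = e (m₀ (X (some j))) := by
      let : Algebra C (B ⧸ N) := (e.toRingHom.comp (algebraMap C _)).toAlgebra
      have hC : ∀ c, algebraMap C (B ⧸ N) c = e (algebraMap C _ c) := fun _ => rfl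
      have : IsScalarTower R C (B ⧸ N) := of_algebraMap_eq fun x => by
        rw [hC, ← IsScalarTower.algebraMap_apply, AlgHom.commutes]
      let eC : (MvPolynomial (Option (Fin n)) C ⧸ sysIdeal G) →ₐ[C] B ⧸ N :=
        { e with commutes' := fun c => rfl }
      obtain ⟨a, ha⟩ := hu.exists_right_inv
      have h1 : ∀ i, aeval (fun j => a * e (m₀ (X (some j)))) (F i) = 0 := fun i => by
        have h2 := hG i (B ⧸ N) (fun j => a * e (m₀ (X (some j)))) (e (m₀ (X none)))
        have h3 : (fun o : Option (Fin n) => o.elim (e (m₀ (X none))) fun j =>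
            e (m₀ (X none)) * (a * e (m₀ (X (some j))))) = fun o => eC (m₀ (X o)) := by
          funext o
          cases o with
          | none => rfl
          | some j =>
            change e (m₀ (X none)) * (a * e (m₀ (X (some j)))) = e (m₀ (X (some j)))
            rw [← mul_assoc, ha, one_mul]
        have h4 : aeval (fun o => eC (m₀ (X o))) (G i) = 0 :=
          (comp_aeval_apply (fun j => X j) (eC.comp m₀) (G i)).symm.trans (by simp [hm₀G])
        rw [h3, h4] at h2
        exact ((hu.pow _).mul_right_eq_zero.1 h2.symm)
      obtain ⟨eE, heE⟩ := exists_algHom_of_sys ψ hψ hker h1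
      refine ⟨eE.restrictScalars R, fun c => eE.commutes c, fun j => ?_⟩
      rw [AlgHom.restrictScalars_apply, heE, aeval_X, ← mul_assoc, ha, one_mul]
    obtain ⟨eE, heC, heX⟩ := hE
    let l : E →ₐ[R] B := FormallySmooth.lift N ⟨2, hN⟩ eE
    have hl : ∀ x, mk N (l x) = eE x := fun x =>
      DFunLike.congr_fun (FormallySmooth.comp_lift N ⟨2, hN⟩ eE) x
    obtain ⟨σ, hσ⟩ := mk_surjective (e (m₀ (X none)))
    let : Algebra C B := (l.comp f).toRingHom.toAlgebra
    have hC : ∀ c, algebraMap C B c = l (f c) := fun _ => rfl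
    have : IsScalarTower R C B := of_algebraMap_eq fun x =>
      ((l.comp f).commutes x).symm
    let lC : E →ₐ[C] B := { l with commutes' := fun c => rfl }
    have h1 : ∀ i, aeval (fun o : Option (Fin n) => o.elim σ fun j => σ * lC (ψ (X j))) (G i) = 0 :=
      fun i => by
        have h4 : aeval (fun o => lC (ψ (X o))) (F i) = 0 :=
          (comp_aeval_apply (fun j => X j) (lC.comp ψ) (F i)).symm.trans (by simp [hψF])
        rw [hG, h4, mul_zero]
    obtain ⟨e', he'⟩ := exists_algHom_of_sys m₀ hm₀ hm₀k h1
    refine ⟨e'.restrictScalars R, AlgHom.coe_ringHom_injective ?_⟩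
    have h5 : ((mk N).comp e'.toRingHom).comp m₀.toRingHom = e.toRingHom.comp m₀.toRingHom := by
      refine MvPolynomial.ringHom_ext (fun c => ?_) fun o => ?_
      · change mk N (e' (m₀ (MvPolynomial.C c))) = e (m₀ (MvPolynomial.C c))
        rw [he', aeval_C, hC, hl, heC]
      · change mk N (e' (m₀ (X o))) = e (m₀ (X o))
        rw [he', aeval_X]
        cases o with
        | none => exact hσ
        | some j =>
          change mk N (σ * l (ψ (X j))) = _
          rw [map_mul, hl, hσ, heX]
    exact (RingHom.cancel_right hm₀).1 h5
  · have : φ' (m₀ (X none)) = τ * s := (hφ' _).trans (by simp [y])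
    rw [AlgHom.restrictScalars_apply, this]
    exact mul_mem τ.2 s.2

end Homogenize

section EssentiallySmooth

theorem map_smoothIdeal_eq_top {R C E : Type u} [CommRing R] [CommRing C] [CommRing E]
    [Algebra R C] [Algebra R E] [Algebra C E] [IsScalarTower R C E]
    [FinitePresentation R C] (M : Submonoid C) [IsLocalization M E]
    [FormallySmooth R E] : (smoothIdeal R C).map (algebraMap C E) = ⊤ := by
  by_contra h
  obtain ⟨Q, hQ, hle⟩ := Ideal.exists_le_maximal _ h
  have hQp := hQ.isPrime
  have h1 : IsLocalization.AtPrime (AtPrime Q) (Q.comap (algebraMap C E)) :=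
    IsLocalization.isLocalization_isLocalization_atPrime_isLocalization M _ Q
  have h2 : FormallySmooth R (AtPrime Q) :=
    have : FormallySmooth E (AtPrime Q) :=
      .of_isLocalization Q.primeCompl
    FormallySmooth.comp R E _
  have h3 : Algebra.IsSmoothAt R (Q.comap (algebraMap C E)) :=
    (FormallySmooth.iff_of_equiv ((IsLocalization.algEquiv
      (Q.comap (algebraMap C E)).primeCompl _ _).restrictScalars R)).1 h2
  obtain ⟨c, hc, hs⟩ := Algebra.IsSmoothAt.exists_notMem_smooth R (Q.comap (algebraMap C E))
  exact hc (hle (mem_map_of_mem _ (SmoothOn.of_smooth (Localization.Away c))))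

/-- Maps to a formally smooth algebra essentially of finite type factor through smooth algebras. -/
theorem hasSmoothFactor_of_essFiniteType {R C E : Type u} [CommRing R] [CommRing C] [CommRing E]
    [Algebra R C] [Algebra R E] [IsNoetherianRing R] [FiniteType R C]
    [EssFiniteType R E] [FormallySmooth R E] (f : C →ₐ[R] E) :
    HasSmoothFactor f := by
  classical
  obtain ⟨σ, hσ⟩ := (Algebra.essFiniteType_iff R E).1 (inferInstance : EssFiniteType R E)
  obtain ⟨τ, hτ⟩ := (inferInstance : FiniteType R C)
  let ω : Finset E := σ ∪ τ.image f
  have hle : Algebra.adjoin R (σ : Set E) ≤ Algebra.adjoin R (ω : Set E) :=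
    Algebra.adjoin_mono (by simp [ω])
  have hω : ∀ s : E, ∃ t ∈ Algebra.adjoin R (ω : Set E),
      IsUnit t ∧ s * t ∈ Algebra.adjoin R (ω : Set E) := fun s => by
    obtain ⟨t, h1, h2, h3⟩ := hσ s
    exact ⟨t, hle h1, h2, hle h3⟩
  have hloc := (Algebra.essFiniteType_cond_iff R E ω).2 hω
  have hft : FiniteType R (Algebra.adjoin R (ω : Set E)) :=
    (Algebra.adjoin R (ω : Set E)).fg_iff_finiteType.1 ⟨ω, rfl⟩
  have : FinitePresentation R (Algebra.adjoin R (ω : Set E)) :=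
    FinitePresentation.of_finiteType.1 hft
  have hf : ∀ c, f c ∈ Algebra.adjoin R (ω : Set E) := fun c => by
    have h1 : (⊤ : Subalgebra R C).map f ≤ Algebra.adjoin R (ω : Set E) := by
      rw [← hτ, AlgHom.map_adjoin]
      exact Algebra.adjoin_mono (by simp [ω])
    exact h1 ⟨c, trivial, rfl⟩
  have h2 := map_smoothIdeal_eq_top (R := R) (E := E)
    ((IsUnit.submonoid E).comap (algebraMap (Algebra.adjoin R (ω : Set E)) E))
  exact (hasSmoothFactor_of_map_eq_top (Algebra.adjoin R (ω : Set E)).val h2).comp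
    (f.codRestrict _ hf)

open TensorProduct in
theorem HasDesing.hasSmoothFactor_of_tower {R R' B Λ' : Type u} [CommRing R] [CommRing R']
    [CommRing B] [CommRing Λ'] [Algebra R R'] [Algebra R B] [Algebra R Λ'] [Algebra R' Λ']
    [IsScalarTower R R' Λ'] [IsNoetherianRing R] [EssFiniteType R R']
    [FormallySmooth R R'] [FiniteType R B] (H : HasDesing R' Λ')
    (w : B →ₐ[R] Λ') : HasSmoothFactor w := by
  obtain ⟨E, _, _, hE, f, g, hfg⟩ := H (R' ⊗[R] B)
    (Algebra.TensorProduct.lift (Algebra.ofId R' Λ') w fun _ _ => Commute.all _ _)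
  let : Algebra R E := ((algebraMap R' E).comp (algebraMap R R')).toAlgebra
  have : IsScalarTower R R' E := of_algebraMap_eq fun _ => rfl
  have : FormallySmooth R E := FormallySmooth.comp R R' E
  have : EssFiniteType R E := EssFiniteType.comp R R' E
  obtain ⟨E', _, _, hE', f', g', hfg'⟩ := hasSmoothFactor_of_essFiniteType
    ((f.restrictScalars R).comp Algebra.TensorProduct.includeRight)
  refine ⟨E', _, _, hE', f', (g.restrictScalars R).comp g', ?_⟩
  rw [AlgHom.comp_assoc, hfg']
  refine AlgHom.ext fun b => ?_
  refine (DFunLike.congr_fun hfg ((1 : R') ⊗ₜ[R] b)).trans ?_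
  simp

/-- Over a reduced base, desingularization follows from desingularization over a localization and
over the quotients by the inverted elements. -/
theorem HasDesing.of_isLocalization {R R' Λ Λ' : Type u} [CommRing R] [CommRing R'] [CommRing Λ]
    [CommRing Λ'] [Algebra R R'] [Algebra R Λ] [Algebra R Λ'] [Algebra R' Λ'] [Algebra Λ Λ']
    [IsScalarTower R R' Λ'] [IsScalarTower R Λ Λ'] [IsNoetherianRing R] [IsReduced R]
    [Module.Flat R Λ] (M : Submonoid R) [IsLocalization M R']
    [IsLocalization (Algebra.algebraMapSubmonoid Λ M) Λ'] (H : HasDesing R' Λ')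
    (happ : ∀ r ∈ M, ∀ (n : ℕ) (B : Type u) [CommRing B] [Algebra R B] [FiniteType R B]
      (v : B →ₐ[R] Λ), HasSmoothApprox v (r ^ n)) : HasDesing R Λ := by
  intro B _ _ _ v
  have : FinitePresentation R B := FinitePresentation.of_finiteType.1 inferInstance
  have : EssFiniteType R R' := .of_isLocalization R' M
  have : FormallySmooth R R' := .of_isLocalization M
  obtain ⟨E, _, _, hE, f, g, hfg⟩ := H.hasSmoothFactor_of_tower ((toAlgHom R Λ Λ').comp v)
  obtain ⟨C, _, _, _, f', φ, σ, hφ, hσ, hσM⟩ := exists_smoothOn_of_isLocalization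
    (Algebra.algebraMapSubmonoid Λ M) v f g (fun c => DFunLike.congr_fun hfg c)
  obtain ⟨r, hr, hrσ⟩ := hσM
  obtain ⟨D, _, _, _, j, ψ, hψ, hD⟩ := exists_extension φ (J := Unit)
    (fun _ => algebraMap R C r) (fun _ => by
      rw [AlgHom.commutes]
      rw [hrσ]
      exact mem_map_of_mem _ hσ)
  have hD := hD ()
  rw [AlgHom.commutes] at hD
  have hred : ∀ x : R, r ^ 2 * x = 0 → r * x = 0 := fun x hx => by
    refine IsReduced.eq_zero _ ⟨2, ?_⟩
    rw [mul_pow, sq x, ← mul_assoc, hx, zero_mul]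
  have h1 := SmoothOn.hasSmoothFactor_of_approx ψ hD hred (fun x hx =>
    Module.Flat.mul_eq_zero_of_mul_eq_zero hred (by rwa [map_pow])) (fun n => happ r hr n D ψ)
  rw [← hφ, ← hψ, AlgHom.comp_assoc]
  exact h1.comp _

end EssentiallySmooth

section Glue

variable {R : Type u} [CommRing R] {ι κ : Type} [Fintype ι] [Fintype κ]

/-- The relations satisfied by all `(τ, z, T)` with `f z = τ T` and `τ` a nonzerodivisor. -/
def closureIdeal (f : κ → MvPolynomial ι R) : Ideal (MvPolynomial (Option (ι ⊕ κ)) R) where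
  carrier := {F | ∀ (E : Type u) [CommRing E] [Algebra R E] (τ : E) (z : ι → E) (T : κ → E),
    τ ∈ nonZeroDivisors E → (∀ i, aeval z (f i) = τ * T i) →
      aeval (fun o => Option.elim o τ (Sum.elim z T)) F = 0}
  zero_mem' := by simp
  add_mem' := by
    intro a b ha hb E _ _ τ z T hτ h
    rw [map_add, ha E τ z T hτ h, hb E τ z T hτ h, add_zero]
  smul_mem' := by
    intro a b hb E _ _ τ z T hτ h
    rw [smul_eq_mul, map_mul, hb E τ z T hτ h, mul_zero]

variable {f : κ → MvPolynomial ι R}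

theorem map_aeval_option {E A : Type*} [CommRing E] [CommRing A] [Algebra R E] [Algebra R A]
    (g : E →ₐ[R] A) (τ : E) (z : ι → E) (T : κ → E) (F : MvPolynomial (Option (ι ⊕ κ)) R) :
    g (aeval (fun o => Option.elim o τ (Sum.elim z T)) F) =
      aeval (fun o => Option.elim o (g τ) (Sum.elim (fun j => g (z j)) fun i => g (T i))) F := by
  rw [← AlgHom.comp_apply, comp_aeval]
  congr 2
  funext o
  rcases o with _ | _ | _ <;> rfl

theorem aeval_closureIdeal_of_eq_zero {A : Type u} [CommRing A] [Algebra R A] {z : ι → A}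
    (hz : ∀ i, aeval z (f i) = 0) (p : A) {F : MvPolynomial (Option (ι ⊕ κ)) R}
    (hF : F ∈ closureIdeal f) :
    aeval (fun o => Option.elim o p (Sum.elim z (0 : κ → A))) F = 0 := by
  have h := hF (Polynomial A) Polynomial.X (fun j => Polynomial.C (z j)) 0
    Polynomial.monic_X.mem_nonZeroDivisors (fun i => by
      have : aeval (fun j => Polynomial.C (z j)) (f i) =
          toAlgHom R A (Polynomial A) (aeval z (f i)) := by
        rw [← AlgHom.comp_apply, comp_aeval]; rfl
      rw [this, hz]; simp)
  have h2 := congrArg ((Polynomial.aeval (R := A) p).restrictScalars R) h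
  rw [map_aeval_option, map_zero] at h2
  rw [← h2]
  congr 2
  funext o
  rcases o with _ | _ | _ <;> simp

theorem aeval_closureIdeal_of_isUnit {A : Type u} [CommRing A] [Algebra R A] {z : ι → A}
    {T : κ → A} {p : A} (hp : IsUnit p) (hz : ∀ i, aeval z (f i) = p * T i)
    {F : MvPolynomial (Option (ι ⊕ κ)) R} (hF : F ∈ closureIdeal f) :
    aeval (fun o => Option.elim o p (Sum.elim z T)) F = 0 :=
  hF A p z T hp.mem_nonZeroDivisors hz

theorem aeval_closureIdeal_of_smooth [DecidableEq κ] {c : MvPolynomial ι R}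
    {S : ι → κ → MvPolynomial ι R} {d : MvPolynomial (ι ⊕ (κ ⊕ κ)) R}
    {e : κ → MvPolynomial (ι ⊕ (κ ⊕ κ)) R}
    (hd : ∀ (A : Type u) [CommRing A] [Algebra R A] (z : ι → A) (Y T : κ → A) (p : A),
        (∀ i, aeval z (f i) + ∑ l, aeval z (stdMat f c S i l) * Y l - p * T i = 0) → ∀ i,
          aeval (Sum.elim z (Sum.elim Y T)) d * aeval z (f i) =
            p * aeval (Sum.elim z (Sum.elim Y T)) (e i)) 
    {A : Type u} [CommRing A] [Algebra R A] {z : ι → A} {Y T' T : κ → A} {p : A}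
    (hz : ∀ i, aeval z (f i) + ∑ l, aeval z (stdMat f c S i l) * Y l - p * T' i = 0)
    {N : Ideal A} (hN : N ^ 2 = ⊥) (hY : ∀ i, Y i ∈ N) (hc : IsUnit (aeval z c))
    (hdu : IsUnit (aeval (Sum.elim z (Sum.elim Y T')) d))
    (hT : ∀ i, aeval (Sum.elim z (Sum.elim Y T')) d * T i =
      aeval (Sum.elim z (Sum.elim Y T')) (e i)) 
    {F : MvPolynomial (Option (ι ⊕ κ)) R} (hF : F ∈ closureIdeal f) :
    aeval (fun o => Option.elim o p (Sum.elim z T)) F = 0 := by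
  let alg : Algebra (Polynomial R) A := (Polynomial.aeval (R := R) p).toAlgebra
  have hX : algebraMap (Polynomial R) A Polynomial.X = p := by
    change Polynomial.aeval p Polynomial.X = p
    simp
  have tow : IsScalarTower R (Polynomial R) A := of_algebraMap_eq fun r => by
    change _ = Polynomial.aeval p (Polynomial.C r)
    simp
  let f' := fun i => MvPolynomial.map (algebraMap R (Polynomial R)) (f i)
  let c' := MvPolynomial.map (algebraMap R (Polynomial R)) c
  let S' := fun j k => MvPolynomial.map (algebraMap R (Polynomial R)) (S j k)
  let d' := MvPolynomial.map (algebraMap R (Polynomial R)) d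
  let p' : MvPolynomial ι (Polynomial R) := MvPolynomial.C Polynomial.X
  let h := symSys f' (stdMat f' c' S') p'
  let δ := symJac f' (stdMat f' c' S') p' S' * d'
  let W := MvPolynomial (ι ⊕ (κ ⊕ κ)) (Polynomial R) ⧸ sysIdeal h
  let m : MvPolynomial (ι ⊕ (κ ⊕ κ)) (Polynomial R) →ₐ[Polynomial R] W := Ideal.Quotient.mkₐ _ _
  have hm : Surjective m := mk_surjective
  have hmk : ker m = sysIdeal h := mk_ker
  have hFP : FinitePresentation (Polynomial R) W := FinitePresentation.quotient
    (Submodule.fg_span (Set.finite_range _))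
  have hs : SmoothOn (Polynomial R) (m δ) := (smoothOn_iff_liftsAt m hm hmk δ).2
    ((liftsAt_symJac f' (stdMat f' c' S') p' S').of_dvd ⟨_, rfl⟩)
  let L := Localization.Away (m δ)
  have hL : Smooth (Polynomial R) L := hs.smooth L
  have hflat : Module.Flat (Polynomial R) L := inferInstance
  have hxz : ∀ i, aeval (Sum.elim z (Sum.elim Y T')) (h i) = 0 := fun i => by
    simp only [h, aeval_symSys]
    rw [← hz i]
    simp only [f', c', S', ← map_stdMat, aeval_map_of_tower, p', aeval_C, hX]
  obtain ⟨φ, hφ⟩ := exists_algHom_of_sys m hm hmk hxz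
  have hunit : IsUnit (φ (m δ)) := by
    rw [hφ, map_mul]
    refine IsUnit.mul ?_ (by rw [aeval_map_of_tower]; exact hdu)
    refine isUnit_of_sub_mem hN (a := aeval (Sum.elim z (Sum.elim 0 T'))
      (symJac f' (stdMat f' c' S') p' S')) ?_ (aeval_sub_mem ?_ _)
    · rw [aeval_symJac]
      simp only [p', pderiv_C, map_zero, zero_mul, Finset.sum_const_zero, mul_zero, sub_zero, c',
        aeval_map_of_tower]
      have : (Matrix.of fun i k : κ => if i = k then aeval z c else 0) =
          Matrix.diagonal fun _ => aeval z c := by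
        ext i k; simp [Matrix.diagonal_apply]
      rw [this, Matrix.det_diagonal, Finset.prod_const]
      exact hc.pow _
    · rintro (j | i | i)
      · simp
      · simpa using hY i
      · simp
  let ψ : L →ₐ[Polynomial R] A :=
    IsLocalization.liftAlgHom (M := Submonoid.powers (m δ)) (f := φ) (by
      rintro ⟨_, n, rfl⟩
      simpa using hunit.pow n)
  have hψ : ∀ a, ψ (algebraMap W L a) = φ a := fun a => by simp [ψ]
  let y : ι ⊕ (κ ⊕ κ) → L := fun j => algebraMap W L (m (X j))
  have hy : ∀ a : MvPolynomial (ι ⊕ (κ ⊕ κ)) (Polynomial R), aeval y a = algebraMap W L (m a) := by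
    intro a
    have : aeval y = (toAlgHom (Polynomial R) W L).comp m := by
      ext j; simp [y]
    rw [this]; rfl
  have hy' : y = Sum.elim (fun j => y (inl j)) (Sum.elim (fun i => y (inr (inl i)))
      fun i => y (inr (inr i))) := by
    funext j; rcases j with _ | _ | _ <;> rfl
  have hyd : IsUnit (aeval y d) := by
    have h1 : IsUnit (algebraMap W L (m δ)) := IsLocalization.Away.algebraMap_isUnit (m δ)
    have h2 : algebraMap W L (m δ) = aeval y (symJac f' (stdMat f' c' S') p' S') * aeval y d := by
      rw [← hy, ← aeval_map_of_tower (Rb := Polynomial R) y d]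
      exact map_mul (aeval y) _ _
    exact isUnit_of_mul_isUnit_right (h2 ▸ h1)
  obtain ⟨w, hw⟩ := hyd.exists_right_inv
  have hτ : algebraMap (Polynomial R) L Polynomial.X ∈ nonZeroDivisors L := by
    rw [mem_nonZeroDivisors_iff_right]
    intro x hx
    have := Module.Flat.mul_eq_zero_of_mul_eq_zero (A := L) (a := Polynomial.X)
      (b := (1 : Polynomial R)) (x := x) (fun y hy => by
        rw [one_mul]; exact Polynomial.monic_X.mem_nonZeroDivisors.1 y hy)
      (by rw [mul_comm]; exact hx)
    simpa using this
  have hrel := hd L (fun j => y (inl j)) (fun i => y (inr (inl i)))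
      (fun i => y (inr (inr i))) (algebraMap (Polynomial R) L Polynomial.X) (fun i => by
        have h1 : aeval y (h i) = 0 := by
          rw [hy]
          have : m (h i) = 0 := by
            rw [← mem_ker, hmk]; exact mem_sysIdeal h i
          rw [this, map_zero]
        rw [hy'] at h1
        simp only [h, aeval_symSys] at h1
        rw [← h1]
        simp only [f', c', S', ← map_stdMat, aeval_map_of_tower, p', aeval_C])
  rw [← hy'] at hrel
  have key := hF L (algebraMap (Polynomial R) L Polynomial.X) (fun j => y (inl j))
    (fun i => w * aeval y (e i)) hτ (fun i => by
      have := hrel i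
      linear_combination w * this - aeval (fun j => y (inl j)) (f i) * hw)
  have hψy : ∀ a : MvPolynomial (ι ⊕ (κ ⊕ κ)) R, ψ (aeval y a) =
      aeval (Sum.elim z (Sum.elim Y T')) a := fun a => by
    rw [← aeval_map_of_tower (Rb := Polynomial R), hy, hψ, hφ, aeval_map_of_tower]
  have k2 := congrArg (ψ.restrictScalars R) key
  rw [map_aeval_option, map_zero] at k2
  rw [← k2]
  congr 2
  funext o
  rcases o with _ | j | i
  · simp [hX]
  · have := hψy (X (inl j))
    simpa using this.symm
  · have h1 : ψ (aeval y d) * ψ w = 1 := by rw [← map_mul, hw, map_one]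
    have h3 := hT i
    rw [hψy] at h1
    change T i = ψ (w * aeval y (e i))
    rw [map_mul, hψy, ← h3]
    linear_combination (-T i) * h1

theorem exists_normal_cone [IsNoetherianRing R] (f : κ → MvPolynomial ι R) (p : MvPolynomial ι R)
    {Λ : Type u} [CommRing Λ] [Algebra R Λ] {x : ι → Λ} (hx : ∀ i, aeval x (f i) = 0) :
    ∃ (P : Type u) (_ : CommRing P) (_ : Algebra R P) (_ : FinitePresentation R P)
      (z : ι → P) (T : κ → P) (ψ : P →ₐ[R] Λ), (∀ j, ψ (z j) = x j) ∧
      (∀ i, aeval z (f i) = aeval z p * T i) ∧ SmoothOn R (aeval z p) ∧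
      ∀ c ∈ stdIdeal f, ∃ g, SmoothOn R g ∧ ∃ n : ℕ, ψ g = aeval x c ^ n := by
  classical
  let sp : MvPolynomial (Option (ι ⊕ κ)) R →ₐ[R] MvPolynomial (ι ⊕ κ) R :=
    aeval fun o => Option.elim o (rename inl p) X
  let I : Ideal (MvPolynomial (ι ⊕ κ) R) := (closureIdeal f).map sp
  let P := MvPolynomial (ι ⊕ κ) R ⧸ I
  let m : MvPolynomial (ι ⊕ κ) R →ₐ[R] P := Ideal.Quotient.mkₐ R I
  have hm : Surjective m := mk_surjective
  have hmk : ker m = I := mk_ker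
  have hFT : FiniteType R P := FiniteType.of_surjective m hm
  have hFP : FinitePresentation R P := FinitePresentation.of_finiteType.1 hFT
  have hsp : ∀ {A : Type u} [CommRing A] [Algebra R A] (z : ι → A) (T : κ → A)
      (F : MvPolynomial (Option (ι ⊕ κ)) R), aeval (Sum.elim z T) (sp F) =
        aeval (fun o => Option.elim o (aeval z p) (Sum.elim z T)) F := by
    intro A _ _ z T F
    rw [← AlgHom.comp_apply, comp_aeval]
    congr 2
    funext o
    rcases o with _ | _ <;> simp [aeval_rename]
  have hlift : ∀ {A : Type u} [CommRing A] [Algebra R A] (z : ι → A) (T : κ → A),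
      (∀ F ∈ closureIdeal f, aeval (fun o => Option.elim o (aeval z p) (Sum.elim z T)) F = 0) →
      ∃ g : P →ₐ[R] A, ∀ a, g (m a) = aeval (Sum.elim z T) a := fun z T h =>
    exists_algHom_of_ker_le m hm (aeval (Sum.elim z T)) (by
      rw [hmk, Ideal.map_le_iff_le_comap]
      intro F hF
      rw [mem_comap, mem_ker]
      exact (hsp z T F).trans (h F hF))
  let z : ι → P := fun j => m (X (inl j))
  let T : κ → P := fun i => m (X (inr i))
  have hzT : ∀ a, aeval (Sum.elim z T) a = m a := fun a => by
    have : aeval (Sum.elim z T) = m := by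
      ext j; rcases j with _ | _ <;> simp [z, T]
    rw [this]
  have hrel : ∀ F ∈ closureIdeal f,
      aeval (fun o => Option.elim o (aeval z p) (Sum.elim z T)) F = 0 := fun F hF => by
    rw [← hsp, hzT, ← mem_ker, hmk]
    exact mem_map_of_mem _ hF
  have hfT : ∀ i, aeval z (f i) = aeval z p * T i := fun i => by
    have := hrel (rename (fun j => some (inl j)) (f i) - X none * X (some (inr i))) (by
      intro E _ _ τ z T hτ h
      rw [map_sub, aeval_rename, map_mul, aeval_X, aeval_X, sub_eq_zero]
      exact h i)
    rw [map_sub, aeval_rename, map_mul, aeval_X, aeval_X, sub_eq_zero] at this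
    exact this
  obtain ⟨ψ, hψ⟩ := hlift x 0 fun F hF => aeval_closureIdeal_of_eq_zero hx _ hF
  refine ⟨P, inferInstance, inferInstance, hFP, z, T, ψ, fun j => by simp [z, hψ], hfT, ?_, ?_⟩
  · intro A _ _ N hN g hu
    choose z0 hz0 using fun j => mk_surjective (I := N) (g (z j))
    have hz0' : ∀ a : MvPolynomial ι R, mk N (aeval z0 a) = g (aeval z a) := by
      intro a
      rw [← AlgHom.comp_apply g, comp_aeval]
      change Ideal.Quotient.mkₐ R N (aeval z0 a) = _
      rw [← AlgHom.comp_apply, comp_aeval]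
      congr 2
      funext j
      exact hz0 j
    have hu' : IsUnit (aeval z0 p) := isUnit_of_isUnit_mk hN (by rwa [hz0'])
    obtain ⟨v, hv⟩ := hu'.exists_right_inv
    obtain ⟨g', hg'⟩ := hlift z0 (fun i => v * aeval z0 (f i)) fun F hF =>
      aeval_closureIdeal_of_isUnit hu' (fun i => by
        linear_combination (-aeval z0 (f i)) * hv) hF
    refine ⟨g', ?_⟩
    have : ((Ideal.Quotient.mkₐ R N).comp g').comp m = g.comp m := by
      ext j
      rcases j with j | i
      · simpa [hg'] using hz0 j
      · have h1 : mk N (aeval z0 p) * mk N v = 1 := by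
          rw [← map_mul, hv, map_one]
        have h2 := congrArg g (hfT i)
        rw [map_mul, ← hz0', ← hz0'] at h2
        have : mk N (v * aeval z0 (f i)) = g (T i) := by
          rw [map_mul, h2]
          linear_combination g (T i) * h1
        simpa [hg'] using this
    exact AlgHom.ext fun a => by
      obtain ⟨a, rfl⟩ := hm a
      exact DFunLike.congr_fun this a
  · rintro c ⟨S, hS⟩
    obtain ⟨Q, d, e, hQ, hMQ, hd, he, hdet⟩ := hS.exists_denominator
    let J := symJac f (stdMat f c S) p S
    refine ⟨aeval z c * aeval (Sum.elim z (Sum.elim 0 T)) d * aeval (Sum.elim z (Sum.elim 0 T)) J,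
      ?_, 1 + Fintype.card κ + Fintype.card κ, ?_⟩
    · intro A _ _ N hN g hu
      rw [map_mul, map_mul] at hu
      have huJ := isUnit_of_mul_isUnit_right hu
      have hud := isUnit_of_mul_isUnit_right (isUnit_of_mul_isUnit_left hu)
      have huc := isUnit_of_mul_isUnit_left (isUnit_of_mul_isUnit_left hu)
      choose y0 hy0 using fun j => mk_surjective (I := N) (g (Sum.elim z (Sum.elim 0 T) j))
      have hy0' : ∀ a : MvPolynomial (ι ⊕ (κ ⊕ κ)) R, mk N (aeval y0 a) =
          g (aeval (Sum.elim z (Sum.elim 0 T)) a) := by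
        intro a
        rw [← AlgHom.comp_apply g, comp_aeval]
        change Ideal.Quotient.mkₐ R N (aeval y0 a) = _
        rw [← AlgHom.comp_apply, comp_aeval]
        congr 2
        funext j
        exact hy0 j
      obtain ⟨y, hy, hsys⟩ := liftsAt_symJac f (stdMat f c S) p S A N hN y0 (fun i => by
          rw [← eq_zero_iff_mem, hy0', aeval_symSys, hfT]
          simp) (isUnit_of_isUnit_mk hN (by rw [hy0']; exact huJ))
      have hy1 : ∀ j, mk N (y j) = g (Sum.elim z (Sum.elim 0 T) j) := fun j => by
        rw [← hy0]; exact Ideal.Quotient.eq.2 (hy j)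
      have hy1' : ∀ a : MvPolynomial (ι ⊕ (κ ⊕ κ)) R, mk N (aeval y a) =
          g (aeval (Sum.elim z (Sum.elim 0 T)) a) := fun a => by
        rw [← hy0']; exact Ideal.Quotient.eq.2 (aeval_sub_mem hy a)
      have hdu : IsUnit (aeval y d) := isUnit_of_isUnit_mk hN (by rw [hy1']; exact hud)
      obtain ⟨v, hv⟩ := hdu.exists_right_inv
      have hyS : y = Sum.elim (fun j => y (inl j)) (Sum.elim
          (fun i => y (inr (inl i))) fun i => y (inr (inr i))) := by
        funext j; rcases j with _ | _ | _ <;> rfl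
      have hsys' := hsys
      rw [hyS] at hsys'
      simp only [aeval_symSys] at hsys'
      have hcl := fun (F : MvPolynomial (Option (ι ⊕ κ)) R) (hF : F ∈ closureIdeal f) =>
        aeval_closureIdeal_of_smooth (T := fun i => v * aeval y (e i)) hd hsys' hN (fun i => by
            rw [← eq_zero_iff_mem, hy1]; simp)
          (isUnit_of_isUnit_mk hN (by
            have := hy1' (rename inl c)
            rw [aeval_rename, aeval_rename] at this
            change IsUnit (mk N (aeval (y ∘ inl) c))
            rw [this]; exact huc))
          (by rw [← hyS]; exact hdu)
          (fun i => by rw [← hyS]; linear_combination aeval y (e i) * hv) hF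
      obtain ⟨g', hg'⟩ := hlift _ _ hcl
      refine ⟨g', ?_⟩
      have hMQT : ∀ i, ∑ l, aeval z (Q i l) * T l = ∑ l, aeval z (stdMat f c S i l) * T l := by
        intro i
        have := hrel (∑ l, rename (fun j => some (inl j)) (Q i l) * X (some (inr l)) -
          ∑ l, rename (fun j => some (inl j)) (stdMat f c S i l) * X (some (inr l))) (by
            intro E _ _ τ z T hτ h
            have h1 := congrArg (aeval z) (hMQ i)
            simp only [map_sum, map_mul, h] at h1
            simp only [map_sub, map_sum, map_mul, aeval_rename, aeval_X]
            refine hτ.1 _ ?_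
            change τ * (∑ l, aeval z (Q i l) * T l - ∑ l, aeval z (stdMat f c S i l) * T l) = 0
            rw [mul_sub, mul_sum, mul_sum, sub_eq_zero]
            refine (sum_congr rfl fun l _ => ?_).trans
              (h1.symm.trans (sum_congr rfl fun l _ => ?_)) <;> ring)
        simp only [map_sub, map_sum, map_mul, aeval_rename, aeval_X, sub_eq_zero] at this
        exact this
      have : ((Ideal.Quotient.mkₐ R N).comp g').comp m = g.comp m := by
        ext j
        rcases j with j | i
        · simpa [hg'] using hy1 (inl j)
        · have h1 : mk N (aeval y d) * mk N v = 1 := by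
            rw [← map_mul, hv, map_one]
          have h2 := congrArg g (he P z T hMQT i)
          rw [map_mul, ← hy1', ← hy1'] at h2
          have : mk N (v * aeval y (e i)) = g (T i) := by
            rw [map_mul, h2]
            linear_combination g (T i) * h1
          simpa [hg'] using this
      exact AlgHom.ext fun a => by
        obtain ⟨a, rfl⟩ := hm a
        exact DFunLike.congr_fun this a
    · have hψz : ∀ a, ψ (aeval z a) = aeval x a := fun a => by
        rw [← AlgHom.comp_apply, comp_aeval]
        congr 2
        funext j
        simp [z, hψ]
      have hψy : ∀ a : MvPolynomial (ι ⊕ (κ ⊕ κ)) R, ψ (aeval (Sum.elim z (Sum.elim 0 T)) a) =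
          aeval (Sum.elim x (Sum.elim 0 0)) a := fun a => by
        rw [← AlgHom.comp_apply, comp_aeval]
        congr 2
        funext j
        rcases j with j | i | i <;> simp [z, T, hψ]
      have hdiag : (Matrix.of fun i k : κ => if i = k then aeval x c else 0) =
          Matrix.diagonal fun _ => aeval x c := by
        ext i k; simp [Matrix.diagonal_apply]
      have hQx : ∀ i l, aeval x (Q i l) = 0 := fun i l => aeval_eq_zero_of_mem_sysIdeal hx (hQ i l)
      rw [map_mul, map_mul, hψz, hψy, hψy, hdet, aeval_symJac]
      simp only [hQx, Pi.zero_apply, zero_mul, sub_zero, hdiag, Matrix.det_diagonal,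
        Finset.prod_const, Finset.card_univ]
      ring

end Glue

section Glue

variable {R C Λ : Type u} [CommRing R] [CommRing C] [CommRing Λ] [Algebra R C] [Algebra R Λ]
  [IsNoetherianRing R] [IsReduced Λ] [FinitePresentation R C]

theorem sq_mul_eq_zero_of_isReduced {A : Type*} [CommRing A] [IsReduced A] {a b : A}
    (h : a ^ 2 * b = 0) : a * b = 0 := by
  have : (a * b) ^ 2 = 0 := by linear_combination b * h
  exact pow_eq_zero_iff (n := 2) (by simp) |>.1 this

theorem exists_dominating_of_smoothOn
    (hred : ∀ (E : Type u) [CommRing E] [Algebra R E] [Smooth R E], IsReduced E)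
    (φ : C →ₐ[R] Λ) {a : C} (ha : SmoothOn R a) {C' : Type u} [CommRing C'] [Algebra R C']
    [FinitePresentation R C'] (f₀ : C →ₐ[R] C') (φ' : C' →ₐ[R] Λ)
    (hf₀ : φ'.comp f₀ = φ) :
    ∃ (D : Type u) (_ : CommRing D) (_ : Algebra R D) (_ : FinitePresentation R D)
      (f : C →ₐ[R] D) (g : D →ₐ[R] Λ), g.comp f = φ ∧ φ a ∈ ((smoothIdeal R D).map g).radical ∧
        ∀ c ∈ smoothIdeal R C', φ' c ∈ ((smoothIdeal R D).map g).radical := by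
  classical
  obtain ⟨n, m, h, q, hq, hqk⟩ := exists_presentation R C
  obtain ⟨n', m', f, q', hq', hqk'⟩ := exists_presentation R C'
  obtain ⟨α, rfl⟩ := hq a
  obtain ⟨e, S, hS⟩ := ((smoothOn_iff_liftsAt q hq hqk α).1 ha).pow_mem_stdIdeal
  have hqh : ∀ i, q (h i) = 0 := fun i => by
    have := mem_sysIdeal h i
    rwa [← hqk] at this
  have hqf : ∀ i, q' (f i) = 0 := fun i => by
    have := mem_sysIdeal f i
    rwa [← hqk'] at this
  choose ζ hζ using fun j => hq' (f₀ (q (X j)))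
  have hev : ∀ a, q' (aeval ζ a) = f₀ (q a) := fun a => by
    rw [← AlgHom.comp_apply, ← AlgHom.comp_apply, comp_aeval]
    conv_rhs => rw [aeval_unique (f₀.comp q)]
    congr 2
    funext j
    exact hζ j
  have hhζ : ∀ i, ∃ s : Fin m' → MvPolynomial (Fin n') R, aeval ζ (h i) = ∑ l, s l * f l :=
    fun i => exists_mul_of_mem_sysIdeal (by
      rw [← hqk', mem_ker, hev, hqh, map_zero])
  choose s hs using hhζ
  have hx : ∀ a, aeval (fun j => φ' (q' (X j))) a = φ' (q' a) := fun a =>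
    (comp_aeval_apply (fun j => X j) (φ'.comp q') a).symm.trans (by simp)
  have hw : ∀ a, aeval (fun j => φ (q (X j))) a = φ (q a) := fun a =>
    (comp_aeval_apply (fun j => X j) (φ.comp q) a).symm.trans (by simp)
  obtain ⟨P, _, _, _, z, T, ψ, hψz, hfT, hsm, hstd⟩ :=
    exists_normal_cone f (aeval ζ (α ^ e) ^ 6) (x := fun j => φ' (q' (X j)))
      (fun i => by rw [hx, hqf, map_zero])
  let : Algebra P Λ := ψ.toRingHom.toAlgebra
  have hgΛ : ∀ x, algebraMap P Λ x = ψ x := fun _ => rfl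
  have : IsScalarTower R P Λ := of_algebraMap_eq fun x => (ψ.commutes x).symm
  have hψ : ∀ a, ψ (aeval z a) = φ' (q' a) := fun a => by
    rw [← hx, ← AlgHom.comp_apply, comp_aeval]
    simp only [hψz]
  let ρ : Fin n → P := fun j => aeval z (ζ j)
  have hρ : ∀ a, aeval ρ a = aeval z (aeval ζ a) := fun a =>
    (comp_aeval_apply ζ (aeval z) a).symm
  obtain ⟨B, _, _, hB, ξ, g, hξ, hg, hsmB, hcomp⟩ := exists_desing (hS.map (P := P)) (ρ := ρ)
    (γ := fun i => ∑ l, aeval z (s i l) * T l) (fun i => by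
      rw [aeval_map_of_tower, aeval_map_of_tower, hρ, hs, hρ, map_sum, mul_sum]
      refine sum_congr rfl fun l _ => ?_
      rw [map_mul, hfT, map_pow]; ring)
    (w := fun j => φ (q (X j))) (μ := 0) (fun i => by
      rw [aeval_map_of_tower, hw, hqh, map_zero]) (fun j => by
      rw [hgΛ, hψ, hζ, ← hf₀]; simp) (fun b hb => sq_mul_eq_zero_of_isReduced hb)
  let : Algebra R B := Algebra.compHom B (algebraMap R P)
  have : IsScalarTower R P B := IsScalarTower.of_algebraMap_eq' rfl
  have : FinitePresentation R B := FinitePresentation.trans R P B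
  obtain ⟨f₁, hf₁⟩ := exists_algHom_of_sys q hq hqk (x := ξ) (fun i => by
    rw [← aeval_map_of_tower (Rb := P)]; exact hξ i)
  have hgξ : ∀ a : MvPolynomial (Fin n) R, g (aeval ξ a) = φ (q a) := fun a => by
    rw [← hw]
    refine (comp_aeval_apply ξ (g.restrictScalars R) a).trans ?_
    congr 2
    funext j
    exact hg j
  have htr : ∀ (p : P) (b : B), SmoothOn R p → SmoothOn P b →
      SmoothOn R (algebraMap P B p * b) := fun p b hp hb =>
    hp.trans (hb.of_dvd (Dvd.intro_left _ rfl)) (Dvd.intro _ rfl)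
  have hmem : ∀ b, SmoothOn R b → g b ∈ (smoothIdeal R B).map (g.restrictScalars R) :=
    fun b hb => mem_map_of_mem (g.restrictScalars R) hb
  have hα : φ (q α) ∈ ((smoothIdeal R B).map (g.restrictScalars R)).radical := by
    have h1 := hmem _ (htr _ _ (SmoothOn.of_pow (by rw [map_pow] at hsm; exact hsm)) hsmB)
    rw [map_mul, AlgHom.commutes, hgΛ, aeval_map_of_tower, hgξ, hψ, hev, ← AlgHom.comp_apply φ',
      hf₀, map_pow, map_pow, ← pow_add] at h1
    exact ⟨_, h1⟩
  refine ⟨B, _, _, this, f₁, g.restrictScalars R, ?_, hα, ?_⟩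
  · refine AlgHom.ext fun c => ?_
    obtain ⟨c, rfl⟩ := hq c
    rw [AlgHom.comp_apply, hf₁]
    exact hgξ c
  · intro c hc
    obtain ⟨γ, rfl⟩ := hq' c
    obtain ⟨e', he'⟩ := ((smoothOn_iff_liftsAt q' hq' hqk' γ).1 hc).pow_mem_stdIdeal
    obtain ⟨p, hp, N, hN⟩ := hstd _ he'
    obtain ⟨b, hb, r, hr⟩ := hcomp p (fun E _ _ _ hu x hx => by
      let : Algebra R E := Algebra.compHom E (algebraMap R P)
      have : IsScalarTower R P E := IsScalarTower.of_algebraMap_eq' rfl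
      have : FinitePresentation R E := FinitePresentation.trans R P E
      have h1 : SmoothOn R (algebraMap P E p) := hp.trans (SmoothOn.of_formallySmooth _) dvd_rfl
      have : Smooth R E := h1.smooth_of_isUnit hu
      have := hred E
      exact sq_mul_eq_zero_of_isReduced hx)
    have h1 := hmem _ (htr p b hp hb)
    rw [map_mul, AlgHom.commutes, hgΛ, hr, hgΛ, aeval_map_of_tower, hw, map_pow, map_pow] at h1
    by_cases he : e = 0
    · subst he
      have h2 := hmem _ (htr _ _ (SmoothOn.of_pow (by rw [map_pow] at hsm; exact hsm)) hsmB)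
      rw [map_mul, AlgHom.commutes, hgΛ, aeval_map_of_tower, hgξ, hψ] at h2
      simp only [pow_zero, map_one, mul_one] at h2
      rw [(Ideal.eq_top_iff_one _).2 h2, Ideal.radical_top]
      trivial
    · have h2 := Ideal.le_radical h1
      have h3 : ψ p * ψ p ∈ ((smoothIdeal R B).map (g.restrictScalars R)).radical := by
        have h4 := mul_mem_left _ (ψ p * r) (Ideal.pow_mem_of_mem _ hα e (Nat.pos_of_ne_zero he))
        have := Ideal.sub_mem _ h2 h4
        convert this using 1
        ring
      rw [hN, hx, map_pow, map_pow, ← pow_mul, ← pow_add] at h3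
      exact Ideal.mem_radical_of_pow_mem h3

theorem exists_dominating
    (hred : ∀ (E : Type u) [CommRing E] [Algebra R E] [Smooth R E], IsReduced E)
    (φ : C →ₐ[R] Λ) {C' : Type u} [CommRing C'] [Algebra R C']
    [FinitePresentation R C'] (f₀ : C →ₐ[R] C') (φ' : C' →ₐ[R] Λ)
    (hf₀ : φ'.comp f₀ = φ) :
    ∃ (D : Type u) (_ : CommRing D) (_ : Algebra R D) (_ : FinitePresentation R D)
      (f : C →ₐ[R] D) (g : D →ₐ[R] Λ), g.comp f = φ ∧
        (smoothIdeal R C).map φ ≤ ((smoothIdeal R D).map g).radical ∧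
        (smoothIdeal R C').map φ' ≤ ((smoothIdeal R D).map g).radical := by
  classical
  have key : ∀ s : Finset C, (∀ a ∈ s, a ∈ smoothIdeal R C) →
      ∃ (D : Type u) (_ : CommRing D) (_ : Algebra R D) (_ : FinitePresentation R D)
        (f : C →ₐ[R] D) (g : D →ₐ[R] Λ), g.comp f = φ ∧
          (∀ a ∈ s, φ a ∈ ((smoothIdeal R D).map g).radical) ∧
          (smoothIdeal R C').map φ' ≤ ((smoothIdeal R D).map g).radical := by
    intro s
    induction s using Finset.induction_on with
    | empty => exact fun _ => ⟨C', _, _, inferInstance, f₀, φ', hf₀, by simp, Ideal.le_radical⟩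
    | insert a s has ih =>
      intro hs
      obtain ⟨D, _, _, _, f, g, hfg, h1, h2⟩ := ih fun b hb => hs b (Finset.mem_insert_of_mem hb)
      obtain ⟨D', _, _, _, f', g', hfg', h1', h2'⟩ := exists_dominating_of_smoothOn hred φ
        (mem_smoothIdeal.1 (hs a (Finset.mem_insert_self a s))) f g hfg
      have h3 : (smoothIdeal R D).map g ≤ ((smoothIdeal R D').map g').radical :=
        Ideal.map_le_iff_le_comap.2 h2'
      have h4 := Ideal.radical_mono h3
      rw [Ideal.radical_idem] at h4
      refine ⟨D', _, _, inferInstance, f', g', hfg', fun b hb => ?_, h2.trans h4⟩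
      rcases Finset.mem_insert.1 hb with rfl | hb
      · exact h1'
      · exact h4 (h1 b hb)
  have : IsNoetherianRing C := FiniteType.isNoetherianRing R C
  obtain ⟨s, hs⟩ := (isNoetherianRing_iff_ideal_fg C).1 inferInstance (smoothIdeal R C)
  obtain ⟨D, _, _, _, f, g, hfg, h1, h2⟩ := key s fun a ha => by
    rw [← hs]; exact Submodule.subset_span ha
  refine ⟨D, _, _, inferInstance, f, g, hfg, ?_, h2⟩
  rw [← hs, map_span, span_le]
  rintro _ ⟨a, ha, rfl⟩
  exact h1 a ha

end Glue

theorem exists_maximalIdeal_pow_le_of_mem_minimalPrimes {A : Type*} [CommRing A]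
    [IsNoetherianRing A] {I q : Ideal A} [q.IsPrime] (hq : q ∈ I.minimalPrimes) :
    ∃ M : ℕ, IsLocalRing.maximalIdeal (AtPrime q) ^ M ≤ I.map (algebraMap A (AtPrime q)) := by
  have hle : IsLocalRing.maximalIdeal (AtPrime q) ≤ (I.map (algebraMap A (AtPrime q))).radical := by
    rw [Ideal.radical_eq_sInf]
    refine le_sInf ?_
    rintro p ⟨hp, hpp⟩
    have h1 : I ≤ p.comap (algebraMap A (AtPrime q)) := Ideal.map_le_iff_le_comap.1 hp
    have h2 : p.comap (algebraMap A (AtPrime q)) ≤ q := by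
      refine (Ideal.comap_mono (IsLocalRing.le_maximalIdeal hpp.ne_top)).trans (le_of_eq ?_)
      exact AtPrime.under_maximalIdeal (I := q)
    have h3 := hq.2 ⟨Ideal.IsPrime.comap _, h1⟩ h2
    rw [← AtPrime.map_eq_maximalIdeal, Ideal.map_le_iff_le_comap]
    exact h3
  exact Ideal.exists_pow_le_of_le_radical_of_fg hle (IsNoetherian.noetherian _)

theorem HasDesing.of_localization {R Λ : Type u} [CommRing R] [CommRing Λ] [Algebra R Λ]
    [IsNoetherianRing R] [IsNoetherianRing Λ] [IsReduced Λ]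
    (hred : ∀ (E : Type u) [CommRing E] [Algebra R E] [Smooth R E], IsReduced E)
    (hloc : ∀ (q : Ideal Λ) [q.IsPrime] (C : Type u) [CommRing C] [Algebra R C]
      [FinitePresentation R C] (φ : C →ₐ[R] AtPrime q) (M : ℕ),
      IsLocalRing.maximalIdeal (AtPrime q) ^ M ≤ (smoothIdeal R C).map φ →
        HasSmoothFactor φ) : HasDesing R Λ := by
  intro B _ _ _ v
  let 𝒮 : Set (Ideal Λ) := {J | ∃ (D : Type u) (_ : CommRing D) (_ : Algebra R D)
    (_ : FinitePresentation R D) (f : B →ₐ[R] D) (g : D →ₐ[R] Λ), g.comp f = v ∧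
      ((smoothIdeal R D).map g).radical = J}
  have hB : FinitePresentation R B :=
    FinitePresentation.of_finiteType.1 inferInstance
  have hne : 𝒮.Nonempty := ⟨_, B, _, _, hB, AlgHom.id R B, v, rfl, rfl⟩
  obtain ⟨J, ⟨D, _, _, _, f, g, hfg, rfl⟩, hmax⟩ := set_has_maximal_iff_noetherian.2
    (inferInstance : IsNoetherian Λ Λ) 𝒮 hne
  by_cases htop : (smoothIdeal R D).map g = ⊤
  · rw [← hfg]
    exact (hasSmoothFactor_of_map_eq_top g htop).comp f
  · exfalso
    obtain ⟨q, hq⟩ := Ideal.nonempty_minimalPrimes htop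
    have hqp : q.IsPrime := hq.1.1
    obtain ⟨M, hM⟩ := exists_maximalIdeal_pow_le_of_mem_minimalPrimes hq
    let L := AtPrime q
    obtain ⟨E, _, _, hE, a, b, hab⟩ := hloc q D ((toAlgHom R Λ L).comp g) M (by
      refine hM.trans (le_of_eq ?_)
      exact Ideal.map_map (I := smoothIdeal R D) (g : D →+* Λ) (algebraMap Λ L))
    obtain ⟨C', _, _, _, f', φ', σ, hfφ, hσ, hσq⟩ :=
      exists_smoothOn_of_isLocalization (Λ' := L) q.primeCompl g a b (DFunLike.congr_fun hab)
    obtain ⟨D', _, _, _, f₁, g₁, hfg₁, h1, h2⟩ := exists_dominating hred g f' φ' hfφ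
    have h3 := Ideal.radical_mono h1
    rw [Ideal.radical_idem] at h3
    refine hmax _ ⟨D', _, _, inferInstance, f₁.comp f, g₁, ?_, rfl⟩ (lt_of_le_of_ne h3 ?_)
    · rw [← AlgHom.comp_assoc, hfg₁, hfg]
    · intro heq
      have h4 : φ' σ ∈ ((smoothIdeal R D).map g).radical := by
        rw [heq]; exact h2 (mem_map_of_mem _ hσ)
      exact hσq ((Ideal.IsPrime.radical_le_iff hqp).2 hq.1.2 h4)

section SmoothReduced

open TensorProduct in
theorem Algebra.Smooth.isReduced_of_field (k E : Type*) [Field k] [CommRing E] [Algebra k E]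
    [Smooth k E] : IsReduced E := by
  refine ⟨fun a ha => ?_⟩
  have hsurj := (TensorProduct.toIntegralClosure_bijective_of_smooth
    (R := k) (S := E) (B := Polynomial k)).2
  have hintegral : IsIntegral E (a ⊗ₜ[k] (Polynomial.X : Polynomial k)) := by
    obtain ⟨n, hn⟩ := ha
    refine IsIntegral.of_pow (n := n + 1) (by omega) ?_
    rw [Algebra.TensorProduct.tmul_pow, pow_succ, hn, zero_mul, TensorProduct.zero_tmul]
    exact isIntegral_zero
  obtain ⟨y, hy⟩ := hsurj ⟨_, hintegral⟩
  have hc : ∀ b : integralClosure k (Polynomial k), ∃ c : k, (b : Polynomial k) = .C c := by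
    intro b
    have hb : IsIntegral k (b : Polynomial k) := b.2
    have : IsIntegrallyClosed k := inferInstance
    obtain ⟨f, hf, hfb⟩ := hb
    refine ⟨_, Polynomial.eq_C_of_natDegree_eq_zero ?_⟩
    by_contra hd
    have h2 : (f.comp (b : Polynomial k)) = 0 := by
      rw [← hfb, Polynomial.comp, Polynomial.algebraMap_eq]
    rw [Polynomial.comp_eq_zero_iff] at h2
    rcases h2 with h2 | h2
    · exact hf.ne_zero h2
    · apply hd
      rw [h2.2]; simp
  have hy2 : ∀ y : E ⊗[k] integralClosure k (Polynomial k),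
      ∃ e : E, ((TensorProduct.toIntegralClosure k E (Polynomial k) y :
        integralClosure E (E ⊗[k] Polynomial k)) : E ⊗[k] Polynomial k) = e ⊗ₜ 1 := by
    intro y
    induction y with
    | zero => exact ⟨0, by simp⟩
    | add x y hx hy =>
      obtain ⟨e, he⟩ := hx
      obtain ⟨e', he'⟩ := hy
      exact ⟨e + e', by rw [map_add]; simp [he, he', TensorProduct.add_tmul]⟩
    | tmul x y =>
      obtain ⟨c, hcy⟩ := hc y
      refine ⟨c • x, ?_⟩
      simp only [TensorProduct.toIntegralClosure, AlgHom.coe_codRestrict,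
        Algebra.TensorProduct.map_tmul, AlgHom.coe_id, Subalgebra.coe_val, hcy]
      rw [TensorProduct.smul_tmul, Polynomial.smul_eq_C_mul, mul_one]
      rfl
  obtain ⟨e, he⟩ := hy2 y
  rw [hy] at he
  replace he := congrArg (fun t => (polyEquivTensor k E).symm t) he
  simp only [polyEquivTensor_symm_apply_tmul_eq_smul] at he
  have := congrArg (fun t : Polynomial E => t.coeff 1) he
  simpa [Polynomial.coeff_one] using this

end SmoothReduced

section RegularLocal

open IsLocalRing

variable {R : Type*} [CommRing R] [IsLocalRing R] [IsNoetherianRing R]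

theorem ringKrullDim_le_card_of_span_eq {ι : Type*} [Finite ι] (x : ι → R)
    (hx : span (range x) = maximalIdeal R) : ringKrullDim R ≤ (Nat.card ι : ℕ) := by
  refine (ringKrullDim_le_spanFinrank_maximalIdeal R).trans ?_
  rw [← hx]
  have := Submodule.spanFinrank_span_le_ncard_of_finite (R := R) (Set.finite_range x)
  refine Nat.cast_le.2 (this.trans ?_)
  rw [← Set.image_univ, ← Set.ncard_univ]
  exact Set.ncard_image_le Set.finite_univ

/-- `x` generates the maximal ideal and has as many members as the dimension. -/
def IsRSOP {ι : Type*} (x : ι → R) : Prop :=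
  Finite ι ∧ span (range x) = maximalIdeal R ∧ ringKrullDim R = (Nat.card ι : ℕ)

theorem IsRSOP.quotient {ι : Type*} {x : ι → R} (hx : IsRSOP x) (S : Set ι) :
    ∃ _ : IsLocalRing (R ⧸ span (x '' S)),
      IsRSOP (fun i : {i // i ∉ S} => mk (span (x '' S)) (x i)) := by
  classical
  obtain ⟨hfin, hspan, hdim⟩ := hx
  have hle : span (x '' S) ≤ maximalIdeal R := by
    rw [← hspan]; exact Ideal.span_mono (Set.image_subset_range _ _)
  have hnt : Nontrivial (R ⧸ span (x '' S)) :=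
    Ideal.Quotient.nontrivial_iff.2 (fun h => (maximalIdeal.isMaximal R).ne_top (top_le_iff.1
      (h ▸ hle)))
  have hloc : IsLocalRing (R ⧸ span (x '' S)) :=
    IsLocalRing.of_surjective' (mk _) mk_surjective
  refine ⟨hloc, ?_⟩
  have hsp : span (range (fun i : {i // i ∉ S} =>
      mk (span (x '' S)) (x i))) = maximalIdeal _ := by
    have h1 : (maximalIdeal R).map (mk (span (x '' S))) = maximalIdeal (R ⧸ span (x '' S)) := by
      refine IsLocalRing.eq_maximalIdeal ((Ideal.map_eq_top_or_isMaximal_of_surjective (mk _)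
          mk_surjective inferInstance).resolve_left fun h => ?_)
      have := Ideal.comap_map_of_surjective (mk (span (x '' S))) mk_surjective (maximalIdeal R)
      rw [h, Ideal.comap_top, ← RingHom.ker_eq_comap_bot, mk_ker, sup_eq_left.2 hle] at this
      exact (maximalIdeal.isMaximal R).ne_top this.symm
    rw [← h1, ← hspan, map_span]
    apply le_antisymm
    · refine Ideal.span_mono ?_
      rintro _ ⟨i, rfl⟩
      exact ⟨_, ⟨i.1, rfl⟩, rfl⟩
    · rw [span_le]
      rintro _ ⟨_, ⟨i, rfl⟩, rfl⟩
      by_cases hi : i ∈ S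
      · rw [eq_zero_iff_mem.2 (subset_span (Set.mem_image_of_mem x hi))]
        exact zero_mem _
      · exact subset_span ⟨⟨i, hi⟩, rfl⟩
  refine ⟨inferInstance, hsp, le_antisymm (ringKrullDim_le_card_of_span_eq _ hsp) ?_⟩
  have h2 := ringKrullDim_le_ringKrullDim_quotient_add_encard (x '' S) (by
    rw [IsLocalRing.ringJacobson_eq_maximalIdeal]
    exact fun y hy => hle (subset_span hy))
  have h3 : (x '' S).encard ≤ (S.ncard : ℕ∞) := by
    refine (Set.encard_image_le _ _).trans ?_
    rw [← Set.Finite.cast_ncard_eq S.toFinite]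
  have h4 : Nat.card ι = Nat.card {i // i ∉ S} + S.ncard := by
    have := Set.ncard_add_ncard_compl S
    rw [← this, add_comm]; rfl
  rw [hdim, h4] at h2
  have h5 := h2.trans (add_le_add_right (WithBot.coe_le_coe.2 h3) _)
  generalize ringKrullDim (R ⧸ span (x '' S)) = r at h5 ⊢
  induction r with
  | bot =>
    rw [WithBot.bot_add, le_bot_iff] at h5
    exact absurd h5 (WithBot.natCast_ne_bot _)
  | coe r =>
    induction r with
    | top => exact le_top
    | coe r => norm_cast at h5 ⊢; omega

theorem IsRSOP.notMem {ι : Type*} {x : ι → R} (hx : IsRSOP x) {S : Set ι} {i : ι} (hi : i ∉ S) :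
    x i ∉ span (x '' S) := by
  intro hmem
  obtain ⟨hloc, hfin, hspan, hdim⟩ := hx.quotient S
  have h := ringKrullDim_le_card_of_span_eq (R := R ⧸ span (x '' S))
    (ι := {j : {j // j ∉ S} // j ≠ ⟨i, hi⟩})
    (fun j => mk (span (x '' S)) (x j.1)) (by
      rw [← hspan]
      apply le_antisymm
      · refine Ideal.span_mono ?_
        rintro _ ⟨j, rfl⟩
        exact ⟨j.1, rfl⟩
      · rw [span_le]
        rintro _ ⟨j, rfl⟩
        by_cases hj : j = ⟨i, hi⟩
        · subst hj
          simp only [SetLike.mem_coe]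
          rw [eq_zero_iff_mem.2 hmem]
          exact zero_mem _
        · exact subset_span ⟨⟨j, hj⟩, rfl⟩)
  rw [hdim, Nat.cast_le] at h
  have : Finite {j // j ∉ S} := hfin
  have h3 := Set.ncard_add_ncard_compl ({⟨i, hi⟩} : Set {j // j ∉ S})
  rw [Set.ncard_singleton] at h3
  have h4 : Nat.card {j : {j // j ∉ S} // j ≠ ⟨i, hi⟩} =
    ({⟨i, hi⟩}ᶜ : Set {j // j ∉ S}).ncard := rfl
  omega

theorem IsRSOP.update [DecidableEq ι] {x : ι → R} (hx : IsRSOP x) {y : R}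
    (hy : y ∈ maximalIdeal R) (hy2 : y ∉ maximalIdeal R ^ 2) :
    ∃ i, IsRSOP (Function.update x i y) := by
  classical
  obtain ⟨hfin, hspan, hdim⟩ := hx
  have := Fintype.ofFinite ι
  have hy' := hy
  rw [← hspan, mem_span_range_iff_exists_fun] at hy'
  obtain ⟨c, rfl⟩ := hy'
  have hxm : ∀ i, x i ∈ maximalIdeal R := fun i => hspan ▸ subset_span ⟨i, rfl⟩
  obtain ⟨i, hi⟩ : ∃ i, IsUnit (c i) := by
    by_contra! hc
    refine hy2 (Ideal.sum_mem _ fun i _ => ?_)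
    rw [pow_two]
    exact Ideal.mul_mem_mul ((mem_maximalIdeal _).2 (hc i)) (hxm i)
  refine ⟨i, hfin, le_antisymm ?_ ?_, hdim⟩
  · rw [span_le]
    rintro _ ⟨j, rfl⟩
    by_cases hj : j = i
    · subst hj; simpa using hy
    · simpa [hj] using hxm j
  · rw [← hspan, span_le]
    have hne : ∀ j, j ≠ i → x j ∈ span (range (Function.update x i (∑ i, c i * x i))) := fun j hj =>
      subset_span ⟨j, by simp [hj]⟩
    rintro _ ⟨j, rfl⟩
    by_cases hj : j = i
    · subst hj
      have h1 : (∑ i, c i * x i) ∈ span (range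
        (Function.update x j (∑ i, c i * x i))) := subset_span ⟨j, by simp⟩
      have h2 : c j * x j = (∑ i, c i * x i) - ∑ i ∈ Finset.univ.erase j, c i * x i := by
        rw [← Finset.add_sum_erase _ _ (mem_univ j)]; ring
      refine (Ideal.unit_mul_mem_iff_mem _ hi).1 ?_
      rw [h2]
      exact sub_mem h1 (Ideal.sum_mem _ fun l hl => mul_mem_left _ _
        (hne l (Finset.ne_of_mem_erase hl)))
    · exact hne j hj

theorem IsRSOP.isDomain {ι : Type w} {R : Type v} [CommRing R] [IsLocalRing R]
    [IsNoetherianRing R] {x : ι → R} (hx : IsRSOP x) : IsDomain R := by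
  classical
  obtain ⟨n, hn⟩ : ∃ n, Nat.card ι = n := ⟨_, rfl⟩
  induction n generalizing ι R with
  | zero =>
    have := hx.1
    have hι : IsEmpty ι := Finite.card_eq_zero_iff.1 hn
    have h := hx.2.1
    rw [Set.range_eq_empty, Ideal.span_empty] at h
    exact ((IsLocalRing.isField_iff_maximalIdeal_eq).2 h.symm).isDomain
  | succ n ih =>
    have hfin := hx.1
    -- prime avoidance
    have hex : ∃ y ∈ maximalIdeal R, y ∉ maximalIdeal R ^ 2 ∧ ∀ p ∈ minimalPrimes R, y ∉ p := by
      by_contra! hcon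
      have hminfin := minimalPrimes.finite_of_isNoetherianRing R
      have hsub : (maximalIdeal R : Set R) ⊆ ⋃ I ∈ (↑(insert (maximalIdeal R ^ 2)
          hminfin.toFinset) : Set (Ideal R)), (id I : Ideal R) := by
        intro y hy
        by_cases h2 : y ∈ maximalIdeal R ^ 2
        · exact Set.mem_biUnion (x := maximalIdeal R ^ 2) (by simp) h2
        · obtain ⟨p, hp, hyp⟩ := hcon y hy h2
          exact Set.mem_biUnion (x := p) (by simp [hp]) hyp
      rw [Ideal.subset_union_prime (maximalIdeal R ^ 2) (maximalIdeal R ^ 2)] at hsub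
      · obtain ⟨I, hI, hle⟩ := hsub
        simp only [Finset.mem_insert, Set.Finite.mem_toFinset] at hI
        have hdim := hx.2.2
        rcases hI with rfl | hI
        · have hbot : maximalIdeal R = ⊥ := by
            refine Submodule.eq_bot_of_le_smul_of_le_jacobson_bot (maximalIdeal R) _
              (IsNoetherian.noetherian _) ?_ (IsLocalRing.jacobson_eq_maximalIdeal _ bot_ne_top).ge
            rw [smul_eq_mul, ← pow_two]; exact hle
          have hf := (IsLocalRing.isField_iff_maximalIdeal_eq).2 hbot
          rw [ringKrullDim_eq_zero_of_isField hf, hn] at hdim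
          norm_cast at hdim
        · have hp : I.IsPrime := hI.1.1
          have hIm : I = maximalIdeal R := le_antisymm (le_maximalIdeal hp.ne_top) hle
          have h0 : ringKrullDim R = 0 := by
            rw [← IsLocalRing.maximalIdeal_height_eq_ringKrullDim]
            rw [← hIm, Ideal.height_eq_zero_iff.2 hI]; rfl
          rw [h0, hn] at hdim
          norm_cast at hdim
      · intro I hI h1 _
        simp only [Finset.mem_insert, Set.Finite.mem_toFinset] at hI
        exact (hI.resolve_left h1).1.1
    obtain ⟨y, hy, hy2, hymin⟩ := hex
    obtain ⟨i, hi⟩ := hx.update hy hy2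
    obtain ⟨hloc, hq⟩ := hi.quotient {i}
    have hdom := ih hq (by
      have := Set.ncard_add_ncard_compl ({i} : Set ι)
      rw [Set.ncard_singleton, hn] at this
      have h4 : Nat.card {j // j ∉ ({i} : Set ι)} = ({i}ᶜ : Set ι).ncard := rfl
      omega)
    have hpr : (span (Function.update x i y '' {i})).IsPrime :=
      (Ideal.Quotient.isDomain_iff_prime _).1 hdom
    simp only [Set.image_singleton, Function.update_self] at hpr
    obtain ⟨p, hp, hple⟩ := Ideal.exists_minimalPrimes_le (I := (⊥ : Ideal R))
      (J := span {y}) bot_le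
    have hpp : p.IsPrime := hp.1.1
    have hbot : p = ⊥ := by
      refine Submodule.eq_bot_of_le_smul_of_le_jacobson_bot (maximalIdeal R) _
              (IsNoetherian.noetherian _) ?_ (IsLocalRing.jacobson_eq_maximalIdeal _ bot_ne_top).ge
      intro z hz
      obtain ⟨a, rfl⟩ := Ideal.mem_span_singleton'.1 (hple hz)
      rw [smul_eq_mul, mul_comm a y]
      exact Ideal.mul_mem_mul hy ((hpp.mem_or_mem hz).resolve_right (hymin p hp))
    rw [hbot] at hpp
    exact IsDomain.of_bot_isPrime R

theorem IsRSOP.mem_span_of_mul_mem {ι : Type*} [DecidableEq ι] {x : ι → R} (hx : IsRSOP x)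
    (a : ι → ℕ) (S : Finset ι) (ha : ∀ j ∈ S, 1 ≤ a j) {i : ι} (hi : i ∉ S) {y : R}
    (hy : x i * y ∈ span ((fun j => x j ^ a j) '' (S : Set ι))) :
    y ∈ span ((fun j => x j ^ a j) '' (S : Set ι)) := by
  obtain ⟨N, hN⟩ : ∃ N, ∑ j ∈ S, a j = N := ⟨_, rfl⟩
  induction N using Nat.strong_induction_on generalizing a S i y with
  | h N ih =>
  by_cases h1 : ∀ j ∈ S, a j = 1
  · have himg : (fun j => x j ^ a j) '' (S : Set ι) = x '' (S : Set ι) :=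
      Set.image_congr fun j hj => by simp [h1 j hj]
    rw [himg] at hy ⊢
    obtain ⟨hloc, hq⟩ := hx.quotient (S : Set ι)
    have hpr := (Ideal.Quotient.isDomain_iff_prime _).1 hq.isDomain
    exact (hpr.mem_or_mem hy).resolve_left (hx.notMem hi)
  · push Not at h1
    obtain ⟨j, hjS, hj1⟩ := h1
    have hj2 : 2 ≤ a j := by have := ha j hjS; omega
    have hins : ∀ b, 1 ≤ b → span ((fun l => x l ^ (Function.update a j b) l) '' (S : Set ι)) =
        span {x j ^ b} ⊔ span ((fun l => x l ^ a l) '' (S.erase j : Set ι)) := by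
      intro b _
      rw [← Ideal.span_union]
      congr 1
      have : (S : Set ι) = insert j (S.erase j : Set ι) := by
        rw [← Finset.coe_insert, Finset.insert_erase hjS]
      rw [this, Set.image_insert_eq, Set.singleton_union]
      congr 1
      · simp
      · refine Set.image_congr fun l hl => ?_
        have : l ≠ j := Finset.ne_of_mem_erase hl
        simp [this]
    have hsum : ∀ b, ∑ l ∈ S, Function.update a j b l = b + ∑ l ∈ S.erase j, a l := by
      intro b
      rw [← Finset.add_sum_erase _ _ hjS, Function.update_self]
      congr 1
      exact sum_congr rfl fun l hl => by simp [Finset.ne_of_mem_erase hl]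
    have hsum0 : a j + ∑ l ∈ S.erase j, a l = N := by rw [Finset.add_sum_erase _ _ hjS, hN]
    have hau : Function.update a j (a j) = a := by simp
    have key : ∀ b, 1 ≤ b → b < a j → ∀ {y}, x i * y ∈ span {x j ^ b} ⊔
        span ((fun l => x l ^ a l) '' (S.erase j : Set ι)) →
        y ∈ span {x j ^ b} ⊔ span ((fun l => x l ^ a l) '' (S.erase j : Set ι)) := by
      intro b hb hb2 y hy
      rw [← hins b hb] at hy ⊢
      refine ih (b + ∑ l ∈ S.erase j, a l) (by omega) _ S ?_ hi hy (hsum b)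
      intro l hl
      by_cases hlj : l = j
      · subst hlj; simpa using hb
      · simpa [hlj] using ha l hl
    have keyj : ∀ b, ∀ {y}, x j ^ b * y ∈ span ((fun l => x l ^ a l) ''
        (S.erase j : Set ι)) → y ∈ span ((fun l => x l ^ a l) '' (S.erase j : Set ι)) := by
      intro b
      induction b with
      | zero => intro y hy; simpa using hy
      | succ b ihb =>
        intro y hy
        refine ih (∑ l ∈ S.erase j, a l) (by omega) a (S.erase j)
          (fun l hl => ha l (Finset.mem_of_mem_erase hl)) (i := j) (by simp) (ihb ?_) rfl
        rw [← mul_assoc, ← pow_succ]; exact hy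
    have hIa := hins (a j) (ha j hjS)
    rw [hau] at hIa
    rw [hIa] at hy ⊢
    obtain ⟨u, hu, w, hw, huw⟩ := Submodule.mem_sup.1 hy
    obtain ⟨t, rfl⟩ := Ideal.mem_span_singleton'.1 hu
    have hpow : x j ^ a j = x j ^ (a j - 1) * x j := by
      rw [← pow_succ]; congr 1; omega
    have hy1 := key (a j - 1) (by omega) (by omega) (y := y) (by
      rw [← huw, hpow]
      refine add_mem (Ideal.mem_sup_left ?_) (Ideal.mem_sup_right hw)
      rw [mul_comm, mul_assoc]
      exact mul_mem_right _ _ (mem_span_singleton_self _))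
    obtain ⟨u', hu', w', hw', rfl⟩ := Submodule.mem_sup.1 hy1
    obtain ⟨s, rfl⟩ := Ideal.mem_span_singleton'.1 hu'
    have h3 : x i * s - t * x j ∈ span ((fun l => x l ^ a l) '' (S.erase j : Set ι)) := by
      refine keyj (a j - 1) ?_
      have : x j ^ (a j - 1) * (x i * s - t * x j) = w - x i * w' := by
        rw [hpow] at huw
        linear_combination -huw
      rw [this]
      exact sub_mem hw (mul_mem_left _ _ hw')
    have h4 := key 1 le_rfl (by omega) (y := s) (by
      have : x i * s = t * x j + (x i * s - t * x j) := by ring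
      rw [this, pow_one]
      exact add_mem (Ideal.mem_sup_left (mul_mem_left _ _
        (mem_span_singleton_self _))) (Ideal.mem_sup_right h3))
    obtain ⟨u2, hu2, w2, hw2, rfl⟩ := Submodule.mem_sup.1 h4
    obtain ⟨s2, rfl⟩ := Ideal.mem_span_singleton'.1 hu2
    have : (s2 * x j ^ 1 + w2) * x j ^ (a j - 1) + w' =
        s2 * x j ^ a j + (x j ^ (a j - 1) * w2 + w') := by rw [hpow]; ring
    rw [this]
    exact add_mem (Ideal.mem_sup_left (mul_mem_left _ _ (mem_span_singleton_self _)))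
      (Ideal.mem_sup_right (add_mem (mul_mem_left _ _ hw2) hw'))

theorem IsRSOP.mem_span_of_pow_mul_mem {ι : Type*} [DecidableEq ι] {x : ι → R} (hx : IsRSOP x)
    (a : ι → ℕ) (S : Finset ι) (ha : ∀ j ∈ S, 1 ≤ a j) {i : ι} (hi : i ∉ S) (b : ℕ) {y : R}
    (hy : x i ^ b * y ∈ span ((fun j => x j ^ a j) '' (S : Set ι))) :
    y ∈ span ((fun j => x j ^ a j) '' (S : Set ι)) := by
  induction b generalizing y with
  | zero => simpa using hy
  | succ b ihb =>
    refine hx.mem_span_of_mul_mem a S ha hi (ihb ?_)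
    rw [← mul_assoc, ← pow_succ]; exact hy

theorem IsRSOP.prod_pow_notMem {ι : Type*} [DecidableEq ι] [Fintype ι] {x : ι → R} (hx : IsRSOP x)
    {n : ℕ} (hn : 1 ≤ n) :
    ∏ i, x i ^ (n - 1) ∉ span (range fun i => x i ^ n) := by
  have key : ∀ S : Finset ι, ∏ i ∈ S, x i ^ (n - 1) ∉
      span ((fun i => x i ^ (if i ∈ S then n else 1)) '' (Finset.univ : Finset ι)) := by
    intro S
    induction S using Finset.induction_on with
    | empty =>
      intro h
      simp only [Finset.prod_empty, Finset.notMem_empty, if_false, pow_one, Finset.coe_univ,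
        Set.image_univ, hx.2.1] at h
      exact (Ideal.ne_top_iff_one _).1 (maximalIdeal.isMaximal R).ne_top h
    | insert i S hi ih =>
      intro h
      rw [Finset.prod_insert hi] at h
      have hsplit : ∀ T : Finset ι, (∀ j, j ≠ i → (j ∈ T ↔ j ∈ S)) →
          span ((fun j => x j ^ (if j ∈ T then n else 1)) '' (Finset.univ : Finset ι)) =
          span {x i ^ (if i ∈ T then n else 1)} ⊔
          span ((fun j => x j ^ (if j ∈ S then n else 1)) '' (Finset.univ.erase i)) := by
        intro T hT
        rw [← Ideal.span_union]
        congr 1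
        have : ((Finset.univ : Finset ι) : Set ι) = insert i ((Finset.univ.erase i) : Set ι) := by
          rw [← Finset.coe_insert, Finset.insert_erase (mem_univ i)]
        rw [this, Set.image_insert_eq, Set.singleton_union]
        congr 1
        refine Set.image_congr fun l hl => ?_
        simp [hT l (Finset.ne_of_mem_erase hl)]
      rw [hsplit (insert i S) (by simp +contextual), if_pos (Finset.mem_insert_self _ _)] at h
      refine ih ?_
      rw [hsplit S (by simp), if_neg hi, pow_one]
      obtain ⟨u, hu, w, hw, huw⟩ := Submodule.mem_sup.1 h
      obtain ⟨t, rfl⟩ := Ideal.mem_span_singleton'.1 hu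
      have hpow : x i ^ n = x i ^ (n - 1) * x i := by
        rw [← pow_succ]; congr 1; omega
      have h3 := hx.mem_span_of_pow_mul_mem (fun j => if j ∈ S then n else 1)
        (Finset.univ.erase i) (fun j _ => by split_ifs <;> omega) (i := i) (by simp) (n - 1)
        (y := ∏ i ∈ S, x i ^ (n - 1) - t * x i) (by
          have : x i ^ (n - 1) * (∏ i ∈ S, x i ^ (n - 1) - t * x i) = w := by
            rw [hpow] at huw; linear_combination -huw
          rw [this]; exact hw)
      have : ∏ i ∈ S, x i ^ (n - 1) = t * x i + (∏ i ∈ S, x i ^ (n - 1) - t * x i) := by ring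
      rw [this]
      exact add_mem (Ideal.mem_sup_left (mul_mem_left _ _
        (mem_span_singleton_self _))) (Ideal.mem_sup_right h3)
  simpa using key Finset.univ

end RegularLocal

section Chain

/-- Every member of the list is a nonzerodivisor modulo the ideal of the preceding ones. -/
def WeakReg {R : Type*} [CommRing R] (l : List R) : Prop :=
  ∀ l₁ r l₂, l = l₁ ++ r :: l₂ → ∀ y, r * y ∈ Ideal.ofList l₁ → y ∈ Ideal.ofList l₁

theorem Ideal.mem_ofList_of_map_mem {R R' : Type*} [CommRing R] [CommRing R'] (f : R →+* R')
    (hf : Surjective f) {r : R} (hk : ker f = span {r}) (l : List R) {y : R} :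
    f y ∈ Ideal.ofList (l.map f) ↔ y ∈ Ideal.ofList (r :: l) := by
  rw [← Ideal.map_ofList, ← mem_comap, Ideal.comap_map_of_surjective f hf,
    ← RingHom.ker_eq_comap_bot, hk, Ideal.ofList_cons, sup_comm]

theorem WeakReg.quotient {R R' : Type*} [CommRing R] [CommRing R'] (f : R →+* R')
    (hf : Surjective f) {r : R} (hk : ker f = span {r}) {l : List R}
    (H : WeakReg (r :: l)) : WeakReg (l.map f) := by
  intro l₁ s l₂ hl y hy
  obtain ⟨m₁, m₂', rfl, rfl, hm⟩ := List.map_eq_append_iff.1 hl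
  obtain ⟨s, m₂, rfl, rfl, rfl⟩ := List.map_eq_cons_iff.1 hm
  obtain ⟨y, rfl⟩ := hf y
  rw [← map_mul, Ideal.mem_ofList_of_map_mem f hf hk] at hy
  rw [Ideal.mem_ofList_of_map_mem f hf hk]
  exact H (r :: m₁) s m₂ (by simp) y hy

theorem WeakReg.eq_zero {R : Type*} [CommRing R] {r : R} {l : List R} (H : WeakReg (r :: l))
    {y : R} (hy : r * y = 0) : y = 0 := by
  have := H [] r l rfl y (by simp [hy])
  simpa using this

theorem hasSmoothFactor_of_weakReg {ι κ : Type} [Fintype ι] [Fintype κ]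
    {Db Cb Λb : Type u} [CommRing Db] [CommRing Cb] [CommRing Λb] [Algebra Db Cb]
    [Smooth Db Cb] (ψ : Cb →+* Λb) :
    ∀ (n : ℕ) {D Λ : Type u} [CommRing D] [CommRing Λ] [Algebra D Λ] (l : List D) (_ : l.length = n)
      (h : κ → MvPolynomial ι D) (_ : ∀ r ∈ l, C r ∈ stdIdeal h)
      (v : (MvPolynomial ι D ⧸ sysIdeal h) →ₐ[D] Λ)
      (_ : WeakReg (l.map (· ^ 6)))
      (_ : WeakReg ((l.map (· ^ 6)).map (algebraMap D Λ)))
      (α : D →+* Db) (_ : Surjective α)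
      (_ : ker α = Ideal.ofList (l.map (· ^ 6)))
      (π : Λ →+* Λb) (_ : Surjective π)
      (_ : ker π = Ideal.ofList ((l.map (· ^ 6)).map (algebraMap D Λ)))
      (β : (MvPolynomial ι D ⧸ sysIdeal h) →+* Cb)
      (_ : ∀ d : D, β (algebraMap D _ d) = algebraMap Db Cb (α d))
      (_ : ∀ b, ψ (β b) = π (v b)), HasSmoothFactor v := by
  intro n
  induction n with
  | zero =>
    intro D Λ _ _ _ l hl h hstd v hD hΛ α hα hαk π hπ hπk β hβ hψ
    obtain rfl := List.length_eq_zero_iff.1 hl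
    simp only [List.map_nil, Ideal.ofList_nil] at hαk hπk
    let _ : Algebra D Db := α.toAlgebra
    have hbij : Function.Bijective (Algebra.ofId D Db) :=
      ⟨(RingHom.injective_iff_ker_eq_bot α).2 hαk, hα⟩
    have : Smooth D Db := Smooth.of_equiv (AlgEquiv.ofBijective _ hbij)
    let _ : Algebra D Cb := ((algebraMap Db Cb).comp α).toAlgebra
    have : IsScalarTower D Db Cb := of_algebraMap_eq fun _ => rfl
    have hs : Smooth D Cb := Smooth.comp D Db Cb
    let e : Λ ≃+* Λb := RingEquiv.ofBijective π ⟨(RingHom.injective_iff_ker_eq_bot π).2 hπk, hπ⟩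
    have he : ∀ x, e.symm (π x) = x := fun x => e.symm_apply_apply x
    refine ⟨Cb, _, _, hs, { β with commutes' := hβ },
      { (e.symm : Λb →+* Λ).comp ψ with commutes' := fun d => ?_ }, ?_⟩
    · change e.symm (ψ (algebraMap Db Cb (α d))) = _
      rw [← hβ, hψ, v.commutes, he]
    · refine AlgHom.ext fun b => ?_
      change e.symm (ψ (β b)) = _
      rw [hψ, he]
  | succ n ih =>
    intro D Λ _ _ _ l hl h hstd v hD hΛ α hα hαk π hπ hπk β hβ hψ
    obtain ⟨r, l, rfl⟩ := List.exists_cons_of_length_eq_add_one hl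
    simp only [List.map_cons] at hD hΛ hαk hπk
    let I : Ideal D := span {r ^ 6}
    let J : Ideal Λ := span {algebraMap D Λ (r ^ 6)}
    have hIJ : I ≤ J.comap (algebraMap D Λ) := by
      rw [Ideal.span_singleton_le_iff_mem]; exact mem_span_singleton_self _
    let _ : Algebra (D ⧸ I) (Λ ⧸ J) := (Ideal.quotientMap J (algebraMap D Λ) hIJ).toAlgebra
    have htow : IsScalarTower D (D ⧸ I) (Λ ⧸ J) := of_algebraMap_eq fun _ => rfl
    have hαr : ∀ a ∈ I, α a = 0 := fun a ha => by
      change a ∈ ker α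
      rw [hαk, Ideal.ofList_cons]; exact Ideal.mem_sup_left ha
    have hπr : ∀ a ∈ J, π a = 0 := fun a ha => by
      change a ∈ ker π
      rw [hπk, Ideal.ofList_cons]; exact Ideal.mem_sup_left ha
    let mD : D →+* D ⧸ I := mk I
    let mΛ : Λ →+* Λ ⧸ J := mk J
    let α' : D ⧸ I →+* Db := Ideal.Quotient.lift I α hαr
    let π' : Λ ⧸ J →+* Λb := Ideal.Quotient.lift J π hπr
    let h' : κ → MvPolynomial ι (D ⧸ I) := fun i => MvPolynomial.map mD (h i)
    have hv : ∀ p, v (mk _ p) = aeval (fun i => v (mk _ (X i))) p := fun p => by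
      change (v.comp (Ideal.Quotient.mkₐ D _)) p = _
      rw [MvPolynomial.aeval_unique (v.comp (Ideal.Quotient.mkₐ D _))]
      rfl
    have hβp : ∀ p, β (mk _ p) =
        eval₂ ((algebraMap Db Cb).comp α) (fun i => β (mk _ (X i))) p := fun p => by
      induction p using MvPolynomial.induction_on with
      | C a => rw [eval₂_C]; exact hβ a
      | add p q hp hq => rw [map_add, map_add, hp, hq, eval₂_add]
      | mul_X p i hp => rw [map_mul, map_mul, hp, eval₂_mul, eval₂_X]
    let w : MvPolynomial ι (D ⧸ I) →ₐ[D ⧸ I] Λ ⧸ J :=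
      aeval fun i => mΛ (v (mk _ (X i)))
    have hw : ∀ p, w (MvPolynomial.map mD p) = mΛ (v (mk _ p)) := fun p => by
      rw [hv]
      simp only [w, aeval_def, eval₂_map, hom_eval₂]
      rfl
    have hw0 : ∀ p ∈ sysIdeal h', w p = 0 := by
      suffices sysIdeal h' ≤ ker w from this
      rw [sysIdeal, span_le]
      rintro _ ⟨i, rfl⟩
      change w _ = 0
      rw [hw, eq_zero_iff_mem.2 (subset_span (Set.mem_range_self i)), map_zero, map_zero]
    let v' : (MvPolynomial ι (D ⧸ I) ⧸ sysIdeal h') →ₐ[D ⧸ I] Λ ⧸ J :=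
      Ideal.Quotient.liftₐ _ w hw0
    let b : MvPolynomial ι (D ⧸ I) →+* Cb :=
      eval₂Hom ((algebraMap Db Cb).comp α') fun i => β (mk _ (X i))
    have hb : ∀ p, b (MvPolynomial.map mD p) = β (mk _ p) := fun p => by
      rw [hβp]
      simp only [b, coe_eval₂Hom, eval₂_map]
      rfl
    have hb0 : ∀ p ∈ sysIdeal h', b p = 0 := by
      suffices sysIdeal h' ≤ ker b from this
      rw [sysIdeal, span_le]
      rintro _ ⟨i, rfl⟩
      change b _ = 0
      rw [hb, eq_zero_iff_mem.2 (subset_span (Set.mem_range_self i)), map_zero]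
    let β' : (MvPolynomial ι (D ⧸ I) ⧸ sysIdeal h') →+* Cb := Ideal.Quotient.lift _ b hb0
    have hmD : Surjective mD := mk_surjective
    have hmΛ : Surjective mΛ := mk_surjective
    have hkD : ker mD = span {r ^ 6} := mk_ker
    have hkΛ : ker mΛ = span {algebraMap D Λ (r ^ 6)} := mk_ker
    have hlist1 : (l.map mD).map (· ^ 6) = (l.map (· ^ 6)).map mD := by
      simp [List.map_map, Function.comp_def]
    have hlist2 : ((l.map mD).map (· ^ 6)).map (algebraMap (D ⧸ I) (Λ ⧸ J)) =
        ((l.map (· ^ 6)).map (algebraMap D Λ)).map mΛ := by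
      simp only [hlist1, List.map_map]
      rfl
    have H : HasSmoothFactor v' := by
      refine ih (l.map mD) (by simpa using hl) h' ?_ v' ?_ ?_ α'
        (Ideal.Quotient.lift_surjective_of_surjective _ _ hα) ?_ π'
        (Ideal.Quotient.lift_surjective_of_surjective _ _ hπ) ?_ β' ?_ ?_
      · intro s hs
        obtain ⟨s, hs, rfl⟩ := List.mem_map.1 hs
        obtain ⟨S, hS⟩ := hstd s (List.mem_cons_of_mem _ ‹_›)
        have := hS.map (P := D ⧸ I)
        rw [map_C] at this
        exact ⟨_, this⟩
      · rw [hlist1]; exact hD.quotient mD hmD hkD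
      · rw [hlist2]; exact hΛ.quotient mΛ hmΛ hkΛ
      · ext y
        obtain ⟨y, rfl⟩ := hmD y
        rw [hlist1, Ideal.mem_ofList_of_map_mem mD hmD hkD, ← hαk]
        rfl
      · ext y
        obtain ⟨y, rfl⟩ := hmΛ y
        rw [hlist2, Ideal.mem_ofList_of_map_mem mΛ hmΛ hkΛ, ← hπk]
        rfl
      · intro d
        obtain ⟨d, rfl⟩ := hmD d
        change b (C (mD d)) = _
        simp only [b, coe_eval₂Hom, eval₂_C]
        rfl
      · intro p
        obtain ⟨p, rfl⟩ := mk_surjective p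
        obtain ⟨p, rfl⟩ := MvPolynomial.map_surjective mD hmD p
        change ψ (b _) = π' (w _)
        rw [hb, hw, hψ]
        rfl
    let q : (MvPolynomial ι D ⧸ sysIdeal h) →ₐ[D] (MvPolynomial ι (D ⧸ I) ⧸ sysIdeal h') :=
      Ideal.Quotient.liftₐ _ ((Ideal.Quotient.mkₐ D _).comp (mapAlgHom (Algebra.ofId D (D ⧸ I)))) (by
        suffices sysIdeal h ≤ ker ((Ideal.Quotient.mkₐ D (sysIdeal h')).comp
          (mapAlgHom (Algebra.ofId D (D ⧸ I)))) from this
        rw [sysIdeal, span_le]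
        rintro _ ⟨i, rfl⟩
        exact eq_zero_iff_mem.2 (subset_span ⟨i, rfl⟩))
    have hq : ∀ p, v' (q (mk _ p)) = mΛ (v (mk _ p)) := fun p => hw p
    refine hasSmoothFactor_of_approx v (Ideal.Quotient.mkₐ D (sysIdeal h))
      mk_surjective mk_ker (hstd r (by simp)) ?_ ?_
      (H.hasSmoothApprox (Rb := D ⧸ I) (Λb := Λ ⧸ J) hmD hkD hmΛ hkΛ v q fun x => ?_)
    · intro x hx
      rw [hD.eq_zero (y := x) (by linear_combination r ^ 4 * hx), mul_zero]
    · intro x hx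
      rw [hΛ.eq_zero (y := x) (by rw [map_pow]; linear_combination (algebraMap D Λ r) ^ 4 * hx),
        mul_zero]
    · obtain ⟨p, rfl⟩ := mk_surjective x
      exact hq p

end Chain

section Universal

variable {k : Type u} [CommRing k]

/-- The universal system of equations `h = 0`, `X j ^ M = ∑ l, a l * u j l`
over the polynomial ring in the `X j`. -/
noncomputable def univSys {n m s : ℕ} (h : Fin m → MvPolynomial (Fin n) k)
    (a : Fin s → MvPolynomial (Fin n) k) (d M : ℕ) :
    Fin m ⊕ Fin d → MvPolynomial (Fin n ⊕ Fin d × Fin s) (MvPolynomial (Fin d) k) :=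
  Sum.elim (fun i => rename inl (MvPolynomial.map C (h i)))
    fun j => ∑ l, rename inl (MvPolynomial.map C (a l)) * X (inr (j, l)) - C (X j ^ M)

variable {n m s : ℕ} {h : Fin m → MvPolynomial (Fin n) k}
    {a : Fin s → MvPolynomial (Fin n) k} {d M : ℕ}

theorem aeval_rename_map_C {B : Type*} [CommRing B] [Algebra k B]
    [Algebra (MvPolynomial (Fin d) k) B] [IsScalarTower k (MvPolynomial (Fin d) k) B]
    {τ : Type*} (z : Fin n ⊕ τ → B) (f : MvPolynomial (Fin n) k) :
    aeval z (rename inl (MvPolynomial.map (C : k →+* MvPolynomial (Fin d) k) f)) =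
      aeval (fun i => z (inl i)) f := by
  rw [aeval_rename]
  exact aeval_map_algebraMap (MvPolynomial (Fin d) k) (z ∘ inl) f

theorem aeval_univSys_inl {B : Type*} [CommRing B] [Algebra k B]
    [Algebra (MvPolynomial (Fin d) k) B] [IsScalarTower k (MvPolynomial (Fin d) k) B]
    (z : Fin n ⊕ Fin d × Fin s → B) (i : Fin m) :
    aeval z (univSys h a d M (inl i)) = aeval (fun i => z (inl i)) (h i) :=
  aeval_rename_map_C z _

theorem aeval_univSys_inr {B : Type*} [CommRing B] [Algebra k B]
    [Algebra (MvPolynomial (Fin d) k) B] [IsScalarTower k (MvPolynomial (Fin d) k) B]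
    (z : Fin n ⊕ Fin d × Fin s → B) (j : Fin d) :
    aeval z (univSys h a d M (inr j)) = ∑ l, aeval (fun i => z (inl i)) (a l) * z (inr (j, l)) -
        algebraMap (MvPolynomial (Fin d) k) B (X j) ^ M := by
  simp [univSys, aeval_rename_map_C, map_sub, map_sum]

theorem liftsAt_univSys {l : Fin s} (H : LiftsAt h (a l)) :
    LiftsAt (univSys h a d M) (rename inl (MvPolynomial.map C (a l))) := by
  classical
  intro B _ _ N hN x hx hu
  let _ : Algebra k B := Algebra.compHom B (C : k →+* MvPolynomial (Fin d) k)
  have : IsScalarTower k (MvPolynomial (Fin d) k) B := of_algebraMap_eq fun _ => rfl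
  rw [aeval_rename_map_C] at hu
  obtain ⟨y, hy, hy0⟩ := H B N hN (fun i => x (inl i))
    (fun i => by rw [← aeval_univSys_inl (a := a) (M := M)]; exact hx _) hu
  have hsub : ∀ f : MvPolynomial (Fin n) k, aeval y f - aeval (fun i => x (inl i)) f ∈ N :=
    fun f => aeval_sub_mem hy f
  obtain ⟨w, hw⟩ := (isUnit_of_sub_mem hN hu (hsub (a l))).exists_left_inv
  let δ : Fin d → B := fun j => w * (algebraMap (MvPolynomial (Fin d) k) B (X j) ^ M -
    ∑ l, aeval y (a l) * x (inr (j, l)))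
  have hδ : ∀ j, δ j ∈ N := fun j => by
    refine mul_mem_left _ _ ?_
    have h1 := hx (inr j)
    rw [aeval_univSys_inr] at h1
    have h2 : ∑ l, (aeval y (a l) - aeval (fun i => x (inl i)) (a l)) * x (inr (j, l)) ∈ N :=
      Ideal.sum_mem _ fun l _ => mul_mem_right _ _ (hsub (a l))
    have h3 := neg_mem (add_mem h1 h2)
    simp only [sub_mul, Finset.sum_sub_distrib] at h3
    convert h3 using 1
    ring
  let z : Fin n ⊕ Fin d × Fin s → B := Sum.elim y fun p =>
    x (inr p) + if p.2 = l then δ p.1 else 0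
  refine ⟨z, ?_, ?_⟩
  · rintro (j | ⟨j, l'⟩)
    · exact hy j
    · change x (inr (j, l')) + (if l' = l then δ j else 0) - x (inr (j, l')) ∈ N
      rw [add_sub_cancel_left]
      split_ifs
      · exact hδ j
      · exact zero_mem _
  · rintro (i | j)
    · rw [aeval_univSys_inl]; exact hy0 i
    · rw [aeval_univSys_inr]
      change ∑ l', aeval y (a l') * (x (inr (j, l')) + if l' = l then δ j else 0) - _ = 0
      simp only [mul_add, sum_add_distrib, mul_ite, mul_zero, Finset.sum_ite_eq', mem_univ, if_true]
      simp only [δ]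
      linear_combination (algebraMap (MvPolynomial (Fin d) k) B (X j) ^ M -
        ∑ l, aeval y (a l) * x (inr (j, l))) * hw

theorem exists_pow_mem_stdIdeal_univSys (H : ∀ l, LiftsAt h (a l)) (d M : ℕ) :
    ∃ e, 1 ≤ e ∧ ∀ j, C (X j ^ e) ∈ stdIdeal (univSys h a d M) := by
  classical
  let T := MvPolynomial (Fin d) k
  let I := sysIdeal (univSys h a d M)
  let π : MvPolynomial (Fin n ⊕ Fin d × Fin s) T →ₐ[T] _ ⧸ I := Ideal.Quotient.mkₐ T I
  have hπ : Surjective π := Ideal.Quotient.mkₐ_surjective T I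
  have hker : ker π = I := Ideal.Quotient.mkₐ_ker T I
  have : FinitePresentation T (MvPolynomial (Fin n ⊕ Fin d × Fin s) T ⧸ I) :=
    FinitePresentation.quotient ⟨Finset.univ.image (univSys h a d M), by simp [I, sysIdeal]; rfl⟩
  have key : ∀ j : Fin d, ∃ e, C (X j ^ e) ∈ stdIdeal (univSys h a d M) := fun j => by
    have h1 : ∑ l, π (rename inl (MvPolynomial.map C (a l))) * π (X (inr (j, l))) ∈
        smoothIdeal T (_ ⧸ I) := Ideal.sum_mem _ fun l _ => mul_mem_right _ _
      ((smoothOn_iff_liftsAt π hπ hker _).2 (liftsAt_univSys (H l)))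
    have h2 : π (univSys h a d M (inr j)) = 0 := by
      rw [← mem_ker, hker]; exact mem_sysIdeal _ _
    simp only [univSys, Sum.elim_inr, map_sub, map_sum, map_mul, sub_eq_zero] at h2
    rw [h2, map_pow, map_pow] at h1
    obtain ⟨e, he⟩ := ((smoothOn_iff_liftsAt π hπ hker _).1 (mem_smoothIdeal.1 h1).of_pow).pow_mem_stdIdeal
    exact ⟨e, by rwa [map_pow]⟩
  choose e he using key
  refine ⟨∑ j, e j + 1, by omega, fun j => ?_⟩
  obtain ⟨t, ht⟩ := Nat.exists_eq_add_of_le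
    ((Finset.single_le_sum (fun i _ => Nat.zero_le (e i)) (mem_univ j)).trans
      (Nat.le_succ (∑ j, e j)))
  rw [Nat.succ_eq_add_one] at ht
  rw [ht, pow_add, map_mul]
  exact mul_mem_right _ _ (he j)

end Universal

theorem IsRSOP.weakReg_ofFn {R : Type*} [CommRing R] [IsLocalRing R] [IsNoetherianRing R]
    {d : ℕ} {x : Fin d → R} (hx : IsRSOP x) {n : ℕ} (hn : 1 ≤ n) :
    WeakReg (List.ofFn fun j => x j ^ n) := by
  classical
  intro l₁ r l₂ hl y hy
  have hlen : l₁.length < d := by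
    have := congrArg List.length hl
    simp at this; omega
  let i : Fin d := ⟨l₁.length, hlen⟩
  have hr : r = x i ^ n := by
    have : (List.ofFn fun j => x j ^ n)[l₁.length]'(by simpa using hlen) = r := by simp [hl]
    rw [← this, List.getElem_ofFn]
  let S : Finset (Fin d) := Finset.univ.filter (· < i)
  have hS : Ideal.ofList l₁ = span ((fun j => x j ^ n) '' (S : Set (Fin d))) := by
    rw [Ideal.ofList]
    congr 1
    ext t
    constructor
    · intro ht
      obtain ⟨q, hq, rfl⟩ := List.getElem_of_mem ht
      refine ⟨⟨q, hq.trans hlen⟩, by simp [S, i, hq], ?_⟩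
      have : (List.ofFn fun j => x j ^ n)[q]'(by simp; omega) = l₁[q] := by simp [hl, hq]
      rw [← this, List.getElem_ofFn]
    · rintro ⟨j, hj, rfl⟩
      have hj' : j < i := by simpa [S] using hj
      have hj' : j.1 < l₁.length := hj'
      have : (List.ofFn fun j => x j ^ n)[j.1]'(by simp) = l₁[j.1] := by simp [hl, hj']
      rw [List.getElem_ofFn] at this
      change x j ^ n ∈ l₁
      rw [this]
      exact List.getElem_mem _
  rw [hS] at hy ⊢
  rw [hr] at hy
  exact hx.mem_span_of_pow_mul_mem (fun _ => n) S (fun _ _ => hn) (i := i) (by simp [S]) n hy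

theorem exists_hasSmoothFactor_of_rsop {k C : Type u} [Field k] [CommRing C] [Algebra k C]
    [FiniteType k C] {s : ℕ} (a : Fin s → C) (ha : ∀ l, SmoothOn k (a l)) (d M : ℕ) :
    ∃ n, 1 ≤ n ∧ ∀ {Λ D Cb : Type u} [CommRing Λ] [IsLocalRing Λ] [IsNoetherianRing Λ] [Algebra k Λ]
      [CommRing D] [IsLocalRing D] [IsNoetherianRing D] [Algebra k D] [Algebra D Λ]
      [IsScalarTower k D Λ] [EssFiniteType k D] [FormallySmooth k D]
      (φ : C →ₐ[k] Λ) (x : Fin d → D) (_ : IsRSOP x) (_ : IsRSOP fun j => algebraMap D Λ (x j))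
      [CommRing Cb] [Algebra (D ⧸ span (range fun j => x j ^ n)) Cb]
      [EssFiniteType (D ⧸ span (range fun j => x j ^ n)) Cb]
      [FormallySmooth (D ⧸ span (range fun j => x j ^ n)) Cb]
      (ψ : Cb →+* Λ ⧸ span (range fun j => algebraMap D Λ (x j) ^ n))
      (_ : Injective ψ)
      (_ : ∀ t : D, ψ (algebraMap (D ⧸ span (range fun j => x j ^ n)) Cb (mk _ t)) =
        mk _ (algebraMap D Λ t))
      (_ : ∀ c, ∃ t, ψ t = mk _ (φ c))
      (y : Fin d → Fin s → Λ)
      (_ : ∀ j, ∑ l, φ (a l) * y j l = algebraMap D Λ (x j) ^ M)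
      (_ : ∀ j l, ∃ t, ψ t = mk _ (y j l)), HasSmoothFactor φ := by
  have : FinitePresentation k C := FinitePresentation.of_finiteType.1 inferInstance
  obtain ⟨n₀, m, h, φ₀, hφ₀, hker⟩ := exists_presentation k C
  choose a' ha' using fun l => hφ₀ (a l)
  obtain ⟨e, he, hstd⟩ := exists_pow_mem_stdIdeal_univSys (h := h) (a := a')
    (fun l => (smoothOn_iff_liftsAt φ₀ hφ₀ hker _).1 (by rw [ha']; exact ha l)) d M
  refine ⟨e * 6, by omega, ?_⟩
  intro Λ D Cb _ _ _ _ _ _ _ _ _ _ _ _ φ x hxD hxΛ _ _ _ _ ψ hψ hψD hψC y hy hψy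
  let T := MvPolynomial (Fin d) k
  let _ : Algebra T D := (aeval x).toAlgebra
  have : IsScalarTower k T D := of_algebraMap_eq fun r => (aeval x).commutes r |>.symm
  let _ : Algebra T Λ := ((algebraMap D Λ).comp (algebraMap T D)).toAlgebra
  have : IsScalarTower T D Λ := of_algebraMap_eq fun _ => rfl
  have : IsScalarTower k T Λ := of_algebraMap_eq fun r => by
    rw [IsScalarTower.algebraMap_apply k D Λ, IsScalarTower.algebraMap_apply k T D]; rfl
  have hTX : ∀ j, algebraMap T D (X j) = x j := fun j => aeval_X x j
  let hD : Fin m ⊕ Fin d → MvPolynomial (Fin n₀ ⊕ Fin d × Fin s) D := fun i =>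
    MvPolynomial.map (algebraMap T D) (univSys h a' d M i)
  let z : Fin n₀ ⊕ Fin d × Fin s → Λ := Sum.elim (fun i => φ (φ₀ (X i))) fun p => y p.1 p.2
  have hz0 : ∀ f : MvPolynomial (Fin n₀) k, aeval (fun i => z (inl i)) f = φ (φ₀ f) := fun f => by
    change aeval (fun i => φ (φ₀ (X i))) f = (φ.comp φ₀) f
    congr 1
    ext i
    simp
  have hz : ∀ i, aeval z (hD i) = 0 := fun i => by
    rw [aeval_map_of_tower]
    rcases i with i | j
    · rw [aeval_univSys_inl, hz0]
      have : h i ∈ ker φ₀ := hker ▸ mem_sysIdeal h i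
      rw [(mem_ker).1 this, map_zero]
    · rw [aeval_univSys_inr, sub_eq_zero, IsScalarTower.algebraMap_apply T D Λ, hTX, ← hy]
      exact sum_congr rfl fun l _ => by rw [hz0, ha']; rfl
  let π₀ : MvPolynomial (Fin n₀ ⊕ Fin d × Fin s) D →ₐ[D] _ ⧸ sysIdeal hD :=
    Ideal.Quotient.mkₐ D (sysIdeal hD)
  have hπ₀ : Surjective π₀ := Ideal.Quotient.mkₐ_surjective D _
  have hπ₀k : ker π₀ = sysIdeal hD := Ideal.Quotient.mkₐ_ker D _
  obtain ⟨v, hv⟩ := exists_algHom_of_sys π₀ hπ₀ hπ₀k hz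
  let Jd := span (range fun j => x j ^ (e * 6))
  let Jl := span (range fun j => algebraMap D Λ (x j) ^ (e * 6))
  have hzb : ∀ i, ∃ t, ψ t = mk Jl (z i) := by
    rintro (i | ⟨j, l⟩)
    · exact hψC _
    · exact hψy j l
  choose zb hzb using hzb
  let C₀ := Algebra.adjoin (D ⧸ Jd) (range zb)
  have : FiniteType (D ⧸ Jd) C₀ :=
    C₀.fg_iff_finiteType.1 (Subalgebra.fg_def.2 ⟨_, Set.finite_range zb, rfl⟩)
  obtain ⟨Cb', _, _, hCb', f₀, g₀, hfg₀⟩ := hasSmoothFactor_of_essFiniteType C₀.val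
  let zc : Fin n₀ ⊕ Fin d × Fin s → C₀ := fun i => ⟨zb i, Algebra.subset_adjoin (Set.mem_range_self i)⟩
  let _ : Algebra D C₀ := ((algebraMap (D ⧸ Jd) C₀).comp (mk Jd)).toAlgebra
  let ψ' : C₀ →ₐ[D] Λ ⧸ Jl := { ψ.comp C₀.val.toRingHom with commutes' := fun r => hψD r }
  have hψ' : ∀ f : MvPolynomial (Fin n₀ ⊕ Fin d × Fin s) D,
      ψ (aeval zc f).1 = mk Jl (aeval z f) := fun f => by
    have : ψ'.comp (aeval zc) = (Ideal.Quotient.mkₐ D Jl).comp (aeval z) := by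
      ext i
      simp only [AlgHom.comp_apply, aeval_X]
      exact hzb i
    exact DFunLike.congr_fun this f
  obtain ⟨β, hβ⟩ := exists_algHom_of_sys π₀ hπ₀ hπ₀k (x := zc) fun i => Subtype.ext (hψ (by
    rw [hψ', hz, map_zero]; exact (map_zero ψ).symm))
  let lst : List D := List.ofFn fun j => x j ^ e
  have hl1 : lst.map (· ^ 6) = List.ofFn fun j => x j ^ (e * 6) := by
    simp [lst, List.map_ofFn, Function.comp_def, pow_mul]
  have hl2 : (lst.map (· ^ 6)).map (algebraMap D Λ) =
      List.ofFn fun j => algebraMap D Λ (x j) ^ (e * 6) := by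
    rw [hl1]; simp [List.map_ofFn, Function.comp_def]
  have hofFn : ∀ {R : Type u} [CommRing R] (w : Fin d → R),
      Ideal.ofList (List.ofFn w) = span (range w) := fun w => by
    rw [Ideal.ofList]; congr 1; ext t; simp [List.mem_ofFn]
  have hfac : HasSmoothFactor v := by
    refine hasSmoothFactor_of_weakReg (ψ.comp g₀.toRingHom) d lst (by simp [lst]) hD ?_ v ?_ ?_
      (mk Jd) mk_surjective ?_ (mk Jl)
      mk_surjective ?_ (f₀.toRingHom.comp β.toRingHom) (fun t => ?_) ?_
    · intro r hr
      obtain ⟨j, rfl⟩ := (List.mem_ofFn' _ _).1 hr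
      obtain ⟨S, hS⟩ := hstd j
      have := hS.map (P := D)
      rw [map_C, map_pow, hTX] at this
      exact ⟨_, this⟩
    · rw [hl1]; exact hxD.weakReg_ofFn (by omega)
    · rw [hl2]; exact hxΛ.weakReg_ofFn (by omega)
    · rw [mk_ker, hl1, hofFn]
    · rw [mk_ker, hl2, hofFn]
    · exact (congrArg f₀ (β.commutes t)).trans (f₀.commutes _)
    · intro b
      obtain ⟨b, rfl⟩ := hπ₀ b
      have h1 := DFunLike.congr_fun hfg₀ (β (π₀ b))
      change g₀ (f₀ _) = (β (π₀ b)).1 at h1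
      change ψ (g₀ (f₀ (β (π₀ b)))) = _
      rw [h1, hβ, hψ', hv]
  obtain ⟨P, _, _, hP, f, g, hfg⟩ := hfac
  let _ : Algebra k P := ((algebraMap D P).comp (algebraMap k D)).toAlgebra
  have : IsScalarTower k D P := of_algebraMap_eq fun _ => rfl
  have : EssFiniteType k P := EssFiniteType.comp k D P
  have : FormallySmooth k P := FormallySmooth.comp k D P
  have hw : ∀ i, aeval (fun i => f (π₀ (X (inl i)))) (h i) = 0 := fun i => by
    have h1 : f (π₀ (hD (inl i))) = 0 := by
      have : hD (inl i) ∈ ker π₀ := by rw [hπ₀k]; exact mem_sysIdeal hD _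
      rw [(mem_ker).1 this, map_zero]
    let _ : Algebra T P := ((algebraMap D P).comp (algebraMap T D)).toAlgebra
    have : IsScalarTower T D P := of_algebraMap_eq fun _ => rfl
    have : IsScalarTower k T P := of_algebraMap_eq fun r => by
      rw [IsScalarTower.algebraMap_apply k D P, IsScalarTower.algebraMap_apply k T D]; rfl
    have h2 : ∀ q, f (π₀ q) = aeval (fun i => f (π₀ (X i))) q := fun q => by
      have : f.comp π₀ = aeval (fun i => f (π₀ (X i))) := by ext i; simp
      exact DFunLike.congr_fun this q
    rw [h2, aeval_map_of_tower, aeval_univSys_inl] at h1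
    exact h1
  obtain ⟨w, hw'⟩ := exists_algHom_of_sys φ₀ hφ₀ hker hw
  obtain ⟨E, _, _, hE, f', g', hfg'⟩ := hasSmoothFactor_of_essFiniteType w
  refine ⟨E, _, _, hE, f', (g.restrictScalars k).comp g', ?_⟩
  rw [AlgHom.comp_assoc, hfg']
  apply AlgHom.cancel_right hφ₀ |>.1
  ext i
  change g (w (φ₀ (X i))) = φ (φ₀ (X i))
  rw [hw', aeval_X]
  have := DFunLike.congr_fun hfg (π₀ (X (inl i)))
  change g (f _) = _ at this
  rw [this, hv, aeval_X]
  rfl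

open Algebra in
/-- A field extension is formally smooth as soon as its finitely generated subextensions are. -/
theorem Algebra.FormallySmooth.of_forall_essFiniteType (F : Type v) (K : Type u) [Field F] [Field K] [Algebra F K]
    (H : ∀ L : IntermediateField F K, EssFiniteType F L → FormallySmooth F L) :
    FormallySmooth F K := by
  classical
  refine ⟨inferInstance, ?_⟩
  let G := Generators.self F K
  refine ⟨fun a b => ?_⟩
  suffices h : ∀ x : G.toExtension.H1Cotangent, x = 0 from (h a).trans (h b).symm
  intro x
  obtain ⟨⟨p, hp⟩, hpx⟩ := Extension.Cotangent.mk_surjective x.1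
  have hx : G.toExtension.cotangentComplex x.1 = 0 := x.2
  let L := IntermediateField.adjoin F (p.vars : Set K)
  have : EssFiniteType F L :=
    IntermediateField.essFiniteType_iff.2 (IntermediateField.fg_adjoin_finset _)
  have := H L inferInstance
  have hsub := this.subsingleton_h1Cotangent
  let G₀ := Generators.self F L
  obtain ⟨q, hq⟩ : ∃ q : MvPolynomial L F, rename (algebraMap L K) q = p :=
    exists_rename_eq_of_vars_subset_range p (algebraMap L K) (algebraMap L K).injective
      fun i hi => ⟨⟨i, IntermediateField.subset_adjoin _ _ hi⟩, rfl⟩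
  have hev : ∀ f : MvPolynomial L F, aeval (fun i : K => i) (rename (algebraMap L K) f) =
      algebraMap L K (aeval (fun i : L => i) f) := fun f => by
    rw [aeval_rename]
    exact (aeval_algebraMap_apply K (fun i : L => i) f)
  have hqk : q ∈ G₀.toExtension.ker := by
    have h1 : aeval G.val p = 0 :=
      (mem_ker).1 (G.ker_eq_ker_aeval_val.le (show p ∈ G.ker from hp))
    rw [← hq] at h1
    have h2 := (hev q).symm.trans h1
    refine G₀.ker_eq_ker_aeval_val.ge ((mem_ker).2 ?_)
    exact (algebraMap L K).injective (h2.trans (map_zero _).symm)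
  have hqx : G₀.toExtension.cotangentComplex (Extension.Cotangent.mk ⟨q, hqk⟩) = 0 := by
    apply G₀.cotangentSpaceBasis.repr.injective
    refine Finsupp.ext fun i => ?_
    rw [Extension.cotangentComplex_mk, map_zero, Finsupp.zero_apply]
    refine (G₀.cotangentSpaceBasis_repr_one_tmul q i).trans ((algebraMap L K).injective ?_)
    have h1 := DFunLike.congr_fun (congrArg G.cotangentSpaceBasis.repr hx) (algebraMap L K i)
    rw [← hpx, Extension.cotangentComplex_mk, map_zero, Finsupp.zero_apply] at h1
    have h2 := (G.cotangentSpaceBasis_repr_one_tmul p (algebraMap L K i)).symm.trans h1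
    rw [← hq, pderiv_rename (algebraMap L K).injective] at h2
    exact ((hev _).symm.trans h2).trans (map_zero _).symm
  have h0 : Extension.Cotangent.mk (P := G₀.toExtension) ⟨q, hqk⟩ = 0 := by
    have := hsub.elim ⟨_, hqx⟩ 0
    exact congrArg Subtype.val this
  rw [Extension.Cotangent.mk_eq_zero_iff] at h0
  apply Subtype.ext
  rw [← hpx]
  refine (Extension.Cotangent.mk_eq_zero_iff _).2 ?_
  have hle : G₀.ker.map (rename (R := F) (algebraMap L K)).toRingHom ≤ G.ker := by
    rw [Ideal.map_le_iff_le_comap]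
    intro f hf
    rw [G₀.ker_eq_ker_aeval_val, mem_ker] at hf
    rw [G.ker_eq_ker_aeval_val, mem_comap, mem_ker]
    refine (hev f).trans ((congrArg _ hf).trans (map_zero _))
  have h1 := Ideal.pow_right_mono hle 2 (by
    rw [← Ideal.map_pow]; exact mem_map_of_mem _ h0)
  change p ∈ G.ker ^ 2
  rw [← hq]
  exact h1

theorem Algebra.FormallySmooth.of_perfectField' (F : Type v) (K : Type u) [Field F] [Field K] [Algebra F K]
    [PerfectField F] : FormallySmooth F K :=
  .of_forall_essFiniteType F K fun _ _ => inferInstance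

open IsLocalRing in
/-- If the residue field is formally smooth over `F`, then it lifts to the infinitesimal
neighbourhoods of the closed point. -/
theorem IsLocalRing.exists_section_residueField (F : Type v) (B : Type u) [CommRing F] [CommRing B] [IsLocalRing B]
    [Algebra F B] [FormallySmooth F (ResidueField B)] (N : ℕ) :
    ∃ s : ResidueField B →ₐ[F] B ⧸ maximalIdeal B ^ N,
      ∀ b, ∃ c ∈ maximalIdeal B, s (residue B b) = mk _ (b + c) := by
  rcases Nat.eq_zero_or_pos N with rfl | hN
  · have : Subsingleton (B ⧸ maximalIdeal B ^ 0) := by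
      rw [pow_zero, Ideal.one_eq_top]; exact Ideal.Quotient.subsingleton_iff.2 rfl
    obtain ⟨s⟩ : Nonempty (ResidueField B →ₐ[F] B ⧸ maximalIdeal B ^ 0) := ⟨
      { toFun := fun _ => 0
        map_one' := Subsingleton.elim _ _
        map_mul' := fun _ _ => Subsingleton.elim _ _
        map_zero' := rfl
        map_add' := fun _ _ => Subsingleton.elim _ _
        commutes' := fun _ => Subsingleton.elim _ _ }⟩
    exact ⟨s, fun b => ⟨0, zero_mem _, Subsingleton.elim _ _⟩⟩
  let g : (B ⧸ maximalIdeal B ^ N) →ₐ[F] ResidueField B :=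
    Ideal.Quotient.liftₐ _ (toAlgHom F B (ResidueField B)) fun a ha => by
      change residue B a = 0
      rw [residue_eq_zero_iff]
      exact Ideal.pow_le_self (by omega) ha
  have hgm : ∀ b, g (mk _ b) = residue B b := fun b => rfl
  have hg : Surjective g := fun a => by
    obtain ⟨b, rfl⟩ := residue_surjective a
    exact ⟨_, hgm b⟩
  have hker : IsNilpotent (ker g.toRingHom) := by
    refine ⟨N, ?_⟩
    have : ker g.toRingHom ≤ (maximalIdeal B).map (mk _) := by
      intro a ha
      obtain ⟨b, rfl⟩ := mk_surjective a
      rw [mem_ker] at ha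
      exact mem_map_of_mem _ ((residue_eq_zero_iff b).1 ha)
    rw [Submodule.zero_eq_bot, eq_bot_iff]
    refine (Ideal.pow_right_mono this N).trans ?_
    rw [← Ideal.map_pow, Ideal.map_quotient_self]
  refine ⟨FormallySmooth.liftOfSurjective (AlgHom.id F _) g hg hker, fun b => ?_⟩
  obtain ⟨t, ht⟩ := mk_surjective
    (FormallySmooth.liftOfSurjective (AlgHom.id F _) g hg hker (residue B b))
  have h1 := FormallySmooth.liftOfSurjective_apply (AlgHom.id F _) g hg hker (residue B b)
  rw [← ht, hgm] at h1
  refine ⟨t - b, ?_, ?_⟩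
  · rw [← residue_eq_zero_iff, map_sub, h1, AlgHom.id_apply, sub_self]
  · rw [← ht, add_sub_cancel]

open IsLocalRing in
theorem IsLocalRing.exists_derivation_of_notMem_sq (F : Type v) {B : Type u} [CommRing F] [CommRing B]
    [IsLocalRing B] [Algebra F B] [FormallySmooth F (ResidueField B)] {x : B}
    (hx : x ∈ maximalIdeal B) (hx2 : x ∉ maximalIdeal B ^ 2) :
    ∃ D : Derivation F B (ResidueField B), D x ≠ 0 := by
  obtain ⟨s, hs⟩ := exists_section_residueField F B 2
  have hv : (maximalIdeal B).toCotangent ⟨x, hx⟩ ≠ 0 := by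
    rwa [Ne, Ideal.toCotangent_eq_zero]
  obtain ⟨f, hf⟩ : ∃ f : Module.Dual (ResidueField B) (CotangentSpace B),
      f ((maximalIdeal B).toCotangent ⟨x, hx⟩) ≠ 0 := by
    by_contra! h
    exact hv ((Module.forall_dual_apply_eq_zero_iff (ResidueField B) (V := CotangentSpace B) _).1 h)
  have hfs : ∀ (a : B) (v : CotangentSpace B), f (a • v) = a • f v := fun a v => by
    rw [← algebraMap_smul (ResidueField B) a v, map_smul, algebraMap_smul]
  choose c hc hsc using hs
  have key : ∀ (b t : B) (ht : t ∈ maximalIdeal B), s (residue B b) = mk _ (b - t) →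
     (maximalIdeal B).toCotangent ⟨t, ht⟩ = (maximalIdeal B).toCotangent ⟨-c b, neg_mem (hc b)⟩ := by
    intro b t ht h
    rw [Ideal.toCotangent_eq]
    rw [hsc, Ideal.Quotient.eq] at h
    convert h using 1
    simp
    ring
  let H : B →ₗ[F] ResidueField B :=
    { toFun := fun b => f ((maximalIdeal B).toCotangent ⟨-c b, neg_mem (hc b)⟩)
      map_add' := fun a b => by
        rw [← map_add, ← map_add, ← key (a + b) (-c a + -c b) (add_mem (neg_mem (hc a)) (neg_mem (hc b)))]
        · rfl
        · rw [map_add, map_add, hsc, hsc, ← map_add]; congr 1; ring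
      map_smul' := fun r b => by
        rw [← key (r • b) (algebraMap F B r * -c b) (mul_mem_left _ _ (neg_mem (hc b)))]
        · rw [RingHom.id_apply, ← algebraMap_smul B r (f _), ← hfs, ← map_smul]
          rfl
        · rw [Algebra.smul_def, map_mul, map_mul, hsc b, mul_neg, sub_neg_eq_add, ← mul_add, map_mul]
          congr 1
          exact s.commutes r }
  have hH : ∀ b t (ht : t ∈ maximalIdeal B), s (residue B b) = mk _ (b - t) →
      H b = f ((maximalIdeal B).toCotangent ⟨t, ht⟩) := fun b t ht h => by
    rw [key b t ht h]; rfl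
  refine ⟨Derivation.mk' H fun a b => ?_, ?_⟩
  · rw [hH (a * b) (a * -c b + b * -c a) (add_mem (mul_mem_left _ _ (neg_mem (hc b)))
      (mul_mem_left _ _ (neg_mem (hc a))))]
    · change _ = a • f _ + b • f _
      rw [← hfs, ← hfs, ← map_add, ← map_smul, ← map_smul, ← map_add]
      rfl
    · rw [map_mul, map_mul, hsc, hsc, ← map_mul, Ideal.Quotient.eq]
      convert Ideal.mul_mem_mul (hc a) (hc b) using 1
      · rw [pow_two]
      · ring
  · change H x ≠ 0
    rw [hH x x hx]
    · exact hf
    · rw [sub_self, map_zero, (residue_eq_zero_iff x).2 hx, map_zero]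

open TensorProduct in
/-- Geometric regularity over a field: all local rings of all finite scalar extensions have
regular systems of parameters. -/
def GeomRegular (k Λ : Type u) [Field k] [CommRing Λ] [Algebra k Λ] : Prop :=
  ∀ (k' : Type u) [Field k'] [Algebra k k'] [Module.Finite k k'] (Q : Ideal (k' ⊗[k] Λ)) [Q.IsPrime],
    ∃ (d : ℕ) (x : Fin d → AtPrime Q), IsRSOP x

open IsLocalRing in
theorem IsRSOP.notMem_sq_of_surjective {R R' : Type*} [CommRing R] [IsLocalRing R] [IsNoetherianRing R]
    [CommRing R'] [IsLocalRing R'] {ι : Type*} {y : ι → R'} (hy : IsRSOP y) (f : R →+* R')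
    (hf : Surjective f) {g : R} (hg : g ∈ nonZeroDivisors R)
    (hker : ker f = span {g}) : g ∉ maximalIdeal R ^ 2 := by
  intro hg2
  have := hy.1
  choose z hz using fun i => hf (y i)
  have hloc : IsLocalHom f := hf.isLocalHom
  have hle : span (range z) ≤ maximalIdeal R := by
    rw [span_le]
    rintro _ ⟨i, rfl⟩
    have h1 : y i ∈ maximalIdeal R' := hy.2.1 ▸ subset_span (Set.mem_range_self i)
    rw [← hz i] at h1
    exact (mem_maximalIdeal _).2 fun h => (mem_maximalIdeal _).1 h1 (h.map f)
  have hm : maximalIdeal R ≤ span (range z) ⊔ maximalIdeal R • maximalIdeal R := by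
    intro a ha
    have h1 : f a ∈ maximalIdeal R' := (mem_maximalIdeal _).2 fun h =>
      (mem_maximalIdeal _).1 ha (isUnit_of_map_unit f a h)
    rw [← hy.2.1, show y = f ∘ z from funext fun i => (hz i).symm, Set.range_comp, ← map_span] at h1
    obtain ⟨b, hb, hba⟩ := (Ideal.mem_map_iff_of_surjective f hf).1 h1
    have h2 : a - b ∈ ker f := by rw [mem_ker, map_sub, hba, sub_self]
    rw [hker, Ideal.mem_span_singleton] at h2
    obtain ⟨t, ht⟩ := h2
    rw [show a = b + g * t by rw [← ht]; ring]
    refine Submodule.add_mem_sup hb (mul_mem_right _ _ ?_)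
    rwa [smul_eq_mul, ← pow_two]
  have hm' : span (range z) = maximalIdeal R := le_antisymm hle
    (Submodule.le_of_le_smul_of_le_jacobson_bot (IsNoetherian.noetherian _)
      (maximalIdeal_le_jacobson _) hm)
  have h1 := ringKrullDim_le_card_of_span_eq z hm'
  rw [← hy.2.2] at h1
  have h2 := ringKrullDim_quotient_succ_le_of_nonZeroDivisor hg
  rw [← hker, ringKrullDim_eq_of_ringEquiv (RingHom.quotientKerEquivOfSurjective hf)] at h2
  have h3 := h2.trans h1
  rw [hy.2.2] at h3
  have : Nat.card ι + 1 ≤ Nat.card ι := by exact_mod_cast h3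
  omega

theorem Localization.ker_localRingHom_of_surjective {R S : Type*} [CommRing R] [CommRing S] (f : R →+* S)
    (hf : Surjective f) {g : R} (hker : ker f = span {g}) (Q : Ideal S) [Q.IsPrime] :
    ker (Localization.localRingHom (Q.comap f) Q f rfl) =
      span {algebraMap R (AtPrime (Q.comap f)) g} := by
  apply le_antisymm
  · intro a ha
    obtain ⟨⟨b, t⟩, rfl⟩ := IsLocalization.mk'_surjective (Q.comap f).primeCompl a
    rw [mem_ker, Localization.localRingHom_mk', IsLocalization.mk'_eq_zero_iff] at ha
    obtain ⟨⟨w, hw⟩, hwb⟩ := ha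
    obtain ⟨w, rfl⟩ := hf w
    have h1 : w * b ∈ ker f := by rw [mem_ker, map_mul]; exact hwb
    rw [hker, Ideal.mem_span_singleton] at h1
    have h2 := map_dvd (algebraMap R (AtPrime (Q.comap f))) h1
    have hu : IsUnit (algebraMap R (AtPrime (Q.comap f)) w) :=
      IsLocalization.map_units (M := (Q.comap f).primeCompl) _ ⟨w, hw⟩
    rw [map_mul, hu.dvd_mul_left] at h2
    rw [Ideal.mem_span_singleton]
    refine h2.trans ⟨IsLocalization.mk' _ 1 t, ?_⟩
    rw [← IsLocalization.mk'_one (M := (Q.comap f).primeCompl), ← IsLocalization.mk'_mul]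
    simp
  · rw [Ideal.span_singleton_le_iff_mem, mem_ker, Localization.localRingHom_to_map]
    have : g ∈ ker f := hker ▸ mem_span_singleton_self g
    rw [(mem_ker).1 this, map_zero]

open TensorProduct IsLocalRing in
theorem exists_isPrime_tensorProduct_of_isLocalRing {k Λ k' : Type u} [Field k] [CommRing Λ] [IsLocalRing Λ]
    [Algebra k Λ] [Field k'] [Algebra k k'] : ∃ Q : Ideal (k' ⊗[k] Λ), Q.IsPrime ∧
      ∀ a ∈ maximalIdeal Λ, (1 : k') ⊗ₜ[k] a ∈ Q := by
  obtain ⟨Q, hQ⟩ := Ideal.exists_maximal (k' ⊗[k] ResidueField Λ)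
  refine ⟨Q.comap (Algebra.TensorProduct.map (AlgHom.id k k')
    (toAlgHom k Λ (ResidueField Λ))), inferInstance, fun a ha => ?_⟩
  rw [mem_comap, Algebra.TensorProduct.map_tmul]
  have : toAlgHom k Λ (ResidueField Λ) a = 0 := (residue_eq_zero_iff a).2 ha
  rw [this, tmul_zero]
  exact zero_mem _

open TensorProduct in
theorem TensorProduct.tmul_one_mem_nonZeroDivisors {k E Λ : Type u} [Field k] [CommRing E] [IsDomain E]
    [Algebra k E] [CommRing Λ] [Algebra k Λ] {g : E} (hg : g ≠ 0) :
    g ⊗ₜ[k] (1 : Λ) ∈ nonZeroDivisors (E ⊗[k] Λ) := by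
  have h1 : Injective (LinearMap.rTensor Λ (LinearMap.mulLeft k g)) :=
    Module.Flat.rTensor_preserves_injective_linearMap _ fun a b h => mul_left_cancel₀ hg h
  have h2 : ∀ a : E ⊗[k] Λ, LinearMap.rTensor Λ (LinearMap.mulLeft k g) a = g ⊗ₜ[k] (1 : Λ) * a := by
    intro a
    induction a using TensorProduct.induction_on with
    | zero => simp
    | tmul x y => simp
    | add x y hx hy => rw [map_add, hx, hy, mul_add]
  rw [mem_nonZeroDivisors_iff_right]
  intro x hx
  apply h1
  rw [h2, mul_comm, hx, map_zero]

open TensorProduct IsLocalRing in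
theorem GeomRegular.exists_localRing {k Λ : Type u} [Field k] [CommRing Λ] [IsLocalRing Λ]
    [IsNoetherianRing Λ] [Algebra k Λ] (H : GeomRegular k Λ)
    {E k₁ : Type u} [CommRing E] [IsDomain E] [Algebra k E] [FiniteType k E] [Field k₁]
    [Algebra k k₁] [Module.Finite k k₁] (π : E →ₐ[k] k₁) (hπ : Surjective π) {g : E}
    (hg : g ≠ 0) (hker : ker π = span {g}) :
    ∃ (Q : Ideal (E ⊗[k] Λ)) (_ : Q.IsPrime), algebraMap (E ⊗[k] Λ) (AtPrime Q) (g ⊗ₜ 1) ∈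
      maximalIdeal (AtPrime Q) ∧
      algebraMap (E ⊗[k] Λ) (AtPrime Q) (g ⊗ₜ 1) ∉ maximalIdeal (AtPrime Q) ^ 2 ∧
      ∀ a ∈ maximalIdeal Λ, 1 ⊗ₜ a ∈ Q := by
  obtain ⟨Q, hQ, hQm⟩ := exists_isPrime_tensorProduct_of_isLocalRing (k := k) (Λ := Λ) (k' := k₁)
  obtain ⟨d, y, hy⟩ := H k₁ Q
  have : IsNoetherianRing (Λ ⊗[k] E) := FiniteType.isNoetherianRing Λ _
  have : IsNoetherianRing (E ⊗[k] Λ) :=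
    isNoetherianRing_of_ringEquiv (Λ ⊗[k] E) (Algebra.TensorProduct.comm k Λ E).toRingEquiv
  let θ : (E ⊗[k] Λ) →ₐ[k] k₁ ⊗[k] Λ := Algebra.TensorProduct.map π (AlgHom.id k Λ)
  have hθ : Surjective θ := TensorProduct.map_surjective hπ Function.surjective_id
  have hker' : ker θ.toRingHom = span {g ⊗ₜ[k] (1 : Λ)} := by
    refine (Algebra.TensorProduct.rTensor_ker π hπ).trans ?_
    rw [hker, map_span, Set.image_singleton]
    rfl
  have hreg' : algebraMap (E ⊗[k] Λ) (AtPrime (Q.comap θ.toRingHom)) (g ⊗ₜ 1) ∈ nonZeroDivisors _ :=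
    IsLocalization.map_nonZeroDivisors_le (Q.comap θ.toRingHom).primeCompl _
      (Submonoid.mem_map_of_mem _ (TensorProduct.tmul_one_mem_nonZeroDivisors hg))
  have hsurj : Surjective (Localization.localRingHom (Q.comap θ.toRingHom) Q θ.toRingHom rfl) :=
    (RingHom.surjectiveOnStalks_of_surjective hθ).localRingHom_surjective _ _ rfl
  refine ⟨Q.comap θ.toRingHom, inferInstance, ?_, hy.notMem_sq_of_surjective _ hsurj hreg'
    (Localization.ker_localRingHom_of_surjective θ.toRingHom hθ hker' Q), fun a ha => ?_⟩
  · rw [IsLocalization.AtPrime.to_map_mem_maximal_iff _ (Q.comap θ.toRingHom)]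
    have h1 : g ⊗ₜ[k] (1 : Λ) ∈ ker θ.toRingHom := hker' ▸ mem_span_singleton_self _
    rw [mem_comap, (mem_ker).1 h1]
    exact zero_mem _
  · rw [mem_comap]
    change θ _ ∈ Q
    rw [Algebra.TensorProduct.map_tmul, map_one]
    exact hQm a ha

open TensorProduct IsLocalRing in
theorem GeomRegular.exists_additive_map {k Λ : Type u} [Field k] [CommRing Λ] [IsLocalRing Λ]
    [IsNoetherianRing Λ] [Algebra k Λ] (H : GeomRegular k Λ) {p : ℕ} [hp : Fact p.Prime] [CharP k p]
    {k' : Type u} [Field k'] [Algebra k k'] [Module.Finite k k'] {c : k'} (hc : ∀ b, b ^ p ≠ c) :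
    ∃ (κ : Type u) (_ : Field κ) (i : k' ⊗[k] Λ →+* κ) (D : k' ⊗[k] Λ →+ κ),
      (∀ a b, D (a * b) = i a * D b + i b * D a) ∧ D (c ⊗ₜ 1) ≠ 0 ∧
      ∀ a ∈ maximalIdeal Λ, i (1 ⊗ₜ a) = 0 := by
  have hirr : Irreducible (Polynomial.X ^ p - Polynomial.C c) :=
    (X_pow_sub_C_irreducible_iff_of_prime hp.out).2 hc
  have : Fact (Irreducible (Polynomial.X ^ p - Polynomial.C c)) := ⟨hirr⟩
  have hfin : Module.Finite k' (AdjoinRoot (Polynomial.X ^ p - Polynomial.C c)) :=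
    (AdjoinRoot.powerBasis hirr.ne_zero).finite
  have : Module.Finite k (AdjoinRoot (Polynomial.X ^ p - Polynomial.C c)) := Module.Finite.trans k' _
  have : FiniteType k (Polynomial k') := .trans (S := k') inferInstance inferInstance
  obtain ⟨Q, hQ, h2, h1, hQm⟩ := H.exists_localRing
    ((AdjoinRoot.mkₐ (Polynomial.X ^ p - Polynomial.C c)).restrictScalars k)
    AdjoinRoot.mk_surjective hirr.ne_zero (by
      ext a
      rw [mem_ker, Ideal.mem_span_singleton]
      exact AdjoinRoot.mk_eq_zero)
  have : CharP (AtPrime Q) p :=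
    charP_of_injective_algebraMap (algebraMap k (AtPrime Q)).injective p
  let _ : Algebra (ZMod p) (AtPrime Q) := ZMod.algebra _ p
  have := FormallySmooth.of_perfectField' (ZMod p) (ResidueField (AtPrime Q))
  obtain ⟨D, hD⟩ := exists_derivation_of_notMem_sq (ZMod p) h2 h1
  let ι : k' ⊗[k] Λ →ₐ[k] Polynomial k' ⊗[k] Λ :=
    Algebra.TensorProduct.map (toAlgHom k k' (Polynomial k')) (AlgHom.id k Λ)
  let j : k' ⊗[k] Λ →+* AtPrime Q := (algebraMap _ _).comp ι.toRingHom
  refine ⟨ResidueField (AtPrime Q), inferInstance, (residue _).comp j,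
    D.toLinearMap.toAddMonoidHom.comp j.toAddMonoidHom, fun a b => ?_, fun h => hD ?_, fun a ha => ?_⟩
  · change D (j (a * b)) = _
    rw [map_mul, D.leibniz]
    rfl
  · change D (j (c ⊗ₜ 1)) = 0 at h
    have h3 : (Polynomial.X ^ p - Polynomial.C c) ⊗ₜ[k] (1 : Λ) =
        ((Polynomial.X : Polynomial k') ⊗ₜ[k] (1 : Λ)) ^ p - ι (c ⊗ₜ 1) := by
      rw [Algebra.TensorProduct.tmul_pow, one_pow, sub_tmul]
      rfl
    rw [h3, map_sub, map_pow, map_sub, D.leibniz_pow, ← Nat.cast_smul_eq_nsmul (ResidueField (AtPrime Q)) p]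
    have h4 : ((p : ℕ) : ResidueField (AtPrime Q)) = 0 := by
      rw [← map_natCast (algebraMap k _), CharP.cast_eq_zero, map_zero]
    rw [h4, zero_smul, zero_sub, neg_eq_zero]
    exact h
  · rw [RingHom.comp_apply, residue_eq_zero_iff]
    change algebraMap _ (AtPrime Q) (ι (1 ⊗ₜ a)) ∈ _
    rw [IsLocalization.AtPrime.to_map_mem_maximal_iff _ Q]
    rw [Algebra.TensorProduct.map_tmul, map_one]
    exact hQm a ha

theorem notMem_pow_of_derivation {p : ℕ} [hp : Fact p.Prime] {k Ω : Type u} [Field k] [CharP k p]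
    [Field Ω] [Algebra k Ω] (δ : Derivation ℤ k k) {S : Set Ω}
    (hS : ∀ r ∈ S, ∃ a, δ a = 0 ∧ algebraMap k Ω a = r ^ p) {c : k} (hc : δ c ≠ 0)
    (b : adjoin k S) : b ^ p ≠ algebraMap k _ c := by
  intro h
  have : CharP Ω p := charP_of_injective_algebraMap (algebraMap k Ω).injective p
  suffices H : ∃ a, δ a = 0 ∧ algebraMap k Ω a = b.1 ^ p by
    obtain ⟨a, ha, hab⟩ := H
    have h1 : algebraMap k Ω a = algebraMap k Ω c := hab.trans (congrArg Subtype.val h)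
    rw [(algebraMap k Ω).injective h1] at ha
    exact hc ha
  clear h
  obtain ⟨b, hb⟩ := b
  induction hb using IntermediateField.adjoin_induction with
  | mem x hx => exact hS x hx
  | algebraMap x =>
    refine ⟨x ^ p, ?_, by rw [map_pow]⟩
    rw [δ.leibniz_pow, ← Nat.cast_smul_eq_nsmul k p, CharP.cast_eq_zero, zero_smul]
  | add x y _ _ hx hy =>
    obtain ⟨a, ha, hax⟩ := hx
    obtain ⟨a', ha', hay⟩ := hy
    exact ⟨a + a', by rw [map_add, ha, ha', add_zero], by
      rw [map_add, hax, hay, ← add_pow_char]⟩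
  | inv x _ hx =>
    obtain ⟨a, ha, hax⟩ := hx
    exact ⟨a⁻¹, by rw [Derivation.leibniz_inv, ha, smul_zero], by rw [map_inv₀, hax, inv_pow]⟩
  | mul x y _ _ hx hy =>
    obtain ⟨a, ha, hax⟩ := hx
    obtain ⟨a', ha', hay⟩ := hy
    exact ⟨a * a', by rw [δ.leibniz, ha, ha', smul_zero, smul_zero, add_zero], by
      rw [map_mul, hax, hay, mul_pow]⟩

open TensorProduct IsLocalRing in
theorem GeomRegular.exists_derivation_residueField {k Λ : Type u} [Field k] [CommRing Λ] [IsLocalRing Λ]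
    [IsNoetherianRing Λ] [Algebra k Λ] (H : GeomRegular k Λ) {p : ℕ} [hp : Fact p.Prime] [CharP k p]
    [Algebra (ZMod p) Λ] (δ : Derivation ℤ k k) (s : Finset k) (hs : ∀ a ∈ s, δ a = 0)
    {c : k} (hc : δ c ≠ 0) :
    ∃ D : Derivation (ZMod p) Λ (ResidueField Λ), (∀ a ∈ s, D (algebraMap k Λ a) = 0) ∧
      D (algebraMap k Λ c) ≠ 0 := by
  classical
  choose r hr using fun a : k => IsAlgClosed.exists_pow_nat_eq (algebraMap k (AlgebraicClosure k) a) hp.out.pos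
  have hfs : Finite (r '' (s : Set k)) := (s.finite_toSet.image r).to_subtype
  have hfin : FiniteDimensional k (adjoin k (r '' (s : Set k))) :=
    IntermediateField.finiteDimensional_adjoin fun x _ => Algebra.IsIntegral.isIntegral x
  obtain ⟨κ, _, i, D, hD, hDc, him⟩ := H.exists_additive_map (notMem_pow_of_derivation (p := p) δ
    (S := r '' (s : Set k)) (by
      rintro _ ⟨a, ha, rfl⟩
      exact ⟨a, hs a ha, (hr a).symm⟩) hc)
  let j : Λ →+* κ := i.comp Algebra.TensorProduct.includeRight.toRingHom
  have hj : ∀ a ∈ maximalIdeal Λ, j a = 0 := him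
  let jK : ResidueField Λ →+* κ := Ideal.Quotient.lift _ j hj
  let _ : Algebra (ResidueField Λ) κ := jK.toAlgebra
  have hpow : ∀ (x) (n : ℕ), D (x ^ n) = n * i x ^ (n - 1) * D x := by
    intro x n
    induction n with
    | zero =>
      have := hD 1 1
      rw [mul_one, i.map_one, one_mul] at this
      rw [pow_zero, Nat.cast_zero, zero_mul, zero_mul]
      simpa using this
    | succ n ih =>
      rw [pow_succ, hD, ih, map_pow]
      rcases n with _ | n
      · simp
      · rw [show n + 1 + 1 - 1 = n + 1 from rfl, show n + 1 - 1 = n from rfl]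
        push_cast
        ring
  have hpκ : (p : κ) = 0 := by
    rw [← map_natCast (i.comp (algebraMap k _)), CharP.cast_eq_zero, map_zero]
  have hmov : ∀ a : k, (1 : adjoin k (r '' (s : Set k))) ⊗ₜ[k] algebraMap k Λ a =
      algebraMap k _ a ⊗ₜ 1 := fun a => by
    rw [Algebra.algebraMap_eq_smul_one, Algebra.algebraMap_eq_smul_one, tmul_smul, smul_tmul']
  obtain ⟨f, hf⟩ : ∃ f : Module.Dual (ResidueField Λ) κ, f (D (1 ⊗ₜ algebraMap k Λ c)) ≠ 0 := by
    by_contra! h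
    rw [hmov] at h
    exact hDc ((Module.forall_dual_apply_eq_zero_iff (ResidueField Λ) _).1 h)
  have hfsm : ∀ (a : Λ) (v : κ), f (j a * v) = a • f v := fun a v => by
    have : j a * v = residue Λ a • v := rfl
    rw [this, map_smul]
    rfl
  let E : Λ →+ ResidueField Λ := f.toAddMonoidHom.comp
    (D.comp (Algebra.TensorProduct.includeRight (R := k)
      (A := adjoin k (r '' (s : Set k)))).toRingHom.toAddMonoidHom)
  have hE : ∀ a, E a = f (D (1 ⊗ₜ a)) := fun a => rfl
  refine ⟨Derivation.mk' (AddMonoidHom.toZModLinearMap p E) fun a b => ?_, fun a ha => ?_, hf⟩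
  · change E (a * b) = a • E b + b • E a
    rw [hE, hE, hE, ← hfsm, ← hfsm, ← map_add]
    congr 1
    have := hD (1 ⊗ₜ a) (1 ⊗ₜ b)
    rw [Algebra.TensorProduct.tmul_mul_tmul, one_mul] at this
    exact this
  · change E _ = 0
    have h1 : algebraMap k (adjoin k (r '' (s : Set k))) a =
        ⟨r a, IntermediateField.subset_adjoin _ _ ⟨a, ha, rfl⟩⟩ ^ p := Subtype.ext (hr a).symm
    rw [hE, hmov, h1, ← one_pow p, ← Algebra.TensorProduct.tmul_pow, hpow, hpκ, zero_mul, zero_mul, map_zero]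

open TensorProduct IsLocalRing KaehlerDifferential in
/-- Derivations of the base field into the residue field extend to a geometrically regular local
algebra. -/
theorem GeomRegular.exists_derivation_extending {k Λ : Type u} [Field k] [CommRing Λ] [IsLocalRing Λ]
    [IsNoetherianRing Λ] [Algebra k Λ] (H : GeomRegular k Λ) {p : ℕ} [hp : Fact p.Prime] [CharP k p]
    [Algebra (ZMod p) k] [Algebra (ZMod p) Λ] [IsScalarTower (ZMod p) k Λ]
    (δ : Derivation (ZMod p) k (ResidueField Λ)) :
    ∃ D : Derivation (ZMod p) Λ (ResidueField Λ), ∀ a, D (algebraMap k Λ a) = δ a := by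
  classical
  obtain ⟨b, hb, hspan, hli⟩ := exists_linearIndependent k (range (KaehlerDifferential.D (ZMod p) k))
  rw [KaehlerDifferential.span_range_derivation] at hspan
  choose c hc using fun i : b => hb i.2
  let B : Module.Basis b k (Ω[k⁄ZMod p]) := Module.Basis.mk hli (by rw [Subtype.range_coe, hspan])
  have hB : ∀ i, B i = KaehlerDifferential.D (ZMod p) k (c i) := fun i => by
    rw [Module.Basis.mk_apply, hc]
  let w : b → ResidueField Λ ⊗[Λ] Ω[Λ⁄ZMod p] :=
    fun i => 1 ⊗ₜ KaehlerDifferential.D (ZMod p) Λ (algebraMap k Λ (c i))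
  have key : ∀ (D : Derivation (ZMod p) Λ (ResidueField Λ)) (x : Λ),
      LinearMap.liftBaseChange (ResidueField Λ) D.liftKaehlerDifferential
        (1 ⊗ₜ KaehlerDifferential.D (ZMod p) Λ x) = D x := fun D x => by simp
  have hw : LinearIndependent (ResidueField Λ) w := by
    rw [linearIndependent_iff']
    intro t g hg i0 hi0
    let δ₁ : Derivation (ZMod p) k k := (B.coord i0).compDer (KaehlerDifferential.D (ZMod p) k)
    have hδ : ∀ i, δ₁ (c i) = if i = i0 then 1 else 0 := fun i => by
      change B.coord i0 (KaehlerDifferential.D (ZMod p) k (c i)) = _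
      rw [← hB, Module.Basis.coord_apply, Module.Basis.repr_self, Finsupp.single_apply]
    obtain ⟨D, hD, hD0⟩ := H.exists_derivation_residueField (p := p) (δ₁.restrictScalars ℤ)
      ((t.erase i0).image c) (by
        intro a ha
        obtain ⟨i, hi, rfl⟩ := Finset.mem_image.1 ha
        exact (hδ i).trans (if_neg (Finset.ne_of_mem_erase hi))) (c := c i0) (by
        change δ₁ (c i0) ≠ 0
        rw [hδ, if_pos rfl]
        exact one_ne_zero)
    have h1 := congrArg (LinearMap.liftBaseChange (ResidueField Λ) D.liftKaehlerDifferential) hg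
    rw [map_sum, map_zero, Finset.sum_eq_single i0] at h1
    · rw [map_smul, key, smul_eq_mul] at h1
      exact (mul_eq_zero.1 h1).resolve_right hD0
    · intro i hi hne
      rw [map_smul, key, hD _ (Finset.mem_image_of_mem _ (Finset.mem_erase.2 ⟨hne, hi⟩)), smul_zero]
    · exact fun h => absurd hi0 h
  obtain ⟨f, hf⟩ : ∃ f : (ResidueField Λ ⊗[Λ] Ω[Λ⁄ZMod p]) →ₗ[ResidueField Λ] ResidueField Λ,
      ∀ i, f (w i) = δ (c i) := by
    obtain ⟨f, hf⟩ := LinearMap.exists_extend ((Module.Basis.span hw).constr ℕ fun i => δ (c i))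
    refine ⟨f, fun i => ?_⟩
    have h1 := LinearMap.congr_fun hf (Module.Basis.span hw i)
    rw [Module.Basis.constr_basis, LinearMap.comp_apply, Submodule.subtype_apply,
      Module.Basis.span_apply] at h1
    exact h1
  let D : Derivation (ZMod p) Λ (ResidueField Λ) :=
    ((f.restrictScalars Λ).comp (TensorProduct.mk Λ (ResidueField Λ) _ 1)).compDer
      (KaehlerDifferential.D (ZMod p) Λ)
  have hDa : ∀ x, D x = f (1 ⊗ₜ KaehlerDifferential.D (ZMod p) Λ x) := fun x => rfl
  let Dk : Derivation (ZMod p) k (ResidueField Λ) := D.compAlgebraMap k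
  have hDk : ∀ a, Dk a = D (algebraMap k Λ a) := fun a => rfl
  refine ⟨D, fun a => ?_⟩
  have h2 : Dk.liftKaehlerDifferential = δ.liftKaehlerDifferential := by
    refine B.ext fun i => ?_
    rw [hB, Derivation.liftKaehlerDifferential_comp_D, Derivation.liftKaehlerDifferential_comp_D,
      hDk, hDa]
    exact hf i
  have := LinearMap.congr_fun h2 (KaehlerDifferential.D (ZMod p) k a)
  rwa [Derivation.liftKaehlerDifferential_comp_D, Derivation.liftKaehlerDifferential_comp_D, hDk] at this

open TensorProduct KaehlerDifferential in
theorem Algebra.FormallySmooth.adjoin_of_linearIndependent {F : Type v} {k K : Type u} [Field F] [PerfectField F] [Field k]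
    [Field K] [Algebra F k] [Algebra k K] [Algebra F K] [IsScalarTower F k K] (S : Set k)
    (hS : LinearIndependent K fun b : S => D F K (algebraMap k K b)) :
    FormallySmooth (IntermediateField.adjoin F S) K := by
  set E := IntermediateField.adjoin F S with hE
  have hFK : FormallySmooth F K := .of_perfectField' F K
  let w : S → K ⊗[E] Ω[E⁄F] := fun b =>
    1 ⊗ₜ D F E ⟨b, IntermediateField.subset_adjoin F S b.2⟩
  have hspan : ∀ a : E, (1 : K) ⊗ₜ[E] D F E a ∈ Submodule.span K (range w) := by
    rintro ⟨a, ha⟩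
    induction ha using IntermediateField.adjoin_induction with
    | mem x hx => exact Submodule.subset_span ⟨⟨x, hx⟩, rfl⟩
    | algebraMap x =>
      have : D F E ⟨algebraMap F k x, algebraMap_mem _ x⟩ = 0 :=
        (D F E).map_algebraMap x
      rw [this, tmul_zero]
      exact zero_mem _
    | add x y hx hy h1 h2 =>
      have : D F E ⟨x + y, add_mem hx hy⟩ = D F E ⟨x, hx⟩ +
        D F E ⟨y, hy⟩ := (D F E).map_add ⟨x, hx⟩ ⟨y, hy⟩
      rw [this, tmul_add]
      exact add_mem h1 h2
    | inv x hx h1 =>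
      have : D F E ⟨x⁻¹, inv_mem hx⟩ = -(⟨x, hx⟩ : E)⁻¹ ^ 2 •
        D F E ⟨x, hx⟩ := (D F E).leibniz_inv ⟨x, hx⟩
      rw [this, tmul_smul]
      exact Submodule.smul_of_tower_mem _ _ h1
    | mul x y hx hy h1 h2 =>
      have : D F E ⟨x * y, mul_mem hx hy⟩ = (⟨x, hx⟩ : E) • D F E ⟨y, hy⟩ +
        (⟨y, hy⟩ : E) • D F E ⟨x, hx⟩ := (D F E).leibniz ⟨x, hx⟩ ⟨y, hy⟩
      rw [this, tmul_add, tmul_smul, tmul_smul]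
      exact add_mem (Submodule.smul_of_tower_mem _ _ h2) (Submodule.smul_of_tower_mem _ _ h1)
  have htop : ⊤ ≤ Submodule.span K (range w) := by
    rw [top_le_iff, Submodule.eq_top_iff']
    intro z
    induction z with
    | zero => exact zero_mem _
    | add a b ha hb => exact add_mem ha hb
    | tmul a b =>
      have hb : b ∈ Submodule.span E (range (D F E)) := by
        rw [KaehlerDifferential.span_range_derivation]; trivial
      rw [show a ⊗ₜ[E] b = a • ((1 : K) ⊗ₜ[E] b) by rw [smul_tmul', smul_eq_mul, mul_one]]
      refine Submodule.smul_mem _ _ ?_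
      induction hb using Submodule.span_induction with
      | mem x hx => obtain ⟨c, rfl⟩ := hx; exact hspan c
      | zero => rw [tmul_zero]; exact zero_mem _
      | add x y _ _ h1 h2 => rw [tmul_add]; exact add_mem h1 h2
      | smul c x _ h1 => rw [tmul_smul]; exact Submodule.smul_of_tower_mem _ _ h1
  have hinj : Injective (KaehlerDifferential.mapBaseChange F E K) := by
    have hcomp : ∀ b, KaehlerDifferential.mapBaseChange F E K (w b) =
        D F K (algebraMap k K b) := fun b => by
      simp only [w, KaehlerDifferential.mapBaseChange_tmul, one_smul, KaehlerDifferential.map_D]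
      rfl
    refine LinearMap.injective_of_linearIndependent (top_le_iff.1 htop) ?_
    have h1 : KaehlerDifferential.mapBaseChange F E K ∘ w =
        fun b : S => D F K (algebraMap k K b) := funext hcomp
    rw [h1]
    exact hS
  have hsub : Subsingleton (Algebra.H1Cotangent E K) := by
    refine subsingleton_of_forall_eq 0 fun z => ?_
    have h1 : Algebra.H1Cotangent.δ F E K z = 0 :=
      hinj (((Algebra.H1Cotangent.exact_δ_mapBaseChange F E K).apply_apply_eq_zero z).trans (map_zero _).symm)
    obtain ⟨y, rfl⟩ := (Algebra.H1Cotangent.exact_map_δ F E K z).1 h1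
    rw [Subsingleton.elim y 0, map_zero]
  exact { projective_kaehlerDifferential := inferInstance, subsingleton_h1Cotangent := hsub }

/-- A field extension `k / E` with `k ^ p ⊆ E` without nonzero derivations is trivial. -/
theorem Subfield.eq_top_of_derivation {p : ℕ} [hp : Fact p.Prime] {k : Type u} [Field k] [CharP k p]
    (E : Subfield k) (hE : ∀ a : k, a ^ p ∈ E)
    (h : ∀ δ : Derivation ℤ k k, (∀ a ∈ E, δ a = 0) → δ = 0) : E = ⊤ := by
  by_contra hne
  obtain ⟨a, ha⟩ : ∃ a, a ∉ E := by
    by_contra! h'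
    exact hne (eq_top_iff.2 fun a _ => h' a)
  obtain ⟨M, hEM, hM⟩ := zorn_le_nonempty₀ {M : Subfield k | a ∉ M} (by
    intro c hc hch M hM
    refine ⟨sSup c, ?_, fun z hz => le_sSup hz⟩
    change a ∉ sSup c
    rw [Subfield.mem_sSup_of_directedOn ⟨M, hM⟩ hch.directedOn]
    rintro ⟨N, hN, haN⟩
    exact hc hN haN) E ha
  have hMp : ∀ b : k, b ^ p ∈ M := fun b => hEM (hE b)
  have hmax : ∀ N : Subfield k, M ≤ N → a ∉ N → N ≤ M := fun N h1 h2 => hM.2 h2 h1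
  have haM : a ∉ M := hM.1
  have : CharP M p := inferInstance
  have hintegral : ∀ b : k, IsIntegral M b := fun b =>
    ⟨Polynomial.X ^ p - Polynomial.C ⟨b ^ p, hMp b⟩, Polynomial.monic_X_pow_sub_C _ hp.out.ne_zero, by
      rw [Polynomial.eval₂_sub, Polynomial.eval₂_X_pow, Polynomial.eval₂_C]
      exact sub_self _⟩
  have hfr : ∀ b : k, b ∉ M → Module.finrank M (adjoin M {b}) = p := by
    intro b hb
    rw [adjoin.finrank (hintegral b)]
    have hirr : Irreducible (Polynomial.X ^ p - Polynomial.C (⟨b ^ p, hMp b⟩ : M)) := by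
      refine X_pow_sub_C_irreducible_of_prime hp.out fun c hc => hb ?_
      have h1 : (c : k) ^ p = b ^ p := congrArg Subtype.val hc
      rw [← frobenius_inj k p h1]
      exact c.2
    rw [← minpoly.eq_of_irreducible_of_monic hirr (by
        rw [map_sub, map_pow, Polynomial.aeval_X, Polynomial.aeval_C]
        exact sub_self _)
      (Polynomial.monic_X_pow_sub_C _ hp.out.ne_zero), Polynomial.natDegree_X_pow_sub_C]
  have hgen : adjoin M {a} = ⊤ := by
    rw [eq_top_iff]
    intro b _
    by_cases hb : b ∈ M
    · exact algebraMap_mem (adjoin M {a}) ⟨b, hb⟩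
    have hab : a ∈ adjoin M {b} := by
      by_contra hab
      refine hb (hmax (adjoin M {b}).toSubfield (fun x hx => ?_) hab
        (IntermediateField.mem_adjoin_simple_self M b))
      exact algebraMap_mem (adjoin M {b}) ⟨x, hx⟩
    have hfin : FiniteDimensional M (adjoin M {b}) :=
      adjoin.finiteDimensional (hintegral b)
    have heq := IntermediateField.eq_of_le_of_finrank_eq
      (IntermediateField.adjoin_simple_le_iff.2 hab) ((hfr a haM).trans (hfr b hb).symm)
    rw [heq]
    exact IntermediateField.mem_adjoin_simple_self M b
  have hfin : FiniteDimensional M k := by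
    have := adjoin.finiteDimensional (hintegral a)
    rw [hgen] at this
    exact Module.Finite.equiv (IntermediateField.topEquiv (F := M) (E := k)).toLinearEquiv
  have hur : Algebra.FormallyUnramified M k := by
    refine ⟨?_⟩
    by_contra hns
    rw [not_subsingleton_iff_nontrivial] at hns
    obtain ⟨ω, hω⟩ := exists_ne (0 : Ω[k⁄M])
    refine hω ((Module.forall_dual_apply_eq_zero_iff k _).1 fun f => ?_)
    have h1 := h ((f.compDer (D M k)).restrictScalars ℤ) (fun x hx =>
      (f.compDer (D M k)).map_algebraMap ⟨x, hEM hx⟩)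
    have h2 : f.compDer (D M k) = 0 := Derivation.ext fun x =>
      Derivation.congr_fun h1 x
    have h3 : f = 0 := Derivation.liftKaehlerDifferential_unique _ _ (by
      rw [h2]
      exact Derivation.ext fun _ => rfl)
    rw [h3, LinearMap.zero_apply]
  have hpi : IsPurelyInseparable M k := by
    rw [isPurelyInseparable_iff_pow_mem M p]
    exact fun b => ⟨1, ⟨⟨b ^ p, hMp b⟩, by rw [pow_one]; rfl⟩⟩
  have htop := Algebra.FormallyUnramified.range_eq_top_of_isPurelyInseparable M k
  obtain ⟨c, hc⟩ : a ∈ (algebraMap M k).range := htop ▸ trivial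
  exact haM (hc ▸ c.2)

theorem Subfield.eq_top_of_iterate {p : ℕ} [hp : Fact p.Prime] {k : Type u} [Field k] [CharP k p]
    (S : Set k) (h : ∀ δ : Derivation ℤ k k, (∀ a ∈ S, δ a = 0) → δ = 0) (e : ℕ) (E : Subfield k)
    (hSE : S ⊆ E) (hE : ∀ a : k, a ^ p ^ e ∈ E) : E = ⊤ := by
  induction e generalizing E with
  | zero => exact eq_top_iff.2 fun a _ => by simpa using hE a
  | succ e ih =>
    have h1 : E.comap (frobenius k p) = ⊤ := by
      refine ih _ (fun a ha => ?_) fun a => ?_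
      · exact pow_mem (hSE ha) p
      · change (a ^ p ^ e) ^ p ∈ E
        rw [← pow_mul, ← pow_succ]
        exact hE a
    refine E.eq_top_of_derivation (p := p) (fun a => ?_) fun δ hδ => h δ fun a ha => hδ a (hSE ha)
    have : a ∈ E.comap (frobenius k p) := h1 ▸ trivial
    exact this

open IsLocalRing in
theorem exists_finset_derivation_eq_zero {F : Type v} {k Λ : Type u} [Field F] [Field k] [CommRing Λ] [IsLocalRing Λ]
    [IsNoetherianRing Λ] [Algebra F k] [Algebra k Λ] [Algebra F Λ] [IsScalarTower F k Λ] (S : Set k)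
    (hS : ∀ D : Derivation F (ResidueField Λ) (ResidueField Λ),
      (∀ a ∈ S, D (algebraMap k _ a) = 0) → ∀ a : k, D (algebraMap k _ a) = 0) :
    ∃ c : Finset k, ∀ D : Derivation F Λ (ResidueField Λ),
      (∀ a ∈ S, D (algebraMap k Λ a) = 0) → (∀ a ∈ c, D (algebraMap k Λ a) = 0) →
        ∀ a, D (algebraMap k Λ a) = 0 := by
  classical
  obtain ⟨m, x, hx⟩ := Submodule.fg_iff_exists_fin_generating_family.1
    (IsNoetherian.noetherian (maximalIdeal Λ))
  let W : Finset k → Submodule (ResidueField Λ) (Derivation F Λ (ResidueField Λ)) := fun c =>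
    { carrier := {D | (∀ a ∈ S, D (algebraMap k Λ a) = 0) ∧ ∀ a ∈ c, D (algebraMap k Λ a) = 0}
      add_mem' := fun {D E} hD hE => ⟨fun a ha => by
        rw [Derivation.add_apply, hD.1 a ha, hE.1 a ha, add_zero], fun a ha => by
        rw [Derivation.add_apply, hD.2 a ha, hE.2 a ha, add_zero]⟩
      zero_mem' := ⟨fun _ _ => rfl, fun _ _ => rfl⟩
      smul_mem' := fun r D hD => ⟨fun a ha => by
        rw [Derivation.smul_apply, hD.1 a ha, smul_zero], fun a ha => by
        rw [Derivation.smul_apply, hD.2 a ha, smul_zero]⟩ }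
  let t : Derivation F Λ (ResidueField Λ) →ₗ[ResidueField Λ] (Fin m → ResidueField Λ) :=
    { toFun := fun D i => D (x i)
      map_add' := fun D E => rfl
      map_smul' := fun r D => rfl }
  obtain ⟨_, ⟨c, rfl⟩, hc⟩ := IsArtinian.set_has_minimal (range fun c => (W c).map t) ⟨_, ∅, rfl⟩
  refine ⟨c, fun D h1 h2 a => ?_⟩
  have hle : (W (insert a c)).map t ≤ (W c).map t := Submodule.map_mono fun E hE =>
    ⟨hE.1, fun b hb => hE.2 b (Finset.mem_insert_of_mem hb)⟩
  have heq : (W (insert a c)).map t = (W c).map t :=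
    (eq_or_lt_of_le hle).resolve_right (hc _ ⟨_, rfl⟩)
  obtain ⟨E, hE, hEt⟩ : t D ∈ (W (insert a c)).map t := heq ▸ ⟨D, ⟨h1, h2⟩, rfl⟩
  have hres : ∀ z ∈ maximalIdeal Λ, ∀ w : ResidueField Λ, z • w = 0 := fun z hz w => by
    rw [Algebra.smul_def, ResidueField.algebraMap_eq, (residue_eq_zero_iff z).2 hz, zero_mul]
  have hq : ∀ z ∈ maximalIdeal Λ, (D - E) z = 0 := by
    intro z hz
    rw [← hx] at hz
    induction hz using Submodule.span_induction with
    | mem y hy =>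
      obtain ⟨i, rfl⟩ := hy
      rw [Derivation.sub_apply, sub_eq_zero]
      exact (congrFun hEt i).symm
    | zero => exact map_zero _
    | add y z _ _ h1 h2 => rw [map_add, h1, h2, add_zero]
    | smul b y hy h1 =>
      rw [hx] at hy
      rw [smul_eq_mul, Derivation.leibniz, h1, hres y hy, smul_zero, add_zero]
  let G : ResidueField Λ →ₗ[F] ResidueField Λ :=
    ((maximalIdeal Λ).restrictScalars F).liftQ (D - E).toLinearMap hq
  have hG : ∀ z, G (residue Λ z) = (D - E) z := fun z => rfl
  let G' : Derivation F (ResidueField Λ) (ResidueField Λ) := Derivation.mk' G fun y z => by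
    obtain ⟨y, rfl⟩ := residue_surjective y
    obtain ⟨z, rfl⟩ := residue_surjective z
    rw [← map_mul, hG, hG, hG, Derivation.leibniz]
    rfl
  have h3 := hS G' (fun b hb => by
    change G (residue Λ (algebraMap k Λ b)) = 0
    rw [hG, Derivation.sub_apply, h1 b hb, hE.1 b hb, sub_zero]) a
  have h4 : (D - E) (algebraMap k Λ a) = 0 := h3
  rwa [Derivation.sub_apply, hE.2 a (Finset.mem_insert_self _ _), sub_zero] at h4

open IsLocalRing KaehlerDifferential in
theorem exists_linearIndependent_differentials (F : Type v) (k K : Type u) [Field F] [Field k]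
    [Field K] [Algebra F k] [Algebra k K] [Algebra F K] [IsScalarTower F k K] :
    ∃ S : Set k, (LinearIndependent K fun b : S => KaehlerDifferential.D F K (algebraMap k K b)) ∧
      ∀ D : Derivation F K K, (∀ a ∈ S, D (algebraMap k K a) = 0) → ∀ a : k, D (algebraMap k K a) = 0 := by
  obtain ⟨b, hb, hspan, hli⟩ := exists_linearIndependent K
    (range fun a : k => KaehlerDifferential.D F K (algebraMap k K a))
  choose c hc using fun i : b => hb i.2
  refine ⟨range c, ?_, fun D hD a => ?_⟩
  · refine hli.comp (fun x : range c => ⟨KaehlerDifferential.D F K (algebraMap k K x), ?_⟩) ?_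
    · obtain ⟨_, i, rfl⟩ := x
      change KaehlerDifferential.D F K (algebraMap k K (c i)) ∈ b
      rw [show KaehlerDifferential.D F K (algebraMap k K (c i)) = i from hc i]
      exact i.2
    · rintro ⟨_, i, rfl⟩ ⟨_, j, rfl⟩ hij
      have h1 : i.1 = j.1 := (hc i).symm.trans ((congrArg Subtype.val hij).trans (hc j))
      rw [Subtype.ext h1]
  · have h1 : KaehlerDifferential.D F K (algebraMap k K a) ∈ Submodule.span K b :=
      hspan ▸ Submodule.subset_span ⟨a, rfl⟩
    have h2 : Submodule.span K b ≤ LinearMap.ker D.liftKaehlerDifferential := by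
      rw [Submodule.span_le]
      intro i hi
      change D.liftKaehlerDifferential i = 0
      rw [← show KaehlerDifferential.D F K (algebraMap k K (c ⟨i, hi⟩)) = i from hc ⟨i, hi⟩,
        Derivation.liftKaehlerDifferential_comp_D]
      exact hD _ ⟨_, rfl⟩
    have h3 := h2 h1
    rwa [LinearMap.mem_ker, Derivation.liftKaehlerDifferential_comp_D] at h3

open IsLocalRing in
/-- A section of the residue field on an infinitesimal neighbourhood of the closed point which is
almost compatible with the base field. -/
structure AlmostSection (k Λ : Type u) [Field k] [CommRing Λ] [IsLocalRing Λ] [Algebra k Λ] (N : ℕ) where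
  toRingHom : ResidueField Λ →+* Λ ⧸ maximalIdeal Λ ^ N
  gens : Finset k
  apply_residue : ∀ b, ∃ c ∈ maximalIdeal Λ, toRingHom (residue Λ b) = mk _ (b + c)
  eq_top : ∀ E : Subfield k, (∀ a, toRingHom (algebraMap k _ a) = mk _ (algebraMap k Λ a) → a ∈ E) →
    (gens : Set k) ⊆ E → E = ⊤

open IsLocalRing in
theorem AlmostSection.nonempty_of_charZero (k Λ : Type u) [Field k] [CharZero k] [CommRing Λ] [IsLocalRing Λ]
    [Algebra k Λ] (N : ℕ) : Nonempty (AlmostSection k Λ N) := by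
  have : FormallySmooth k (ResidueField Λ) := .of_perfectField' k _
  obtain ⟨s, hs⟩ := exists_section_residueField k Λ N
  exact ⟨{ toRingHom := s, gens := ∅, apply_residue := hs, eq_top := fun E hE _ =>
    eq_top_iff.2 fun a _ => hE a (s.commutes a) }⟩

open IsLocalRing in
theorem GeomRegular.nonempty_almostSection {k Λ : Type u} [Field k] [CommRing Λ] [IsLocalRing Λ]
    [IsNoetherianRing Λ] [Algebra k Λ] (H : GeomRegular k Λ) (p : ℕ) [hp : Fact p.Prime] [CharP k p]
    [Algebra (ZMod p) k] [Algebra (ZMod p) Λ] [IsScalarTower (ZMod p) k Λ] (N : ℕ) :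
    Nonempty (AlmostSection k Λ N) := by
  have hch : CharP Λ p := charP_of_injective_algebraMap (algebraMap k Λ).injective p
  obtain ⟨S, hli, hS⟩ := exists_linearIndependent_differentials (ZMod p) k (ResidueField Λ)
  obtain ⟨c, hc⟩ := exists_finset_derivation_eq_zero S hS
  have hfs := FormallySmooth.adjoin_of_linearIndependent S hli
  have hfs' : @FormallySmooth (adjoin (ZMod p) S) (ResidueField Λ) _ _
      (ResidueField.algebra (R := Λ) (R₀ := adjoin (ZMod p) S)) := hfs
  obtain ⟨s, hs⟩ := exists_section_residueField (adjoin (ZMod p) S) Λ N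
  refine ⟨{ toRingHom := s, gens := c, apply_residue := hs, eq_top := fun E hE hcE => ?_ }⟩
  refine Subfield.eq_top_of_iterate (p := p) (S ∪ c) (fun δ hδ => ?_) N E ?_ fun a => hE _ ?_
  · let g : k →+ ResidueField Λ := (algebraMap k (ResidueField Λ)).toAddMonoidHom.comp δ.toLinearMap.toAddMonoidHom
    have hg : ∀ a, g a = algebraMap k (ResidueField Λ) (δ a) := fun a => rfl
    obtain ⟨D, hD⟩ := H.exists_derivation_extending (Derivation.mk' (AddMonoidHom.toZModLinearMap p g) fun a b => by
      change g (a * b) = a • g b + b • g a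
      rw [hg, hg, hg, δ.leibniz, map_add, smul_eq_mul, smul_eq_mul, map_mul, map_mul, Algebra.smul_def,
        Algebra.smul_def])
    have hDg : ∀ a, D (algebraMap k Λ a) = algebraMap k _ (δ a) := hD
    refine Derivation.ext fun a => (algebraMap k (ResidueField Λ)).injective ?_
    rw [← hDg, Derivation.zero_apply, map_zero]
    refine hc D (fun b hb => ?_) (fun b hb => ?_) a
    · rw [hDg, hδ b (.inl hb), map_zero]
    · rw [hDg, hδ b (.inr hb), map_zero]
  · rintro a (ha | ha)
    · exact hE a (s.commutes ⟨a, IntermediateField.subset_adjoin (ZMod p) S ha⟩)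
    · exact hcE ha
  · obtain ⟨z, hz, hsz⟩ := hs (algebraMap k Λ a)
    change s (algebraMap k _ (a ^ p ^ N)) = _
    rw [map_pow, map_pow, show algebraMap k (ResidueField Λ) a = residue Λ (algebraMap k Λ a) from rfl, hsz,
      map_pow, ← map_pow, add_pow_char_pow, map_add]
    refine (add_eq_left.2 (eq_zero_iff_mem.2 ?_))
    exact Ideal.pow_le_pow_right (Nat.lt_pow_self hp.out.one_lt).le (Ideal.pow_mem_pow hz _)

/-- The subring generated by the elements `x i` and the image of a subfield under a section. -/
noncomputable def sectionSubring {R K : Type*} [CommRing R] [Field K] {d : ℕ} (s : K →+* R) (x : Fin d → R)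
    (L : Subfield K) : Subring R :=
  (eval₂Hom (s.comp L.subtype) x).range

section SectionSubring

variable {R K : Type*} [CommRing R] [Field K] {d : ℕ} {s : K →+* R} {x : Fin d → R} {L : Subfield K}

theorem map_mem_sectionSubring {a : K} (ha : a ∈ L) : s a ∈ sectionSubring s x L :=
  ⟨C ⟨a, ha⟩, by simp⟩

theorem self_mem_sectionSubring (i : Fin d) : x i ∈ sectionSubring s x L :=
  ⟨X i, by simp⟩

theorem MvPolynomial.sub_C_constantCoeff_mem {k τ : Type*} [CommRing k] (f : MvPolynomial τ k) :
    f - C (constantCoeff f) ∈ span (range (X : τ → MvPolynomial τ k)) := by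
  induction f using MvPolynomial.induction_on with
  | C a => simp
  | add p q hp hq =>
    rw [map_add, map_add, add_sub_add_comm]
    exact add_mem hp hq
  | mul_X p i _ =>
    rw [map_mul, constantCoeff_X, mul_zero, map_zero, sub_zero]
    exact mul_mem_left _ _ (subset_span ⟨i, rfl⟩)

variable {ρ : R →+* K}

theorem exists_eq_of_mem_sectionSubring (hρ : ∀ a, ρ (s a) = a)
    (hx : span (range x) = ker ρ) {t : R} (ht : t ∈ sectionSubring s x L) :
    ρ t ∈ L ∧ ∃ c : Fin d → R, (∀ i, c i ∈ sectionSubring s x L) ∧ t - s (ρ t) = ∑ i, c i * x i := by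
  obtain ⟨f, rfl⟩ := ht
  obtain ⟨c, hc⟩ := mem_span_range_iff_exists_fun.1 (sub_C_constantCoeff_mem f)
  have h1 : eval₂Hom (s.comp L.subtype) x f - s (constantCoeff f).1 =
      ∑ i, eval₂Hom (s.comp L.subtype) x (c i) * x i := by
    have := congrArg (eval₂Hom (s.comp L.subtype) x) hc
    rw [map_sum, map_sub] at this
    simp only [map_mul, eval₂Hom_X', eval₂Hom_C] at this
    exact this.symm
  have h2 : ρ (eval₂Hom (s.comp L.subtype) x f) = (constantCoeff f).1 := by
    have : eval₂Hom (s.comp L.subtype) x f - s (constantCoeff f).1 ∈ ker ρ := by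
      rw [h1, ← hx]
      exact sum_mem fun i _ => mul_mem_left _ _ (subset_span ⟨i, rfl⟩)
    rw [mem_ker, map_sub, hρ, sub_eq_zero] at this
    exact this
  change ρ (eval₂Hom (s.comp L.subtype) x f) ∈ L ∧ _
  rw [h2]
  refine ⟨(constantCoeff f).2, fun i => eval₂Hom (s.comp L.subtype) x (c i), fun i => ⟨_, rfl⟩, ?_⟩
  exact h1

theorem exists_inv_mem_sectionSubring (hρ : ∀ a, ρ (s a) = a)
    (hx : span (range x) = ker ρ) {N : ℕ} (hN : ker ρ ^ N = ⊥) {t : R}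
    (ht : t ∈ sectionSubring s x L) (h0 : ρ t ≠ 0) : ∃ t' ∈ sectionSubring s x L, t * t' = 1 := by
  obtain ⟨h1, c, hc, hcx⟩ := exists_eq_of_mem_sectionSubring hρ hx ht
  set n := t - s (ρ t) with hn
  have hnT : n ∈ sectionSubring s x L := sub_mem ht (map_mem_sectionSubring h1)
  have hnil : n ^ N = 0 := by
    rw [← Ideal.mem_bot, ← hN]
    refine Ideal.pow_mem_pow ?_ N
    rw [mem_ker, hn, map_sub, hρ, sub_self]
  have hm : s (ρ t)⁻¹ ∈ sectionSubring s x L := map_mem_sectionSubring (inv_mem h1)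
  refine ⟨s (ρ t)⁻¹ * ∑ i ∈ Finset.range N, (-(s (ρ t)⁻¹ * n)) ^ i,
    mul_mem hm (sum_mem fun i _ => pow_mem (neg_mem (mul_mem hm hnT)) i), ?_⟩
  have h2 : s (ρ t) * s (ρ t)⁻¹ = 1 := by rw [← map_mul, mul_inv_cancel₀ h0, map_one]
  have h3 : t * s (ρ t)⁻¹ = 1 - -(s (ρ t)⁻¹ * n) := by
    linear_combination h2 - s (ρ t)⁻¹ * hn
  rw [← mul_assoc, h3, mul_neg_geom_sum, neg_pow, mul_pow, hnil, mul_zero, mul_zero, sub_zero]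

theorem mem_sectionSubring_top (hρ : ∀ a, ρ (s a) = a)
    (hx : span (range x) = ker ρ) {N : ℕ} (hN : ker ρ ^ N = ⊥) (r : R) :
    r ∈ sectionSubring s x ⊤ := by
  suffices H : ∀ (n : ℕ) (r : R), ∃ t ∈ sectionSubring s x ⊤, r - t ∈ ker ρ ^ n by
    obtain ⟨t, ht, h⟩ := H N r
    rw [hN, Ideal.mem_bot, sub_eq_zero] at h
    rwa [h]
  intro n
  induction n with
  | zero => exact fun r => ⟨0, zero_mem _, by simp⟩
  | succ n ih =>
    intro r
    have h1 : r - s (ρ r) ∈ span (range x) := by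
      rw [hx, mem_ker, map_sub, hρ, sub_self]
    obtain ⟨c, hc⟩ := mem_span_range_iff_exists_fun.1 h1
    choose t ht hct using fun i => ih (c i)
    refine ⟨s (ρ r) + ∑ i, t i * x i, add_mem (map_mem_sectionSubring trivial)
      (sum_mem fun i _ => mul_mem (ht i) (self_mem_sectionSubring i)), ?_⟩
    rw [← sub_sub, ← hc, ← Finset.sum_sub_distrib]
    refine sum_mem fun i _ => ?_
    rw [← sub_mul, pow_succ]
    refine Ideal.mul_mem_mul (hct i) ?_
    rw [← hx]
    exact subset_span ⟨i, rfl⟩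

theorem exists_finset_mem_sectionSubring (hρ : ∀ a, ρ (s a) = a)
    (hx : span (range x) = ker ρ) {N : ℕ} (hN : ker ρ ^ N = ⊥) (r : R) :
    ∃ Z : Finset K, ∀ L : Subfield K, (Z : Set K) ⊆ L → r ∈ sectionSubring s x L := by
  obtain ⟨f, rfl⟩ := mem_sectionSubring_top hρ hx hN r
  let g : MvPolynomial (Fin d) K := map (⊤ : Subfield K).subtype f
  refine ⟨g.coeffs, fun L hL => ?_⟩
  obtain ⟨h, hh⟩ : g ∈ range (map L.subtype) := mem_range_map_iff_coeffs_subset.2 fun a ha =>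
    ⟨⟨a, hL ha⟩, rfl⟩
  refine ⟨h, ?_⟩
  have h1 : ∀ (M : Subfield K) (e : MvPolynomial (Fin d) M), eval₂Hom (s.comp M.subtype) x e =
      eval₂Hom s x (map M.subtype e) := fun M e => by
    rw [coe_eval₂Hom, coe_eval₂Hom, eval₂_map]
  have h2 : eval₂Hom (s.comp L.subtype) x h = eval₂Hom (s.comp (⊤ : Subfield K).subtype) x f := by
    rw [h1, h1, hh]
  exact h2

end SectionSubring

section Residue

open IsLocalRing

variable {Λ : Type u} [CommRing Λ] [IsLocalRing Λ]

/-- The map from an infinitesimal neighbourhood of the closed point to the residue field. -/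
noncomputable def residuePow (Λ : Type u) [CommRing Λ] [IsLocalRing Λ] {N : ℕ} (hN : N ≠ 0) :
    Λ ⧸ maximalIdeal Λ ^ N →+* ResidueField Λ :=
  Ideal.Quotient.lift _ (residue Λ) fun _ h => (residue_eq_zero_iff _).2 (Ideal.pow_le_self hN h)

theorem residuePow_mk {N : ℕ} (hN : N ≠ 0) (b : Λ) :
    residuePow Λ hN (mk _ b) = residue Λ b := rfl

theorem ker_residuePow {N : ℕ} (hN : N ≠ 0) :
    ker (residuePow Λ hN) = (maximalIdeal Λ).map (mk (maximalIdeal Λ ^ N)) := by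
  refine le_antisymm (fun r hr => ?_) (Ideal.map_le_iff_le_comap.2 fun b hb => ?_)
  · obtain ⟨b, rfl⟩ := mk_surjective r
    rw [mem_ker, residuePow_mk, residue_eq_zero_iff] at hr
    exact mem_map_of_mem _ hr
  · rw [mem_comap, mem_ker, residuePow_mk, residue_eq_zero_iff]
    exact hb

theorem ker_residuePow_pow {N : ℕ} (hN : N ≠ 0) : ker (residuePow Λ hN) ^ N = ⊥ := by
  rw [ker_residuePow, ← Ideal.map_pow, Ideal.map_quotient_self]

theorem span_range_mk_comp {N : ℕ} (hN : N ≠ 0) {d : ℕ} {x : Fin d → Λ}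
    (hx : span (range x) = maximalIdeal Λ) :
    span (range fun i => mk (maximalIdeal Λ ^ N) (x i)) = ker (residuePow Λ hN) := by
  rw [ker_residuePow, ← hx, map_span, ← Set.range_comp]
  rfl

theorem AlmostSection.residuePow_apply {k : Type u} [Field k] [Algebra k Λ] {N : ℕ} (hN : N ≠ 0)
    (σ : AlmostSection k Λ N) (a : ResidueField Λ) : residuePow Λ hN (σ.toRingHom a) = a := by
  obtain ⟨b, rfl⟩ := residue_surjective a
  obtain ⟨c, hc, h⟩ := σ.apply_residue b
  rw [h, residuePow_mk, map_add, (residue_eq_zero_iff c).2 hc, add_zero]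

theorem AlmostSection.exists_finset {k : Type u} [Field k] [Algebra k Λ] {N : ℕ} (hN : N ≠ 0)
    (σ : AlmostSection k Λ N) {d : ℕ} {x : Fin d → Λ}
    (hx : span (range x) = maximalIdeal Λ) (G : Finset Λ) :
    ∃ Z : Finset (ResidueField Λ), ∀ L : Subfield (ResidueField Λ), (Z : Set (ResidueField Λ)) ⊆ L →
      (∀ a, σ.toRingHom (algebraMap k _ a) = Ideal.Quotient.mk _ (algebraMap k Λ a) →
        algebraMap k (ResidueField Λ) a ∈ L) →
      (∀ g ∈ G, Ideal.Quotient.mk _ g ∈ sectionSubring σ.toRingHom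
        (fun i => Ideal.Quotient.mk _ (x i)) L) ∧
      ∀ a, Ideal.Quotient.mk _ (algebraMap k Λ a) ∈ sectionSubring σ.toRingHom
        (fun i => Ideal.Quotient.mk _ (x i)) L := by
  classical
  have hker := span_range_mk_comp hN hx
  have hρ := σ.residuePow_apply hN
  have hnil := ker_residuePow_pow (Λ := Λ) hN
  choose Z hZ using fun g : Λ => exists_finset_mem_sectionSubring hρ hker hnil
    (Ideal.Quotient.mk _ g)
  refine ⟨(G ∪ σ.gens.image (algebraMap k Λ)).biUnion Z, fun L hL hk => ?_⟩
  have h1 : ∀ g ∈ G ∪ σ.gens.image (algebraMap k Λ), Ideal.Quotient.mk _ g ∈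
      sectionSubring σ.toRingHom (fun i => Ideal.Quotient.mk _ (x i)) L := fun g hg =>
    hZ g L fun a ha => hL (Finset.mem_biUnion.2 ⟨g, hg, ha⟩)
  refine ⟨fun g hg => h1 g (Finset.mem_union_left _ hg), ?_⟩
  let f : k →+* Λ ⧸ maximalIdeal Λ ^ N := (Ideal.Quotient.mk _).comp (algebraMap k Λ)
  let T : Subring (Λ ⧸ maximalIdeal Λ ^ N) :=
    sectionSubring σ.toRingHom (fun i => Ideal.Quotient.mk _ (x i)) L
  let E : Subfield k :=
    { Subring.comap f T with
      inv_mem' := by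
        intro a ha
        rcases eq_or_ne a 0 with rfl | h0
        · rw [inv_zero]; exact ha
        have h2 : residuePow Λ hN (f a) ≠ 0 := by
          change residue Λ (algebraMap k Λ a) ≠ 0
          rw [Ne, residue_eq_zero_iff, mem_maximalIdeal, mem_nonunits_iff, not_not]
          exact (IsUnit.mk0 a h0).map _
        obtain ⟨t', ht', h3⟩ := exists_inv_mem_sectionSubring hρ hker hnil ha h2
        change f a⁻¹ ∈ T
        have h4 : f a⁻¹ * f a = 1 := by rw [← map_mul, inv_mul_cancel₀ h0, map_one]
        rwa [show f a⁻¹ = t' from left_inv_eq_right_inv h4 h3] }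
  have hE : E = ⊤ := σ.eq_top E (fun a ha => by
      change f a ∈ T
      rw [show f a = _ from ha.symm]
      exact map_mem_sectionSubring (hk a ha)) fun a ha =>
    h1 _ (Finset.mem_union_right _ (Finset.mem_image_of_mem _ ha))
  intro a
  have : a ∈ E := hE ▸ trivial
  exact this

theorem map_le_of_sectionSubring_le {k : Type u} [Field k] [Algebra k Λ] {N : ℕ}
    (σ : AlmostSection k Λ N) {B : Type u} [CommRing B] (hN : N ≠ 0)
    (θ : B →+* Λ) [IsLocalHom θ] {d : ℕ} (x : Fin d → Λ) (hx : ∀ i, x i ∈ θ.range)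
    {Z : Set (ResidueField Λ)} (hZ : ∀ z ∈ Z, ∃ b, σ.toRingHom z = mk _ (θ b))
    {t : Λ ⧸ maximalIdeal Λ ^ N}
    (ht : t ∈ sectionSubring σ.toRingHom (fun i => mk _ (x i)) (Subfield.closure Z)) :
    ∃ b, t = mk _ (θ b) := by
  let S : Subring (Λ ⧸ maximalIdeal Λ ^ N) := ((mk _).comp θ).range
  let E : Subfield (ResidueField Λ) :=
    { Subring.comap σ.toRingHom S with
      inv_mem' := by
        rintro a ⟨b, hb⟩
        rcases eq_or_ne a 0 with rfl | h0
        · rw [inv_zero]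
          exact ⟨b, hb⟩
        have h1 : residue Λ (θ b) = a := by
          rw [← σ.residuePow_apply hN a, ← hb]
          rfl
        have h2 : IsUnit b := by
          refine isUnit_of_map_unit θ b ?_
          by_contra hu
          exact h0 (h1 ▸ (residue_eq_zero_iff _).2 hu)
        obtain ⟨c, hc⟩ := h2.exists_right_inv
        refine ⟨c, ?_⟩
        have h3 : σ.toRingHom a⁻¹ * σ.toRingHom a = 1 := by
          rw [← map_mul, inv_mul_cancel₀ h0, map_one]
        rw [← hb] at h3
        refine (left_inv_eq_right_inv h3 ?_).symm
        rw [← map_mul, hc, map_one] }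
  have hE : Subfield.closure Z ≤ E := Subfield.closure_le.2 fun z hz => by
    obtain ⟨b, hb⟩ := hZ z hz
    exact ⟨b, hb.symm⟩
  suffices h : t ∈ S by
    obtain ⟨b, hb⟩ := h
    exact ⟨b, hb.symm⟩
  obtain ⟨f, rfl⟩ := ht
  induction f using MvPolynomial.induction_on with
  | C a =>
    rw [eval₂Hom_C]
    exact hE a.2
  | add p q hp hq =>
    rw [map_add]
    exact add_mem hp hq
  | mul_X p i hp =>
    rw [map_mul, eval₂Hom_X']
    obtain ⟨b, hb⟩ := hx i
    exact mul_mem hp ⟨b, by rw [← hb]; rfl⟩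

end Residue

open IsLocalRing in
/-- The local algebra of essentially finite type which models a neighbourhood of a point. -/
theorem AlmostSection.exists_model {k Λ : Type u} [Field k] [CommRing Λ] [IsLocalRing Λ] [Algebra k Λ] {N : ℕ}
    (hN : N ≠ 0) (σ : AlmostSection k Λ N) {d : ℕ} {x : Fin d → Λ}
    (hx : span (range x) = maximalIdeal Λ) (G : Finset Λ) :
    ∃ (τ : Type u) (_ : Finite τ) (P : Ideal (MvPolynomial τ k)) (_ : P.IsPrime)
      (θ : AtPrime P →ₐ[k] Λ) (_ : IsLocalHom θ.toRingHom)
      (Y : Fin d → AtPrime P), (∀ j, θ (Y j) = x j) ∧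
      (∀ g ∈ G, ∃ b, θ b - g ∈ maximalIdeal Λ ^ N) ∧
      ∀ b ∈ maximalIdeal (AtPrime P), ∃ c : Fin d → AtPrime P,
        θ (b - ∑ j, c j * Y j) ∈ maximalIdeal Λ ^ N := by
  have hker := span_range_mk_comp hN hx
  have hρ := σ.residuePow_apply hN
  have hnil := ker_residuePow_pow (Λ := Λ) hN
  obtain ⟨Z, hZ⟩ := σ.exists_finset hN hx G
  let W : Set (ResidueField Λ) := Z ∪ {z | ∃ a : k, z = algebraMap k _ a ∧
    σ.toRingHom (algebraMap k _ a) = Ideal.Quotient.mk _ (algebraMap k Λ a)}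
  obtain ⟨hGT, hkT⟩ := hZ (Subfield.closure W) (fun z hz => Subfield.subset_closure (Or.inl hz))
    fun a ha => Subfield.subset_closure (Or.inr ⟨a, rfl, ha⟩)
  choose zl hzl using fun z : Z => mk_surjective (σ.toRingHom z)
  let θ₀ : MvPolynomial (Z ⊕ Fin d) k →ₐ[k] Λ := aeval (Sum.elim zl x)
  let P : Ideal (MvPolynomial (Z ⊕ Fin d) k) := (maximalIdeal Λ).comap θ₀
  have hunit : ∀ y : P.primeCompl, IsUnit (θ₀ y) := fun y => by
    by_contra hu
    exact y.2 hu
  let θ : AtPrime P →ₐ[k] Λ := IsLocalization.liftAlgHom hunit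
  have hθ : ∀ f, θ (algebraMap _ _ f) = θ₀ f := fun f => IsLocalization.lift_eq (g := θ₀.toRingHom) hunit f
  have hloc : IsLocalHom θ.toRingHom := by
    refine ⟨fun b hb => ?_⟩
    obtain ⟨f, y, rfl⟩ := IsLocalization.exists_mk'_eq P.primeCompl b
    rw [IsLocalization.AtPrime.isUnit_mk'_iff _ P]
    intro hf
    have h1 : θ (IsLocalization.mk' _ f y) * θ₀ y = θ₀ f := by
      rw [← hθ, ← map_mul, IsLocalization.mk'_spec, hθ]
    exact (mem_nonunits_iff.1 hf) (h1 ▸ hb.mul (hunit y))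
  let T : Subring (Λ ⧸ maximalIdeal Λ ^ N) :=
    sectionSubring σ.toRingHom (fun i => Ideal.Quotient.mk _ (x i)) (Subfield.closure W)
  have hTS : ∀ t ∈ T, ∃ b, t = Ideal.Quotient.mk _ (θ b) := fun t ht =>
    map_le_of_sectionSubring_le σ hN θ.toRingHom x (Z := W)
      (fun i => ⟨algebraMap (MvPolynomial (Z ⊕ Fin d) k) _ (X (inr i)), (hθ _).trans (by simp [θ₀])⟩) (by
        rintro z (hz | ⟨a, rfl, ha⟩)
        · let z' : Z := ⟨z, hz⟩
          refine ⟨algebraMap (MvPolynomial (Z ⊕ Fin d) k) _ (X (inl z')), ?_⟩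
          change _ = Ideal.Quotient.mk _ (θ _)
          rw [hθ, show σ.toRingHom z = _ from (hzl z').symm]
          simp [θ₀]
        · refine ⟨algebraMap k _ a, ha.trans ?_⟩
          change _ = Ideal.Quotient.mk _ (θ _)
          rw [θ.commutes]) ht
  have hfT : ∀ f, Ideal.Quotient.mk _ (θ₀ f) ∈ T := by
    intro f
    induction f using MvPolynomial.induction_on with
    | C a => simpa [θ₀] using hkT a
    | add p q hp hq =>
      rw [map_add, map_add]
      exact add_mem hp hq
    | mul_X p i hp =>
      rw [map_mul, map_mul]
      refine mul_mem hp ?_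
      rcases i with i | i
      · rw [show θ₀ (X (inl i)) = zl i by simp [θ₀], hzl]
        exact map_mem_sectionSubring (Subfield.subset_closure (Or.inl i.2))
      · rw [show θ₀ (X (inr i)) = x i by simp [θ₀]]
        exact self_mem_sectionSubring i
  have hbT : ∀ b, Ideal.Quotient.mk _ (θ b) ∈ T := by
    intro b
    obtain ⟨f, y, rfl⟩ := IsLocalization.exists_mk'_eq P.primeCompl b
    have h1 : θ (IsLocalization.mk' _ f y) * θ₀ y = θ₀ f := by
      rw [← hθ, ← map_mul, IsLocalization.mk'_spec, hθ]
    obtain ⟨t, ht, hyt⟩ := exists_inv_mem_sectionSubring hρ hker hnil (hfT y) (by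
      rw [residuePow_mk, Ne, residue_eq_zero_iff, mem_maximalIdeal, mem_nonunits_iff, not_not]
      exact hunit y)
    have h2 := mul_mem (hfT f) ht
    rwa [← h1, map_mul, mul_assoc, hyt, mul_one] at h2
  refine ⟨Z ⊕ Fin d, inferInstance, P, inferInstance, θ, hloc,
    fun j => algebraMap _ _ (X (inr j)), fun j => (hθ _).trans (by simp [θ₀]), ?_, ?_⟩
  · intro g hg
    obtain ⟨b, hb⟩ := hTS _ (hGT g hg)
    exact ⟨b, Ideal.Quotient.eq.1 hb.symm⟩
  · intro b hb
    obtain ⟨-, c, hc, hbc⟩ := exists_eq_of_mem_sectionSubring hρ hker (hbT b)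
    have h0 : residuePow Λ hN (Ideal.Quotient.mk _ (θ b)) = 0 := by
      rw [residuePow_mk, residue_eq_zero_iff]
      exact fun hu => hb (isUnit_of_map_unit θ.toRingHom b hu)
    rw [h0, map_zero, sub_zero] at hbc
    choose e he using fun i => hTS _ (hc i)
    refine ⟨e, ?_⟩
    rw [← eq_zero_iff_mem, map_sub, map_sub, hbc, map_sum, map_sum, sub_eq_zero]
    refine sum_congr rfl fun i _ => ?_
    rw [map_mul, map_mul, ← he, hθ]
    simp [θ₀]

section Cotangent

open IsLocalRing

variable {B : Type*} [CommRing B] [IsLocalRing B]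

theorem linearIndependent_toCotangent_iff {ι : Type*} [Fintype ι] {x : ι → B}
    (hx : ∀ i, x i ∈ maximalIdeal B) :
    LinearIndependent (ResidueField B)
      (fun i => ((maximalIdeal B).toCotangent ⟨x i, hx i⟩ : CotangentSpace B)) ↔
      ∀ c : ι → B, ∑ i, c i * x i ∈ maximalIdeal B ^ 2 → ∀ i, c i ∈ maximalIdeal B := by
  have key : ∀ c : ι → B, ∑ i, residue B (c i) • ((maximalIdeal B).toCotangent ⟨x i, hx i⟩ :
      CotangentSpace B) = 0 ↔ ∑ i, c i * x i ∈ maximalIdeal B ^ 2 := by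
    intro c
    have h1 : ∑ i, residue B (c i) • ((maximalIdeal B).toCotangent ⟨x i, hx i⟩ : CotangentSpace B) =
        (maximalIdeal B).toCotangent (∑ i, c i • ⟨x i, hx i⟩) := by
      rw [map_sum]
      refine sum_congr rfl fun i _ => ?_
      rw [map_smul]
      rfl
    rw [h1, Ideal.toCotangent_eq_zero]
    simp
  rw [Fintype.linearIndependent_iff]
  constructor
  · intro h c hc i
    exact (residue_eq_zero_iff _).1 (h (fun i => residue B (c i)) ((key c).2 hc) i)
  · intro h g hg i
    choose c hc using fun i => residue_surjective (g i)
    obtain rfl : g = fun i => residue B (c i) := funext fun i => (hc i).symm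
    exact (residue_eq_zero_iff _).2 (h c ((key c).1 hg) i)

theorem span_toCotangent_eq_top_iff [IsNoetherianRing B] {ι : Type*} {x : ι → B}
    (hx : ∀ i, x i ∈ maximalIdeal B) :
    Submodule.span (ResidueField B)
      (range fun i => ((maximalIdeal B).toCotangent ⟨x i, hx i⟩ : CotangentSpace B)) = ⊤ ↔
      span (range x) = maximalIdeal B := by
  have h1 : (range fun i => ((maximalIdeal B).toCotangent ⟨x i, hx i⟩ : CotangentSpace B)) =
      (maximalIdeal B).toCotangent '' range (fun i => (⟨x i, hx i⟩ : maximalIdeal B)) :=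
    Set.range_comp _ _
  rw [h1, CotangentSpace.span_image_eq_top_iff,
    ← (Submodule.map_injective_of_injective (Submodule.injective_subtype (maximalIdeal B))).eq_iff,
    Submodule.map_span, Submodule.map_top, Submodule.range_subtype, ← Set.range_comp]
  rfl

theorem IsRSOP.mem_maximalIdeal {ι : Type*} {x : ι → B} (hx : IsRSOP x) (i : ι) :
    x i ∈ maximalIdeal B := hx.2.1 ▸ subset_span ⟨i, rfl⟩

theorem IsRSOP.mem_of_sum_mem [IsNoetherianRing B] {ι : Type*} [Fintype ι] {x : ι → B} (hx : IsRSOP x)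
    {c : ι → B} (hc : ∑ i, c i * x i ∈ maximalIdeal B ^ 2) (i : ι) : c i ∈ maximalIdeal B := by
  refine (linearIndependent_toCotangent_iff hx.mem_maximalIdeal).1 ?_ c hc i
  refine linearIndependent_of_top_le_span_of_card_le_finrank
    ((span_toCotangent_eq_top_iff hx.mem_maximalIdeal).2 hx.2.1).ge ?_
  have h1 := ringKrullDim_le_spanFinrank_maximalIdeal B
  rw [hx.2.2, spanFinrank_maximalIdeal_eq_finrank_cotangentSpace, Nat.card_eq_fintype_card] at h1
  exact_mod_cast h1

theorem isRSOP_of_isRegularLocalRing [IsRegularLocalRing B] {ι : Type*} [Fintype ι] {x : ι → B}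
    (hx : ∀ i, x i ∈ maximalIdeal B) (hli : LinearIndependent (ResidueField B)
      (fun i => ((maximalIdeal B).toCotangent ⟨x i, hx i⟩ : CotangentSpace B)))
    (hspan : Submodule.span (ResidueField B)
      (range fun i => ((maximalIdeal B).toCotangent ⟨x i, hx i⟩ : CotangentSpace B)) = ⊤) :
    IsRSOP x := by
  refine ⟨inferInstance, (span_toCotangent_eq_top_iff hx).1 hspan, ?_⟩
  rw [← (IsRegularLocalRing.iff_finrank_cotangentSpace B).1 inferInstance,
    Module.finrank_eq_card_basis (Module.Basis.mk hli hspan.ge), Nat.card_eq_fintype_card]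

theorem exists_isRSOP_sumElim [IsRegularLocalRing B] {d : ℕ} {Y : Fin d → B}
    (hY : ∀ j, Y j ∈ maximalIdeal B)
    (hli : ∀ c : Fin d → B, ∑ i, c i * Y i ∈ maximalIdeal B ^ 2 → ∀ i, c i ∈ maximalIdeal B)
    {I : Ideal B} (hI : I ≤ maximalIdeal B) (hgen : maximalIdeal B ≤ span (range Y) ⊔ I) :
    ∃ (e : ℕ) (g : Fin e → B), (∀ i, g i ∈ I) ∧ IsRSOP (Sum.elim Y g) := by
  let f := fun j => ((maximalIdeal B).toCotangent ⟨Y j, hY j⟩ : CotangentSpace B)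
  have hf : LinearIndependent (ResidueField B) f := (linearIndependent_toCotangent_iff hY).2 hli
  let W := Submodule.span (ResidueField B) (range f)
  let h : I → CotangentSpace B ⧸ W := fun b =>
    W.mkQ ((maximalIdeal B).toCotangent ⟨b.1, hI b.2⟩ : CotangentSpace B)
  have htop : Submodule.span (ResidueField B) (range h) = ⊤ := by
    rw [eq_top_iff]
    rintro v -
    obtain ⟨w, rfl⟩ := W.mkQ_surjective v
    obtain ⟨⟨b, hb⟩, rfl⟩ := (maximalIdeal B).toCotangent_surjective w
    obtain ⟨y, hy, b', hb', rfl⟩ := Submodule.mem_sup.1 (hgen hb)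
    have hy' : y ∈ maximalIdeal B := span_le.2 (by rintro _ ⟨j, rfl⟩; exact hY j) hy
    have h1 : ((maximalIdeal B).toCotangent ⟨y, hy'⟩ : CotangentSpace B) ∈ W := by
      obtain ⟨c, hc⟩ := mem_span_range_iff_exists_fun.1 hy
      have h2 : (⟨y, hy'⟩ : maximalIdeal B) = ∑ i, c i • ⟨Y i, hY i⟩ := Subtype.ext (by simp [← hc])
      rw [h2, map_sum]
      refine sum_mem fun i _ => ?_
      rw [map_smul]
      exact W.smul_mem (residue B (c i)) (Submodule.subset_span ⟨i, rfl⟩)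
    have h3 : (⟨y + b', hb⟩ : maximalIdeal B) = ⟨y, hy'⟩ + ⟨b', hI hb'⟩ := rfl
    rw [h3, map_add, map_add, show W.mkQ _ = 0 from (Submodule.Quotient.mk_eq_zero W).2 h1, zero_add]
    exact Submodule.subset_span ⟨⟨b', hb'⟩, rfl⟩
  obtain ⟨b, hb, hspan, hbli⟩ := exists_linearIndependent (ResidueField B) (range h)
  have hfin : Finite b := hbli.finite
  obtain ⟨e, ⟨ε⟩⟩ := Finite.exists_equiv_fin b
  choose g hg using fun i : Fin e => hb (ε.symm i).2
  have hgY : ∀ i, Sum.elim Y (fun i => (g i).1) i ∈ maximalIdeal B := by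
    rintro (i | i)
    · exact hY i
    · exact hI (g i).2
  have hfam : (fun i => ((maximalIdeal B).toCotangent ⟨Sum.elim Y (fun i => (g i).1) i, hgY i⟩ : CotangentSpace B)) =
      Sum.elim f (fun i => (maximalIdeal B).toCotangent ⟨(g i).1, hI (g i).2⟩) := by
    ext1 i
    rcases i with i | i <;> rfl
  refine ⟨e, fun i => (g i).1, fun i => (g i).2, isRSOP_of_isRegularLocalRing hgY ?_ ?_⟩
  · rw [hfam]
    refine LinearIndependent.sumElim_of_quotient (M' := W)
      (f := fun i => ⟨f i, Submodule.subset_span ⟨i, rfl⟩⟩) ?_ _ ?_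
    · exact LinearIndependent.of_comp W.subtype hf
    · have h1 := hbli.comp _ ε.symm.injective
      have h2 : Subtype.val ∘ ε.symm = fun i => h (g i) := funext fun i => (hg i).symm
      rw [h2] at h1
      exact h1
  · rw [hfam, Set.Sum.elim_range, Submodule.span_union]
    have h1 : (Submodule.span (ResidueField B) (range fun i =>
        ((maximalIdeal B).toCotangent ⟨(g i).1, hI (g i).2⟩ : CotangentSpace B))).map W.mkQ = ⊤ := by
      rw [Submodule.map_span, ← Set.range_comp, ← htop, ← hspan]
      congr 1
      ext v
      constructor
      · rintro ⟨i, rfl⟩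
        change h (g i) ∈ b
        rw [hg i]
        exact (ε.symm i).2
      · intro hv
        refine ⟨ε ⟨v, hv⟩, ?_⟩
        have := hg (ε ⟨v, hv⟩)
        rw [ε.symm_apply_apply] at this
        exact this
    have h2 := congrArg (Submodule.comap W.mkQ) h1
    rwa [Submodule.comap_map_mkQ, Submodule.comap_top] at h2

theorem exists_isRSOP [IsRegularLocalRing B] : ∃ (d : ℕ) (x : Fin d → B), IsRSOP x := by
  obtain ⟨e, g, -, h⟩ := exists_isRSOP_sumElim (B := B) (d := 0) (Y := Fin.elim0) (fun j => j.elim0)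
    (fun _ _ i => i.elim0) le_rfl le_sup_right
  have h1 : range (Sum.elim Fin.elim0 g) = range g := by
    rw [Set.Sum.elim_range, Set.range_eq_empty, Set.empty_union]
  refine ⟨e, g, inferInstance, h1 ▸ h.2.1, h.2.2.trans ?_⟩
  simp

end Cotangent

open IsLocalRing in
theorem Derivation.apply_eq_zero_of_mem_sq {F B : Type*} [CommRing F] [CommRing B] [IsLocalRing B]
    [Algebra F B] (D : Derivation F B (ResidueField B)) {h : B} (hh : h ∈ maximalIdeal B ^ 2) : D h = 0 := by
  rw [pow_two] at hh
  refine Submodule.mul_induction_on hh (fun a ha b hb => ?_) fun a b ha hb => ?_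
  · rw [D.leibniz, Algebra.smul_def, Algebra.smul_def, ResidueField.algebraMap_eq,
      (residue_eq_zero_iff a).2 ha, (residue_eq_zero_iff b).2 hb, zero_mul, zero_mul, add_zero]
  · rw [map_add, ha, hb, add_zero]

/-- A derivation which kills `k` is `k`-linear. -/
def Derivation.ofKills {F k B M : Type*} [CommRing F] [CommRing k] [CommRing B] [Algebra F k]
    [Algebra k B] [Algebra F B] [AddCommGroup M] [Module F M] [Module k M] [Module B M]
    [IsScalarTower k B M] (E : Derivation F B M) (hE : ∀ a, E (algebraMap k B a) = 0) :
    Derivation k B M :=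
  Derivation.mk'
    { toFun := E
      map_add' := map_add E
      map_smul' := fun (a : k) b => by
        rw [Algebra.smul_def, E.leibniz, hE, smul_zero, add_zero, algebraMap_smul, RingHom.id_apply] }
    E.leibniz

open IsLocalRing in
/-- If derivations of `k` extend to `Λ` then the differentials of a regular parameter
of a local algebra which is of higher order on `Λ` is not zero. -/
theorem exists_derivation_apply_ne_zero (F : Type v) {k B Λ : Type u} [Field F] [Field k]
    [CommRing B] [IsLocalRing B] [CommRing Λ] [IsLocalRing Λ] [Algebra F k] [Algebra k B] [Algebra F B]
    [Algebra F Λ] [Algebra k Λ] [Algebra B Λ] [IsScalarTower F k B] [IsScalarTower F k Λ]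
    [IsScalarTower k B Λ] [IsScalarTower F B Λ] [IsLocalHom (algebraMap B Λ)]
    [FormallySmooth F (ResidueField B)]
    (hext : ∀ δ : Derivation F k (ResidueField Λ), ∃ D : Derivation F Λ (ResidueField Λ),
      ∀ a, D (algebraMap k Λ a) = δ a)
    {h : B} (hh : h ∈ maximalIdeal B) (hh2 : h ∉ maximalIdeal B ^ 2)
    (hhΛ : algebraMap B Λ h ∈ maximalIdeal Λ ^ 2) :
    ∃ E : Derivation k B (ResidueField B), E h ≠ 0 := by
  obtain ⟨D, hD⟩ := exists_derivation_of_notMem_sq F hh hh2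
  let DK : Derivation F B (ResidueField Λ) :=
    ((Algebra.linearMap (ResidueField B) (ResidueField Λ)).restrictScalars B).compDer D
  have hDK : ∀ b, DK b = algebraMap (ResidueField B) (ResidueField Λ) (D b) := fun b => rfl
  obtain ⟨D', hD'⟩ := hext (DK.compAlgebraMap k)
  let D'' : Derivation F B (ResidueField Λ) := D'.compAlgebraMap B
  have hD'' : ∀ b, D'' b = D' (algebraMap B Λ b) := fun b => rfl
  let E : Derivation k B (ResidueField Λ) := (DK - D'').ofKills fun a => by
    rw [Derivation.sub_apply, hD'', ← IsScalarTower.algebraMap_apply, hD', sub_eq_zero]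
    rfl
  have hE : E h ≠ 0 := by
    change DK h - D'' h ≠ 0
    rw [hD'', D'.apply_eq_zero_of_mem_sq hhΛ, sub_zero, hDK]
    exact (map_ne_zero _).2 hD
  obtain ⟨f, hf⟩ : ∃ f : Module.Dual (ResidueField B) (ResidueField Λ), f (E h) ≠ 0 := by
    by_contra! hf
    exact hE ((Module.forall_dual_apply_eq_zero_iff (ResidueField B) (E h)).1 hf)
  exact ⟨(f.restrictScalars B).compDer E, hf⟩

open IsLocalRing TensorProduct KaehlerDifferential in
theorem exists_dual_derivations {k B : Type u} [Field k] [CommRing B] [IsLocalRing B] [Algebra k B]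
    {τ : Type u} (t : τ → B) (ht : ∀ E : Derivation k B (ResidueField B), (∀ i, E (t i) = 0) → E = 0)
    {e : ℕ} (g : Fin e → B) (hg : ∀ i, g i ∈ maximalIdeal B)
    (hgE : ∀ c : Fin e → B, (∃ i, c i ∉ maximalIdeal B) →
      ∃ E : Derivation k B (ResidueField B), E (∑ i, c i * g i) ≠ 0) :
    ∃ T : Set τ, (∀ i₀, ∃ E : Derivation k B (ResidueField B), (∀ j ∈ T, E (t j) = 0) ∧
        E (g i₀) = 1 ∧ ∀ i, i ≠ i₀ → E (g i) = 0) ∧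
      ∀ E : Derivation k B (ResidueField B), (∀ j ∈ T, E (t j) = 0) → (∀ i, E (g i) = 0) → E = 0 := by
  classical
  let dd : B → ResidueField B ⊗[B] Ω[B⁄k] := fun b => 1 ⊗ₜ KaehlerDifferential.D k B b
  have key : ∀ (E : Derivation k B (ResidueField B)) (b : B),
      LinearMap.liftBaseChange (ResidueField B) E.liftKaehlerDifferential (dd b) = E b := fun E x => by
    simp [dd]
  let der : Module.Dual (ResidueField B) (ResidueField B ⊗[B] Ω[B⁄k]) →
      Derivation k B (ResidueField B) := fun f =>
    ((f.restrictScalars B).comp (TensorProduct.mk B (ResidueField B) _ 1)).compDer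
      (KaehlerDifferential.D k B)
  have hder : ∀ f b, der f b = f (dd b) := fun f b => rfl
  have hdd : ∀ c : Fin e → B, dd (∑ i, c i * g i) = ∑ i, residue B (c i) • dd (g i) := by
    intro c
    change TensorProduct.mk B (ResidueField B) _ 1 _ = _
    rw [map_sum, map_sum]
    refine sum_congr rfl fun i _ => ?_
    rw [Derivation.leibniz, map_add, map_smul, map_smul, TensorProduct.mk_apply, TensorProduct.mk_apply,
      TensorProduct.smul_tmul', TensorProduct.smul_tmul', Algebra.smul_def, Algebra.smul_def (g i),
      ResidueField.algebraMap_eq, (residue_eq_zero_iff (g i)).2 (hg i), zero_mul, zero_tmul, add_zero,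
      TensorProduct.smul_tmul', smul_eq_mul]
  have hli : LinearIndependent (ResidueField B) fun i => dd (g i) := by
    rw [Fintype.linearIndependent_iff]
    intro a ha
    choose c hc using fun i => residue_surjective (a i)
    obtain rfl : a = fun i => residue B (c i) := funext fun i => (hc i).symm
    by_contra! hne
    obtain ⟨i, hi⟩ := hne
    obtain ⟨E, hE⟩ := hgE c ⟨i, fun h => hi ((residue_eq_zero_iff _).2 h)⟩
    rw [← key, hdd, ha, map_zero] at hE
    exact hE rfl
  have hspan : Submodule.span (ResidueField B) (range fun i => dd (t i)) = ⊤ := by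
    by_contra hne
    obtain ⟨f, hf0, hf⟩ := Submodule.exists_le_ker_of_lt_top _ (lt_top_iff_ne_top.2 hne)
    have h1 := ht (der f) fun i => hf (Submodule.subset_span ⟨i, rfl⟩)
    refine hf0 (LinearMap.restrictScalars_injective B ?_)
    refine TensorProduct.ext' fun a w => ?_
    have h2 : f.restrictScalars B ∘ₗ (TensorProduct.mk B (ResidueField B) (Ω[B⁄k]) 1) = 0 :=
      Derivation.liftKaehlerDifferential_unique _ _ (Derivation.ext fun b => by
        exact congrArg (fun D : Derivation k B (ResidueField B) => D b) h1)
    have h3 : f (1 ⊗ₜ w) = 0 := LinearMap.congr_fun h2 w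
    change f (a ⊗ₜ w) = 0
    rw [show a ⊗ₜ[B] w = a • (1 ⊗ₜ[B] w) by rw [TensorProduct.smul_tmul', smul_eq_mul, mul_one],
      map_smul, h3, smul_zero]
  obtain ⟨b, hb, hsb, htb, hbli⟩ := exists_linearIndepOn_id_extension
    (K := ResidueField B) (s := range fun i => dd (g i))
    (t := range (fun i => dd (g i)) ∪ range fun i => dd (t i))
    hli.linearIndepOn_id Set.subset_union_left
  have hbtop : ⊤ ≤ Submodule.span (ResidueField B) (range ((↑) : b → ResidueField B ⊗[B] Ω[B⁄k])) := by
    rw [Subtype.range_coe, ← hspan, Submodule.span_le]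
    exact fun v hv => htb (Or.inr hv)
  let bb := Module.Basis.mk hbli.linearIndependent hbtop
  refine ⟨{j | dd (t j) ∈ b \ range fun i => dd (g i)}, fun i₀ => ?_, fun E hET hEg => ?_⟩
  · let i₀' : b := ⟨dd (g i₀), hsb ⟨i₀, rfl⟩⟩
    have hco : ∀ (v) (hv : v ∈ b), v ≠ dd (g i₀) → bb.coord i₀' v = 0 := fun v hv hne => by
      have h1 : bb ⟨v, hv⟩ = v := Module.Basis.mk_apply _ _ _
      rw [← h1, Module.Basis.coord_apply, Module.Basis.repr_self, Finsupp.single_apply, if_neg]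
      exact fun h => hne (congrArg Subtype.val h)
    refine ⟨der (bb.coord i₀'), fun j hj => ?_, ?_, fun i hi => ?_⟩
    · exact hco _ hj.1 fun h => hj.2 ⟨i₀, h.symm⟩
    · rw [hder]
      have h1 : bb i₀' = dd (g i₀) := Module.Basis.mk_apply _ _ _
      rw [← h1, Module.Basis.coord_apply, Module.Basis.repr_self, Finsupp.single_eq_same]
    · exact hco _ (hsb ⟨i, rfl⟩) fun h => hi (hli.injective h)
  · refine Derivation.ext fun x => ?_
    rw [← key, Derivation.zero_apply]
    have h1 : LinearMap.liftBaseChange (ResidueField B) E.liftKaehlerDifferential = 0 := by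
      refine bb.ext fun v => ?_
      rw [Module.Basis.mk_apply, LinearMap.zero_apply]
      by_cases hv : v.1 ∈ range fun i => dd (g i)
      · obtain ⟨i, hi⟩ := hv
        rw [← hi]
        exact (key E _).trans (hEg i)
      · obtain ⟨j, hj⟩ := (hb v.2).resolve_left hv
        rw [← hj]
        refine (key E _).trans (hET j ?_)
        change dd (t j) ∈ b \ range fun i => dd (g i)
        rw [show dd (t j) = v from hj]
        exact ⟨v.2, hv⟩
    rw [h1, LinearMap.zero_apply]

theorem MvPolynomial.formallySmooth_of_rename {k τ : Type u} [CommRing k] (T : Set τ)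
    [Algebra (MvPolynomial T k) (MvPolynomial τ k)]
    (h : algebraMap (MvPolynomial T k) (MvPolynomial τ k) = (rename Subtype.val).toRingHom) :
    FormallySmooth (MvPolynomial T k) (MvPolynomial τ k) := by
  classical
  refine .of_comp_surjective fun Q _ _ I _ f => ?_
  choose q hq using fun i : τ => mk_surjective (f (X i))
  let s : MvPolynomial τ k →+* Q := eval₂Hom ((algebraMap (MvPolynomial T k) Q).comp C)
    fun i => if hi : i ∈ T then algebraMap (MvPolynomial T k) Q (X ⟨i, hi⟩) else q i
  have hC : ∀ a, algebraMap (MvPolynomial T k) (MvPolynomial τ k) (C a) = C a := fun a => by simp [h]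
  have hX : ∀ i, algebraMap (MvPolynomial T k) (MvPolynomial τ k) (X i) = X i.1 := fun a => by simp [h]
  have hs : s.comp (algebraMap (MvPolynomial T k) (MvPolynomial τ k)) =
      algebraMap (MvPolynomial T k) Q := by
    refine MvPolynomial.ringHom_ext (fun a => ?_) fun i => ?_
    · simp [hC, s]
    · simp [hX, s]
  refine ⟨{ s with commutes' := fun r => RingHom.congr_fun hs r }, ?_⟩
  refine AlgHom.coe_ringHom_injective (MvPolynomial.ringHom_ext (fun a => ?_) fun i => ?_)
  · change mk I (s (C a)) = f (C a)
    rw [← hC, f.commutes]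
    exact congrArg _ (RingHom.congr_fun hs _)
  · change mk I (s (X i)) = f (X i)
    by_cases hi : i ∈ T
    · rw [show (X i : MvPolynomial τ k) = algebraMap (MvPolynomial T k) (MvPolynomial τ k) (X ⟨i, hi⟩) from
        (hX ⟨i, hi⟩).symm, f.commutes]
      exact congrArg _ (RingHom.congr_fun hs _)
    · rw [← hq]
      simp [s, hi]

open IsLocalRing TensorProduct KaehlerDifferential in
theorem Algebra.FormallySmooth.of_dual_derivations {R B S : Type u} [CommRing R] [CommRing B] [CommRing S]
    [IsLocalRing S] [Algebra R B] [Algebra B S] [Algebra R S] [IsScalarTower R B S]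
    [FormallySmooth R B] [Module.Free B (Ω[B⁄R])] [Module.Finite B (Ω[B⁄R])]
    (hsurj : Surjective (algebraMap B S)) {e : ℕ} {g : Fin e → B}
    (hker : ker (algebraMap B S) = span (range g))
    (hE : ∀ i₀, ∃ E : Derivation R B (ResidueField S), E (g i₀) = 1 ∧ ∀ i, i ≠ i₀ → E (g i) = 0) :
    FormallySmooth R S := by
  rw [FormallySmooth.iff_injective_cotangentComplexBaseChange_residueField B hsurj
    (hker ▸ Submodule.fg_span (Set.finite_range g))]
  have hg : ∀ i, g i ∈ ker (algebraMap B S) := fun i => hker ▸ subset_span ⟨i, rfl⟩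
  let w : Fin e → ResidueField S ⊗[B] ker (algebraMap B S) := fun i => 1 ⊗ₜ ⟨g i, hg i⟩
  have hspan : ∀ z, z ∈ Submodule.span (ResidueField S) (range w) := by
    intro z
    induction z with
    | zero => exact zero_mem _
    | add x y hx hy => exact add_mem hx hy
    | tmul a y =>
      obtain ⟨y, hy⟩ := y
      obtain ⟨c, hc⟩ := mem_span_range_iff_exists_fun.1 (hker ▸ hy)
      obtain rfl := hc
      have h1 : (⟨∑ i, c i * g i, hy⟩ : ker (algebraMap B S)) = ∑ i, c i • ⟨g i, hg i⟩ :=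
        Subtype.ext (by simp)
      rw [h1, TensorProduct.tmul_sum]
      refine sum_mem fun i _ => ?_
      have h2 : a ⊗ₜ[B] (c i • (⟨g i, hg i⟩ : ker (algebraMap B S))) = (c i • a) • w i := by
        rw [TensorProduct.tmul_smul, TensorProduct.smul_tmul', TensorProduct.smul_tmul', smul_eq_mul,
          mul_one]
      rw [h2]
      exact Submodule.smul_mem _ _ (Submodule.subset_span ⟨i, rfl⟩)
  rw [injective_iff_map_eq_zero]
  intro z hz
  obtain ⟨c, rfl⟩ := (Submodule.mem_span_range_iff_exists_fun _).1 (hspan z)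
  have h0 : ∀ i, c i = 0 := by
    intro i₀
    obtain ⟨E, hE1, hE0⟩ := hE i₀
    have h1 := congrArg (LinearMap.liftBaseChange (ResidueField S) E.liftKaehlerDifferential) hz
    have h2 : ∀ i, LinearMap.liftBaseChange (ResidueField S) E.liftKaehlerDifferential
        (cotangentComplexBaseChange R S B (ResidueField S) (w i)) = E (g i) := fun i => by
      rw [cotangentComplexBaseChange_tmul, kerToTensor_apply]
      simp
    rw [map_sum, map_sum, map_zero, Finset.sum_eq_single i₀] at h1
    · rw [map_smul, map_smul, h2, hE1, smul_eq_mul, mul_one] at h1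
      exact h1
    · intro i _ hi
      rw [map_smul, map_smul, h2, hE0 i hi, smul_zero]
    · exact fun h => absurd (mem_univ _) h
  simp [h0]

open IsLocalRing TensorProduct KaehlerDifferential in
theorem Algebra.FormallyUnramified.of_forall_derivation_eq_zero {R S : Type u} [CommRing R] [CommRing S]
    [IsLocalRing S] [Algebra R S] [EssFiniteType R S]
    (h : ∀ E : Derivation R S (ResidueField S), E = 0) : Algebra.FormallyUnramified R S := by
  refine ⟨?_⟩
  rw [← IsLocalRing.subsingleton_tensorProduct (R := S), subsingleton_iff_forall_eq 0]
  intro z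
  rw [← Module.forall_dual_apply_eq_zero_iff (ResidueField S)]
  intro f
  have h1 : f.restrictScalars S ∘ₗ (TensorProduct.mk S (ResidueField S) (Ω[S⁄R]) 1) = 0 :=
    Derivation.liftKaehlerDifferential_unique _ _
      ((h ((f.restrictScalars S ∘ₗ (TensorProduct.mk S (ResidueField S) (Ω[S⁄R]) 1)).compDer
        (D R S))).trans (by ext; rfl))
  induction z with
  | zero => exact map_zero f
  | add x y hx hy => rw [map_add, hx, hy, add_zero]
  | tmul a w =>
    have h3 : f (1 ⊗ₜ w) = 0 := LinearMap.congr_fun h1 w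
    rw [show a ⊗ₜ[S] w = a • (1 ⊗ₜ[S] w) by rw [TensorProduct.smul_tmul', smul_eq_mul, mul_one],
      map_smul, h3, smul_zero]

theorem Derivation.apply_algebraMap_eq_zero_of_X {k B τ M : Type u} [CommRing k] [CommRing B] [Algebra k B]
    [Algebra (MvPolynomial τ k) B] [IsScalarTower k (MvPolynomial τ k) B] [AddCommGroup M] [Module k M]
    [Module B M] [IsScalarTower k B M] (E : Derivation k B M)
    (hE : ∀ i, E (algebraMap (MvPolynomial τ k) B (X i)) = 0) (f : MvPolynomial τ k) :
    E (algebraMap (MvPolynomial τ k) B f) = 0 := by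
  induction f using MvPolynomial.induction_on with
  | C a =>
    rw [← MvPolynomial.algebraMap_eq, ← IsScalarTower.algebraMap_apply, E.map_algebraMap]
  | add p q hp hq => rw [map_add, map_add, hp, hq, add_zero]
  | mul_X p i hp => rw [map_mul, E.leibniz, hp, hE, smul_zero, smul_zero, add_zero]

open IsLocalRing KaehlerDifferential in
/-- The quotient of a smooth local algebra by a suitable sequence is étale over a polynomial
algebra. -/
theorem formallyEtale_quotient_of_dual_derivations {R k B : Type u} [CommRing R] [Field k] [CommRing B] [IsLocalRing B]
    [Algebra k R] [Algebra k B] [Algebra R B] [IsScalarTower k R B] [FormallySmooth R B]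
    [EssFiniteType R B] {e : ℕ} {g : Fin e → B}
    (hg : ∀ i, g i ∈ maximalIdeal B)
    (hE : ∀ i₀, ∃ E : Derivation k B (ResidueField B), (∀ r, E (algebraMap R B r) = 0) ∧
        E (g i₀) = 1 ∧ ∀ i, i ≠ i₀ → E (g i) = 0)
    (hE' : ∀ E : Derivation k B (ResidueField B), (∀ r, E (algebraMap R B r) = 0) →
      (∀ i, E (g i) = 0) → E = 0) :
    FormallySmooth R (B ⧸ span (range g)) ∧ Algebra.FormallyUnramified R (B ⧸ span (range g)) := by
  have hle : span (range g) ≤ maximalIdeal B := span_le.2 (by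
    rintro _ ⟨i, rfl⟩
    exact hg i)
  have hnt : Nontrivial (B ⧸ span (range g)) := Ideal.Quotient.nontrivial_iff.2
    (ne_top_of_le_ne_top Ideal.IsPrime.ne_top' hle)
  have hloc : IsLocalRing (B ⧸ span (range g)) :=
    .of_surjective' _ mk_surjective
  have hlh : IsLocalHom (algebraMap B (B ⧸ span (range g))) :=
    .of_surjective _ mk_surjective
  have hsurj : Surjective (algebraMap B (B ⧸ span (range g))) :=
    mk_surjective
  let ρ : ResidueField B →ₗ[B] ResidueField (B ⧸ span (range g)) :=
    (Algebra.linearMap (ResidueField B) _).restrictScalars B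
  have hρs : Surjective ρ := by
    intro a
    obtain ⟨b, rfl⟩ := residue_surjective a
    obtain ⟨c, rfl⟩ := hsurj b
    exact ⟨residue B c, rfl⟩
  have hρi : Injective ρ :=
    (algebraMap (ResidueField B) (ResidueField (B ⧸ span (range g)))).injective
  have hρ1 : ρ 1 = 1 := map_one (algebraMap (ResidueField B) _)
  let ε := LinearEquiv.ofBijective ρ ⟨hρi, hρs⟩
  constructor
  · have : Module.Free B (Ω[B⁄R]) := Module.free_of_flat_of_isLocalRing
    refine FormallySmooth.of_dual_derivations hsurj (by
      rw [Ideal.Quotient.algebraMap_eq, mk_ker]) fun i₀ => ?_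
    obtain ⟨E, hER, h1, h0⟩ := hE i₀
    refine ⟨ρ.compDer (E.ofKills hER), ?_, fun i hi => ?_⟩
    · exact (congrArg ρ h1).trans hρ1
    · exact (congrArg ρ (h0 i hi)).trans (map_zero ρ)
  · refine Algebra.FormallyUnramified.of_forall_derivation_eq_zero fun E => ?_
    let E' : Derivation k B (ResidueField B) :=
      (ε.symm.toLinearMap.compDer (E.compAlgebraMap B)).restrictScalars k
    have hE'a : ∀ b, E' b = ε.symm (E (algebraMap B _ b)) := fun b => rfl
    have h1 := hE' E' (fun r => by
      rw [hE'a, ← IsScalarTower.algebraMap_apply, E.map_algebraMap, map_zero]) fun i => by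
      have hgi : mk (span (range g)) (g i) = 0 :=
        eq_zero_iff_mem.2 (subset_span ⟨i, rfl⟩)
      rw [hE'a, Ideal.Quotient.algebraMap_eq, hgi, map_zero, map_zero]
    ext b
    obtain ⟨b, rfl⟩ := hsurj b
    have h2 := hE'a b
    rw [h1, Derivation.zero_apply] at h2
    rw [Derivation.zero_apply]
    exact (ε.symm.map_eq_zero_iff).1 h2.symm

open IsLocalRing in
/-- The data of a regular local ring `D` which is smooth over `k`, with a local homomorphism
`D → B` such that `B ⧸ I` is flat and étale over `D`. -/
structure EtaleModel (k B : Type u) [Field k] [CommRing B] [IsLocalRing B] [Algebra k B] (I : Ideal B) where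
  D : Type u
  [commRing : CommRing D]
  [isRegularLocalRing : IsRegularLocalRing D]
  [algebra : Algebra k D]
  [algebraB : Algebra D B]
  [isScalarTower : IsScalarTower k D B]
  [essFiniteType : EssFiniteType k D]
  [formallySmooth : FormallySmooth k D]
  [isLocalHom : IsLocalHom (algebraMap D B)]
  [flat_quotient : Module.Flat D (B ⧸ I)]
  [formallySmooth_quotient : FormallySmooth D (B ⧸ I)]
  [formallyUnramified_quotient : Algebra.FormallyUnramified D (B ⧸ I)]
  [essFiniteType_quotient : EssFiniteType D (B ⧸ I)]

attribute [instance] EtaleModel.commRing EtaleModel.isRegularLocalRing EtaleModel.algebra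
  EtaleModel.algebraB EtaleModel.isScalarTower EtaleModel.essFiniteType EtaleModel.formallySmooth
  EtaleModel.isLocalHom EtaleModel.flat_quotient EtaleModel.formallySmooth_quotient
  EtaleModel.formallyUnramified_quotient EtaleModel.essFiniteType_quotient

open IsLocalRing in
theorem EtaleModel.nonempty_of_dual_derivations {R k B : Type u} [CommRing R] [Field k] [CommRing B] [IsLocalRing B]
    [IsNoetherianRing B] [IsRegularRing R]
    [Algebra k R] [Algebra k B] [Algebra R B] [IsScalarTower k R B] [FormallySmooth R B]
    [EssFiniteType R B] [Module.Flat R B] [EssFiniteType k R] [FormallySmooth k R]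
    {e : ℕ} {g : Fin e → B} (hg : ∀ i, g i ∈ maximalIdeal B)
    (hE : ∀ i₀, ∃ E : Derivation k B (ResidueField B), (∀ r, E (algebraMap R B r) = 0) ∧
        E (g i₀) = 1 ∧ ∀ i, i ≠ i₀ → E (g i) = 0)
    (hE' : ∀ E : Derivation k B (ResidueField B), (∀ r, E (algebraMap R B r) = 0) →
      (∀ i, E (g i) = 0) → E = 0) :
    Nonempty (EtaleModel k B (span (range g))) := by
  obtain ⟨hFS, hFU⟩ := formallyEtale_quotient_of_dual_derivations hg hE hE'
  let p : Ideal R := (maximalIdeal B).comap (algebraMap R B)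
  have hunit : ∀ y : p.primeCompl, IsUnit (algebraMap R B y) := fun y => by
    by_contra h
    exact y.2 h
  let : Algebra (AtPrime p) B := (IsLocalization.lift hunit).toAlgebra
  have htow : IsScalarTower R (AtPrime p) B :=
    .of_algebraMap_eq fun r => (IsLocalization.lift_eq hunit r).symm
  have htowk : IsScalarTower k (AtPrime p) B := .of_algebraMap_eq fun r => by
    rw [IsScalarTower.algebraMap_apply k R (AtPrime p), ← IsScalarTower.algebraMap_apply R,
      ← IsScalarTower.algebraMap_apply]
  have hloc : IsLocalHom (algebraMap (AtPrime p) B) := by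
    refine ⟨fun a ha => ?_⟩
    obtain ⟨r, s, rfl⟩ := IsLocalization.exists_mk'_eq p.primeCompl a
    rw [IsLocalization.AtPrime.isUnit_mk'_iff _ p]
    intro hr
    have h1 : algebraMap (AtPrime p) B (IsLocalization.mk' _ r s) * algebraMap R B s =
        algebraMap R B r := by
      rw [IsScalarTower.algebraMap_apply R (AtPrime p) B,
        IsScalarTower.algebraMap_apply R (AtPrime p) B, ← map_mul, IsLocalization.mk'_spec]
    have h2 := ha.mul (hunit s)
    rw [h1] at h2
    exact hr h2
  have hflatB : Module.Flat (AtPrime p) B :=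
    (Module.flat_iff_of_isLocalization (AtPrime p) p.primeCompl B).2 inferInstance
  have hFS1 : FormallySmooth (AtPrime p) (B ⧸ span (range g)) :=
    FormallySmooth.localization_base p.primeCompl
  have hFU1 : Algebra.FormallyUnramified (AtPrime p) (B ⧸ span (range g)) :=
    Algebra.FormallyUnramified.of_restrictScalars R _ _
  have hflat : Module.Flat (AtPrime p) (B ⧸ span (range g)) :=
    FormallySmooth.flat_of_algHom_of_isNoetherianRing
      (Ideal.Quotient.mkₐ (AtPrime p) (span (range g)))
      (Ideal.Quotient.mkₐ_surjective _ _)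
  have hEB : EssFiniteType R (B ⧸ span (range g)) := .comp R B _
  have hEk : EssFiniteType R (AtPrime p) := .of_isLocalization _ p.primeCompl
  have hEk2 : EssFiniteType k (AtPrime p) := .comp k R _
  have hE1 : EssFiniteType (AtPrime p) (B ⧸ span (range g)) :=
    .of_comp R _ _
  exact ⟨{ D := AtPrime p }⟩

open IsLocalRing in
theorem EtaleModel.nonempty {k τ : Type u} [Field k] [Finite τ] (P : Ideal (MvPolynomial τ k)) [P.IsPrime]
    {e : ℕ} {g : Fin e → AtPrime P} (hg : ∀ i, g i ∈ maximalIdeal (AtPrime P))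
    (hgE : ∀ c : Fin e → AtPrime P, (∃ i, c i ∉ maximalIdeal (AtPrime P)) →
      ∃ E : Derivation k (AtPrime P) (ResidueField (AtPrime P)), E (∑ i, c i * g i) ≠ 0) :
    Nonempty (EtaleModel k (AtPrime P) (span (range g))) := by
  obtain ⟨T, hT, hT'⟩ := exists_dual_derivations
    (fun i : τ => algebraMap (MvPolynomial τ k) (AtPrime P) (X i)) (fun E hE => by
      have h0 := E.apply_algebraMap_eq_zero_of_X hE
      ext b
      obtain ⟨r, s, rfl⟩ := IsLocalization.exists_mk'_eq P.primeCompl b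
      have h1 := congrArg E (IsLocalization.mk'_spec (AtPrime P) r s)
      rw [E.leibniz, h0, h0, smul_zero, zero_add, Algebra.smul_def] at h1
      refine (mul_eq_zero.1 h1).resolve_left fun h => ?_
      have h2 := (IsLocalization.map_units (AtPrime P) s).map
        (algebraMap (AtPrime P) (ResidueField (AtPrime P)))
      rw [h] at h2
      exact not_isUnit_zero h2) g hg hgE
  let : Algebra (MvPolynomial T k) (MvPolynomial τ k) := (rename Subtype.val).toRingHom.toAlgebra
  have hmap : algebraMap (MvPolynomial T k) (MvPolynomial τ k) = (rename Subtype.val).toRingHom := rfl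
  have ht1 : IsScalarTower k (MvPolynomial T k) (MvPolynomial τ k) := .of_algebraMap_eq fun r => by
    rw [hmap]
    simp [MvPolynomial.algebraMap_eq]
  have ht3 : IsScalarTower k (MvPolynomial T k) (AtPrime P) := .of_algebraMap_eq fun r => by
    rw [IsScalarTower.algebraMap_apply (MvPolynomial T k) (MvPolynomial τ k) (AtPrime P),
      ← IsScalarTower.algebraMap_apply k, ← IsScalarTower.algebraMap_apply k]
  have hfs : FormallySmooth (MvPolynomial T k) (MvPolynomial τ k) :=
    MvPolynomial.formallySmooth_of_rename T hmap
  have hft : FiniteType (MvPolynomial T k) (MvPolynomial τ k) :=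
    .of_restrictScalars_finiteType k _ _
  have hfp : FinitePresentation (MvPolynomial T k) (MvPolynomial τ k) :=
    .of_finiteType.1 hft
  have hsm : Smooth (MvPolynomial T k) (MvPolynomial τ k) := ⟨hfs, hfp⟩
  have hfl : Module.Flat (MvPolynomial τ k) (AtPrime P) :=
    IsLocalization.flat _ P.primeCompl
  have hfl2 : Module.Flat (MvPolynomial T k) (AtPrime P) :=
    .trans _ (MvPolynomial τ k) _
  have hfsl : FormallySmooth (MvPolynomial τ k) (AtPrime P) :=
    .of_isLocalization P.primeCompl
  have hfs2 : FormallySmooth (MvPolynomial T k) (AtPrime P) :=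
    .comp _ (MvPolynomial τ k) _
  have hel : EssFiniteType (MvPolynomial τ k) (AtPrime P) :=
    .of_isLocalization _ P.primeCompl
  have hel2 : EssFiniteType (MvPolynomial T k) (AtPrime P) :=
    .comp _ (MvPolynomial τ k) _
  have hXT : ∀ i : T, algebraMap (MvPolynomial T k) (AtPrime P) (X i) =
      algebraMap (MvPolynomial τ k) (AtPrime P) (X i.1) := fun i => by
    rw [IsScalarTower.algebraMap_apply (MvPolynomial T k) (MvPolynomial τ k) (AtPrime P), hmap]
    simp
  refine EtaleModel.nonempty_of_dual_derivations (R := MvPolynomial T k) hg (fun i₀ => ?_) fun E hE hEg => ?_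
  · obtain ⟨E, h1, h2, h3⟩ := hT i₀
    exact ⟨E, E.apply_algebraMap_eq_zero_of_X fun i => by rw [hXT]; exact h1 i i.2, h2, h3⟩
  · exact hT' E (fun j hj => by rw [← hXT ⟨j, hj⟩]; exact hE _) hEg

section Socle

variable {S ι : Type*} [CommRing S] [IsLocalRing S] [Fintype ι] [DecidableEq ι] {X : ι → S}

theorem pow_mul_mem_span_pow {e : ι → ℕ} (i : ι) (c a : ℕ) (he : e i = c + a) {b : S}
    (hb : b ∈ span (range fun j => X j ^ (Function.update e i c j + 1))) :
    X i ^ a * b ∈ span (range fun j => X j ^ (e j + 1)) := by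
  induction hb using Submodule.span_induction with
  | zero => rw [mul_zero]; exact zero_mem _
  | add y z _ _ hy hz => rw [mul_add]; exact add_mem hy hz
  | smul r y _ hy => rw [smul_eq_mul, mul_left_comm]; exact mul_mem_left _ _ hy
  | mem y hy =>
    obtain ⟨j, rfl⟩ := hy
    by_cases hj : j = i
    · subst hj
      refine subset_span ⟨j, ?_⟩
      simp only [Function.update_self]
      rw [he, ← pow_add]
      congr 1
      omega
    · refine mul_mem_left _ _ (subset_span ⟨j, ?_⟩)
      simp only [Function.update_of_ne hj]

theorem prod_pow_eq_pow_mul_prod_update {e : ι → ℕ} (i : ι) (c a : ℕ) (he : e i = c + a) :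
    ∏ j, X j ^ e j = X i ^ a * ∏ j, X j ^ Function.update e i c j := by
  rw [← Finset.mul_prod_erase _ _ (mem_univ i),
    ← Finset.mul_prod_erase Finset.univ (fun j => X j ^ Function.update e i c j) (mem_univ i),
    Function.update_self, ← mul_assoc, ← pow_add, he, add_comm c a]
  congr 1
  refine Finset.prod_congr rfl fun j hj => ?_
  rw [Function.update_of_ne (Finset.ne_of_mem_erase hj)]

/-- Every nonzero ideal modulo powers of parameters contains the product of the parameters to the
highest possible powers. -/
theorem exists_mul_sub_prod_pow_mem (hX : span (range X) = IsLocalRing.maximalIdeal S) :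
    ∀ (N : ℕ) (e : ι → ℕ) (_ : ∑ i, e i = N) (s : S)
      (_ : s ∉ span (range fun j => X j ^ (e j + 1))),
      ∃ t, t * s - ∏ j, X j ^ e j ∈ span (range fun j => X j ^ (e j + 1)) := by
  intro N
  induction N using Nat.strong_induction_on with
  | _ N ih =>
  intro e he s hs
  by_cases h0 : ∀ i, e i = 0
  · simp only [h0, zero_add, pow_one, hX] at hs
    obtain ⟨u, rfl⟩ := (IsLocalRing.notMem_maximalIdeal.1 hs)
    exact ⟨(u⁻¹ : Sˣ), by simp [h0]⟩
  · push Not at h0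
    obtain ⟨i, hi⟩ := h0
    obtain ⟨k, hk⟩ := Nat.exists_eq_succ_of_ne_zero hi
    have hlt : ∀ c ≤ k, ∑ j, Function.update e i c j < N := fun c hc => by
      rw [← he]
      refine Finset.sum_lt_sum (fun j _ => ?_) ⟨i, mem_univ _, ?_⟩
      · by_cases hj : j = i
        · subst hj
          rw [Function.update_self]
          omega
        · rw [Function.update_of_ne hj]
      · rw [Function.update_self]
        omega
    by_cases hs' : s ∈ span (range fun j => X j ^ (Function.update e i k j + 1))
    · obtain ⟨b, hb⟩ := mem_span_range_iff_exists_fun.1 hs'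
      rw [← Finset.add_sum_erase _ _ (mem_univ i)] at hb
      have h1 : ∑ j ∈ Finset.univ.erase i, b j * X j ^ (Function.update e i k j + 1) ∈
          span (range fun j => X j ^ (e j + 1)) := sum_mem fun j hj => by
        rw [Function.update_of_ne (Finset.ne_of_mem_erase hj)]
        exact mul_mem_left _ _ (subset_span ⟨j, rfl⟩)
      have h2 : s = X i ^ (k + 1) * b i +
          ∑ j ∈ Finset.univ.erase i, b j * X j ^ (Function.update e i k j + 1) := by
        rw [← hb, Function.update_self, mul_comm (b i)]
      have h3 : b i ∉ span (range fun j => X j ^ (Function.update e i 0 j + 1)) := fun h => by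
        apply hs
        rw [h2]
        exact add_mem (pow_mul_mem_span_pow i 0 (k + 1) (by omega) h) h1
      obtain ⟨t, ht⟩ := ih _ (hlt 0 (Nat.zero_le _)) _ rfl _ h3
      refine ⟨t, ?_⟩
      have h4 := pow_mul_mem_span_pow (X := X) (e := e) i 0 (k + 1) (by omega) ht
      have h5 := add_mem h4 (mul_mem_left _ t h1)
      convert h5 using 1
      rw [prod_pow_eq_pow_mul_prod_update (X := X) (e := e) i 0 (k + 1) (by omega)]
      conv_lhs => rw [h2]
      ring
    · obtain ⟨t, ht⟩ := ih _ (hlt k le_rfl) _ rfl _ hs'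
      refine ⟨X i * t, ?_⟩
      have h4 := pow_mul_mem_span_pow (X := X) (e := e) i k 1 (by omega) ht
      rw [prod_pow_eq_pow_mul_prod_update (X := X) (e := e) i k 1 (by omega)]
      convert h4 using 1
      ring

theorem ker_le_span_pow_of_prod_pow_ne_zero {Q : Type*} [CommRing Q]
    (hX : span (range X) = IsLocalRing.maximalIdeal S) (f : S →+* Q) {n : ℕ} (hn : 1 ≤ n)
    (hf : ∀ j, f (X j ^ n) = 0) (hne : f (∏ j, X j ^ (n - 1)) ≠ 0) :
    ker f ≤ span (range fun j => X j ^ n) := by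
  obtain ⟨n, rfl⟩ := Nat.exists_eq_add_of_le' hn
  intro s hs
  by_contra h
  obtain ⟨t, ht⟩ := exists_mul_sub_prod_pow_mem hX _ (fun _ => n) rfl s h
  have hle : span (range fun j => X j ^ (n + 1)) ≤ ker f := span_le.2 (by
    rintro _ ⟨j, rfl⟩
    exact hf j)
  have h1 := (mem_ker).1 (hle ht)
  rw [map_sub, map_mul, (mem_ker).1 hs, mul_zero, zero_sub, neg_eq_zero] at h1
  exact hne h1

end Socle

open IsLocalRing in
theorem exists_isRSOP_of_flat_of_formallyUnramified {D S : Type u} [CommRing D] [IsRegularLocalRing D]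
    [CommRing S] [IsLocalRing S] [IsNoetherianRing S] [Algebra D S] [IsLocalHom (algebraMap D S)]
    [Module.Flat D S] [Algebra.FormallyUnramified D S] [EssFiniteType D S] {d : ℕ}
    (hd : ringKrullDim S = d) : ∃ X : Fin d → D, IsRSOP X ∧ IsRSOP fun j => algebraMap D S (X j) := by
  obtain ⟨s, X, hX⟩ := exists_isRSOP (B := D)
  have hspan : span (range fun j => algebraMap D S (X j)) = maximalIdeal S := by
    rw [← Algebra.FormallyUnramified.map_maximalIdeal (R := D), ← hX.2.1, map_span, ← Set.range_comp]
    rfl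
  have h1 := ringKrullDim_le_card_of_span_eq _ hspan
  have hlo : (maximalIdeal S).LiesOver (maximalIdeal D) :=
    ⟨(((local_hom_TFAE (algebraMap D S)).out 0 4 :).1 ‹IsLocalHom (algebraMap D S)›).symm⟩
  have h2 := Ideal.height_eq_height_add_of_liesOver_of_hasGoingDown (maximalIdeal D) (maximalIdeal S)
  have h3 : ringKrullDim D ≤ ringKrullDim S := by
    rw [← maximalIdeal_height_eq_ringKrullDim, ← maximalIdeal_height_eq_ringKrullDim, h2]
    exact_mod_cast le_self_add
  rw [hd, Nat.card_fin] at h1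
  rw [hd, hX.2.2, Nat.card_fin] at h3
  obtain rfl : s = d := le_antisymm (by exact_mod_cast h3) (by exact_mod_cast h1)
  exact ⟨X, hX, inferInstance, hspan, by rw [hd, Nat.card_fin]⟩

section Models

open IsLocalRing

/-- A regular local ring `D` smooth over `k` with a homomorphism `D → Λ` carrying parameters to
parameters, and an étale `D`-algebra `S` which maps to `Λ` modulo a power of the maximal ideal and whose
image contains given elements. -/
structure TruncatedModel (k Λ : Type u) [Field k] [CommRing Λ] [IsLocalRing Λ] [Algebra k Λ] {d : ℕ}
    (x : Fin d → Λ) (N : ℕ) (G : Finset Λ) where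
  D : Type u
  [commRing : CommRing D]
  [isRegularLocalRing : IsRegularLocalRing D]
  [algebra : Algebra k D]
  [essFiniteType : EssFiniteType k D]
  [formallySmooth : FormallySmooth k D]
  S : Type u
  [commRingS : CommRing S]
  [isLocalRingS : IsLocalRing S]
  [algebraS : Algebra D S]
  [essFiniteTypeS : EssFiniteType D S]
  [formallySmoothS : FormallySmooth D S]
  θ : D →ₐ[k] Λ
  η : S →+* Λ ⧸ maximalIdeal Λ ^ N
  η_algebraMap : ∀ a, η (algebraMap D S a) = mk _ (θ a)
  X : Fin d → D
  isRSOP : IsRSOP X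
  isRSOP_S : IsRSOP fun j => algebraMap D S (X j)
  isRSOP_Λ : IsRSOP fun j => θ (X j)
  exists_η_eq : ∀ g ∈ G, ∃ b, η b = mk _ g
  coeff : Fin d → Fin d → Λ
  exists_η_eq_coeff : ∀ j i, ∃ b, η b = mk _ (coeff j i)
  sub_sum_mem : ∀ j, θ (X j) - ∑ i, coeff j i * x i ∈ maximalIdeal Λ ^ N

attribute [instance] TruncatedModel.commRing TruncatedModel.isRegularLocalRing TruncatedModel.algebra
  TruncatedModel.essFiniteType TruncatedModel.formallySmooth TruncatedModel.commRingS
  TruncatedModel.isLocalRingS TruncatedModel.algebraS TruncatedModel.essFiniteTypeS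
  TruncatedModel.formallySmoothS

theorem map_mem_maximalIdeal_pow {B Λ : Type*} [CommRing B] [CommRing Λ] [IsLocalRing B] [IsLocalRing Λ]
    (θ : B →+* Λ) [IsLocalHom θ] {n : ℕ} {b : B} (hb : b ∈ maximalIdeal B ^ n) :
    θ b ∈ maximalIdeal Λ ^ n := by
  have h1 := mem_map_of_mem θ hb
  rw [Ideal.map_pow] at h1
  exact Ideal.pow_right_mono (((local_hom_TFAE θ).out 0 2 :).1 ‹IsLocalHom θ›) n h1

theorem exists_isRSOP_sumElim_of_isLocalHom {B Λ : Type*} [CommRing B] [IsRegularLocalRing B] [CommRing Λ] [IsLocalRing Λ]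
    [IsNoetherianRing Λ] (θ : B →+* Λ) [IsLocalHom θ] {d N : ℕ} (hN : 2 ≤ N) {x : Fin d → Λ} (hx : IsRSOP x)
    {Y : Fin d → B} (hY : ∀ j, θ (Y j) = x j)
    (hgen : ∀ b ∈ maximalIdeal B, ∃ c : Fin d → B, θ (b - ∑ j, c j * Y j) ∈ maximalIdeal Λ ^ N) :
    ∃ (e : ℕ) (g : Fin e → B), (∀ i, θ (g i) ∈ maximalIdeal Λ ^ N) ∧ IsRSOP (Sum.elim Y g) := by
  have hmem : ∀ b, θ b ∈ maximalIdeal Λ → b ∈ maximalIdeal B := fun b hb =>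
    ((local_hom_TFAE θ).out 0 4 :).1 ‹IsLocalHom θ› ▸ (mem_comap.2 hb)
  obtain ⟨e, g, hg, hg'⟩ := exists_isRSOP_sumElim (B := B) (Y := Y)
    (fun j => hmem _ (by rw [hY]; exact hx.mem_maximalIdeal j))
    (fun c hc i => hmem _ (hx.mem_of_sum_mem (c := fun i => θ (c i)) (by
      have h1 := map_mem_maximalIdeal_pow θ hc
      simpa [hY] using h1) i))
    (I := (maximalIdeal Λ ^ N).comap θ) (fun b hb => hmem _ (Ideal.pow_le_self (by omega) hb))
    (fun b hb => by
      obtain ⟨c, hc⟩ := hgen b hb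
      rw [← add_sub_cancel (∑ j, c j * Y j) b]
      exact Submodule.add_mem_sup (sum_mem fun j _ => mul_mem_left _ _ (subset_span ⟨j, rfl⟩))
        (mem_comap.2 hc))
  exact ⟨e, g, hg, hg'⟩

theorem exists_derivation_sum_ne_zero (F : Type v) {k B Λ : Type u} [Field F] [Field k]
    [CommRing B] [IsLocalRing B] [IsNoetherianRing B] [CommRing Λ] [IsLocalRing Λ] [Algebra F k] [Algebra k B] [Algebra F B]
    [Algebra F Λ] [Algebra k Λ] [IsScalarTower F k B] [IsScalarTower F k Λ]
    [FormallySmooth F (ResidueField B)] (θ : B →ₐ[k] Λ) [IsLocalHom θ.toRingHom]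
    (hext : ∀ δ : Derivation F k (ResidueField Λ), ∃ D : Derivation F Λ (ResidueField Λ),
      ∀ a, D (algebraMap k Λ a) = δ a) {d e : ℕ} {Y : Fin d → B} {g : Fin e → B}
    (hYg : IsRSOP (Sum.elim Y g)) (hg : ∀ i, θ (g i) ∈ maximalIdeal Λ ^ 2) (c : Fin e → B)
    (hc : ∃ i, c i ∉ maximalIdeal B) : ∃ E : Derivation k B (ResidueField B), E (∑ i, c i * g i) ≠ 0 := by
  let : Algebra B Λ := θ.toRingHom.toAlgebra
  have ht : IsScalarTower k B Λ := .of_algebraMap_eq fun a => (θ.commutes a).symm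
  have ht' : IsScalarTower F B Λ := .of_algebraMap_eq fun a => by
    rw [IsScalarTower.algebraMap_apply F k B, ← IsScalarTower.algebraMap_apply k B Λ,
      ← IsScalarTower.algebraMap_apply]
  have hl : IsLocalHom (algebraMap B Λ) := ‹IsLocalHom θ.toRingHom›
  refine exists_derivation_apply_ne_zero F hext
    (sum_mem fun i _ => mul_mem_left _ _ (hYg.mem_maximalIdeal (inr i))) (fun h => ?_) ?_
  · obtain ⟨i, hi⟩ := hc
    exact hi (hYg.mem_of_sum_mem (c := Sum.elim 0 c) (by simpa using h) (inr i))
  · rw [map_sum]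
    refine sum_mem fun i _ => ?_
    rw [map_mul]
    exact mul_mem_left _ _ (hg i)

theorem EtaleModel.nonempty_truncatedModel {k B Λ : Type u} [Field k] [CommRing B] [IsLocalRing B]
    [IsNoetherianRing B] [CommRing Λ] [IsLocalRing Λ] [IsNoetherianRing Λ] [Algebra k B] [Algebra k Λ]
    (θ : B →ₐ[k] Λ) [IsLocalHom θ.toRingHom] {d e N : ℕ} (hN : 2 ≤ N) {x : Fin d → Λ} (hx : IsRSOP x)
    {Y : Fin d → B} (hY : ∀ j, θ (Y j) = x j) {g : Fin e → B} (hg : ∀ i, θ (g i) ∈ maximalIdeal Λ ^ N)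
    (hYg : IsRSOP (Sum.elim Y g)) (E : EtaleModel k B (span (range g))) {G : Finset Λ}
    (hG : ∀ a ∈ G, ∃ b, θ b - a ∈ maximalIdeal Λ ^ N) : Nonempty (TruncatedModel k Λ x N G) := by
  have himg : Sum.elim Y g '' range inr = range g := by
    rw [← Set.range_comp, Sum.elim_comp_inr]
  obtain ⟨hloc, hS⟩ := hYg.quotient (range inr)
  rw [himg] at hloc
  have hdim : ringKrullDim (B ⧸ span (range g)) = d := by
    rw [← himg, hS.2.2]
    norm_cast
    let f : Fin d → {i : Fin d ⊕ Fin e // i ∉ range inr} := fun j => ⟨inl j, by simp⟩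
    have hf : Function.Bijective f := by
      refine ⟨fun i j h => Sum.inl_injective (congrArg Subtype.val h), ?_⟩
      rintro ⟨i | i, hi⟩
      · exact ⟨i, rfl⟩
      · exact absurd ⟨i, rfl⟩ hi
    have h1 := Nat.card_congr (Equiv.ofBijective f hf)
    rw [← h1, Nat.card_fin]
  have hlh : IsLocalHom (Ideal.Quotient.mk (span (range g))) :=
    .of_surjective _ mk_surjective
  have hlh2 : IsLocalHom (algebraMap E.D (B ⧸ span (range g))) :=
    RingHom.isLocalHom_comp (Ideal.Quotient.mk (span (range g))) (algebraMap E.D B)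
  obtain ⟨X, hX, hXS⟩ := exists_isRSOP_of_flat_of_formallyUnramified (D := E.D) hdim
  have hker : ∀ b ∈ span (range g), θ b ∈ maximalIdeal Λ ^ N := fun b hb =>
    mem_comap.1 ((span_le (I := (maximalIdeal Λ ^ N).comap θ)).2 (by
      rintro _ ⟨i, rfl⟩
      exact hg i) hb)
  let η : B ⧸ span (range g) →+* Λ ⧸ maximalIdeal Λ ^ N :=
    Ideal.quotientMap _ θ.toRingHom hker
  let θD : E.D →ₐ[k] Λ := θ.comp (toAlgHom k E.D B)
  have hmB : ∀ j, algebraMap E.D B (X j) ∈ span (range Y) ⊔ span (range g) := fun j => by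
    rw [← Ideal.span_union, ← Set.Sum.elim_range, hYg.2.1]
    exact ((local_hom_TFAE (algebraMap E.D B)).out 0 2 :).1 E.isLocalHom
      (mem_map_of_mem _ (hX.mem_maximalIdeal j))
  have hco : ∀ j, ∃ c : Fin d → B, algebraMap E.D B (X j) - ∑ i, c i * Y i ∈ span (range g) :=
    fun j => by
      obtain ⟨y, hy, z, hz, hyz⟩ := Submodule.mem_sup.1 (hmB j)
      obtain ⟨c, rfl⟩ := mem_span_range_iff_exists_fun.1 hy
      exact ⟨c, by rwa [← hyz, add_sub_cancel_left]⟩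
  choose c hc using hco
  have hXΛ : IsRSOP fun j => θD (X j) := by
    refine ⟨inferInstance, ?_, hx.2.2⟩
    refine le_antisymm (span_le.2 ?_) ?_
    · rintro _ ⟨j, rfl⟩
      have h1 : algebraMap E.D B (X j) ∈ maximalIdeal B ^ 1 := by
        rw [pow_one]
        exact ((local_hom_TFAE (algebraMap E.D B)).out 0 2 :).1 E.isLocalHom
          (mem_map_of_mem _ (hX.mem_maximalIdeal j))
      have h2 := map_mem_maximalIdeal_pow θ.toRingHom h1
      rwa [pow_one] at h2
    · refine Submodule.le_of_le_smul_of_le_jacobson_bot (IsNoetherian.noetherian _)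
        (IsLocalRing.jacobson_eq_maximalIdeal _ bot_ne_top).ge ?_
      conv_lhs => rw [← hx.2.1]
      refine span_le.2 ?_
      rintro _ ⟨j, rfl⟩
      have h1 : Ideal.Quotient.mk (span (range g)) (Y j) ∈
          span (range fun j => algebraMap E.D (B ⧸ span (range g)) (X j)) := by
        rw [hXS.2.1]
        exact ((local_hom_TFAE (Ideal.Quotient.mk (span (range g)))).out 0 2 :).1 hlh
          (mem_map_of_mem _ (hYg.mem_maximalIdeal (inl j)))
      obtain ⟨a, ha⟩ := mem_span_range_iff_exists_fun.1 h1
      choose a' ha' using fun i => mk_surjective (a i)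
      have h2 : Y j - ∑ i, a' i * algebraMap E.D B (X i) ∈ span (range g) := by
        rw [← Ideal.Quotient.eq, map_sum, ← ha]
        refine sum_congr rfl fun i _ => ?_
        rw [map_mul, ha']
        rfl
      have h3 := hker _ h2
      rw [map_sub, map_sum, hY] at h3
      rw [SetLike.mem_coe, ← add_sub_cancel (∑ i, θ (a' i * algebraMap E.D B (X i))) (x j)]
      refine Submodule.add_mem_sup (sum_mem fun i _ => ?_) ?_
      · rw [map_mul]
        exact mul_mem_left _ _ (subset_span ⟨i, rfl⟩)
      · rw [smul_eq_mul, ← pow_two]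
        exact Ideal.pow_le_pow_right hN h3
  exact ⟨{
    D := E.D
    S := B ⧸ span (range g)
    θ := θD
    η := η
    η_algebraMap := fun a => rfl
    X := X
    isRSOP := hX
    isRSOP_S := hXS
    isRSOP_Λ := hXΛ
    exists_η_eq := fun a ha => by
      obtain ⟨b, hb⟩ := hG a ha
      exact ⟨Ideal.Quotient.mk _ b, Ideal.Quotient.eq.2 hb⟩
    coeff := fun j i => θ (c j i)
    exists_η_eq_coeff := fun j i => ⟨Ideal.Quotient.mk _ (c j i), rfl⟩
    sub_sum_mem := fun j => by
      have h1 := hker _ (hc j)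
      simp only [map_sub, map_sum, map_mul, hY] at h1
      exact h1 }⟩

theorem AlmostSection.nonempty_truncatedModel (F : Type v) {k Λ : Type u} [Field F] [PerfectField F] [Field k]
    [CommRing Λ] [IsLocalRing Λ] [IsNoetherianRing Λ] [Algebra F k]
    [Algebra F Λ] [Algebra k Λ] [IsScalarTower F k Λ]
    (hext : ∀ δ : Derivation F k (ResidueField Λ), ∃ D : Derivation F Λ (ResidueField Λ),
      ∀ a, D (algebraMap k Λ a) = δ a) {N : ℕ} (hN : 2 ≤ N) (σ : AlmostSection k Λ N) {d : ℕ} {x : Fin d → Λ}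
    (hx : IsRSOP x) (G : Finset Λ) : Nonempty (TruncatedModel k Λ x N G) := by
  obtain ⟨τ, _, P, _, θ, _, Y, hY, hG, hgen⟩ := σ.exists_model (by omega) hx.2.1 G
  obtain ⟨e, g, hg, hYg⟩ := exists_isRSOP_sumElim_of_isLocalHom θ.toRingHom hN hx hY hgen
  have hfs : FormallySmooth F (ResidueField (AtPrime P)) := .of_perfectField' F _
  obtain ⟨E⟩ := EtaleModel.nonempty P (fun i => hYg.mem_maximalIdeal (inr i))
    (exists_derivation_sum_ne_zero F θ hext hYg fun i => Ideal.pow_le_pow_right hN (hg i))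
  exact E.nonempty_truncatedModel θ hN hx hY hg hYg hG

theorem span_range_pow_le_span_range_pow {R : Type*} [CommRing R] {d : ℕ} (z : Fin d → R) (n : ℕ) :
    span (range z) ^ (d * n + 1) ≤ span (range fun j => z j ^ n) := by
  rw [span, Submodule.span_pow]
  refine Submodule.span_le.2 fun a ha => ?_
  obtain ⟨f, rfl⟩ := Set.mem_pow.1 ha
  rw [SetLike.mem_coe, List.prod_ofFn]
  choose h hh using fun i => (f i).2
  simp only [← hh]
  obtain ⟨j, hj⟩ := Fintype.exists_lt_card_fiber_of_mul_lt_card (f := h) (n := n) (by simp)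
  have h1 : ∏ i with h i = j, z (h i) ∣ ∏ i, z (h i) :=
    Finset.prod_dvd_prod_of_subset _ _ _ (Finset.subset_univ _)
  refine Ideal.mem_of_dvd _ h1 ?_
  rw [Finset.prod_congr rfl fun i hi => by rw [(Finset.mem_filter.1 hi).2], Finset.prod_const]
  exact Ideal.mem_of_dvd _ (pow_dvd_pow _ hj.le) (subset_span ⟨j, rfl⟩)

theorem exists_sum_mul_eq_pow {Λ : Type*} [CommRing Λ] (W : Subring Λ) {d s M : ℕ} {x c : Fin d → Λ}
    (hc : ∀ i, c i ∈ W) {b : Fin s → Λ} {v : (Fin M → Fin d) → Fin s → Λ} (hv : ∀ f l, v f l ∈ W)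
    (hsum : ∀ f, ∑ l, b l * v f l = ∏ i, x (f i)) :
    ∃ y : Fin s → Λ, (∀ l, y l ∈ W) ∧ ∑ l, b l * y l = (∑ i, c i * x i) ^ M := by
  refine ⟨fun l => ∑ f : Fin M → Fin d, (∏ i, c (f i)) * v f l,
    fun l => sum_mem fun f _ => mul_mem (prod_mem fun i _ => hc _) (hv f l), ?_⟩
  have h1 : (∑ i, c i * x i) ^ M = ∏ _j : Fin M, ∑ i, c i * x i := by simp
  rw [h1, Finset.prod_univ_sum, Fintype.piFinset_univ]
  simp_rw [mul_sum, Finset.prod_mul_distrib]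
  rw [sum_comm]
  refine sum_congr rfl fun f _ => ?_
  rw [← hsum, mul_sum]
  exact sum_congr rfl fun l _ => by ring

theorem exists_sum_of_sub_sum_mem {Λ : Type*} [CommRing Λ] {q : Ideal Λ} {d N : ℕ} {x : Fin d → Λ}
    (hx : span (range x) = q) {z : Λ} {c : Fin d → Λ}
    (hz : z - ∑ i, c i * x i ∈ q ^ (N + 1)) :
    ∃ c' : Fin d → Λ, z = ∑ i, c' i * x i ∧ ∀ i, c' i - c i ∈ q ^ N := by
  rw [pow_succ, ← smul_eq_mul] at hz
  conv at hz => enter [1, 2]; rw [← hx]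
  obtain ⟨r, hr, hr'⟩ := (Submodule.mem_ideal_smul_span_iff_exists_sum _ _ _).1 hz
  refine ⟨fun i => c i + r i, ?_, fun i => by simpa using hr i⟩
  rw [Finsupp.sum_fintype r (fun i a => a • x i) (fun i => zero_smul _ _)] at hr'
  simp_rw [add_mul, sum_add_distrib]
  simp_rw [smul_eq_mul] at hr'
  rw [hr']
  ring

open TensorProduct in
theorem exists_injective_of_ker_le {D S Λ : Type u} [CommRing D] [CommRing S] [CommRing Λ] [Algebra D S]
    [Algebra D Λ] (I : Ideal D) (K : Ideal Λ) (hIK : ∀ a ∈ I, algebraMap D Λ a ∈ K) (η : S →+* Λ ⧸ K)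
    (hη : ∀ a, η (algebraMap D S a) = mk K (algebraMap D Λ a))
    (hker : ker η ≤ I.map (algebraMap D S)) :
    ∃ ψ : (D ⧸ I) ⊗[D] S →+* Λ ⧸ K, Injective ψ ∧
      (∀ a, ψ (algebraMap (D ⧸ I) _ (mk I a)) = mk K (algebraMap D Λ a)) ∧
      ∀ s, ψ (1 ⊗ₜ s) = η s := by
  let f : D ⧸ I →ₐ[D] Λ ⧸ K := Ideal.Quotient.liftₐ I (Algebra.ofId D (Λ ⧸ K)) fun a ha =>
    eq_zero_iff_mem.2 (hIK a ha)
  let η' : S →ₐ[D] Λ ⧸ K := { η with commutes' := hη }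
  refine ⟨(Algebra.TensorProduct.productMap f η').toRingHom, ?_, fun a => ?_, fun s => ?_⟩
  · rw [injective_iff_map_eq_zero]
    intro z hz
    have hz' : ∃ s : S, z = 1 ⊗ₜ s := by
      clear hz
      induction z with
      | zero => exact ⟨0, (tmul_zero _ _).symm⟩
      | add x y hx hy =>
        obtain ⟨s, rfl⟩ := hx
        obtain ⟨t, rfl⟩ := hy
        exact ⟨s + t, (tmul_add _ _ _).symm⟩
      | tmul a s =>
        obtain ⟨a, rfl⟩ := mk_surjective a
        refine ⟨a • s, ?_⟩
        rw [← smul_tmul, Algebra.smul_def, mul_one]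
        rfl
    obtain ⟨s, rfl⟩ := hz'
    have h1 : η s = 0 := by
      have h2 : (Algebra.TensorProduct.productMap f η') (1 ⊗ₜ s) = 0 := hz
      rw [Algebra.TensorProduct.productMap_apply_tmul, map_one, one_mul] at h2
      exact h2
    have h3 : s ∈ I.map (algebraMap D S) := hker h1
    have h4 : I.map (algebraMap D S) ≤
        ker (Algebra.TensorProduct.includeRight : S →ₐ[D] (D ⧸ I) ⊗[D] S) := by
      rw [Ideal.map_le_iff_le_comap]
      intro a ha
      rw [mem_comap, mem_ker, AlgHom.commutes,
        IsScalarTower.algebraMap_apply D (D ⧸ I) ((D ⧸ I) ⊗[D] S), Ideal.Quotient.algebraMap_eq,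
        eq_zero_iff_mem.2 ha, map_zero]
    exact h4 h3
  · change Algebra.TensorProduct.productMap f η' (algebraMap (D ⧸ I) _ (mk I a)) = _
    rw [Algebra.TensorProduct.algebraMap_apply, Algebra.TensorProduct.productMap_apply_tmul, map_one, mul_one]
    rfl
  · change Algebra.TensorProduct.productMap f η' (1 ⊗ₜ s) = _
    rw [Algebra.TensorProduct.productMap_apply_tmul, map_one, one_mul]
    rfl

theorem exists_smoothOn_sum_eq {k C Λ : Type u} [CommRing k] [CommRing C] [CommRing Λ] [Algebra k C] [Algebra k Λ]
    [FinitePresentation k C] (φ : C →ₐ[k] Λ) {σ : Type} [Fintype σ] [DecidableEq σ] (z : σ → Λ)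
    (hz : ∀ f, z f ∈ (smoothIdeal k C).map φ) :
    ∃ (s : ℕ) (a : Fin s → C) (v : σ → Fin s → Λ), (∀ l, SmoothOn k (a l)) ∧
      ∀ f, ∑ l, φ (a l) * v f l = z f := by
  choose n c r hc hr using fun f => exists_sum_of_mem_map_smoothIdeal (hz f)
  let e := (Fintype.equivFin (Σ f, Fin (n f))).symm
  refine ⟨Fintype.card (Σ f, Fin (n f)), fun l => c (e l).1 (e l).2,
    fun f l => if (e l).1 = f then r (e l).1 (e l).2 else 0, fun l => hc _ _, fun f => ?_⟩
  rw [e.sum_comp (fun p : Σ f, Fin (n f) => φ (c p.1 p.2) * if p.1 = f then r p.1 p.2 else 0),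
    Fintype.sum_sigma, Finset.sum_eq_single f]
  · simp [hr]
  · intro j _ hj
    simp [hj]
  · exact fun h => absurd (mem_univ _) h

open TensorProduct in
theorem hasSmoothFactor_of_truncatedModel {k C Λ : Type u} [Field k] [CommRing C] [CommRing Λ] [IsLocalRing Λ]
    [IsNoetherianRing Λ] [Algebra k C] [Algebra k Λ] [FinitePresentation k C] (φ : C →ₐ[k] Λ) {M : ℕ}
    (hM : maximalIdeal Λ ^ M ≤ (smoothIdeal k C).map φ) {d : ℕ} {x : Fin d → Λ} (hx : IsRSOP x)
    (H : ∀ N, 2 ≤ N → ∀ G : Finset Λ, Nonempty (TruncatedModel k Λ x N G)) : HasSmoothFactor φ := by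
  classical
  obtain ⟨s, a, v, ha, hv⟩ := exists_smoothOn_sum_eq φ (fun f : Fin M → Fin d => ∏ i, x (f i)) fun f => by
    refine hM ?_
    have h1 := Ideal.prod_mem_prod (s := Finset.univ) (I := fun _ : Fin M => maximalIdeal Λ)
      (x := fun i => x (f i)) fun i _ => hx.mem_maximalIdeal _
    simpa using h1
  obtain ⟨n, hn, key⟩ := exists_hasSmoothFactor_of_rsop a ha d M
  obtain ⟨Z, hZ⟩ := (inferInstance : FiniteType k C).1
  obtain ⟨T⟩ := H (d * n + 1 + 1) (by omega)
    (Z.image φ ∪ Finset.univ.image fun p : (Fin M → Fin d) × Fin s => v p.1 p.2)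
  let : Algebra T.D Λ := T.θ.toRingHom.toAlgebra
  have hT : ∀ t, algebraMap T.D Λ t = T.θ t := fun t => rfl
  have htow : IsScalarTower k T.D Λ := .of_algebraMap_eq fun a => (T.θ.commutes a).symm
  have hXq : span (range fun j => algebraMap T.D Λ (T.X j)) = maximalIdeal Λ := T.isRSOP_Λ.2.1
  have hqK : maximalIdeal Λ ^ (d * n + 1) ≤ span (range fun j => algebraMap T.D Λ (T.X j) ^ n) := by
    rw [← hXq]
    exact span_range_pow_le_span_range_pow _ n
  have hqK' := (Ideal.pow_le_pow_right (I := maximalIdeal Λ) (Nat.le_succ (d * n + 1))).trans hqK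
  let η : T.S →+* Λ ⧸ span (range fun j => algebraMap T.D Λ (T.X j) ^ n) :=
    (Ideal.Quotient.factor hqK').comp T.η
  have hη : ∀ a, η (algebraMap T.D T.S a) = Ideal.Quotient.mk _ (algebraMap T.D Λ a) := fun a =>
    (congrArg (Ideal.Quotient.factor hqK') (T.η_algebraMap a)).trans (Ideal.Quotient.factor_mk _ _)
  have hηmem : ∀ {w}, (∃ b, T.η b = Ideal.Quotient.mk _ w) → ∃ b, η b = Ideal.Quotient.mk _ w := by
    rintro w ⟨b, hb⟩
    exact ⟨b, (congrArg (Ideal.Quotient.factor hqK') hb).trans (Ideal.Quotient.factor_mk _ _)⟩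
  have hker := ker_le_span_pow_of_prod_pow_ne_zero T.isRSOP_S.2.1 η hn (fun j => by
      rw [← map_pow, hη, eq_zero_iff_mem, map_pow]
      exact subset_span ⟨j, rfl⟩)
    (by
      simp_rw [← map_pow]
      rw [← map_prod, hη, Ne, eq_zero_iff_mem, map_prod]
      simp_rw [map_pow]
      exact T.isRSOP_Λ.prod_pow_notMem hn)
  obtain ⟨ψ, hψ, hψD, hψS⟩ := exists_injective_of_ker_le (S := T.S)
    (span (range fun j => T.X j ^ n)) _ (fun a ha => by
      have h1 := mem_map_of_mem (algebraMap T.D Λ) ha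
      rw [map_span, ← Set.range_comp] at h1
      simpa [Function.comp_def] using h1) η hη (by
      rw [map_span, ← Set.range_comp]
      simpa [Function.comp_def] using hker)
  let W : Subring Λ := η.range.comap (Ideal.Quotient.mk _)
  have hWψ : ∀ {w}, w ∈ W → ∃ t, ψ t = Ideal.Quotient.mk _ w := by
    rintro w ⟨b, hb⟩
    exact ⟨1 ⊗ₜ b, (hψS b).trans hb⟩
  have hWk : ∀ r : k, algebraMap k Λ r ∈ W := fun r =>
    ⟨algebraMap T.D T.S (algebraMap k T.D r), by rw [hη, ← IsScalarTower.algebraMap_apply]⟩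
  have hWv : ∀ f l, v f l ∈ W := fun f l => hηmem (T.exists_η_eq _ (Finset.mem_union_right _
    (Finset.mem_image.2 ⟨(f, l), mem_univ _, rfl⟩)))
  let WA : Subalgebra k Λ := { W with algebraMap_mem' := hWk }
  have hWC : ∀ c, φ c ∈ W := fun c => by
    have h1 : (⊤ : Subalgebra k C) ≤ WA.comap φ := by
      rw [← hZ, Algebra.adjoin_le_iff]
      exact fun z hz => hηmem (T.exists_η_eq _ (Finset.mem_union_left _ (Finset.mem_image_of_mem _ hz)))
    exact h1 (Algebra.mem_top (x := c))
  have hy : ∀ j, ∃ y : Fin s → Λ, (∀ l, y l ∈ W) ∧ ∑ l, φ (a l) * y l = algebraMap T.D Λ (T.X j) ^ M := by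
    intro j
    obtain ⟨c', hc', hcc⟩ := exists_sum_of_sub_sum_mem hx.2.1 (T.sub_sum_mem j)
    rw [hT, hc']
    refine exists_sum_mul_eq_pow W (fun i => ?_) hWv hv
    obtain ⟨b, hb⟩ := hηmem (T.exists_η_eq_coeff j i)
    exact ⟨b, hb.trans (Ideal.Quotient.eq.2 (by
      rw [← neg_sub]
      exact neg_mem (hqK (hcc i))))⟩
  choose y hyW hy using hy
  exact key φ T.X T.isRSOP T.isRSOP_Λ ψ hψ hψD (fun c => hWψ (hWC c)) y hy fun j l => hWψ (hyW j l)

theorem IsRSOP.ringEquiv {R S : Type*} [CommRing R] [IsLocalRing R] [CommRing S] [IsLocalRing S] {ι : Type*}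
    {x : ι → R} (hx : IsRSOP x) (e : R ≃+* S) : IsRSOP fun i => e (x i) := by
  refine ⟨hx.1, ?_, by rw [← ringKrullDim_eq_of_ringEquiv e, hx.2.2]⟩
  have h1 : span (range fun i => e (x i)) = (span (range x)).map e := by
    rw [map_span, ← Set.range_comp]
    rfl
  rw [h1, hx.2.1]
  ext a
  rw [← Ideal.comap_symm, mem_comap, IsLocalRing.mem_maximalIdeal, IsLocalRing.mem_maximalIdeal, mem_nonunits_iff,
    mem_nonunits_iff, MulEquiv.isUnit_map]

def LocallyRegular (T : Type u) [CommRing T] : Prop :=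
  ∀ (Q : Ideal T) [Q.IsPrime], ∃ (d : ℕ) (x : Fin d → AtPrime Q), IsRSOP x

theorem LocallyRegular.of_isLocalization {T T' : Type u} [CommRing T] [CommRing T'] [Algebra T T']
    (H : LocallyRegular T) (W : Submonoid T) [IsLocalization W T'] : LocallyRegular T' := by
  intro Q _
  obtain ⟨d, x, hx⟩ := H (Q.comap (algebraMap T T'))
  have := IsLocalization.isLocalization_isLocalization_atPrime_isLocalization W (AtPrime Q) Q
  exact ⟨d, _, hx.ringEquiv (IsLocalization.algEquiv (Q.comap (algebraMap T T')).primeCompl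
    (AtPrime (Q.comap (algebraMap T T'))) (AtPrime Q)).toRingEquiv⟩

theorem LocallyRegular.of_ringEquiv {T T' : Type u} [CommRing T] [CommRing T'] (H : LocallyRegular T)
    (e : T ≃+* T') : LocallyRegular T' := by
  let : Algebra T T' := e.toRingHom.toAlgebra
  have : IsLocalization (⊥ : Submonoid T) T' := IsLocalization.of_le_isUnit_of_bijective
    (by rintro _ ⟨_, rfl, rfl⟩; exact (map_one (algebraMap T T')).symm ▸ isUnit_one) e.bijective
  exact H.of_isLocalization ⊥

theorem IsRegularLocalRingP.exists_isRSOP {R : Type u} [CommRing R] [IsLocalRing R] (H : IsRegularLocalRingP R) :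
    ∃ (d : ℕ) (x : Fin d → R), IsRSOP x := by
  obtain ⟨_, _, s, hs, hdim⟩ := H
  refine ⟨s.card, fun i => (s.equivFin.symm i : R), inferInstance, ?_, ?_⟩
  · rw [← hs]
    congr 1
    ext a
    constructor
    · rintro ⟨i, rfl⟩
      exact (s.equivFin.symm i).2
    · exact fun ha => ⟨s.equivFin ⟨a, ha⟩, by simp⟩
  · rw [← hdim, Nat.card_eq_fintype_card, Fintype.card_fin]
    rfl

open TensorProduct

theorem GeomRegular.locallyRegular {k Λ : Type u} [Field k] [CommRing Λ] [Algebra k Λ] (H : GeomRegular k Λ) :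
    LocallyRegular Λ :=
  LocallyRegular.of_ringEquiv (T := k ⊗[k] Λ) (fun Q _ => H k Q) (Algebra.TensorProduct.lid k Λ).toRingEquiv

theorem GeomRegular.of_isLocalization {k Λ Λ' : Type u} [Field k] [CommRing Λ] [CommRing Λ'] [Algebra k Λ]
    [Algebra k Λ'] [Algebra Λ Λ'] [IsScalarTower k Λ Λ'] (H : GeomRegular k Λ) (M : Submonoid Λ)
    [IsLocalization M Λ'] : GeomRegular k Λ' := by
  intro k' _ _ _
  have h1 : LocallyRegular (Λ ⊗[k] k') :=
    LocallyRegular.of_ringEquiv (T := k' ⊗[k] Λ) (fun Q _ => H k' Q) (Algebra.TensorProduct.comm k k' Λ).toRingEquiv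
  let f : Λ ⊗[k] k' →ₐ[Λ] Λ' ⊗[k] k' := Algebra.TensorProduct.map (Algebra.ofId Λ Λ') (AlgHom.id k k')
  let : Algebra (Λ ⊗[k] k') (Λ' ⊗[k] k') := f.toRingHom.toAlgebra
  have : IsScalarTower Λ (Λ ⊗[k] k') (Λ' ⊗[k] k') := .of_algebraMap_eq fun a => (f.commutes a).symm
  have h2 : IsLocalizedModule M (Algebra.linearMap Λ Λ') := inferInstance
  have h3 : IsLocalizedModule M (TensorProduct.AlgebraTensorModule.rTensor k k' (Algebra.linearMap Λ Λ')) :=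
    inferInstance
  have h4 : IsLocalization (Algebra.algebraMapSubmonoid (Λ ⊗[k] k') M) (Λ' ⊗[k] k') :=
    isLocalizedModule_iff_isLocalization.1 h3
  exact (h1.of_isLocalization (T' := Λ' ⊗[k] k') (Algebra.algebraMapSubmonoid (Λ ⊗[k] k') M)).of_ringEquiv
    (Algebra.TensorProduct.comm k Λ' k').toRingEquiv

theorem GeomRegular.hasSmoothFactor {k C Λ : Type u} [Field k] [CommRing C] [CommRing Λ] [IsLocalRing Λ]
    [IsNoetherianRing Λ] [Algebra k C] [Algebra k Λ] [FinitePresentation k C] (H : GeomRegular k Λ)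
    {d : ℕ} {x : Fin d → Λ} (hx : IsRSOP x) (φ : C →ₐ[k] Λ) {M : ℕ}
    (hM : maximalIdeal Λ ^ M ≤ (smoothIdeal k C).map φ) : HasSmoothFactor φ := by
  refine hasSmoothFactor_of_truncatedModel φ hM hx fun N hN G => ?_
  obtain ⟨p, hp⟩ := CharP.exists k
  obtain hp0 | rfl := CharP.char_is_prime_or_zero k p
  · have : Fact p.Prime := ⟨hp0⟩
    let : Algebra (ZMod p) k := ZMod.algebra k p
    let : Algebra (ZMod p) Λ := Algebra.compHom Λ (algebraMap (ZMod p) k)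
    have : IsScalarTower (ZMod p) k Λ := .of_algebraMap_eq' rfl
    obtain ⟨σ⟩ := H.nonempty_almostSection p N
    exact σ.nonempty_truncatedModel (ZMod p) H.exists_derivation_extending hN hx G
  · have : CharZero k := CharP.charP_to_charZero k
    obtain ⟨σ⟩ := AlmostSection.nonempty_of_charZero k Λ N
    exact σ.nonempty_truncatedModel k (fun δ => ⟨0, fun a => (δ.map_algebraMap a).symm⟩) hN hx G

theorem GeomRegular.hasDesing {k Λ : Type u} [Field k] [CommRing Λ] [IsNoetherianRing Λ] [Algebra k Λ]
    (H : GeomRegular k Λ) : HasDesing k Λ := by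
  have hΛ := H.locallyRegular
  have : IsReduced Λ := isReduced_ofLocalizationMaximal Λ fun q _ => by
    obtain ⟨d, x, hx⟩ := hΛ q
    have : IsDomain (AtPrime q) := hx.isDomain
    infer_instance
  refine HasDesing.of_localization (fun E => Smooth.isReduced_of_field k E) fun q _ C _ _ _ φ M hM => ?_
  obtain ⟨d, x, hx⟩ := hΛ q
  exact (H.of_isLocalization q.primeCompl).hasSmoothFactor hx φ hM

/-- The fibers of `R → Λ` over the residue fields of `R` are geometrically regular. -/
def FibersGeomRegular (R Λ : Type u) [CommRing R] [CommRing Λ] [Algebra R Λ] : Prop :=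
  ∀ (κ : Type u) [Field κ] [Algebra R κ],
    (∀ z : κ, ∃ a b : R, algebraMap R κ b ≠ 0 ∧ z * algebraMap R κ b = algebraMap R κ a) →
      GeomRegular κ (κ ⊗[R] Λ)

theorem GeomRegular.of_algEquiv {k Λ Λ' : Type u} [Field k] [CommRing Λ] [CommRing Λ'] [Algebra k Λ]
    [Algebra k Λ'] (H : GeomRegular k Λ) (e : Λ ≃ₐ[k] Λ') : GeomRegular k Λ' := fun k' _ _ _ =>
  LocallyRegular.of_ringEquiv (T := k' ⊗[k] Λ) (fun Q _ => H k' Q)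
    (Algebra.TensorProduct.congr (AlgEquiv.refl (A₁ := k') (R := k)) e).toRingEquiv

theorem FibersGeomRegular.quotient {R Λ : Type u} [CommRing R] [CommRing Λ] [Algebra R Λ]
    (H : FibersGeomRegular R Λ) (I : Ideal R) : FibersGeomRegular (R ⧸ I) (Λ ⧸ I.map (algebraMap R Λ)) := by
  intro κ _ _ hκ
  let : Algebra R κ := Algebra.compHom κ (algebraMap R (R ⧸ I))
  have : IsScalarTower R (R ⧸ I) κ := .of_algebraMap_eq' rfl
  have h1 := H κ fun z => by
    obtain ⟨a, b, hb, h⟩ := hκ z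
    obtain ⟨a, rfl⟩ := mk_surjective a
    obtain ⟨b, rfl⟩ := mk_surjective b
    exact ⟨a, b, hb, h⟩
  exact h1.of_algEquiv (((Algebra.TensorProduct.congr (AlgEquiv.refl (A₁ := κ) (R := κ))
    (Algebra.TensorProduct.quotIdealMapEquivQuotTensor Λ I)).trans
      (Algebra.TensorProduct.cancelBaseChange R (R ⧸ I) κ κ Λ)).symm)

theorem HasGeometricallyRegularFibers.fibersGeomRegular {A A' : Type u} [CommRing A] [CommRing A'] [Algebra A A']
    (H : HasGeometricallyRegularFibers A A') : FibersGeomRegular A A' := by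
  intro κ _ _ hκ k' _ _ _
  let P := ker (algebraMap A κ)
  have hP : P.IsPrime := RingHom.ker_isPrime _
  let : Algebra (A ⧸ P) κ := (RingHom.kerLift (algebraMap A κ)).toAlgebra
  have hinj : Injective (algebraMap (A ⧸ P) κ) := RingHom.kerLift_injective _
  have : IsScalarTower A (A ⧸ P) κ := .of_algebraMap_eq fun a => rfl
  have : FaithfulSMul (A ⧸ P) κ := (faithfulSMul_iff_algebraMap_injective _ _).2 hinj
  let : Algebra (FractionRing (A ⧸ P)) κ := FractionRing.liftAlgebra (A ⧸ P) κ
  have : IsScalarTower (A ⧸ P) (FractionRing (A ⧸ P)) κ := inferInstance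
  have hsurj : Surjective (algebraMap (FractionRing (A ⧸ P)) κ) := fun z => by
    obtain ⟨a, b, hb, h⟩ := hκ z
    refine ⟨algebraMap (A ⧸ P) _ (mk P a) / algebraMap (A ⧸ P) _ (mk P b), ?_⟩
    rw [map_div₀, ← IsScalarTower.algebraMap_apply, ← IsScalarTower.algebraMap_apply]
    exact (div_eq_iff hb).2 h.symm
  have : Module.Finite (FractionRing (A ⧸ P)) κ := Module.Finite.of_surjective (Algebra.linearMap _ κ) hsurj
  let : Algebra A k' := Algebra.compHom k' (algebraMap A κ)
  have : IsScalarTower A κ k' := .of_algebraMap_eq' rfl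
  let : Algebra (A ⧸ P) k' := Algebra.compHom k' (algebraMap (A ⧸ P) κ)
  have : IsScalarTower (A ⧸ P) κ k' := .of_algebraMap_eq' rfl
  let : Algebra (FractionRing (A ⧸ P)) k' := Algebra.compHom k' (algebraMap (FractionRing (A ⧸ P)) κ)
  have : IsScalarTower (FractionRing (A ⧸ P)) κ k' := .of_algebraMap_eq' rfl
  have : IsScalarTower (A ⧸ P) (FractionRing (A ⧸ P)) k' := .of_algebraMap_eq fun a => by
    rw [IsScalarTower.algebraMap_apply (FractionRing (A ⧸ P)) κ k',
      ← IsScalarTower.algebraMap_apply (A ⧸ P) (FractionRing (A ⧸ P)) κ, ← IsScalarTower.algebraMap_apply]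
  have : IsScalarTower A (A ⧸ P) k' := .of_algebraMap_eq fun a => rfl
  have : Module.Finite (FractionRing (A ⧸ P)) k' := Module.Finite.trans κ k'
  have h1 : LocallyRegular (k' ⊗[A ⧸ P] (A' ⧸ P.map (algebraMap A A'))) := fun Q _ => (H P hP k' Q).exists_isRSOP
  refine LocallyRegular.of_ringEquiv h1 ?_
  exact (((Algebra.TensorProduct.congr (AlgEquiv.refl (A₁ := k') (R := k'))
    (Algebra.TensorProduct.quotIdealMapEquivQuotTensor A' P)).trans
      (Algebra.TensorProduct.cancelBaseChange A (A ⧸ P) k' k' A')).trans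
        (Algebra.TensorProduct.cancelBaseChange A κ k' k' A').symm).toRingEquiv

theorem isLocalization_fractionRing_of_mem_minimalPrimes {R : Type u} [CommRing R] [IsReduced R] {p : Ideal R}
    [p.IsPrime] (hp : p ∈ minimalPrimes R) : IsLocalization p.primeCompl (FractionRing (R ⧸ p)) := by
  have hz : ∀ a, algebraMap R (FractionRing (R ⧸ p)) a = 0 ↔ a ∈ p := fun a => by
    rw [IsScalarTower.algebraMap_apply R (R ⧸ p), FaithfulSMul.algebraMap_eq_zero_iff,
      Ideal.Quotient.algebraMap_eq, eq_zero_iff_mem]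
  refine ⟨fun y => ?_, fun z => ?_, fun {a b} h => ?_⟩
  · exact isUnit_iff_ne_zero.2 fun h => y.2 ((hz _).1 h)
  · obtain ⟨a, b, hb, rfl⟩ := IsFractionRing.div_surjective (A := R ⧸ p) z
    obtain ⟨a, rfl⟩ := mk_surjective a
    obtain ⟨b, rfl⟩ := mk_surjective b
    have hb' : b ∉ p := fun h => nonZeroDivisors.ne_zero hb (eq_zero_iff_mem.2 h)
    exact ⟨(a, ⟨b, hb'⟩), div_mul_cancel₀ _ fun h => hb' ((hz b).1 h)⟩
  · rw [← sub_eq_zero, ← map_sub, hz] at h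
    have h1 : algebraMap R (AtPrime p) (a - b) = 0 := by
      have h2 := mem_map_of_mem (algebraMap R (AtPrime p)) h
      rw [← IsLocalization.AtPrime.radical_map_of_mem_minimalPrimes _ p ⊥ hp, Ideal.map_bot] at h2
      exact IsNilpotent.eq_zero h2
    obtain ⟨c, hc⟩ := (IsLocalization.map_eq_zero_iff p.primeCompl _ _).1 h1
    exact ⟨c, sub_eq_zero.1 (by rw [← mul_sub, hc])⟩

theorem FibersGeomRegular.hasDesing {A : Type u} [CommRing A] [IsNoetherianRing A] (I : Ideal A) :
    ∀ (R Λ : Type u) [CommRing R] [CommRing Λ] [Algebra A R] [Algebra R Λ] [IsNoetherianRing Λ] [Module.Flat R Λ],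
      Surjective (algebraMap A R) → ker (algebraMap A R) = I → FibersGeomRegular R Λ →
        HasDesing R Λ := by
  induction I using IsNoetherian.induction with
  | _ I ih =>
  intro R Λ _ _ _ _ _ _ hsurj hker H
  have : IsNoetherianRing R := isNoetherianRing_of_surjective A R _ hsurj
  have happ : ∀ r : R, r ≠ 0 → ∀ (B : Type u) [CommRing B] [Algebra R B] [FiniteType R B]
      (v : B →ₐ[R] Λ), HasSmoothApprox v r := by
    intro r hr B _ _ _ v
    have : Module.Flat (R ⧸ span {r}) (Λ ⧸ (span {r}).map (algebraMap R Λ)) :=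
      .of_linearEquiv (Algebra.TensorProduct.quotIdealMapEquivQuotTensor Λ (span {r})).toLinearEquiv
    have hlt : I < ker (algebraMap A (R ⧸ span {r})) := by
      obtain ⟨a, rfl⟩ := hsurj r
      rw [← hker]
      refine SetLike.lt_iff_le_and_exists.2 ⟨fun b hb => ?_, a, ?_, hr⟩
      · rw [mem_ker, IsScalarTower.algebraMap_apply A R (R ⧸ _), (mem_ker).1 hb, map_zero]
      · rw [mem_ker, IsScalarTower.algebraMap_apply A R (R ⧸ _)]
        exact eq_zero_iff_mem.2 (mem_span_singleton_self _)
    refine (ih _ hlt (R ⧸ span {r}) (Λ ⧸ (span {r}).map (algebraMap R Λ))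
      (mk_surjective.comp hsurj) rfl (H.quotient _)).hasSmoothApprox
        mk_surjective mk_ker mk_surjective ?_ v
    rw [Ideal.Quotient.algebraMap_eq, mk_ker, map_span, Set.image_singleton]
  by_cases hred : IsReduced R
  · cases subsingleton_or_nontrivial R
    · intro B _ _ _ v
      have := (algebraMap R B).codomain_trivial
      exact ⟨B, _, _, .of_equiv (AlgEquiv.ofBijective (Algebra.ofId R B)
        ⟨Function.injective_of_subsingleton _, Function.surjective_to_subsingleton _⟩), AlgHom.id R B, v, rfl⟩
    obtain ⟨p, hp⟩ := Ideal.nonempty_minimalPrimes (bot_ne_top (α := Ideal R))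
    have hpp : p.IsPrime := hp.1.1
    have hloc := isLocalization_fractionRing_of_mem_minimalPrimes hp
    let κ := FractionRing (R ⧸ p)
    let : Algebra Λ (κ ⊗[R] Λ) := Algebra.TensorProduct.rightAlgebra
    have hmod : IsLocalizedModule p.primeCompl (toAlgHom R Λ (κ ⊗[R] Λ)).toLinearMap := inferInstance
    have hΛ : IsLocalization (Algebra.algebraMapSubmonoid Λ p.primeCompl) (κ ⊗[R] Λ) :=
      isLocalizedModule_iff_isLocalization.1 hmod
    have hnoeth : IsNoetherianRing (κ ⊗[R] Λ) := IsLocalization.isNoetherianRing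
      (Algebra.algebraMapSubmonoid Λ p.primeCompl) _ inferInstance
    have hgeom : GeomRegular κ (κ ⊗[R] Λ) := H κ fun z => by
      obtain ⟨⟨a, b⟩, hab⟩ := IsLocalization.surj p.primeCompl z
      exact ⟨a, b, (IsLocalization.map_units κ b).ne_zero, hab⟩
    refine HasDesing.of_isLocalization p.primeCompl hgeom.hasDesing fun r hr n => happ _ fun h => hr ?_
    rw [eq_zero_of_pow_eq_zero h]
    exact p.zero_mem
  · obtain ⟨r, hr0, hr⟩ : ∃ r : R, r ≠ 0 ∧ r ^ 2 = 0 := by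
      by_contra! h
      exact hred (isReduced_iff_pow_one_lt 2 one_lt_two |>.2 fun r hr => by_contra fun h0 => h r h0 hr)
    exact HasDesing.of_sq_eq_zero hr (happ r hr0)

end Models

theorem stmt0 (A A' : Type u) [CommRing A] [CommRing A']
    [IsNoetherianRing A] [IsNoetherianRing A'] [Algebra A A']
    (hflat : Module.Flat A A') (hreg : HasGeometricallyRegularFibers A A')
    (B : Type u) [CommRing B] [Algebra A B] [Algebra.FiniteType A B]
    (v : B →ₐ[A] A') :
    ∃ (C : Type u) (_ : CommRing C) (_ : Algebra A C), Algebra.Smooth A C ∧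
      ∃ (f : B →ₐ[A] C) (g : C →ₐ[A] A'), g.comp f = v :=
  FibersGeomRegular.hasDesing _ A A' Function.surjective_id rfl hreg.fibersGeomRegular B v
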